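/- Let N ≥ 2, 0 < c_N < … < c_1 and Δ_1, …, Δ_N ∈ ℝ, and let u be a smooth solution of the quartic gKdV equation with lim_{t→+∞} ‖u(t,·) − ∑_{j=1}^N Q_{c_j}(· − c_j t − Δ_j)‖_{H¹} = 0. Then for all t ∈ ℝ: (1) ∫ u²(t,x) dx = (∑_{j=1}^N c_j^{1/6}) ∫ Q²; (2) E(u(t,·)) = (∑_{j=1}^N c_j^{7/6}) E(Q); (3) u(t,·) is integrable and ∫ u(t,x) dx = (∑_{j=1}^N c_j^{−1/6}) ∫ Q. -/

import Mathlib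

open Real MeasureTheory Filter

noncomputable def Q (x : ℝ) : ℝ := (5 / (2 * Real.cosh (3 * x / 2) ^ 2)) ^ ((1:ℝ)/3)

noncomputable def Qc (c x : ℝ) : ℝ := c ^ ((1:ℝ)/3) * Q (Real.sqrt c * x)

noncomputable def H1norm (f : ℝ → ℝ) : ℝ :=
  Real.sqrt (∫ x : ℝ, ((f x) ^ 2 + (deriv f x) ^ 2))

noncomputable def IsGKdVSolution (u : ℝ → ℝ → ℝ) : Prop :=
  ContDiff ℝ (⊤ : ℕ∞) (Function.uncurry u) ∧
  (∀ t x : ℝ, deriv (fun s => u s x) t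
      + deriv (fun y => iteratedDeriv 2 (u t) y + (u t y) ^ 4) x = 0) ∧
  (∀ (t : ℝ) (k : ℕ), Integrable (fun x => (iteratedDeriv k (u t) x) ^ 2))

noncomputable def Energy (v : ℝ → ℝ) : ℝ :=
  ∫ x : ℝ, ((deriv v x) ^ 2 - (2 / 5) * (v x) ^ 5)

namespace GKdV

/-! ### Cauchy–Schwarz and one-dimensional Sobolev bounds -/

lemma integrable_mul_of_sq {f g : ℝ → ℝ} (hf : Continuous f) (hg : Continuous g)
    (hf2 : Integrable fun x => f x ^ 2) (hg2 : Integrable fun x => g x ^ 2) :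
    Integrable fun x => f x * g x := by
  refine (hf2.add hg2).mono' (hf.mul hg).aestronglyMeasurable (ae_of_all _ fun x => ?_)
  simp only [Pi.add_apply, Real.norm_eq_abs, abs_mul]
  nlinarith [sq_nonneg (|f x| - |g x|), sq_abs (f x), sq_abs (g x), sq_nonneg (f x),
    sq_nonneg (g x)]

lemma integral_abs_mul_le {f g : ℝ → ℝ} (hf : Continuous f) (hg : Continuous g)
    (hf2 : Integrable fun x => f x ^ 2) (hg2 : Integrable fun x => g x ^ 2) :
    2 * ∫ x, |f x * g x| ≤ (∫ x, f x ^ 2) + ∫ x, g x ^ 2 := by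
  rw [← integral_add hf2 hg2, ← integral_const_mul]
  refine integral_mono ((integrable_mul_of_sq hf hg hf2 hg2).abs.const_mul 2) (hf2.add hg2)
    fun x => ?_
  simp only [abs_mul]
  nlinarith [sq_nonneg (|f x| - |g x|), sq_abs (f x), sq_abs (g x)]

lemma integral_abs_mul_sq_le {f g : ℝ → ℝ} (hf : Continuous f) (hg : Continuous g)
    (hf2 : Integrable fun x => f x ^ 2) (hg2 : Integrable fun x => g x ^ 2) :
    (∫ x, |f x * g x|) ^ 2 ≤ (∫ x, f x ^ 2) * ∫ x, g x ^ 2 := by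
  have hfg := (integrable_mul_of_sq hf hg hf2 hg2).abs
  have key : ∀ l : ℝ, 0 ≤ (∫ x, f x ^ 2) * (l * l) + (-2 * ∫ x, |f x * g x|) * l
      + ∫ x, g x ^ 2 := by
    intro l
    have h : (∫ x, (l * |f x| - |g x|) ^ 2) = (∫ x, f x ^ 2) * (l * l)
        + (-2 * ∫ x, |f x * g x|) * l + ∫ x, g x ^ 2 := by
      rw [← integral_mul_const, ← integral_const_mul, ← integral_mul_const,
        ← integral_add (hf2.mul_const _) ((hfg.const_mul _).mul_const _),
        ← integral_add ((hf2.mul_const _).fun_add ((hfg.const_mul _).mul_const _)) hg2]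
      congr 1
      ext x
      simp only [abs_mul]
      linear_combination (l ^ 2) * sq_abs (f x) + sq_abs (g x)
    rw [← h]
    exact integral_nonneg fun x => sq_nonneg _
  have := discrim_le_zero key
  rw [discrim] at this
  nlinarith

lemma sq_le_two_integral {f f' : ℝ → ℝ} (hd : ∀ x, HasDerivAt f (f' x) x) (hc : Continuous f')
    (hf2 : Integrable fun x => f x ^ 2) (hg2 : Integrable fun x => f' x ^ 2) (x : ℝ) :
    f x ^ 2 ≤ 2 * ∫ y, |f y * f' y| := by
  have hf : Continuous f := continuous_iff_continuousAt.2 fun x => (hd x).continuousAt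
  have hfg := integrable_mul_of_sq hf hc hf2 hg2
  have hder : ∀ y, HasDerivAt (fun y => f y ^ 2) (2 * (f y * f' y)) y := fun y => by
    refine ((hd y).fun_pow 2).congr_deriv ?_
    ring
  have hint : Integrable fun y => 2 * (f y * f' y) := hfg.const_mul 2
  have h0 : Tendsto (fun y => f y ^ 2) atBot (nhds 0) :=
    tendsto_zero_of_hasDerivAt_of_integrableOn_Iic (a := x) (fun y _ => hder y)
      hint.integrableOn hf2.integrableOn
  have := integral_Iic_of_hasDerivAt_of_tendsto' (a := x) (fun y _ => hder y)
      hint.integrableOn h0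
  rw [sub_zero] at this
  rw [← this, ← integral_const_mul]
  refine (setIntegral_mono_on hint.integrableOn (hfg.abs.const_mul 2).integrableOn
    measurableSet_Iic fun y _ => ?_).trans
    (setIntegral_le_integral (hfg.abs.const_mul 2) (ae_of_all _ fun y => by positivity))
  linarith [le_abs_self (f y * f' y)]

lemma sq_le_H1 {f f' : ℝ → ℝ} (hd : ∀ x, HasDerivAt f (f' x) x) (hc : Continuous f')
    (hf2 : Integrable fun x => f x ^ 2) (hg2 : Integrable fun x => f' x ^ 2) (x : ℝ) :
    f x ^ 2 ≤ (∫ y, f y ^ 2) + ∫ y, f' y ^ 2 := by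
  have hf : Continuous f := continuous_iff_continuousAt.2 fun x => (hd x).continuousAt
  exact (sq_le_two_integral hd hc hf2 hg2 x).trans (integral_abs_mul_le hf hc hf2 hg2)

lemma pow_four_le {f f' : ℝ → ℝ} (hd : ∀ x, HasDerivAt f (f' x) x) (hc : Continuous f')
    (hf2 : Integrable fun x => f x ^ 2) (hg2 : Integrable fun x => f' x ^ 2) (x : ℝ) :
    f x ^ 4 ≤ 4 * ((∫ y, f y ^ 2) * ∫ y, f' y ^ 2) := by
  have hf : Continuous f := continuous_iff_continuousAt.2 fun x => (hd x).continuousAt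
  have h1 := sq_le_two_integral hd hc hf2 hg2 x
  have h2 := integral_abs_mul_sq_le hf hc hf2 hg2
  have h3 : (f x ^ 2) ^ 2 ≤ (2 * ∫ y, |f y * f' y|) ^ 2 := pow_le_pow_left₀ (sq_nonneg _) h1 2
  nlinarith

/-! ### The solution and its derivatives -/

/-- The spatial derivatives `U k` of a solution of the quartic gKdV equation, with the evolution
equations of the first three of them. -/
structure Sol (U : ℕ → ℝ → ℝ → ℝ) : Prop where
  cont : ∀ k, Continuous fun p : ℝ × ℝ => U k p.1 p.2
  dx : ∀ k t x, HasDerivAt (U k t) (U (k + 1) t x) x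
  dt0 : ∀ t x, HasDerivAt (fun s => U 0 s x) (-U 3 t x - 4 * U 0 t x ^ 3 * U 1 t x) t
  dt1 : ∀ t x, HasDerivAt (fun s => U 1 s x)
    (-U 4 t x - 12 * U 0 t x ^ 2 * U 1 t x ^ 2 - 4 * U 0 t x ^ 3 * U 2 t x) t
  dt2 : ∀ t x, HasDerivAt (fun s => U 2 s x)
    (-U 5 t x - 4 * U 0 t x ^ 3 * U 3 t x - 36 * U 0 t x ^ 2 * U 1 t x * U 2 t x
      - 24 * U 0 t x * U 1 t x ^ 3) t
  sq : ∀ k t, Integrable fun x => U k t x ^ 2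

/-- Directional derivative of a function on the plane. -/
noncomputable def dirDeriv (e : ℝ × ℝ) (f : ℝ × ℝ → ℝ) (p : ℝ × ℝ) : ℝ := fderiv ℝ f p e

lemma contDiff_dirDeriv {f : ℝ × ℝ → ℝ} (hf : ContDiff ℝ (⊤ : ℕ∞) f) (e : ℝ × ℝ) :
    ContDiff ℝ (⊤ : ℕ∞) (dirDeriv e f) :=
  (hf.fderiv_right (m := (⊤ : ℕ∞)) (by simp)).clm_apply contDiff_const

lemma dirDeriv_comm {f : ℝ × ℝ → ℝ} (hf : ContDiff ℝ (⊤ : ℕ∞) f) (e e' p : ℝ × ℝ) :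
    dirDeriv e (dirDeriv e' f) p = dirDeriv e' (dirDeriv e f) p := by
  have hd : DifferentiableAt ℝ (fderiv ℝ f) p :=
    ((hf.fderiv_right (m := (⊤ : ℕ∞)) (by simp)).differentiable (by simp)) p
  have h : ∀ a b, dirDeriv a (dirDeriv b f) p = fderiv ℝ (fderiv ℝ f) p a b := by
    intro a b
    have : HasFDerivAt (dirDeriv b f)
        ((fderiv ℝ (fderiv ℝ f) p).flip b) p := by
      have := hd.hasFDerivAt.clm_apply (hasFDerivAt_const b p)
      exact this.congr_fderiv (by simp)
    rw [dirDeriv, this.fderiv]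
    rfl
  rw [h, h]
  exact (hf.contDiffAt.isSymmSndFDerivAt (by simpa using WithTop.coe_le_coe.2 (le_top : (2 : ℕ∞) ≤ ⊤))) _ _

lemma hasDerivAt_snd {f : ℝ × ℝ → ℝ} (hf : ContDiff ℝ (⊤ : ℕ∞) f) (t x : ℝ) :
    HasDerivAt (fun y => f (t, y)) (dirDeriv (0, 1) f (t, x)) x := by
  have h := (hf.differentiable (by simp) (t, x)).hasFDerivAt
  exact h.comp_hasDerivAt x ((hasDerivAt_const x t).prodMk (hasDerivAt_id x))

lemma hasDerivAt_fst {f : ℝ × ℝ → ℝ} (hf : ContDiff ℝ (⊤ : ℕ∞) f) (t x : ℝ) :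
    HasDerivAt (fun s => f (s, x)) (dirDeriv (1, 0) f (t, x)) t := by
  have h := (hf.differentiable (by simp) (t, x)).hasFDerivAt
  exact h.comp_hasDerivAt t ((hasDerivAt_id t).prodMk (hasDerivAt_const t x))

/-- Iterated derivative of a function on the plane in its second variable. -/
noncomputable def iterSnd (f : ℝ × ℝ → ℝ) : ℕ → ℝ × ℝ → ℝ
  | 0 => f
  | k + 1 => dirDeriv (0, 1) (iterSnd f k)

lemma contDiff_iterSnd {f : ℝ × ℝ → ℝ} (hf : ContDiff ℝ (⊤ : ℕ∞) f) (k : ℕ) :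
    ContDiff ℝ (⊤ : ℕ∞) (iterSnd f k) := by
  induction k with
  | zero => exact hf
  | succ k ih => exact contDiff_dirDeriv ih _

lemma iteratedDeriv_eq_iterSnd {u : ℝ → ℝ → ℝ} (hu : ContDiff ℝ (⊤ : ℕ∞) (Function.uncurry u))
    (k : ℕ) (t : ℝ) : iteratedDeriv k (u t) = fun x => iterSnd (Function.uncurry u) k (t, x) := by
  induction k with
  | zero => ext x; simp [iterSnd, Function.uncurry]
  | succ k ih =>
    ext x
    rw [iteratedDeriv_succ, ih]
    exact (hasDerivAt_snd (contDiff_iterSnd hu k) t x).deriv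

/-- The time derivative of a spatial derivative is the spatial derivative of the time
derivative. -/
lemma hasDerivAt_time_succ {f g : ℝ × ℝ → ℝ} (hf : ContDiff ℝ (⊤ : ℕ∞) f)
    {g' : ℝ → ℝ → ℝ} (ht : ∀ t x, HasDerivAt (fun s => f (s, x)) (g (t, x)) t)
    (hg : ∀ t x, HasDerivAt (fun y => g (t, y)) (g' t x) x) (t x : ℝ) :
    HasDerivAt (fun s => dirDeriv (0, 1) f (s, x)) (g' t x) t := by
  have h := hasDerivAt_fst (contDiff_dirDeriv hf (0, 1)) t x
  have he : dirDeriv (1, 0) f = g := by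
    ext ⟨s, y⟩
    exact (hasDerivAt_fst hf s y).unique (ht s y)
  rw [dirDeriv_comm hf, he] at h
  have h2 := hasDerivAt_snd (contDiff_dirDeriv hf (1, 0)) t x
  rw [he] at h2
  exact h.congr_deriv (h2.unique (hg t x))

theorem sol_of_isGKdVSolution {u : ℝ → ℝ → ℝ} (hu : IsGKdVSolution u) :
    Sol fun k t => iteratedDeriv k (u t) := by
  obtain ⟨hc, heq, hsq⟩ := hu
  set V := iterSnd (Function.uncurry u) with hV
  have hVc : ∀ k, ContDiff ℝ (⊤ : ℕ∞) (V k) := contDiff_iterSnd hc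
  have hdx : ∀ k t x, HasDerivAt (fun y => V k (t, y)) (V (k + 1) (t, x)) x :=
    fun k t x => hasDerivAt_snd (hVc k) t x
  have h0 : ∀ t x, HasDerivAt (fun s => V 0 (s, x))
      (-V 3 (t, x) - 4 * V 0 (t, x) ^ 3 * V 1 (t, x)) t := by
    intro t x
    have h1 := hasDerivAt_fst (hVc 0) t x
    have h2 := heq t x
    have h3 : deriv (fun s => u s x) t = dirDeriv (1, 0) (V 0) (t, x) := h1.deriv
    rw [h3, iteratedDeriv_eq_iterSnd hc] at h2
    have h4 := ((hdx 2 t x).fun_add ((hdx 0 t x).fun_pow 4)).deriv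
    have h5 : (fun y => u t y) = fun y => V 0 (t, y) := rfl
    refine h1.congr_deriv ?_
    have h6 : (fun y => iterSnd (Function.uncurry u) 2 (t, y) + u t y ^ 4)
      = fun y => V 2 (t, y) + V 0 (t, y) ^ 4 := rfl
    rw [h6, h4] at h2
    push_cast at h2
    linear_combination h2
  have h1 : ∀ t x, HasDerivAt (fun s => V 1 (s, x))
      (-V 4 (t, x) - 12 * V 0 (t, x) ^ 2 * V 1 (t, x) ^ 2 - 4 * V 0 (t, x) ^ 3 * V 2 (t, x)) t := by
    refine hasDerivAt_time_succ (g := fun p => -V 3 p - 4 * V 0 p ^ 3 * V 1 p)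
      (g' := fun t x => -V 4 (t, x) - 12 * V 0 (t, x) ^ 2 * V 1 (t, x) ^ 2
        - 4 * V 0 (t, x) ^ 3 * V 2 (t, x)) (hVc 0) h0 fun t x => ?_
    refine ((hdx 3 t x).fun_neg.fun_sub
      ((((hdx 0 t x).fun_pow 3).const_mul 4).fun_mul (hdx 1 t x))).congr_deriv ?_
    push_cast
    ring
  have h2 : ∀ t x, HasDerivAt (fun s => V 2 (s, x))
      (-V 5 (t, x) - 4 * V 0 (t, x) ^ 3 * V 3 (t, x) - 36 * V 0 (t, x) ^ 2 * V 1 (t, x) * V 2 (t, x)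
      - 24 * V 0 (t, x) * V 1 (t, x) ^ 3) t := by
    refine hasDerivAt_time_succ (g := fun p => -V 4 p - 12 * V 0 p ^ 2 * V 1 p ^ 2
        - 4 * V 0 p ^ 3 * V 2 p)
      (g' := fun t x => -V 5 (t, x) - 4 * V 0 (t, x) ^ 3 * V 3 (t, x)
        - 36 * V 0 (t, x) ^ 2 * V 1 (t, x) * V 2 (t, x)
      - 24 * V 0 (t, x) * V 1 (t, x) ^ 3) (hVc 1) h1 fun t x => ?_
    refine (((hdx 4 t x).fun_neg.fun_sub
      ((((hdx 0 t x).fun_pow 2).const_mul 12).fun_mul ((hdx 1 t x).fun_pow 2))).fun_sub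
      ((((hdx 0 t x).fun_pow 3).const_mul 4).fun_mul (hdx 2 t x))).congr_deriv ?_
    push_cast
    ring
  have hU : (fun k t => iteratedDeriv k (u t)) = fun k t x => V k (t, x) := by
    ext k t x
    rw [iteratedDeriv_eq_iterSnd hc]
  rw [hU]
  refine ⟨fun k => (hVc k).continuous, hdx, h0, h1, h2, fun k t => ?_⟩
  have := hsq t k
  rwa [iteratedDeriv_eq_iterSnd hc] at this

/-! ### Weights and localized balance laws -/

/-- A function `f` with its first three derivatives, all bounded by `K`. -/
structure Weight (K : ℝ) (f f1 f2 f3 : ℝ → ℝ) : Prop where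
  d0 : ∀ x, HasDerivAt f (f1 x) x
  d1 : ∀ x, HasDerivAt f1 (f2 x) x
  d2 : ∀ x, HasDerivAt f2 (f3 x) x
  c3 : Continuous f3
  b0 : ∀ x, |f x| ≤ K
  b1 : ∀ x, |f1 x| ≤ K
  b2 : ∀ x, |f2 x| ≤ K
  b3 : ∀ x, |f3 x| ≤ K

namespace Weight

variable {K K' : ℝ} {f f1 f2 f3 g g1 g2 g3 : ℝ → ℝ}

lemma c0 (h : Weight K f f1 f2 f3) : Continuous f :=
  continuous_iff_continuousAt.2 fun x => (h.d0 x).continuousAt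

lemma c1 (h : Weight K f f1 f2 f3) : Continuous f1 :=
  continuous_iff_continuousAt.2 fun x => (h.d1 x).continuousAt

lemma c2 (h : Weight K f f1 f2 f3) : Continuous f2 :=
  continuous_iff_continuousAt.2 fun x => (h.d2 x).continuousAt

lemma mul (h : Weight K f f1 f2 f3) (h' : Weight K' g g1 g2 g3) :
    Weight (8 * (K * K')) (fun x => f x * g x) (fun x => f1 x * g x + f x * g1 x)
      (fun x => f2 x * g x + 2 * (f1 x * g1 x) + f x * g2 x)
      (fun x => f3 x * g x + 3 * (f2 x * g1 x) + 3 * (f1 x * g2 x) + f x * g3 x) := by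
  have hK : 0 ≤ K := (abs_nonneg _).trans (h.b0 0)
  have hb : ∀ a b : ℝ, |a| ≤ K → |b| ≤ K' → -(K * K') ≤ a * b ∧ a * b ≤ K * K' :=
    fun a b ha hb => by
      have : |a * b| ≤ K * K' := by
        rw [abs_mul]; exact mul_le_mul ha hb (abs_nonneg _) hK
      exact abs_le.1 this
  have hKK : 0 ≤ K * K' := mul_nonneg hK ((abs_nonneg _).trans (h'.b0 0))
  have e0 := h.b0; have e1 := h.b1; have e2 := h.b2; have e3 := h.b3
  have e0' := h'.b0; have e1' := h'.b1; have e2' := h'.b2; have e3' := h'.b3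
  constructor
  · exact fun x => (h.d0 x).fun_mul (h'.d0 x)
  · intro x
    refine (((h.d1 x).fun_mul (h'.d0 x)).fun_add ((h.d0 x).fun_mul (h'.d1 x))).congr_deriv ?_
    ring
  · intro x
    refine ((((h.d2 x).fun_mul (h'.d0 x)).fun_add
      (((h.d1 x).fun_mul (h'.d1 x)).const_mul 2)).fun_add
      ((h.d0 x).fun_mul (h'.d2 x))).congr_deriv ?_
    ring
  · have := h.c0; have := h.c1; have := h.c2; have := h.c3
    have := h'.c0; have := h'.c1; have := h'.c2; have := h'.c3
    fun_prop
  · intro x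
    have := hb _ _ (e0 x) (e0' x)
    rw [abs_le]; constructor <;> linarith
  · intro x
    have := hb _ _ (e1 x) (e0' x)
    have := hb _ _ (e0 x) (e1' x)
    rw [abs_le]; constructor <;> linarith
  · intro x
    have := hb _ _ (e2 x) (e0' x)
    have := hb _ _ (e1 x) (e1' x)
    have := hb _ _ (e0 x) (e2' x)
    rw [abs_le]; constructor <;> linarith
  · intro x
    have := hb _ _ (e3 x) (e0' x)
    have := hb _ _ (e2 x) (e1' x)
    have := hb _ _ (e1 x) (e2' x)
    have := hb _ _ (e0 x) (e3' x)
    rw [abs_le]; constructor <;> linarith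

/-- Dilation by a factor at least one. -/
lemma comp_div (h : Weight K f f1 f2 f3) {R : ℝ} (hR : 1 ≤ R) :
    Weight K (fun x => f (x / R)) (fun x => f1 (x / R) / R) (fun x => f2 (x / R) / R ^ 2)
      (fun x => f3 (x / R) / R ^ 3) := by
  have hb : ∀ (a : ℝ) (n : ℕ), |a| ≤ K → |a / R ^ n| ≤ K := fun a n ha => by
    rw [abs_div, abs_of_pos (pow_pos (by linarith : 0 < R) n)]
    exact (div_le_self (abs_nonneg _) (one_le_pow₀ hR)).trans ha
  have hd : ∀ x, HasDerivAt (fun x => x / R) (1 / R) x := fun x => (hasDerivAt_id x).div_const R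
  have hR0 : R ≠ 0 := by positivity
  constructor
  · intro x
    refine ((h.d0 (x / R)).comp x (hd x)).congr_deriv ?_
    ring
  · intro x
    refine (((h.d1 (x / R)).comp x (hd x)).div_const R).congr_deriv ?_
    field_simp
  · intro x
    refine (((h.d2 (x / R)).comp x (hd x)).div_const (R ^ 2)).congr_deriv ?_
    field_simp
  · have := h.c3
    fun_prop
  · exact fun x => h.b0 _
  · intro x
    simpa using hb _ 1 (h.b1 (x / R))
  · exact fun x => hb _ 2 (h.b2 (x / R))
  · exact fun x => hb _ 3 (h.b3 (x / R))

lemma const (a : ℝ) : Weight |a| (fun _ => a) (fun _ => 0) (fun _ => 0) fun _ => 0 := by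
  constructor <;> intros <;> first | simp | skip
  · exact hasDerivAt_const _ _
  · exact hasDerivAt_const _ _
  · exact hasDerivAt_const _ _
  · exact continuous_const

end Weight

/-- Compactly supported weights increasing to one. -/
lemma exists_cutoff : ∃ (K : ℝ) (χ χ1 χ2 χ3 : ℕ → ℝ → ℝ),
    (∀ n, Weight K (χ n) (χ1 n) (χ2 n) (χ3 n)) ∧
    (∀ n, ∃ A, ∀ x, A < |x| → χ n x = 0 ∧ χ1 n x = 0 ∧ χ2 n x = 0 ∧ χ3 n x = 0) ∧
    ∀ x, ∀ᶠ n in atTop, χ n x = 1 ∧ χ1 n x = 0 ∧ χ2 n x = 0 ∧ χ3 n x = 0 := by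
  let b : ContDiffBump (0 : ℝ) := ⟨1, 2, one_pos, one_lt_two⟩
  have hb : ContDiff ℝ (⊤ : ℕ∞) b := b.contDiff
  have hc : ∀ k : ℕ, ContDiff ℝ (⊤ : ℕ∞) (deriv^[k] b) := fun k => by
    induction k with
    | zero => exact hb
    | succ k ih =>
      rw [Function.iterate_succ_apply']
      exact (contDiff_infty_iff_deriv.1 ih).2
  have hs : ∀ k : ℕ, HasCompactSupport (deriv^[k] b) := fun k => by
    induction k with
    | zero => exact b.hasCompactSupport
    | succ k ih =>
      rw [Function.iterate_succ_apply']
      exact ih.deriv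
  have hd : ∀ k x, HasDerivAt (deriv^[k] b) (deriv^[k + 1] b x) x := fun k x => by
    rw [Function.iterate_succ_apply']
    exact ((hc k).differentiable (by simp) x).hasDerivAt
  choose B hB using fun k : ℕ => (hc k).continuous.bounded_above_of_compact_support (hs k)
  have hz : ∀ k x, 2 < |x| → deriv^[k] b x = 0 := fun k => by
    induction k with
    | zero =>
      intro x hx
      exact b.zero_of_le_dist (by simpa using hx.le)
    | succ k ih =>
      intro x hx
      have : (deriv^[k] b) =ᶠ[nhds x] fun _ => 0 := by
        filter_upwards [(isOpen_lt continuous_const continuous_abs).mem_nhds hx] with y hy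
        exact ih y hy
      rw [Function.iterate_succ_apply', this.deriv_eq, deriv_const]
  have h1 : ∀ k x, |x| < 1 → deriv^[k + 1] b x = 0 := fun k => by
    induction k with
    | zero =>
      intro x hx
      have : b =ᶠ[nhds x] fun _ => 1 := by
        filter_upwards [(isOpen_lt continuous_abs continuous_const).mem_nhds hx] with y hy
        exact b.one_of_mem_closedBall (by simpa using (le_of_lt hy))
      simp only [zero_add, Function.iterate_one]
      rw [this.deriv_eq, deriv_const]
    | succ k ih =>
      intro x hx
      have : (deriv^[k + 1] b) =ᶠ[nhds x] fun _ => 0 := by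
        filter_upwards [(isOpen_lt continuous_abs continuous_const).mem_nhds hx] with y hy
        exact ih y hy
      rw [Function.iterate_succ_apply', this.deriv_eq, deriv_const]
  have hw : Weight (|B 0| + |B 1| + |B 2| + |B 3|) b (deriv^[1] b) (deriv^[2] b) (deriv^[3] b) := by
    refine ⟨hd 0, hd 1, hd 2, (hc 3).continuous, fun x => ?_, fun x => ?_, fun x => ?_, fun x => ?_⟩
    · have := hB 0 x
      simp only [Function.iterate_zero, id, Real.norm_eq_abs] at this
      linarith [le_abs_self (B 0), abs_nonneg (B 1), abs_nonneg (B 2), abs_nonneg (B 3)]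
    · have := hB 1 x
      rw [Real.norm_eq_abs] at this
      linarith [le_abs_self (B 1), abs_nonneg (B 0), abs_nonneg (B 2), abs_nonneg (B 3)]
    · have := hB 2 x
      rw [Real.norm_eq_abs] at this
      linarith [le_abs_self (B 2), abs_nonneg (B 0), abs_nonneg (B 1), abs_nonneg (B 3)]
    · have := hB 3 x
      rw [Real.norm_eq_abs] at this
      linarith [le_abs_self (B 3), abs_nonneg (B 0), abs_nonneg (B 1), abs_nonneg (B 2)]
  refine ⟨_, fun n x => b (x / (n + 1)), fun n x => deriv^[1] b (x / (n + 1)) / (n + 1),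
    fun n x => deriv^[2] b (x / (n + 1)) / (n + 1) ^ 2,
    fun n x => deriv^[3] b (x / (n + 1)) / (n + 1) ^ 3, fun n => hw.comp_div (by simp),
    fun n => ⟨2 * (n + 1), fun x hx => ?_⟩, fun x => ?_⟩
  · have : 2 < |x / (n + 1)| := by
      rw [abs_div, abs_of_pos (by positivity : (0 : ℝ) < n + 1), lt_div_iff₀ (by positivity)]
      exact hx
    refine ⟨hz 0 _ this, ?_, ?_, ?_⟩
    · simp only [hz 1 _ this, zero_div]
    · simp only [hz 2 _ this, zero_div]
    · simp only [hz 3 _ this, zero_div]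
  · obtain ⟨m, hm⟩ := exists_nat_gt |x|
    filter_upwards [eventually_ge_atTop m] with n hn
    have : |x / (n + 1)| < 1 := by
      rw [abs_div, abs_of_pos (by positivity : (0 : ℝ) < n + 1), div_lt_one (by positivity)]
      have : (m : ℝ) ≤ n := by exact_mod_cast hn
      linarith
    refine ⟨b.one_of_mem_closedBall (mem_closedBall_zero_iff.2 this.le), ?_, ?_, ?_⟩
    · simp only [h1 0 _ this, zero_div]
    · simp only [h1 1 _ this, zero_div]
    · simp only [h1 2 _ this, zero_div]

/-- Jointly continuous functions integrable in space, uniformly for times in `T`. -/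
def L1On (T : Set ℝ) (f : ℝ → ℝ → ℝ) : Prop :=
  (Continuous fun p : ℝ × ℝ => f p.1 p.2) ∧
    ∃ C, ∀ t ∈ T, Integrable (f t) ∧ ∫ x, |f t x| ≤ C

/-- The local balance law `∂ₜρ = S + ∂ₓ(j + ∂ₓk + ∂ₓ²m)`. -/
structure Balance (ρ S j k k1 m m1 m2 F : ℝ → ℝ → ℝ) : Prop where
  dt : ∀ t x, HasDerivAt (fun s => ρ s x) (S t x + F t x) t
  dF : ∀ t x, HasDerivAt (fun y => j t y + k1 t y + m2 t y) (F t x) x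
  dk : ∀ t x, HasDerivAt (k t) (k1 t x) x
  dm : ∀ t x, HasDerivAt (m t) (m1 t x) x
  dm1 : ∀ t x, HasDerivAt (m1 t) (m2 t x) x
  cF : Continuous fun p : ℝ × ℝ => F p.1 p.2
  ck1 : Continuous fun p : ℝ × ℝ => k1 p.1 p.2
  cm1 : Continuous fun p : ℝ × ℝ => m1 p.1 p.2
  cm2 : Continuous fun p : ℝ × ℝ => m2 p.1 p.2

/-- The right-hand side of the balance law tested against a weight moving with speed `σ`. -/
def flux (ρ S j k m : ℝ → ℝ → ℝ) (f f1 f2 f3 : ℝ → ℝ) (σ t x : ℝ) : ℝ :=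
  S t x * f (x - σ * t) - j t x * f1 (x - σ * t) + k t x * f2 (x - σ * t)
    - m t x * f3 (x - σ * t) - σ * (ρ t x * f1 (x - σ * t))

section

variable {ρ S j k k1 m m1 m2 F : ℝ → ℝ → ℝ} {f f1 f2 f3 : ℝ → ℝ} {K : ℝ}

lemma balance_of_compact (hb : Balance ρ S j k k1 m m1 m2 F)
    (cρ : Continuous fun p : ℝ × ℝ => ρ p.1 p.2) (cS : Continuous fun p : ℝ × ℝ => S p.1 p.2)
    (cj : Continuous fun p : ℝ × ℝ => j p.1 p.2) (ck : Continuous fun p : ℝ × ℝ => k p.1 p.2)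
    (cm : Continuous fun p : ℝ × ℝ => m p.1 p.2) (hf : Weight K f f1 f2 f3) {A : ℝ}
    (hA : ∀ x, A < |x| → f x = 0 ∧ f1 x = 0 ∧ f2 x = 0 ∧ f3 x = 0) (σ s t : ℝ) :
    (∫ x, ρ t x * f (x - σ * t)) - ∫ x, ρ s x * f (x - σ * s)
      = ∫ τ in s..t, ∫ x, flux ρ S j k m f f1 f2 f3 σ τ x := by
  have c0 := hf.c0; have c1 := hf.c1; have c2 := hf.c2; have c3 := hf.c3
  have cF := hb.cF; have ck1 := hb.ck1; have cm1 := hb.cm1; have cm2 := hb.cm2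
  let G : ℝ → ℝ → ℝ := fun τ x =>
    (S τ x + F τ x) * f (x - σ * τ) + ρ τ x * (f1 (x - σ * τ) * (-σ))
  have cG : Continuous fun p : ℝ × ℝ => G p.1 p.2 := by
    simp only [G]; fun_prop
  have hder : ∀ x τ, HasDerivAt (fun τ => ρ τ x * f (x - σ * τ)) (G τ x) τ := by
    intro x τ
    have h1 : HasDerivAt (fun τ => x - σ * τ) (-σ) τ := by
      simpa using ((hasDerivAt_id τ).const_mul σ).const_sub x
    exact (hb.dt τ x).fun_mul ((hf.d0 (x - σ * τ)).comp τ h1)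
  have supp : ∀ τ (g : ℝ → ℝ), Continuous g → (∀ x, A < |x - σ * τ| → g x = 0) →
      Integrable g := by
    intro τ g hg hz
    refine hg.integrable_of_hasCompactSupport
      (HasCompactSupport.intro (isCompact_Icc (a := σ * τ - A) (b := σ * τ + A)) fun x hx => ?_)
    refine hz x ?_
    by_contra hlt
    rw [not_lt, abs_le] at hlt
    exact hx ⟨by linarith, by linarith⟩
  have hFTC : ∀ x, ∫ τ in s..t, G τ x = ρ t x * f (x - σ * t) - ρ s x * f (x - σ * s) := by
    intro x
    refine intervalIntegral.integral_eq_sub_of_hasDerivAt (fun τ _ => hder x τ) ?_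
    have : Continuous fun τ => G τ x := by
      simp only [G]; fun_prop
    exact this.intervalIntegrable _ _
  have i1 : ∀ τ, Integrable fun x => ρ τ x * f (x - σ * τ) := fun τ =>
    supp τ _ (by fun_prop) fun x hx => by rw [(hA _ hx).1, mul_zero]
  rw [← integral_sub (i1 t) (i1 s)]
  simp_rw [← hFTC]
  have hprod : Integrable (Function.uncurry G)
      ((volume.restrict (Set.uIoc s t)).prod volume) := by
    let B := |A| + |σ| * (|s| + |t|)
    have hK : IsCompact (Set.uIcc s t ×ˢ Set.Icc (-B) B) := isCompact_uIcc.prod isCompact_Icc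
    have hint : IntegrableOn (Function.uncurry G) (Set.uIcc s t ×ˢ Set.Icc (-B) B)
        (volume.prod volume) := by
      exact ContinuousOn.integrableOn_compact hK (by exact cG.continuousOn)
    have h2 : IntegrableOn (Function.uncurry G) (Set.uIcc s t ×ˢ Set.univ)
        (volume.prod volume) := by
      refine hint.of_forall_sdiff_eq_zero (measurableSet_uIcc.prod MeasurableSet.univ) ?_
      rintro ⟨τ, x⟩ ⟨⟨hτ, -⟩, hx⟩
      have hτ' : |τ| ≤ |s| + |t| := by
        rcases Set.mem_uIcc.1 hτ with h | h <;> rw [abs_le] <;> constructor <;>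
          linarith [neg_abs_le s, neg_abs_le t, le_abs_self s, le_abs_self t]
      have : A < |x - σ * τ| := by
        by_contra hlt
        rw [not_lt] at hlt
        refine hx ⟨hτ, abs_le.1 ?_⟩
        have e1 : |x| ≤ |x - σ * τ| + |σ * τ| := by
          simpa using abs_add_le (x - σ * τ) (σ * τ)
        rw [abs_mul] at e1
        have := mul_le_mul_of_nonneg_left hτ' (abs_nonneg σ)
        have := le_abs_self A
        simp only [B]
        linarith
      simp only [Function.uncurry, G, (hA _ this).1, (hA _ this).2.1]
      ring
    have h3 := h2.mono_set (Set.prod_mono (Set.uIoc_subset_uIcc (a := s) (b := t))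
      (subset_refl Set.univ))
    rwa [IntegrableOn, ← Measure.prod_restrict, Measure.restrict_univ] at h3
  rw [← intervalIntegral_integral_swap hprod]
  congr 1
  ext τ
  have hpot : ∀ x, HasDerivAt (fun x => (j τ x + k1 τ x + m2 τ x) * f (x - σ * τ)
      - k τ x * f1 (x - σ * τ) - m1 τ x * f1 (x - σ * τ) + m τ x * f2 (x - σ * τ))
      (G τ x - flux ρ S j k m f f1 f2 f3 σ τ x) x := by
    intro x
    have hs : HasDerivAt (fun x => x - σ * τ) 1 x := (hasDerivAt_id x).sub_const _
    have w0 := (hf.d0 (x - σ * τ)).comp x hs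
    have w1 := (hf.d1 (x - σ * τ)).comp x hs
    have w2 := (hf.d2 (x - σ * τ)).comp x hs
    refine (((((hb.dF τ x).fun_mul w0).fun_sub ((hb.dk τ x).fun_mul w1)).fun_sub
      ((hb.dm1 τ x).fun_mul w1)).fun_add ((hb.dm τ x).fun_mul w2)).congr_deriv ?_
    simp only [G, flux, Function.comp_apply]
    ring
  have iG : Integrable (G τ) := supp τ _ (by simp only [G]; fun_prop) fun x hx => by
    simp only [G, (hA _ hx).1, (hA _ hx).2.1]
    ring
  have iFl : Integrable (flux ρ S j k m f f1 f2 f3 σ τ) :=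
    supp τ _ (by unfold flux; fun_prop) fun x hx => by
      obtain ⟨e0, e1, e2, e3⟩ := hA _ hx
      simp only [flux, e0, e1, e2, e3]
      ring
  have := integral_eq_zero_of_hasDerivAt_of_integrable hpot (iG.sub iFl)
    (supp τ _ (by fun_prop) fun x hx => by
      obtain ⟨e0, e1, e2, e3⟩ := hA _ hx
      simp only [e0, e1, e2]
      ring)
  rw [integral_sub iG iFl] at this
  linarith

lemma L1On.integrable_mul {T : Set ℝ} (h : L1On T ρ) {t : ℝ} (ht : t ∈ T) {g : ℝ → ℝ}
    (hg : Continuous g) {K : ℝ} (hK : ∀ x, |g x| ≤ K) : Integrable fun x => ρ t x * g x := by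
  obtain ⟨C, hC⟩ := h.2
  refine (hC t ht).1.mul_bdd (c := K) hg.aestronglyMeasurable (ae_of_all _ fun x => hK x)

/-- Integrated balance law for densities and fluxes that are integrable uniformly in time. -/
theorem balance_integral (hb : Balance ρ S j k k1 m m1 m2 F) {s t : ℝ}
    (hρ : L1On (Set.uIcc s t) ρ) (hS : L1On (Set.uIcc s t) S) (hj : L1On (Set.uIcc s t) j)
    (hk : L1On (Set.uIcc s t) k) (hm : L1On (Set.uIcc s t) m) (hf : Weight K f f1 f2 f3) (σ : ℝ) :
    (∫ x, ρ t x * f (x - σ * t)) - ∫ x, ρ s x * f (x - σ * s)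
      = ∫ τ in s..t, ∫ x, flux ρ S j k m f f1 f2 f3 σ τ x := by
  obtain ⟨Kc, χ, χ1, χ2, χ3, hχ, hχz, hχ1⟩ := exists_cutoff
  obtain ⟨cρ, Cρ, bρ⟩ := id hρ
  obtain ⟨cS, CS, bS⟩ := id hS
  obtain ⟨cj, Cj, bj⟩ := id hj
  obtain ⟨ck, Ck, bk⟩ := id hk
  obtain ⟨cm, Cm, bm⟩ := id hm
  set L := 8 * (K * Kc) with hL
  have hw := fun n => hf.mul (hχ n)
  have hL0 : 0 ≤ L := (abs_nonneg _).trans ((hw 0).b0 0)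
  choose A hA using hχz
  have hbal := fun n => balance_of_compact hb cρ cS cj ck cm (hw n) (A := A n) (fun x hx => by
      obtain ⟨e0, e1, e2, e3⟩ := hA n x hx
      simp only [e0, e1, e2, e3, mul_zero, add_zero, and_self]) σ s t
  have hev : ∀ y, ∀ᶠ n in atTop, f y * χ n y = f y ∧ f1 y * χ n y + f y * χ1 n y = f1 y ∧
      f2 y * χ n y + 2 * (f1 y * χ1 n y) + f y * χ2 n y = f2 y ∧
      f3 y * χ n y + 3 * (f2 y * χ1 n y) + 3 * (f1 y * χ2 n y) + f y * χ3 n y = f3 y := by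
    intro y
    filter_upwards [hχ1 y] with n ⟨e0, e1, e2, e3⟩
    simp only [e0, e1, e2, e3]
    refine ⟨by ring, by ring, by ring, by ring⟩
  have hlim : ∀ τ ∈ Set.uIcc s t, Tendsto (fun n => ∫ x, ρ τ x * (f (x - σ * τ) * χ n (x - σ * τ)))
      atTop (nhds (∫ x, ρ τ x * f (x - σ * τ))) := by
    intro τ hτ
    refine tendsto_integral_of_dominated_convergence (fun x => |ρ τ x| * L) (fun n => ?_)
      ((bρ τ hτ).1.abs.mul_const L) (fun n => ae_of_all _ fun x => ?_) (ae_of_all _ fun x => ?_)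
    · have := hf.c0; have := (hχ n).c0
      exact Continuous.aestronglyMeasurable (by fun_prop)
    · rw [Real.norm_eq_abs, abs_mul]
      exact mul_le_mul_of_nonneg_left ((hw n).b0 _) (abs_nonneg _)
    · refine tendsto_const_nhds.congr' ?_
      filter_upwards [hev (x - σ * τ)] with n hn
      rw [hn.1]
  have hl := (hlim t Set.right_mem_uIcc).sub (hlim s Set.left_mem_uIcc)
  refine tendsto_nhds_unique hl ?_
  simp_rw [hbal]
  let g : ℝ → ℝ → ℝ := fun τ x => L * (|S τ x| + |j τ x| + |k τ x| + |m τ x| + |σ| * |ρ τ x|)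
  have hgi : ∀ τ ∈ Set.uIcc s t, Integrable (g τ) := fun τ hτ =>
    ((((bS τ hτ).1.abs.add (bj τ hτ).1.abs).add (bk τ hτ).1.abs).add (bm τ hτ).1.abs).add
      ((bρ τ hτ).1.abs.const_mul _) |>.const_mul L
  have hgI : ∀ τ ∈ Set.uIcc s t, ∫ x, g τ x ≤ L * (CS + Cj + Ck + Cm + |σ| * Cρ) := by
    intro τ hτ
    obtain ⟨i1, e1⟩ := bS τ hτ
    obtain ⟨i2, e2⟩ := bj τ hτ
    obtain ⟨i3, e3⟩ := bk τ hτ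
    obtain ⟨i4, e4⟩ := bm τ hτ
    obtain ⟨i5, e5⟩ := bρ τ hτ
    have : ∫ x, g τ x = L * ((∫ x, |S τ x|) + (∫ x, |j τ x|) + (∫ x, |k τ x|) + (∫ x, |m τ x|)
        + |σ| * ∫ x, |ρ τ x|) := by
      simp only [g]
      rw [integral_const_mul, integral_add, integral_add, integral_add, integral_add,
        integral_const_mul]
      · exact i1.abs
      · exact i2.abs
      · exact i1.abs.add i2.abs
      · exact i3.abs
      · exact (i1.abs.add i2.abs).add i3.abs
      · exact i4.abs
      · exact ((i1.abs.add i2.abs).add i3.abs).add i4.abs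
      · exact i5.abs.const_mul _
    rw [this]
    have := mul_le_mul_of_nonneg_left e5 (abs_nonneg σ)
    exact mul_le_mul_of_nonneg_left (by linarith) hL0
  have hcw : ∀ n, Continuous fun p : ℝ × ℝ => flux ρ S j k m
      (fun x => f x * χ n x) (fun x => f1 x * χ n x + f x * χ1 n x)
      (fun x => f2 x * χ n x + 2 * (f1 x * χ1 n x) + f x * χ2 n x)
      (fun x => f3 x * χ n x + 3 * (f2 x * χ1 n x) + 3 * (f1 x * χ2 n x) + f x * χ3 n x)
      σ p.1 p.2 := by
    intro n
    have := hf.c0; have := hf.c1; have := hf.c2; have := hf.c3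
    have := (hχ n).c0; have := (hχ n).c1; have := (hχ n).c2; have := (hχ n).c3
    unfold flux
    fun_prop
  have hdom : ∀ n τ x, |flux ρ S j k m
      (fun x => f x * χ n x) (fun x => f1 x * χ n x + f x * χ1 n x)
      (fun x => f2 x * χ n x + 2 * (f1 x * χ1 n x) + f x * χ2 n x)
      (fun x => f3 x * χ n x + 3 * (f2 x * χ1 n x) + 3 * (f1 x * χ2 n x) + f x * χ3 n x)
      σ τ x| ≤ g τ x := by
    intro n τ x
    have hm' : ∀ a b : ℝ, |b| ≤ L → |a * b| ≤ L * |a| := fun a b h => by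
      rw [abs_mul, mul_comm L]; exact mul_le_mul_of_nonneg_left h (abs_nonneg _)
    have e0 := hm' (S τ x) _ ((hw n).b0 (x - σ * τ))
    have e1 := hm' (j τ x) _ ((hw n).b1 (x - σ * τ))
    have e2 := hm' (k τ x) _ ((hw n).b2 (x - σ * τ))
    have e3 := hm' (m τ x) _ ((hw n).b3 (x - σ * τ))
    have e4 := mul_le_mul_of_nonneg_left (hm' (ρ τ x) _ ((hw n).b1 (x - σ * τ))) (abs_nonneg σ)
    rw [← abs_mul] at e4
    simp only [flux, g]
    refine (abs_sub _ _).trans ?_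
    refine (add_le_add_left (abs_sub _ _) _).trans ?_
    refine (add_le_add_left (add_le_add_left (abs_add_le _ _) _) _).trans ?_
    refine (add_le_add_left (add_le_add_left (add_le_add_left (abs_sub _ _) _) _) _).trans ?_
    linarith
  refine intervalIntegral.tendsto_integral_filter_of_dominated_convergence
    (fun _ => L * (CS + Cj + Ck + Cm + |σ| * Cρ)) (Eventually.of_forall fun n => ?_)
    (Eventually.of_forall fun n => ae_of_all _ fun τ hτ => ?_) intervalIntegrable_const
    (ae_of_all _ fun τ hτ => ?_)
  · exact ((hcw n).stronglyMeasurable.integral_prod_right').aestronglyMeasurable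
  · have hτ' := Set.uIoc_subset_uIcc hτ
    exact (norm_integral_le_of_norm_le (hgi τ hτ') (ae_of_all _ fun x => hdom n τ x)).trans
      (hgI τ hτ')
  · have hτ' := Set.uIoc_subset_uIcc hτ
    refine tendsto_integral_of_dominated_convergence (g τ) (fun n => ?_) (hgi τ hτ')
      (fun n => ae_of_all _ fun x => hdom n τ x) (ae_of_all _ fun x => ?_)
    · exact ((hcw n).comp (by fun_prop : Continuous fun x : ℝ => (τ, x))).aestronglyMeasurable
    · refine tendsto_const_nhds.congr' ?_
      filter_upwards [hev (x - σ * τ)] with n ⟨e0, e1, e2, e3⟩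
      simp only [flux, e0, e1, e2, e3]

end

/-! ### Uniform Lebesgue bounds on time sets -/

/-- Jointly continuous functions square-integrable in space, uniformly for times in `T`. -/
def L2On (T : Set ℝ) (f : ℝ → ℝ → ℝ) : Prop :=
  (Continuous fun p : ℝ × ℝ => f p.1 p.2) ∧
    ∃ C, ∀ t ∈ T, (Integrable fun x => f t x ^ 2) ∧ ∫ x, f t x ^ 2 ≤ C

/-- Jointly continuous functions bounded in space, uniformly for times in `T`. -/
def BddOn (T : Set ℝ) (f : ℝ → ℝ → ℝ) : Prop :=
  (Continuous fun p : ℝ × ℝ => f p.1 p.2) ∧ ∃ C, ∀ t ∈ T, ∀ x, |f t x| ≤ C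

section

variable {T : Set ℝ} {f g : ℝ → ℝ → ℝ}

lemma slice_continuous (h : Continuous fun p : ℝ × ℝ => f p.1 p.2) (t : ℝ) : Continuous (f t) :=
  h.comp (by fun_prop : Continuous fun x : ℝ => (t, x))

lemma L1On.congr (hf : L1On T f) (h : ∀ t x, g t x = f t x) : L1On T g := by
  have : g = f := by ext t x; exact h t x
  rwa [this]

lemma L1On.mul (hf : L2On T f) (hg : L2On T g) : L1On T fun t x => f t x * g t x := by
  obtain ⟨cf, C, hC⟩ := hf
  obtain ⟨cg, D, hD⟩ := hg
  refine ⟨cf.mul cg, (C + D) / 2, fun t ht => ?_⟩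
  obtain ⟨i1, e1⟩ := hC t ht
  obtain ⟨i2, e2⟩ := hD t ht
  refine ⟨integrable_mul_of_sq (slice_continuous cf t) (slice_continuous cg t) i1 i2, ?_⟩
  linarith [integral_abs_mul_le (slice_continuous cf t) (slice_continuous cg t) i1 i2]

lemma L1On.sq (hf : L2On T f) : L1On T fun t x => f t x ^ 2 :=
  (L1On.mul hf hf).congr fun _ _ => by ring

lemma L1On.mul_bdd (hf : L1On T f) (hg : BddOn T g) : L1On T fun t x => f t x * g t x := by
  obtain ⟨cf, C, hC⟩ := hf
  obtain ⟨cg, D, hD⟩ := hg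
  refine ⟨cf.mul cg, C * D, fun t ht => ?_⟩
  obtain ⟨i1, e1⟩ := hC t ht
  have hi : Integrable fun x => f t x * g t x :=
    i1.mul_bdd (c := D) (slice_continuous cg t).aestronglyMeasurable (ae_of_all _ (hD t ht))
  refine ⟨hi, ?_⟩
  have hD0 : 0 ≤ D := (abs_nonneg _).trans (hD t ht 0)
  refine (integral_mono hi.abs (i1.abs.mul_const D) fun x => ?_).trans ?_
  · simp only [abs_mul]
    exact mul_le_mul_of_nonneg_left (hD t ht x) (abs_nonneg _)
  · rw [integral_mul_const]
    exact mul_le_mul_of_nonneg_right e1 hD0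

lemma L1On.const_mul (hf : L1On T f) (a : ℝ) : L1On T fun t x => a * f t x :=
  (hf.mul_bdd (g := fun _ _ => a) ⟨continuous_const, |a|, fun _ _ _ => le_rfl⟩).congr
    fun _ _ => mul_comm _ _

lemma L1On.add (hf : L1On T f) (hg : L1On T g) : L1On T fun t x => f t x + g t x := by
  obtain ⟨cf, C, hC⟩ := hf
  obtain ⟨cg, D, hD⟩ := hg
  refine ⟨cf.add cg, C + D, fun t ht => ?_⟩
  obtain ⟨i1, e1⟩ := hC t ht
  obtain ⟨i2, e2⟩ := hD t ht
  refine ⟨i1.fun_add i2, ?_⟩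
  refine (integral_mono (i1.fun_add i2).abs (i1.abs.fun_add i2.abs)
    fun x => abs_add_le _ _).trans ?_
  rw [integral_add i1.abs i2.abs]
  linarith

lemma L1On.neg (hf : L1On T f) : L1On T fun t x => -f t x :=
  (hf.const_mul (-1)).congr fun _ _ => by ring

lemma L1On.sub (hf : L1On T f) (hg : L1On T g) : L1On T fun t x => f t x - g t x :=
  (hf.add hg.neg).congr fun _ _ => by ring

lemma L1On.zero : L1On T fun _ _ => 0 :=
  ⟨continuous_const, 0, fun _ _ => by simp⟩

lemma L2On.mul_bdd (hf : L2On T f) (hg : BddOn T g) : L2On T fun t x => f t x * g t x := by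
  have h := L1On.mul_bdd (L1On.mul_bdd (L1On.sq hf) hg) hg
  obtain ⟨c, C, hC⟩ := h.congr (g := fun t x => (f t x * g t x) ^ 2) fun t x => by ring
  refine ⟨hf.1.mul hg.1, C, fun t ht => ⟨(hC t ht).1, ?_⟩⟩
  simpa only [abs_sq] using (hC t ht).2

lemma L2On.const_mul (hf : L2On T f) (a : ℝ) : L2On T fun t x => a * f t x := by
  have := hf.mul_bdd (g := fun _ _ => a) ⟨continuous_const, |a|, fun _ _ _ => le_rfl⟩
  simpa only [mul_comm] using this

lemma L2On.add (hf : L2On T f) (hg : L2On T g) : L2On T fun t x => f t x + g t x := by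
  have h := ((L1On.sq hf).add ((L1On.mul hf hg).const_mul 2)).add (L1On.sq hg)
  obtain ⟨c, C, hC⟩ := h.congr (g := fun t x => (f t x + g t x) ^ 2) fun t x => by ring
  refine ⟨hf.1.add hg.1, C, fun t ht => ⟨(hC t ht).1, ?_⟩⟩
  simpa only [abs_sq] using (hC t ht).2

lemma BddOn.mul (hf : BddOn T f) (hg : BddOn T g) : BddOn T fun t x => f t x * g t x := by
  obtain ⟨cf, C, hC⟩ := hf
  obtain ⟨cg, D, hD⟩ := hg
  refine ⟨cf.mul cg, C * D, fun t ht x => ?_⟩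
  rw [abs_mul]
  exact mul_le_mul (hC t ht x) (hD t ht x) (abs_nonneg _) ((abs_nonneg _).trans (hC t ht x))

lemma BddOn.pow (hf : BddOn T f) (n : ℕ) : BddOn T fun t x => f t x ^ n := by
  obtain ⟨cf, C, hC⟩ := hf
  refine ⟨cf.pow n, C ^ n, fun t ht x => ?_⟩
  rw [abs_pow]
  exact pow_le_pow_left₀ (abs_nonneg _) (hC t ht x) n

lemma BddOn.of_H1 (hd : ∀ t x, HasDerivAt (f t) (g t x) x) (hf : L2On T f) (hg : L2On T g) :
    BddOn T f := by
  obtain ⟨cf, C, hC⟩ := hf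
  obtain ⟨cg, D, hD⟩ := hg
  refine ⟨cf, √(C + D), fun t ht x => ?_⟩
  refine Real.abs_le_sqrt ?_
  exact (sq_le_H1 (hd t) (slice_continuous cg t) (hC t ht).1 (hD t ht).1 x).trans
    (add_le_add (hC t ht).2 (hD t ht).2)

lemma L1On.mono {T' : Set ℝ} (hf : L1On T f) (h : T' ⊆ T) : L1On T' f :=
  ⟨hf.1, hf.2.imp fun _ hC t ht => hC t (h ht)⟩

lemma L2On.mono {T' : Set ℝ} (hf : L2On T f) (h : T' ⊆ T) : L2On T' f :=
  ⟨hf.1, hf.2.imp fun _ hC t ht => hC t (h ht)⟩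

end

/-- Fatou's lemma for sequences with uniformly bounded integrals. -/
lemma integral_le_of_tendsto {F : ℕ → ℝ → ℝ} {f : ℝ → ℝ} {A : ℝ}
    (hF : ∀ n, Integrable (F n)) (hF0 : ∀ n x, 0 ≤ F n x) (hf : Continuous f)
    (hlim : ∀ x, Tendsto (fun n => F n x) atTop (nhds (f x)))
    (hA : ∀ n, ∫ x, F n x ≤ A) : ∫ x, f x ≤ A := by
  have hf0 : ∀ x, 0 ≤ f x := fun x => ge_of_tendsto' (hlim x) fun n => hF0 n x
  have hA0 : 0 ≤ A := (integral_nonneg (hF0 0)).trans (hA 0)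
  rw [integral_eq_lintegral_of_nonneg_ae (ae_of_all _ hf0) hf.aestronglyMeasurable]
  refine ENNReal.toReal_le_of_le_ofReal hA0 ?_
  have h1 : ∀ x, ENNReal.ofReal (f x) = liminf (fun n => ENNReal.ofReal (F n x)) atTop :=
    fun x => ((ENNReal.continuous_ofReal.tendsto _).comp (hlim x)).liminf_eq.symm
  simp_rw [h1]
  refine (lintegral_liminf_le' fun n => (hF n).aemeasurable.ennreal_ofReal).trans ?_
  refine liminf_le_of_le (by isBoundedDefault) fun b hb => ?_
  obtain ⟨n, hn⟩ := hb.exists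
  refine hn.trans ?_
  rw [← ofReal_integral_eq_lintegral_ofReal (hF n) (ae_of_all _ (hF0 n))]
  exact ENNReal.ofReal_le_ofReal (hA n)

/-- Unweighted integrated balance law. -/
lemma balance_total {ρ S j k k1 m m1 m2 F : ℝ → ℝ → ℝ} (hb : Balance ρ S j k k1 m m1 m2 F)
    {s t : ℝ} (hρ : L1On (Set.uIcc s t) ρ) (hS : L1On (Set.uIcc s t) S)
    (hj : L1On (Set.uIcc s t) j) (hk : L1On (Set.uIcc s t) k) (hm : L1On (Set.uIcc s t) m) :
    (∫ x, ρ t x) - ∫ x, ρ s x = ∫ τ in s..t, ∫ x, S τ x := by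
  have := balance_integral hb hρ hS hj hk hm (Weight.const 1) 0
  simpa [flux] using this

/-! ### Balance laws of the quartic gKdV equation -/

namespace Sol

variable {U : ℕ → ℝ → ℝ → ℝ}

lemma cont_slice (hU : Sol U) (k : ℕ) (t : ℝ) : Continuous (U k t) :=
  slice_continuous (hU.cont k) t

lemma balance_mass (hU : Sol U) : Balance (fun t x => U 0 t x ^ 2) (fun _ _ => 0)
    (fun t x => 3 * U 1 t x ^ 2 - 8 / 5 * U 0 t x ^ 5) (fun _ _ => 0) (fun _ _ => 0)
    (fun t x => -U 0 t x ^ 2) (fun t x => -2 * (U 0 t x * U 1 t x))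
    (fun t x => -2 * (U 1 t x ^ 2 + U 0 t x * U 2 t x))
    (fun t x => -8 * U 0 t x ^ 4 * U 1 t x - 2 * U 0 t x * U 3 t x) := by
  have h0 := hU.cont 0; have h1 := hU.cont 1; have h2 := hU.cont 2; have h3 := hU.cont 3
  refine ⟨fun t x => ?_, fun t x => ?_, fun t x => hasDerivAt_const _ _, fun t x => ?_,
    fun t x => ?_, by fun_prop, by fun_prop, by fun_prop, by fun_prop⟩
  · refine ((hU.dt0 t x).fun_pow 2).congr_deriv ?_
    push_cast; ring
  · refine (((((hU.dx 1 t x).fun_pow 2).const_mul 3).fun_sub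
      (((hU.dx 0 t x).fun_pow 5).const_mul (8 / 5))).fun_add (hasDerivAt_const x 0)).fun_add
      ((((hU.dx 1 t x).fun_pow 2).fun_add ((hU.dx 0 t x).fun_mul (hU.dx 2 t x))).const_mul (-2))
      |>.congr_deriv ?_
    push_cast; ring
  · refine ((hU.dx 0 t x).fun_pow 2).fun_neg.congr_deriv ?_
    push_cast; ring
  · refine (((hU.dx 0 t x).fun_mul (hU.dx 1 t x)).const_mul (-2)).congr_deriv ?_
    ring

lemma balance_energy (hU : Sol U) :
    Balance (fun t x => U 1 t x ^ 2 - 2 / 5 * U 0 t x ^ 5) (fun _ _ => 0)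
    (fun t x => 3 * (U 2 t x + U 0 t x ^ 4) ^ 2 - 2 * (U 0 t x ^ 4 * (U 2 t x + U 0 t x ^ 4)))
    (fun t x => -2 * (U 1 t x * (U 2 t x + U 0 t x ^ 4)))
    (fun t x => -2 * (U 2 t x * (U 2 t x + U 0 t x ^ 4)
      + U 1 t x * (U 3 t x + 4 * U 0 t x ^ 3 * U 1 t x))) (fun _ _ => 0) (fun _ _ => 0)
    (fun _ _ => 0)
    (fun t x => 2 * U 0 t x ^ 4 * (U 3 t x + 4 * U 0 t x ^ 3 * U 1 t x)
      - 2 * U 1 t x * (U 4 t x + 12 * U 0 t x ^ 2 * U 1 t x ^ 2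
        + 4 * U 0 t x ^ 3 * U 2 t x)) := by
  have h0 := hU.cont 0; have h1 := hU.cont 1; have h2 := hU.cont 2; have h3 := hU.cont 3
  have h4 := hU.cont 4
  have hw : ∀ t x, HasDerivAt (fun x => U 2 t x + U 0 t x ^ 4)
      (U 3 t x + 4 * U 0 t x ^ 3 * U 1 t x) x := fun t x => by
    refine ((hU.dx 2 t x).fun_add ((hU.dx 0 t x).fun_pow 4)).congr_deriv ?_
    push_cast; ring
  refine ⟨fun t x => ?_, fun t x => ?_, fun t x => ?_, fun t x => hasDerivAt_const _ _,
    fun t x => hasDerivAt_const _ _, by fun_prop, by fun_prop, by fun_prop, by fun_prop⟩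
  · refine (((hU.dt1 t x).fun_pow 2).fun_sub
      (((hU.dt0 t x).fun_pow 5).const_mul (2 / 5))).congr_deriv ?_
    push_cast; ring
  · refine ((((hw t x).fun_pow 2).const_mul 3).fun_sub
      ((((hU.dx 0 t x).fun_pow 4).fun_mul (hw t x)).const_mul 2)).fun_add
      ((((hU.dx 2 t x).fun_mul (hw t x)).fun_add ((hU.dx 1 t x).fun_mul
        ((hU.dx 3 t x).fun_add ((((hU.dx 0 t x).fun_pow 3).const_mul 4).fun_mul
          (hU.dx 1 t x))))).const_mul (-2)) |>.fun_add (hasDerivAt_const x 0)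
      |>.congr_deriv ?_
    push_cast; ring
  · exact ((hU.dx 1 t x).fun_mul (hw t x)).const_mul (-2)

lemma balance_second (hU : Sol U) :
    Balance (fun t x => U 2 t x ^ 2 - 20 / 3 * (U 0 t x ^ 3 * U 1 t x ^ 2))
    (fun t x => 2 * U 1 t x ^ 5 + 80 * (U 0 t x ^ 5 * U 1 t x ^ 3))
    (fun t x => 3 * U 3 t x ^ 2 - 4 * (U 0 t x ^ 3 * U 2 t x ^ 2)
      - 20 / 3 * (-2 * (U 0 t x ^ 3 * (U 1 t x * U 3 t x)) + U 0 t x ^ 3 * U 2 t x ^ 2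
        + 3 * (U 0 t x ^ 2 * U 1 t x ^ 2 * U 2 t x) - 4 * (U 0 t x ^ 6 * U 1 t x ^ 2))
      - 2 * (U 0 t x * U 1 t x ^ 4)) (fun _ _ => 0) (fun _ _ => 0)
    (fun t x => -U 2 t x ^ 2) (fun t x => -2 * (U 2 t x * U 3 t x))
    (fun t x => -2 * (U 3 t x ^ 2 + U 2 t x * U 4 t x))
    (fun t x => 2 * U 2 t x * (-U 5 t x - 4 * U 0 t x ^ 3 * U 3 t x
        - 36 * U 0 t x ^ 2 * U 1 t x * U 2 t x - 24 * U 0 t x * U 1 t x ^ 3)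
      - 20 / 3 * (3 * U 0 t x ^ 2 * U 1 t x ^ 2 * (-U 3 t x - 4 * U 0 t x ^ 3 * U 1 t x)
        + 2 * U 0 t x ^ 3 * U 1 t x * (-U 4 t x - 12 * U 0 t x ^ 2 * U 1 t x ^ 2
          - 4 * U 0 t x ^ 3 * U 2 t x)) - 2 * U 1 t x ^ 5 - 80 * (U 0 t x ^ 5 * U 1 t x ^ 3)) := by
  have h0 := hU.cont 0; have h1 := hU.cont 1; have h2 := hU.cont 2; have h3 := hU.cont 3
  have h4 := hU.cont 4; have h5 := hU.cont 5
  refine ⟨fun t x => ?_, fun t x => ?_, fun t x => hasDerivAt_const _ _, fun t x => ?_,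
    fun t x => ?_, by fun_prop, by fun_prop, by fun_prop, by fun_prop⟩
  · refine (((hU.dt2 t x).fun_pow 2).fun_sub ((((hU.dt0 t x).fun_pow 3).fun_mul
      ((hU.dt1 t x).fun_pow 2)).const_mul (20 / 3))).congr_deriv ?_
    push_cast; ring
  · have d0 := hU.dx 0 t x; have d1 := hU.dx 1 t x; have d2 := hU.dx 2 t x
    have d3 := hU.dx 3 t x; have d4 := hU.dx 4 t x
    refine ((((d3.fun_pow 2).const_mul 3).fun_sub
      (((d0.fun_pow 3).fun_mul (d2.fun_pow 2)).const_mul 4)).fun_sub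
      ((((((d0.fun_pow 3).fun_mul (d1.fun_mul d3)).const_mul (-2)).fun_add
        ((d0.fun_pow 3).fun_mul (d2.fun_pow 2))).fun_add
        ((((d0.fun_pow 2).fun_mul (d1.fun_pow 2)).fun_mul d2).const_mul 3)).fun_sub
        (((d0.fun_pow 6).fun_mul (d1.fun_pow 2)).const_mul 4) |>.const_mul (20 / 3))).fun_sub
      ((d0.fun_mul (d1.fun_pow 4)).const_mul 2) |>.fun_add (hasDerivAt_const x 0) |>.fun_add
      (((d3.fun_pow 2).fun_add (d2.fun_mul d4)).const_mul (-2)) |>.congr_deriv ?_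
    push_cast; ring
  · refine ((hU.dx 2 t x).fun_pow 2).fun_neg.congr_deriv ?_
    push_cast; ring
  · refine (((hU.dx 2 t x).fun_mul (hU.dx 3 t x)).const_mul (-2)).congr_deriv ?_
    ring

lemma balance_integral (hU : Sol U) : Balance (fun t x => U 0 t x) (fun _ _ => 0)
    (fun t x => -U 0 t x ^ 4) (fun _ _ => 0) (fun _ _ => 0)
    (fun t x => -U 0 t x) (fun t x => -U 1 t x) (fun t x => -U 2 t x)
    (fun t x => -U 3 t x - 4 * U 0 t x ^ 3 * U 1 t x) := by
  have h0 := hU.cont 0; have h1 := hU.cont 1; have h2 := hU.cont 2; have h3 := hU.cont 3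
  refine ⟨fun t x => ?_, fun t x => ?_, fun t x => hasDerivAt_const _ _, fun t x => ?_,
    fun t x => ?_, by fun_prop, by fun_prop, by fun_prop, by fun_prop⟩
  · exact (hU.dt0 t x).congr_deriv (by ring)
  · refine (((hU.dx 0 t x).fun_pow 4).fun_neg.fun_add (hasDerivAt_const x 0)).fun_add
      (hU.dx 2 t x).fun_neg |>.congr_deriv ?_
    push_cast; ring
  · exact (hU.dx 0 t x).fun_neg
  · exact (hU.dx 1 t x).fun_neg

/-- Balance law for the square of a spatial difference of the second derivative. -/
lemma balance_diff (hU : Sol U) (h : ℝ) :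
    Balance (fun t x => (U 2 t (x + h) - U 2 t x) ^ 2)
    (fun t x => 12 * (U 0 t (x + h) ^ 2 * U 1 t (x + h)) * (U 2 t (x + h) - U 2 t x) ^ 2
      - 8 * ((U 0 t (x + h) ^ 3 - U 0 t x ^ 3) * U 3 t x * (U 2 t (x + h) - U 2 t x))
      - 2 * ((U 2 t (x + h) - U 2 t x) *
        ((36 * (U 0 t (x + h) ^ 2 * U 1 t (x + h) * U 2 t (x + h))
            + 24 * (U 0 t (x + h) * U 1 t (x + h) ^ 3))
          - (36 * (U 0 t x ^ 2 * U 1 t x * U 2 t x) + 24 * (U 0 t x * U 1 t x ^ 3)))))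
    (fun t x => 3 * (U 3 t (x + h) - U 3 t x) ^ 2
      - 4 * (U 0 t (x + h) ^ 3 * (U 2 t (x + h) - U 2 t x) ^ 2))
    (fun _ _ => 0) (fun _ _ => 0)
    (fun t x => -(U 2 t (x + h) - U 2 t x) ^ 2)
    (fun t x => -2 * ((U 2 t (x + h) - U 2 t x) * (U 3 t (x + h) - U 3 t x)))
    (fun t x => -2 * ((U 3 t (x + h) - U 3 t x) ^ 2
      + (U 2 t (x + h) - U 2 t x) * (U 4 t (x + h) - U 4 t x)))
    (fun t x => -2 * (U 2 t (x + h) - U 2 t x) * (U 5 t (x + h) - U 5 t x)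
      - 12 * (U 0 t (x + h) ^ 2 * U 1 t (x + h)) * (U 2 t (x + h) - U 2 t x) ^ 2
      - 8 * U 0 t (x + h) ^ 3 * (U 2 t (x + h) - U 2 t x) * (U 3 t (x + h) - U 3 t x)) := by
  have h0 := hU.cont 0; have h1 := hU.cont 1; have h2 := hU.cont 2; have h3 := hU.cont 3
  have h4 := hU.cont 4; have h5 := hU.cont 5
  have hs : ∀ k t x, HasDerivAt (fun y => U k t (y + h)) (U (k + 1) t (x + h)) x := fun k t x =>
    (hU.dx k t (x + h)).comp_add_const x h
  have hz : ∀ k t x, HasDerivAt (fun y => U k t (y + h) - U k t y)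
      (U (k + 1) t (x + h) - U (k + 1) t x) x := fun k t x => (hs k t x).fun_sub (hU.dx k t x)
  refine ⟨fun t x => ?_, fun t x => ?_, fun t x => hasDerivAt_const _ _, fun t x => ?_,
    fun t x => ?_, by fun_prop, by fun_prop, by fun_prop, by fun_prop⟩
  · refine (((hU.dt2 t (x + h)).fun_sub (hU.dt2 t x)).fun_pow 2).congr_deriv ?_
    push_cast; ring
  · refine ((((hz 3 t x).fun_pow 2).const_mul 3).fun_sub
      ((((hs 0 t x).fun_pow 3).fun_mul ((hz 2 t x).fun_pow 2)).const_mul 4)).fun_add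
      (hasDerivAt_const x 0) |>.fun_add ((((hz 3 t x).fun_pow 2).fun_add
      ((hz 2 t x).fun_mul (hz 4 t x))).const_mul (-2)) |>.congr_deriv ?_
    push_cast; ring
  · refine ((hz 2 t x).fun_pow 2).fun_neg.congr_deriv ?_
    push_cast; ring
  · refine (((hz 2 t x).fun_mul (hz 3 t x)).const_mul (-2)).congr_deriv ?_
    ring

end Sol

/-! ### A Baire category argument for local boundedness -/

lemma exists_bound_of_locally {N : ℝ → ℝ} {K : Set ℝ} (hK : IsCompact K)
    (h : ∀ t ∈ K, ∃ ε > 0, ∃ C, ∀ τ, |τ - t| < ε → N τ ≤ C) : ∃ C, ∀ τ ∈ K, N τ ≤ C := by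
  refine hK.induction_on (p := fun s => ∃ C, ∀ τ ∈ s, N τ ≤ C) ⟨0, by simp⟩ ?_ ?_ ?_
  · rintro s t hst ⟨C, hC⟩
    exact ⟨C, fun τ hτ => hC τ (hst hτ)⟩
  · rintro s t ⟨C, hC⟩ ⟨D, hD⟩
    refine ⟨max C D, fun τ hτ => ?_⟩
    rcases hτ with hτ | hτ
    · exact (hC τ hτ).trans (le_max_left _ _)
    · exact (hD τ hτ).trans (le_max_right _ _)
  · intro t ht
    obtain ⟨ε, hε, C, hC⟩ := h t ht
    refine ⟨Metric.ball t ε, mem_nhdsWithin_of_mem_nhds (Metric.ball_mem_nhds t hε), C,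
      fun τ hτ => hC τ ?_⟩
    rwa [Metric.mem_ball, Real.dist_eq] at hτ

lemma abs_sub_le_of_mem_uIcc {a b t : ℝ} (h : b ∈ Set.uIcc a t) : |t - b| ≤ |t - a| := by
  exact Set.abs_sub_right_of_mem_uIcc h

/-- A function with closed sublevel sets is locally bounded as soon as its bounds propagate
over short intervals where it is bounded, and boundedness extends to end points. -/
lemma locally_bounded_of_propagation {N : ℝ → ℝ} (hcl : ∀ K, IsClosed {t | N t ≤ K})
    (hA : ∀ n, ∃ K, ∃ δ > 0, ∀ s t, |t - s| ≤ δ → (∃ C, ∀ τ ∈ Set.uIcc s t, N τ ≤ C) → N s ≤ n →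
      ∀ τ ∈ Set.uIcc s t, N τ ≤ K)
    (hB : ∀ a t, |t - a| ≤ 1 → (∀ b ∈ Set.uIcc a t, b ≠ a → ∃ C, ∀ τ ∈ Set.uIcc b t, N τ ≤ C) →
      ∃ C, ∀ τ ∈ Set.uIcc a t, N τ ≤ C) (t : ℝ) :
    ∃ ε > 0, ∃ C, ∀ τ, |τ - t| < ε → N τ ≤ C := by
  by_contra hbad
  let F : Set ℝ := {t | ¬ ∃ ε > 0, ∃ C, ∀ τ, |τ - t| < ε → N τ ≤ C}
  have hFc : IsClosed F := by
    rw [← isOpen_compl_iff, Metric.isOpen_iff]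
    intro x hx
    simp only [F, Set.mem_compl_iff, Set.mem_ofPred_eq, not_not] at hx
    obtain ⟨ε, hε, C, hC⟩ := hx
    refine ⟨ε / 2, by positivity, fun y hy => ?_⟩
    simp only [F, Set.mem_compl_iff, Set.mem_ofPred_eq, not_not]
    refine ⟨ε / 2, by positivity, C, fun τ hτ => hC τ ?_⟩
    rw [Metric.mem_ball, Real.dist_eq] at hy
    have : |τ - x| ≤ |τ - y| + |y - x| := abs_sub_le _ _ _
    linarith
  have htF : t ∈ F := hbad
  have : Nonempty F := ⟨⟨t, htF⟩⟩
  have : CompleteSpace F := hFc.completeSpace_coe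
  obtain ⟨n, hn⟩ := nonempty_interior_of_iUnion_of_closed
    (f := fun n : ℕ => {x : F | N x ≤ n})
    (fun n => (hcl n).preimage continuous_subtype_val) (by
      ext x
      simp only [Set.mem_iUnion, Set.mem_ofPred_eq, Set.mem_univ, iff_true]
      exact exists_nat_ge _)
  obtain ⟨⟨a, haF⟩, ha⟩ := hn
  rw [mem_interior_iff_mem_nhds, Metric.mem_nhds_iff] at ha
  obtain ⟨r, hr, hball⟩ := ha
  have hFn : ∀ b ∈ F, |b - a| < r → N b ≤ n := fun b hb hba =>
    hball (show (⟨b, hb⟩ : F) ∈ Metric.ball ⟨a, haF⟩ r from hba)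
  obtain ⟨K, δ, hδ, hK⟩ := hA n
  refine haF ⟨min r (min δ 1), by positivity, max n K, fun τ hτ => ?_⟩
  have hτ1 : |τ - a| < r := lt_of_lt_of_le hτ (min_le_left _ _)
  have hτ2 : |τ - a| < δ := lt_of_lt_of_le hτ ((min_le_right _ _).trans (min_le_left _ _))
  have hτ3 : |τ - a| < 1 := lt_of_lt_of_le hτ ((min_le_right _ _).trans (min_le_right _ _))
  have hcomp : IsCompact (F ∩ Set.uIcc a τ) := isCompact_uIcc.inter_left hFc
  obtain ⟨b, ⟨hbF, hbI⟩, hbmin⟩ := hcomp.exists_isMinOn ⟨a, haF, Set.left_mem_uIcc⟩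
    (f := fun x => |τ - x|) (by fun_prop)
  have hbn : N b ≤ n := by
    refine hFn b hbF ((Set.abs_sub_left_of_mem_uIcc hbI).trans_lt hτ1)
  have hbτ : |τ - b| ≤ |τ - a| := abs_sub_le_of_mem_uIcc hbI
  have hbd := hB b τ (by linarith) fun c hc hcb => by
    refine exists_bound_of_locally isCompact_uIcc fun d hd => ?_
    by_contra hdF
    have hd1 : |τ - d| ≤ |τ - c| := abs_sub_le_of_mem_uIcc hd
    have hd2 : |τ - c| < |τ - b| := by
      refine lt_of_le_of_ne (abs_sub_le_of_mem_uIcc hc) fun h => hcb ?_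
      rcases Set.mem_uIcc.1 hc with hc | hc
      · rw [abs_of_nonneg (by linarith), abs_of_nonneg (by linarith)] at h
        linarith
      · rw [abs_of_nonpos (by linarith), abs_of_nonpos (by linarith)] at h
        linarith
    have hsub : d ∈ Set.uIcc a τ := by
      have h1 : Set.uIcc c τ ⊆ Set.uIcc b τ := Set.uIcc_subset_uIcc hc Set.right_mem_uIcc
      have h2 : Set.uIcc b τ ⊆ Set.uIcc a τ := Set.uIcc_subset_uIcc hbI Set.right_mem_uIcc
      exact h2 (h1 hd)
    have := hbmin ⟨(hdF : d ∈ F), hsub⟩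
    simp only [Set.mem_ofPred_eq] at this
    linarith
  exact (hK b τ (by linarith) hbd hbn τ Set.right_mem_uIcc).trans (le_max_right _ _)

/-- A bounded function that is at most an affine function of slope `η < 1` of its bounds. -/
lemma le_of_affine_bound {g : ℝ → ℝ} {T : Set ℝ} {a η : ℝ} (hη : η < 1)
    (hb : ∃ C, ∀ τ ∈ T, g τ ≤ C)
    (h : ∀ G, (∀ τ ∈ T, g τ ≤ G) → ∀ τ ∈ T, g τ ≤ a + η * G) : ∀ τ ∈ T, g τ ≤ a / (1 - η) := by
  intro τ hτ
  obtain ⟨C, hC⟩ := hb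
  have hbdd : BddAbove (g '' T) := ⟨C, by rintro _ ⟨x, hx, rfl⟩; exact hC x hx⟩
  have h1 : ∀ x ∈ T, g x ≤ sSup (g '' T) := fun x hx => le_csSup hbdd ⟨x, hx, rfl⟩
  have h2 : sSup (g '' T) ≤ a + η * sSup (g '' T) := by
    refine csSup_le ⟨_, τ, hτ, rfl⟩ ?_
    rintro _ ⟨x, hx, rfl⟩
    exact h _ h1 x hx
  refine (h1 τ hτ).trans ?_
  rw [le_div_iff₀ (by linarith)]
  linarith

/-! ### A priori bounds -/

lemma cube_le (a : ℝ) {η : ℝ} (hη : 0 < η) : |a| ^ 3 ≤ η * a ^ 4 + η⁻¹ ^ 3 := by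
  have h4 : a ^ 4 = |a| ^ 4 := by rw [← abs_pow, abs_of_nonneg (by positivity)]
  rw [h4]
  have ha := abs_nonneg a
  rcases le_total |a| η⁻¹ with h | h
  · have := pow_le_pow_left₀ ha h 3
    have : 0 ≤ η * |a| ^ 4 := by positivity
    linarith
  · have h1 : 1 ≤ η * |a| := by
      calc (1 : ℝ) = η * η⁻¹ := (mul_inv_cancel₀ hη.ne').symm
        _ ≤ η * |a| := mul_le_mul_of_nonneg_left h hη.le
    have : 0 ≤ η⁻¹ ^ 3 := by positivity
    nlinarith [pow_nonneg ha 3]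

lemma le_of_sq_le {a n : ℝ} (h : a ^ 2 ≤ n) : |a| ≤ 1 + n := by
  nlinarith [sq_abs a, sq_nonneg (|a| - 1), abs_nonneg a]

/-- Mean square of a difference. -/
lemma integral_diff_sq_le {f f' : ℝ → ℝ} (hd : ∀ x, HasDerivAt f (f' x) x) (hc : Continuous f')
    (h2 : Integrable fun x => f' x ^ 2) {h : ℝ} (hh : 0 < h) :
    (Integrable fun x => (f (x + h) - f x) ^ 2) ∧
      ∫ x, (f (x + h) - f x) ^ 2 ≤ h ^ 2 * ∫ x, f' x ^ 2 := by
  have hf : Continuous f := continuous_iff_continuousAt.2 fun x => (hd x).continuousAt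
  have key : ∀ x, (f (x + h) - f x) ^ 2 ≤ h * ∫ s in (0)..h, f' (x + s) ^ 2 := by
    intro x
    have e1 : f (x + h) - f x = ∫ s in (0)..h, f' (x + s) := by
      have := intervalIntegral.integral_eq_sub_of_hasDerivAt (a := 0) (b := h)
        (f := fun s => f (x + s)) (f' := fun s => f' (x + s))
        (fun s _ => (hd (x + s)).comp_const_add x s)
        ((hc.comp (by fun_prop : Continuous fun s => x + s)).intervalIntegrable _ _)
      rw [this, add_zero]
    set D := f (x + h) - f x with hD
    have i1 : IntervalIntegrable (fun s => f' (x + s) ^ 2) volume 0 h :=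
      Continuous.intervalIntegrable (by fun_prop) _ _
    have i2 : IntervalIntegrable (fun s => f' (x + s)) volume 0 h :=
      Continuous.intervalIntegrable (by fun_prop) _ _
    have e2 : 0 ≤ ∫ s in (0)..h, (h * f' (x + s) - D) ^ 2 :=
      intervalIntegral.integral_nonneg hh.le fun s _ => sq_nonneg _
    have e3 : (∫ s in (0)..h, (h * f' (x + s) - D) ^ 2)
        = h ^ 2 * (∫ s in (0)..h, f' (x + s) ^ 2) - 2 * h * D * (∫ s in (0)..h, f' (x + s))
          + h * D ^ 2 := by
      have : (fun s => (h * f' (x + s) - D) ^ 2) = fun s => h ^ 2 * f' (x + s) ^ 2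
          - 2 * h * D * f' (x + s) + D ^ 2 := by ext s; ring
      rw [this, intervalIntegral.integral_add ((i1.const_mul _).sub (i2.const_mul _))
        intervalIntegrable_const, intervalIntegral.integral_sub (i1.const_mul _) (i2.const_mul _),
        intervalIntegral.integral_const_mul, intervalIntegral.integral_const_mul,
        intervalIntegral.integral_const]
      simp
    rw [e3, ← e1] at e2
    have : 0 ≤ h * (h * (∫ s in (0)..h, f' (x + s) ^ 2) - D ^ 2) := by linarith
    have := nonneg_of_mul_nonneg_right this hh
    linarith
  have hprod : Integrable (Function.uncurry fun s x => f' (x + s) ^ 2)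
      ((volume.restrict (Set.uIoc 0 h)).prod volume) := by
    rw [integrable_prod_iff]
    · refine ⟨ae_of_all _ fun s => h2.comp_add_right s, ?_⟩
      have : (fun s : ℝ => ∫ x, ‖Function.uncurry (fun s x => f' (x + s) ^ 2) (s, x)‖)
          = fun _ => ∫ x, f' x ^ 2 := by
        ext s
        simp only [Function.uncurry, Real.norm_eq_abs, abs_sq]
        exact integral_add_right_eq_self (fun x => f' x ^ 2) s
      rw [this, Set.uIoc_of_le hh.le]
      exact integrable_const _
    · exact Continuous.aestronglyMeasurable (by simp only [Function.uncurry_def]; fun_prop)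
  have hI : Integrable fun x => ∫ s in (0)..h, f' (x + s) ^ 2 := by
    have := hprod.integral_prod_right
    simpa [intervalIntegral.integral_of_le hh.le, Set.uIoc_of_le hh.le] using this
  have hint : Integrable fun x => (f (x + h) - f x) ^ 2 := by
    refine (hI.const_mul h).mono' (Continuous.aestronglyMeasurable (by fun_prop))
      (ae_of_all _ fun x => ?_)
    rw [Real.norm_eq_abs, abs_sq]
    exact key x
  refine ⟨hint, (integral_mono hint (hI.const_mul h) key).trans_eq ?_⟩
  rw [integral_const_mul, ← intervalIntegral_integral_swap hprod]
  have : ∀ s : ℝ, ∫ x, f' (x + s) ^ 2 = ∫ x, f' x ^ 2 := fun s =>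
    integral_add_right_eq_self (fun x => f' x ^ 2) s
  simp_rw [this, intervalIntegral.integral_const]
  simp
  ring

namespace Sol

/-- Squared norm of the `i`-th derivative. -/
noncomputable def en (U : ℕ → ℝ → ℝ → ℝ) (i : ℕ) (t : ℝ) : ℝ := ∫ x, U i t x ^ 2

/-- The energy density. -/
noncomputable def eden (U : ℕ → ℝ → ℝ → ℝ) (t x : ℝ) : ℝ := U 1 t x ^ 2 - 2 / 5 * U 0 t x ^ 5

/-- Uniform bounds on the first three derivatives for times in `T`. -/
def Reg (U : ℕ → ℝ → ℝ → ℝ) (T : Set ℝ) : Prop := ∃ C, ∀ τ ∈ T, ∀ i ≤ 3, en U i τ ≤ C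

variable {U : ℕ → ℝ → ℝ → ℝ} {T : Set ℝ}

lemma en_nonneg (i : ℕ) (t : ℝ) : 0 ≤ en U i t := integral_nonneg fun _ => sq_nonneg _

lemma Reg.l2 (hU : Sol U) (hT : Reg U T) {i : ℕ} (hi : i ≤ 3) : L2On T (U i) := by
  obtain ⟨C, hC⟩ := hT
  exact ⟨hU.cont i, C, fun t ht => ⟨hU.sq i t, hC t ht i hi⟩⟩

lemma Reg.bdd (hU : Sol U) (hT : Reg U T) {i : ℕ} (hi : i ≤ 2) : BddOn T (U i) :=
  BddOn.of_H1 (hU.dx i) (hT.l2 hU (by omega)) (hT.l2 hU (by omega))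

lemma sup_sq (hU : Sol U) (i : ℕ) (t x : ℝ) : U i t x ^ 2 ≤ en U i t + en U (i + 1) t :=
  sq_le_H1 (hU.dx i t) (hU.cont_slice (i + 1) t) (hU.sq i t) (hU.sq (i + 1) t) x

lemma sup_four (hU : Sol U) (i : ℕ) (t x : ℝ) : U i t x ^ 4 ≤ 4 * (en U i t * en U (i + 1) t) :=
  pow_four_le (hU.dx i t) (hU.cont_slice (i + 1) t) (hU.sq i t) (hU.sq (i + 1) t) x

lemma Reg.l1_mass (hU : Sol U) (hT : Reg U T) : L1On T fun t x => U 0 t x ^ 2 :=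
  L1On.sq (hT.l2 hU (by norm_num))

lemma Reg.l1_pow (hU : Sol U) (hT : Reg U T) (n : ℕ) : L1On T fun t x => U 0 t x ^ (n + 2) :=
  ((hT.l1_mass hU).mul_bdd ((hT.bdd hU (by norm_num : 0 ≤ 2)).pow n)).congr fun _ _ => by ring

lemma Reg.l1_eden (hU : Sol U) (hT : Reg U T) :
    L1On T fun t x => U 1 t x ^ 2 - 2 / 5 * U 0 t x ^ 5 :=
  (L1On.sq (hT.l2 hU (by norm_num))).sub ((hT.l1_pow hU 3).const_mul _)

lemma Reg.l1_mass_flux (hU : Sol U) (hT : Reg U T) :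
    L1On T fun t x => 3 * U 1 t x ^ 2 - 8 / 5 * U 0 t x ^ 5 :=
  ((L1On.sq (hT.l2 hU (by norm_num))).const_mul _).sub ((hT.l1_pow hU 3).const_mul _)

lemma Reg.l2_w (hU : Sol U) (hT : Reg U T) : L2On T fun t x => U 2 t x + U 0 t x ^ 4 := by
  have h := ((hT.l2 hU (by norm_num : 0 ≤ 3)).mul_bdd ((hT.bdd hU (by norm_num : 0 ≤ 2)).pow 3))
  have := (hT.l2 hU (by norm_num : 2 ≤ 3)).add h
  have e : (fun t x => U 2 t x + U 0 t x ^ 4) = fun t x => U 2 t x + U 0 t x * U 0 t x ^ 3 := by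
    ext t x; ring
  rwa [e]

lemma Reg.l1_energy_flux (hU : Sol U) (hT : Reg U T) : L1On T fun t x =>
    3 * (U 2 t x + U 0 t x ^ 4) ^ 2 - 2 * (U 0 t x ^ 4 * (U 2 t x + U 0 t x ^ 4)) := by
  have h := ((hT.l2 hU (by norm_num : 0 ≤ 3)).mul_bdd ((hT.bdd hU (by norm_num : 0 ≤ 2)).pow 3))
  refine (((L1On.sq (hT.l2_w hU)).const_mul 3).sub
    ((L1On.mul h (hT.l2_w hU)).const_mul 2)).congr fun _ _ => by ring

lemma Reg.l1_energy_flux' (hU : Sol U) (hT : Reg U T) : L1On T fun t x =>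
    -2 * (U 1 t x * (U 2 t x + U 0 t x ^ 4)) :=
  (L1On.mul (hT.l2 hU (by norm_num)) (hT.l2_w hU)).const_mul _

lemma mass_eq (hU : Sol U) {s t : ℝ} (hT : Reg U (Set.uIcc s t)) : en U 0 t = en U 0 s := by
  have := balance_total hU.balance_mass (hT.l1_mass hU) L1On.zero (hT.l1_mass_flux hU) L1On.zero
    (hT.l1_mass hU).neg
  simp only [integral_zero, intervalIntegral.integral_zero] at this
  exact sub_eq_zero.1 this

lemma energy_eq (hU : Sol U) {s t : ℝ} (hT : Reg U (Set.uIcc s t)) :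
    ∫ x, eden U t x = ∫ x, eden U s x := by
  have := balance_total hU.balance_energy (hT.l1_eden hU) L1On.zero (hT.l1_energy_flux hU)
    (hT.l1_energy_flux' hU) L1On.zero
  simp only [integral_zero, intervalIntegral.integral_zero] at this
  exact sub_eq_zero.1 this

lemma integrable_pow (hU : Sol U) (n : ℕ) (t : ℝ) : Integrable fun x => U 0 t x ^ (n + 2) := by
  have hT : Reg U {t} := ⟨∑ i ∈ Finset.range 4, en U i t, fun τ hτ i hi => by
    rw [Set.mem_singleton_iff.1 hτ]
    exact Finset.single_le_sum (f := fun i => en U i t) (fun i _ => en_nonneg i t)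
      (Finset.mem_range.2 (by omega))⟩
  exact ((hT.l1_pow hU n).2.choose_spec t rfl).1

lemma integral_five_le (hU : Sol U) (t : ℝ) {η : ℝ} (hη : 0 < η) :
    ∫ x, |U 0 t x ^ 5| ≤ en U 0 t * (η * (4 * (en U 0 t * en U 1 t)) + η⁻¹ ^ 3) := by
  have : en U 0 t * (η * (4 * (en U 0 t * en U 1 t)) + η⁻¹ ^ 3)
      = ∫ x, U 0 t x ^ 2 * (η * (4 * (en U 0 t * en U 1 t)) + η⁻¹ ^ 3) := by
    rw [integral_mul_const]; rfl
  rw [this]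
  refine integral_mono (hU.integrable_pow 3 t).abs ((hU.sq 0 t).mul_const _) fun x => ?_
  have h1 := cube_le (U 0 t x) hη
  have h2 := mul_le_mul_of_nonneg_left (hU.sup_four 0 t x) hη.le
  have : |U 0 t x ^ 5| = U 0 t x ^ 2 * |U 0 t x| ^ 3 := by
    rw [← sq_abs (U 0 t x), abs_pow]; ring
  simp only [this]
  refine mul_le_mul_of_nonneg_left ?_ (sq_nonneg _)
  simp only [zero_add] at h2
  linarith

lemma integral_eden (hU : Sol U) (t : ℝ) :
    ∫ x, eden U t x = en U 1 t - 2 / 5 * ∫ x, U 0 t x ^ 5 := by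
  simp only [eden]
  rw [integral_sub (hU.sq 1 t) ((hU.integrable_pow 3 t).const_mul _), integral_const_mul]
  rfl

/-- The mass and energy control the first-order norm. -/
lemma first_order_bound (hU : Sol U) {n e : ℝ} : ∃ K, ∀ t, en U 0 t ≤ n →
    |∫ x, eden U t x| ≤ e → en U 1 t ≤ K := by
  refine ⟨5 / 3 * (e + 2 / 5 * n * (4 * n ^ 2 + 1) ^ 3), fun t hn he => ?_⟩
  have h0 := en_nonneg (U := U) 0 t
  have h1 := en_nonneg (U := U) 1 t
  set η : ℝ := (4 * n ^ 2 + 1)⁻¹ with hη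
  have hη0 : 0 < η := by positivity
  have h5 := hU.integral_five_le t hη0
  rw [hη, inv_inv, ← hη] at h5
  have h6 := hU.integral_eden t
  have h7 : ∫ x, U 0 t x ^ 5 ≤ ∫ x, |U 0 t x ^ 5| :=
    integral_mono (hU.integrable_pow 3 t) (hU.integrable_pow 3 t).abs fun x => le_abs_self _
  have h8 := (le_abs_self _).trans he
  have h9 : 4 * n ^ 2 * η ≤ 1 := by
    rw [hη, ← div_eq_mul_inv, div_le_one (by positivity)]; linarith
  have h10 : en U 0 t * (η * (4 * (en U 0 t * en U 1 t))) ≤ en U 1 t := by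
    have : en U 0 t ^ 2 ≤ n ^ 2 := pow_le_pow_left₀ h0 hn 2
    calc en U 0 t * (η * (4 * (en U 0 t * en U 1 t))) = 4 * en U 0 t ^ 2 * η * en U 1 t := by ring
      _ ≤ 4 * n ^ 2 * η * en U 1 t := by gcongr
      _ ≤ 1 * en U 1 t := by gcongr
      _ = en U 1 t := one_mul _
  have h11 : en U 0 t * (4 * n ^ 2 + 1) ^ 3 ≤ n * (4 * n ^ 2 + 1) ^ 3 := by gcongr
  nlinarith

lemma propagate_first (hU : Sol U) (n : ℝ) : ∃ K, ∀ s t, Reg U (Set.uIcc s t) → en U 0 s ≤ n →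
    en U 1 s ≤ n → ∀ τ ∈ Set.uIcc s t, en U 0 τ ≤ K ∧ en U 1 τ ≤ K := by
  obtain ⟨K, hK⟩ := hU.first_order_bound (n := n) (e := n + 2 / 5 * (n * (4 * (n * n) + 1)))
  refine ⟨max n K, fun s t hT h0 h1 τ hτ => ?_⟩
  have hT' : Reg U (Set.uIcc s τ) := by
    obtain ⟨C, hC⟩ := hT
    exact ⟨C, fun x hx => hC x (Set.uIcc_subset_uIcc Set.left_mem_uIcc hτ hx)⟩
  have e0 := hU.mass_eq hT'
  have e1 := hU.energy_eq hT'
  refine ⟨(e0.trans_le h0).trans (le_max_left _ _), (hK τ (e0.trans_le h0) ?_).trans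
    (le_max_right _ _)⟩
  rw [e1, hU.integral_eden]
  have h5 := hU.integral_five_le s one_pos
  have h6 : |∫ x, U 0 s x ^ 5| ≤ ∫ x, |U 0 s x ^ 5| := abs_integral_le_integral_abs
  have p0 := en_nonneg (U := U) 0 s
  have p1 := en_nonneg (U := U) 1 s
  have hn : 0 ≤ n := p0.trans h0
  have h7 : en U 0 s * (1 * (4 * (en U 0 s * en U 1 s)) + 1⁻¹ ^ 3) ≤ n * (4 * (n * n) + 1) := by
    simp only [one_mul, inv_one, one_pow]
    gcongr
  rw [abs_le] at h6 ⊢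
  constructor <;> linarith [h6.1, h6.2]

end Sol

namespace Sol

variable {U : ℕ → ℝ → ℝ → ℝ} {T : Set ℝ}

lemma Reg.mono {T' : Set ℝ} (hT : Reg U T) (h : T' ⊆ T) : Reg U T' :=
  let ⟨C, hC⟩ := hT; ⟨C, fun τ hτ => hC τ (h hτ)⟩

lemma abs_le_of_en (hU : Sol U) {n : ℝ} {i : ℕ} {t : ℝ} (h0 : en U i t ≤ n)
    (h1 : en U (i + 1) t ≤ n) (x : ℝ) : |U i t x| ≤ 1 + 2 * n :=
  le_of_sq_le ((hU.sup_sq i t x).trans (by linarith))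

lemma abs_correction_le (hU : Sol U) {n : ℝ} {t : ℝ} (h0 : en U 0 t ≤ n) (h1 : en U 1 t ≤ n) :
    (Integrable fun x => 20 / 3 * (U 0 t x ^ 3 * U 1 t x ^ 2)) ∧
      |∫ x, 20 / 3 * (U 0 t x ^ 3 * U 1 t x ^ 2)| ≤ 20 / 3 * ((1 + 2 * n) ^ 3 * n) := by
  have hn : 0 ≤ n := (en_nonneg 0 t).trans h0
  have hc0 := hU.cont_slice 0 t
  have hc1 := hU.cont_slice 1 t
  have key : ∀ x, ‖20 / 3 * (U 0 t x ^ 3 * U 1 t x ^ 2)‖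
      ≤ 20 / 3 * ((1 + 2 * n) ^ 3 * U 1 t x ^ 2) := by
    intro x
    rw [Real.norm_eq_abs, abs_mul, abs_mul, abs_sq, abs_pow, abs_of_pos (by norm_num : (0:ℝ) < 20 / 3)]
    have := hU.abs_le_of_en h0 h1 x
    gcongr
  have hi : Integrable fun x => 20 / 3 * ((1 + 2 * n) ^ 3 * U 1 t x ^ 2) :=
    ((hU.sq 1 t).const_mul _).const_mul _
  refine ⟨hi.mono' (Continuous.aestronglyMeasurable (by fun_prop)) (ae_of_all _ key), ?_⟩
  refine (norm_integral_le_of_norm_le hi (ae_of_all _ key)).trans ?_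
  rw [integral_const_mul, integral_const_mul]
  change 20 / 3 * ((1 + 2 * n) ^ 3 * en U 1 t) ≤ _
  gcongr

lemma abs_source_le (hU : Sol U) {n G η : ℝ} (hη : 0 < η) {t : ℝ} (h0 : en U 0 t ≤ n)
    (h1 : en U 1 t ≤ n) (h2 : en U 2 t ≤ G) :
    |∫ x, (2 * U 1 t x ^ 5 + 80 * (U 0 t x ^ 5 * U 1 t x ^ 3))|
      ≤ (2 + 80 * (1 + 2 * n) ^ 5) * (1 + (η * (4 * (n * G)) + η⁻¹ ^ 3)) * n := by
  have hn : 0 ≤ n := (en_nonneg 0 t).trans h0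
  have hG : 0 ≤ G := (en_nonneg 2 t).trans h2
  have key : ∀ x, ‖2 * U 1 t x ^ 5 + 80 * (U 0 t x ^ 5 * U 1 t x ^ 3)‖
      ≤ (2 + 80 * (1 + 2 * n) ^ 5) * (1 + (η * (4 * (n * G)) + η⁻¹ ^ 3)) * U 1 t x ^ 2 := by
    intro x
    have ha := hU.abs_le_of_en h0 h1 x
    have hb : |U 1 t x| ^ 3 ≤ η * (4 * (n * G)) + η⁻¹ ^ 3 := by
      refine (cube_le _ hη).trans ?_
      have := hU.sup_four 1 t x
      have : en U 1 t * en U 2 t ≤ n * G := mul_le_mul h1 h2 (en_nonneg _ _) hn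
      gcongr
      linarith
    have hb1 : |U 1 t x| ≤ 1 + |U 1 t x| ^ 3 := by
      nlinarith [abs_nonneg (U 1 t x), sq_nonneg (|U 1 t x| - 1), mul_nonneg (abs_nonneg (U 1 t x)) (sq_nonneg (|U 1 t x| - 1))]
    have hp : |U 0 t x| ^ 5 ≤ (1 + 2 * n) ^ 5 := by gcongr
    rw [Real.norm_eq_abs]
    calc |2 * U 1 t x ^ 5 + 80 * (U 0 t x ^ 5 * U 1 t x ^ 3)|
        ≤ 2 * |U 1 t x| ^ 5 + 80 * (|U 0 t x| ^ 5 * |U 1 t x| ^ 3) := by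
          refine (abs_add_le _ _).trans_eq ?_
          rw [abs_mul, abs_mul, abs_mul, abs_pow, abs_pow, abs_pow]
          norm_num
      _ = 2 * (|U 1 t x| ^ 3 * U 1 t x ^ 2) + 80 * (|U 0 t x| ^ 5 * (|U 1 t x| * U 1 t x ^ 2)) := by
          rw [← sq_abs (U 1 t x)]; ring
      _ ≤ 2 * ((1 + (η * (4 * (n * G)) + η⁻¹ ^ 3)) * U 1 t x ^ 2)
          + 80 * ((1 + 2 * n) ^ 5 * ((1 + (η * (4 * (n * G)) + η⁻¹ ^ 3)) * U 1 t x ^ 2)) := by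
          gcongr
          · linarith
          · linarith
      _ = _ := by ring
  refine (norm_integral_le_of_norm_le ((hU.sq 1 t).const_mul _) (ae_of_all _ key)).trans ?_
  rw [integral_const_mul]
  change _ * en U 1 t ≤ _
  gcongr

lemma Reg.second_balance (hU : Sol U) {s t : ℝ} (hT : Reg U (Set.uIcc s t)) :
    (∫ x, (U 2 t x ^ 2 - 20 / 3 * (U 0 t x ^ 3 * U 1 t x ^ 2)))
      - (∫ x, (U 2 s x ^ 2 - 20 / 3 * (U 0 s x ^ 3 * U 1 s x ^ 2)))
      = ∫ τ in s..t, ∫ x, (2 * U 1 τ x ^ 5 + 80 * (U 0 τ x ^ 5 * U 1 τ x ^ 3)) := by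
  have l0 := hT.l2 hU (i := 0) (by norm_num)
  have l1 := hT.l2 hU (i := 1) (by norm_num)
  have l2 := hT.l2 hU (i := 2) (by norm_num)
  have l3 := hT.l2 hU (i := 3) (by norm_num)
  have b0 := hT.bdd hU (i := 0) (by norm_num)
  have b1 := hT.bdd hU (i := 1) (by norm_num)
  have b2 := hT.bdd hU (i := 2) (by norm_num)
  have q1 := L1On.sq l1
  have q2 := L1On.sq l2
  have q3 := L1On.sq l3
  refine balance_total hU.balance_second ?_ ?_ ?_ L1On.zero q2.neg
  · exact q2.sub (((q1.mul_bdd (b0.pow 3)).const_mul (20 / 3)).congr fun t x => by ring)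
  · exact (((q1.mul_bdd (b1.pow 3)).const_mul 2).congr fun t x => by ring).add
      (((q1.mul_bdd ((b0.pow 5).mul b1)).const_mul 80).congr fun t x => by ring)
  · have a1 := (q3.const_mul 3).sub ((q2.mul_bdd (b0.pow 3)).const_mul 4)
    have a2 := (((L1On.mul l1 l3).mul_bdd (b0.pow 3)).const_mul (-2)).add
      (q2.mul_bdd (b0.pow 3))
    have a3 := (a2.add ((q1.mul_bdd ((b0.pow 2).mul b2)).const_mul 3)).sub
      ((q1.mul_bdd (b0.pow 6)).const_mul 4)
    exact ((a1.sub (a3.const_mul (20 / 3))).sub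
      ((q1.mul_bdd (b0.mul (b1.pow 2))).const_mul 2)).congr fun t x => by ring

/-- Propagation of second-order bounds with an arbitrarily small growth factor. -/
lemma second_order_step (hU : Sol U) (n : ℝ) {η : ℝ} (hη : 0 < η) (hη1 : η < 1) : ∃ C, 0 ≤ C ∧
    ∀ s t, |t - s| ≤ 1 → Reg U (Set.uIcc s t) →
    (∀ τ ∈ Set.uIcc s t, en U 0 τ ≤ n ∧ en U 1 τ ≤ n) →
    ∀ τ ∈ Set.uIcc s t, en U 2 τ ≤ (en U 2 s + C) / (1 - η) := by
  set A : ℝ := (2 + 80 * (1 + 2 * |n|) ^ 5) * |n| with hA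
  have hA0 : 0 ≤ A := by positivity
  set δ : ℝ := η / (4 * A * |n| + 1) with hδ
  have hδ0 : 0 < δ := by positivity
  have hδ1 : A * (δ * (4 * |n|)) ≤ η := by
    rw [hδ, div_mul_eq_mul_div, mul_div_assoc', div_le_iff₀ (by positivity)]
    nlinarith [mul_nonneg hA0 (abs_nonneg n)]
  refine ⟨2 * (20 / 3 * ((1 + 2 * |n|) ^ 3 * |n|)) + A * (1 + δ⁻¹ ^ 3), by positivity,
    fun s t hst hT hn => ?_⟩
  have hs := hn s Set.left_mem_uIcc
  have hn0 : 0 ≤ n := (en_nonneg 0 s).trans hs.1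
  rw [abs_of_nonneg hn0] at *
  refine le_of_affine_bound hη1 (let ⟨C, hC⟩ := hT; ⟨C, fun τ hτ => hC τ hτ 2 (by norm_num)⟩)
    fun G hG τ hτ => ?_
  have hsub : Set.uIcc s τ ⊆ Set.uIcc s t := Set.uIcc_subset_uIcc Set.left_mem_uIcc hτ
  have hG0 : 0 ≤ G := (en_nonneg 2 s).trans (hG s Set.left_mem_uIcc)
  have hb := (hT.mono hsub).second_balance hU
  have hlen : |τ - s| ≤ 1 := by
    rw [Set.uIcc_comm] at hτ
    have := abs_sub_le_of_mem_uIcc hτ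
    rw [abs_sub_comm, abs_sub_comm s t] at this
    linarith
  have hS : ‖∫ r in s..τ, ∫ x, (2 * U 1 r x ^ 5 + 80 * (U 0 r x ^ 5 * U 1 r x ^ 3))‖
      ≤ A * (1 + (δ * (4 * (n * G)) + δ⁻¹ ^ 3)) * |τ - s| := by
    refine intervalIntegral.norm_integral_le_of_norm_le_const fun r hr => ?_
    have hr' := hsub (Set.uIoc_subset_uIcc hr)
    have := hU.abs_source_le hδ0 (hn r hr').1 (hn r hr').2 (hG r hr')
    rw [Real.norm_eq_abs]
    refine this.trans_eq ?_
    rw [hA]; ring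
  have hS' : A * (1 + (δ * (4 * (n * G)) + δ⁻¹ ^ 3)) * |τ - s|
      ≤ A * (1 + δ⁻¹ ^ 3) + η * G := by
    have h1 : A * (1 + (δ * (4 * (n * G)) + δ⁻¹ ^ 3)) * |τ - s|
      ≤ A * (1 + (δ * (4 * (n * G)) + δ⁻¹ ^ 3)) * 1 := by gcongr
    have h2 : A * (δ * (4 * n)) * G ≤ η * G := by gcongr
    linarith
  have split : ∀ r, en U 0 r ≤ n → en U 1 r ≤ n →
      |(∫ x, (U 2 r x ^ 2 - 20 / 3 * (U 0 r x ^ 3 * U 1 r x ^ 2))) - en U 2 r|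
        ≤ 20 / 3 * ((1 + 2 * n) ^ 3 * n) := by
    intro r h0 h1
    obtain ⟨hi, hle⟩ := hU.abs_correction_le h0 h1
    rw [integral_sub (hU.sq 2 r) hi]
    change |en U 2 r - _ - en U 2 r| ≤ _
    rwa [sub_sub_cancel_left, abs_neg]
  have e1 := abs_le.1 (split s hs.1 hs.2)
  have e2 := abs_le.1 (split τ (hn τ hτ).1 (hn τ hτ).2)
  have e3 := (le_abs_self _).trans (hS.trans hS')
  linarith [e1.1, e1.2, e2.1, e2.2]

end Sol

lemma L2On.shift {T : Set ℝ} {f : ℝ → ℝ → ℝ} (hf : L2On T f) (h : ℝ) :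
    L2On T fun t x => f t (x + h) := by
  obtain ⟨hc, C, hC⟩ := hf
  have : Continuous fun p : ℝ × ℝ => (p.1, p.2 + h) := by fun_prop
  refine ⟨hc.comp this, C, fun t ht => ⟨(hC t ht).1.comp_add_right h, ?_⟩⟩
  rw [integral_add_right_eq_self (fun x => f t x ^ 2) h]
  exact (hC t ht).2

lemma BddOn.shift {T : Set ℝ} {f : ℝ → ℝ → ℝ} (hf : BddOn T f) (h : ℝ) :
    BddOn T fun t x => f t (x + h) := by
  obtain ⟨hc, C, hC⟩ := hf
  have : Continuous fun p : ℝ × ℝ => (p.1, p.2 + h) := by fun_prop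
  exact ⟨hc.comp this, C, fun t ht x => hC t ht (x + h)⟩

lemma abs_cube_sub_le {a b B d : ℝ} (ha : |a| ≤ B) (hb : |b| ≤ B) (hd : |a - b| ≤ d) :
    |a ^ 3 - b ^ 3| ≤ 3 * B ^ 2 * d := by
  have hB : 0 ≤ B := (abs_nonneg _).trans ha
  have h1 : |a ^ 2 + a * b + b ^ 2| ≤ 3 * B ^ 2 := by
    have e1 : a ^ 2 ≤ B ^ 2 := sq_le_sq' (by linarith [(abs_le.1 ha).1]) (abs_le.1 ha).2
    have e2 : b ^ 2 ≤ B ^ 2 := sq_le_sq' (by linarith [(abs_le.1 hb).1]) (abs_le.1 hb).2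
    rw [abs_of_nonneg (by nlinarith [sq_nonneg (a + b)])]
    nlinarith [sq_nonneg (a - b)]
  calc |a ^ 3 - b ^ 3| = |a ^ 2 + a * b + b ^ 2| * |a - b| := by rw [← abs_mul]; congr 1; ring
    _ ≤ 3 * B ^ 2 * d := by gcongr

lemma sq_add_four_le (a b c d : ℝ) :
    (a + b + c + d) ^ 2 ≤ 4 * (a ^ 2 + b ^ 2 + c ^ 2 + d ^ 2) := by
  nlinarith [sq_nonneg (a - b), sq_nonneg (a - c), sq_nonneg (a - d), sq_nonneg (b - c),
    sq_nonneg (b - d), sq_nonneg (c - d)]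

namespace Sol

variable {U : ℕ → ℝ → ℝ → ℝ} {T : Set ℝ}

lemma abs_shift_sub_le (hU : Sol U) {B t : ℝ} {i : ℕ} (hB : ∀ x, |U (i + 1) t x| ≤ B) {h : ℝ}
    (hh : 0 < h) (x : ℝ) : |U i t (x + h) - U i t x| ≤ B * h := by
  have := Convex.norm_image_sub_le_of_norm_hasDerivWithin_le (f := U i t) (s := Set.univ)
    (x := x) (y := x + h) (fun y _ => (hU.dx i t y).hasDerivWithinAt) (fun y _ => hB y)
    convex_univ trivial trivial
  simpa [abs_of_pos hh] using this

lemma remainder_deriv_bound (hU : Sol U) {n G t : ℝ} (h0 : en U 0 t ≤ n) (h1 : en U 1 t ≤ n)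
    (h2 : en U 2 t ≤ n) (h3 : en U 3 t ≤ G) {h : ℝ} (hh : 0 < h) :
    (Integrable fun x => ((36 * (U 0 t (x + h) ^ 2 * U 1 t (x + h) * U 2 t (x + h))
            + 24 * (U 0 t (x + h) * U 1 t (x + h) ^ 3))
          - (36 * (U 0 t x ^ 2 * U 1 t x * U 2 t x) + 24 * (U 0 t x * U 1 t x ^ 3))) ^ 2) ∧
      ∫ x, ((36 * (U 0 t (x + h) ^ 2 * U 1 t (x + h) * U 2 t (x + h))
            + 24 * (U 0 t (x + h) * U 1 t (x + h) ^ 3))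
          - (36 * (U 0 t x ^ 2 * U 1 t x * U 2 t x) + 24 * (U 0 t x * U 1 t x ^ 3))) ^ 2
        ≤ h ^ 2 * (4 * 144 ^ 2 * (1 + 2 * n) ^ 6 * (3 * n + n ^ 2 + 1) * (1 + G)) := by
  set B := 1 + 2 * n with hB
  have hn : 0 ≤ n := (en_nonneg 0 t).trans h0
  have hG : 0 ≤ G := (en_nonneg 3 t).trans h3
  have hB1 : 1 ≤ B := by linarith
  have c0 := hU.cont_slice 0 t
  have c1 := hU.cont_slice 1 t
  have c2 := hU.cont_slice 2 t
  have c3 := hU.cont_slice 3 t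
  have hd : ∀ x, HasDerivAt
      (fun x => 36 * (U 0 t x ^ 2 * U 1 t x * U 2 t x) + 24 * (U 0 t x * U 1 t x ^ 3))
      (144 * (U 0 t x * U 1 t x ^ 2 * U 2 t x) + 36 * (U 0 t x ^ 2 * U 2 t x ^ 2)
        + 36 * (U 0 t x ^ 2 * U 1 t x * U 3 t x) + 24 * U 1 t x ^ 4) x := by
    intro x
    have d0 := hU.dx 0 t x
    have d1 := hU.dx 1 t x
    have d2 := hU.dx 2 t x
    refine (((((d0.fun_pow 2).fun_mul d1).fun_mul d2).const_mul 36).fun_add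
      ((d0.fun_mul (d1.fun_pow 3)).const_mul 24)).congr_deriv ?_
    push_cast
    ring
  have key : ∀ x, (144 * (U 0 t x * U 1 t x ^ 2 * U 2 t x) + 36 * (U 0 t x ^ 2 * U 2 t x ^ 2)
        + 36 * (U 0 t x ^ 2 * U 1 t x * U 3 t x) + 24 * U 1 t x ^ 4) ^ 2
      ≤ 4 * 144 ^ 2 * B ^ 6 * ((1 + n + G) * U 2 t x ^ 2 + U 3 t x ^ 2 + U 1 t x ^ 2) := by
    intro x
    have a0 : U 0 t x ^ 2 ≤ B ^ 2 := by
      rw [← sq_abs]; exact pow_le_pow_left₀ (abs_nonneg _) (hU.abs_le_of_en h0 h1 x) 2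
    have a1 : U 1 t x ^ 2 ≤ B ^ 2 := by
      rw [← sq_abs]; exact pow_le_pow_left₀ (abs_nonneg _) (hU.abs_le_of_en h1 h2 x) 2
    have a2 : U 2 t x ^ 2 ≤ n + G := (hU.sup_sq 2 t x).trans (by gcongr)
    set a := U 0 t x ^ 2
    set b := U 1 t x ^ 2
    set e := U 2 t x ^ 2
    set f := U 3 t x ^ 2
    have pa : 0 ≤ a := sq_nonneg _
    have pb : 0 ≤ b := sq_nonneg _
    have pe : 0 ≤ e := sq_nonneg _
    have pf : 0 ≤ f := sq_nonneg _
    refine (sq_add_four_le _ _ _ _).trans ?_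
    have t1 : (144 * (U 0 t x * U 1 t x ^ 2 * U 2 t x)) ^ 2 ≤ 144 ^ 2 * (B ^ 6 * e) := by
      calc (144 * (U 0 t x * U 1 t x ^ 2 * U 2 t x)) ^ 2 = 144 ^ 2 * (a * b ^ 2 * e) := by
            simp only [a, b, e]; ring
        _ ≤ 144 ^ 2 * (B ^ 2 * (B ^ 2) ^ 2 * e) := by gcongr
        _ = _ := by ring
    have t2 : (36 * (U 0 t x ^ 2 * U 2 t x ^ 2)) ^ 2 ≤ 144 ^ 2 * (B ^ 6 * ((n + G) * e)) := by
      calc (36 * (U 0 t x ^ 2 * U 2 t x ^ 2)) ^ 2 = 36 ^ 2 * (a ^ 2 * (e * e)) := by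
            simp only [a, e]; ring
        _ ≤ 144 ^ 2 * ((B ^ 2) ^ 2 * ((n + G) * e)) := by gcongr; norm_num
        _ = 144 ^ 2 * (B ^ 4 * ((n + G) * e)) := by ring
        _ ≤ _ := by gcongr; norm_num
    have t3 : (36 * (U 0 t x ^ 2 * U 1 t x * U 3 t x)) ^ 2 ≤ 144 ^ 2 * (B ^ 6 * f) := by
      calc (36 * (U 0 t x ^ 2 * U 1 t x * U 3 t x)) ^ 2 = 36 ^ 2 * (a ^ 2 * b * f) := by
            simp only [a, b, f]; ring
        _ ≤ 144 ^ 2 * ((B ^ 2) ^ 2 * B ^ 2 * f) := by gcongr; norm_num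
        _ = _ := by ring
    have t4 : (24 * U 1 t x ^ 4) ^ 2 ≤ 144 ^ 2 * (B ^ 6 * b) := by
      calc (24 * U 1 t x ^ 4) ^ 2 = 24 ^ 2 * (b ^ 3 * b) := by simp only [b]; ring
        _ ≤ 144 ^ 2 * ((B ^ 2) ^ 3 * b) := by gcongr; norm_num
        _ = _ := by ring
    linarith
  have hi1 : Integrable fun x => (1 + n + G) * U 2 t x ^ 2 + U 3 t x ^ 2 :=
    ((hU.sq 2 t).const_mul _).fun_add (hU.sq 3 t)
  have hi := (hi1.fun_add (hU.sq 1 t)).const_mul (4 * 144 ^ 2 * B ^ 6)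
  have hint : Integrable fun x => (144 * (U 0 t x * U 1 t x ^ 2 * U 2 t x)
      + 36 * (U 0 t x ^ 2 * U 2 t x ^ 2)
      + 36 * (U 0 t x ^ 2 * U 1 t x * U 3 t x) + 24 * U 1 t x ^ 4) ^ 2 := by
    refine hi.mono' (Continuous.aestronglyMeasurable (by fun_prop)) (ae_of_all _ fun x => ?_)
    rw [Real.norm_eq_abs, abs_sq]
    exact key x
  obtain ⟨r1, r2⟩ := integral_diff_sq_le hd (by fun_prop) hint hh
  refine ⟨r1, r2.trans ?_⟩
  gcongr
  refine (integral_mono hint hi key).trans ?_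
  rw [integral_const_mul, integral_add hi1 (hU.sq 1 t),
    integral_add ((hU.sq 2 t).const_mul _) (hU.sq 3 t), integral_const_mul]
  change 4 * 144 ^ 2 * B ^ 6 * ((1 + n + G) * en U 2 t + en U 3 t + en U 1 t) ≤ _
  rw [mul_assoc (4 * 144 ^ 2 * B ^ 6)]
  gcongr
  have : (1 + n + G) * en U 2 t ≤ (1 + n + G) * n := by gcongr
  nlinarith [mul_nonneg hn hG, mul_nonneg (sq_nonneg n) hG]

end Sol

namespace Sol

variable {U : ℕ → ℝ → ℝ → ℝ} {T : Set ℝ}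

/-- The constant governing the growth of third-order norms. -/
noncomputable def thirdConst (n : ℝ) : ℝ :=
  36 * (1 + 2 * n) ^ 3 + 1 + 4 * 144 ^ 2 * (1 + 2 * n) ^ 6 * (3 * n + n ^ 2 + 1)

lemma diff_source_le (hU : Sol U) {n G t : ℝ} (h0 : en U 0 t ≤ n) (h1 : en U 1 t ≤ n)
    (h2 : en U 2 t ≤ n) (h3 : en U 3 t ≤ G) {h : ℝ} (hh : 0 < h) :
    |∫ x, (12 * (U 0 t (x + h) ^ 2 * U 1 t (x + h)) * (U 2 t (x + h) - U 2 t x) ^ 2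
      - 8 * ((U 0 t (x + h) ^ 3 - U 0 t x ^ 3) * U 3 t x * (U 2 t (x + h) - U 2 t x))
      - 2 * ((U 2 t (x + h) - U 2 t x) *
        ((36 * (U 0 t (x + h) ^ 2 * U 1 t (x + h) * U 2 t (x + h))
            + 24 * (U 0 t (x + h) * U 1 t (x + h) ^ 3))
          - (36 * (U 0 t x ^ 2 * U 1 t x * U 2 t x) + 24 * (U 0 t x * U 1 t x ^ 3)))))|
      ≤ h ^ 2 * (thirdConst n * (1 + G)) := by
  obtain ⟨r1, r2⟩ := hU.remainder_deriv_bound h0 h1 h2 h3 hh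
  obtain ⟨z1, z2⟩ := integral_diff_sq_le (hU.dx 2 t) (hU.cont_slice 3 t) (hU.sq 3 t) hh
  change _ ≤ h ^ 2 * en U 3 t at z2
  set r : ℝ → ℝ := fun x => (36 * (U 0 t (x + h) ^ 2 * U 1 t (x + h) * U 2 t (x + h))
            + 24 * (U 0 t (x + h) * U 1 t (x + h) ^ 3))
          - (36 * (U 0 t x ^ 2 * U 1 t x * U 2 t x) + 24 * (U 0 t x * U 1 t x ^ 3)) with hr
  set B := 1 + 2 * n with hB
  have hn : 0 ≤ n := (en_nonneg 0 t).trans h0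
  have hG : 0 ≤ G := (en_nonneg 3 t).trans h3
  have hB1 : 1 ≤ B := by linarith
  have key : ∀ x, ‖12 * (U 0 t (x + h) ^ 2 * U 1 t (x + h)) * (U 2 t (x + h) - U 2 t x) ^ 2
      - 8 * ((U 0 t (x + h) ^ 3 - U 0 t x ^ 3) * U 3 t x * (U 2 t (x + h) - U 2 t x))
      - 2 * ((U 2 t (x + h) - U 2 t x) * r x)‖
      ≤ (24 * B ^ 3 + 1) * (U 2 t (x + h) - U 2 t x) ^ 2
        + (12 * B ^ 3 * h ^ 2) * U 3 t x ^ 2 + r x ^ 2 := by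
    intro x
    rw [Real.norm_eq_abs]
    set z := U 2 t (x + h) - U 2 t x
    have a0 := hU.abs_le_of_en h0 h1
    have a1 := hU.abs_le_of_en h1 h2
    have d := hU.abs_shift_sub_le a1 hh x
    have d3 := abs_cube_sub_le (a0 (x + h)) (a0 x) d
    have t1 : |12 * (U 0 t (x + h) ^ 2 * U 1 t (x + h)) * z ^ 2| ≤ 12 * B ^ 3 * z ^ 2 := by
      rw [abs_mul, abs_mul, abs_mul, abs_sq z, abs_pow, abs_of_pos (by norm_num : (0:ℝ) < 12)]
      have : |U 0 t (x + h)| ^ 2 * |U 1 t (x + h)| ≤ B ^ 2 * B := by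
        gcongr
        exacts [a0 _, a1 _]
      calc _ ≤ 12 * (B ^ 2 * B) * z ^ 2 := by gcongr
        _ = _ := by ring
    have t2 : |8 * ((U 0 t (x + h) ^ 3 - U 0 t x ^ 3) * U 3 t x * z)|
        ≤ 12 * B ^ 3 * (h ^ 2 * U 3 t x ^ 2 + z ^ 2) := by
      rw [abs_mul, abs_mul, abs_mul, abs_of_pos (by norm_num : (0:ℝ) < 8)]
      calc _ ≤ 8 * (3 * B ^ 2 * (B * h) * |U 3 t x| * |z|) := by gcongr
        _ = 12 * B ^ 3 * (2 * (h * |U 3 t x|) * |z|) := by ring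
        _ ≤ 12 * B ^ 3 * ((h * |U 3 t x|) ^ 2 + |z| ^ 2) := by
          gcongr; exact two_mul_le_add_sq _ _
        _ = _ := by rw [mul_pow, sq_abs, sq_abs]
    have t3 : |2 * (z * r x)| ≤ z ^ 2 + r x ^ 2 := by
      rw [abs_le]; constructor <;> nlinarith [sq_nonneg (z + r x), sq_nonneg (z - r x)]
    refine (abs_sub _ _).trans ?_
    have := abs_sub (12 * (U 0 t (x + h) ^ 2 * U 1 t (x + h)) * z ^ 2)
      (8 * ((U 0 t (x + h) ^ 3 - U 0 t x ^ 3) * U 3 t x * z))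
    linarith
  have i1 := z1.const_mul (24 * B ^ 3 + 1)
  have i2 := (hU.sq 3 t).const_mul (12 * B ^ 3 * h ^ 2)
  refine (norm_integral_le_of_norm_le ((i1.fun_add i2).fun_add r1) (ae_of_all _ key)).trans ?_
  rw [integral_add (i1.fun_add i2) r1, integral_add i1 i2, integral_const_mul, integral_const_mul]
  change _ + 12 * B ^ 3 * h ^ 2 * en U 3 t + _ ≤ _
  have e1 : (24 * B ^ 3 + 1) * ∫ x, (U 2 t (x + h) - U 2 t x) ^ 2
      ≤ (24 * B ^ 3 + 1) * (h ^ 2 * G) := by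
    gcongr
    exact z2.trans (by gcongr)
  have e2 : 12 * B ^ 3 * h ^ 2 * en U 3 t ≤ 12 * B ^ 3 * h ^ 2 * G := by gcongr
  have e3 : (36 * B ^ 3 + 1) * h ^ 2 * G ≤ (36 * B ^ 3 + 1) * h ^ 2 * (1 + G) := by
    gcongr; linarith
  have : thirdConst n = 36 * B ^ 3 + 1 + 4 * 144 ^ 2 * B ^ 6 * (3 * n + n ^ 2 + 1) := rfl
  rw [this]
  linarith

lemma Reg.diff_balance (hU : Sol U) {s t : ℝ} (hT : Reg U (Set.uIcc s t)) (h : ℝ) :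
    (∫ x, (U 2 t (x + h) - U 2 t x) ^ 2) - (∫ x, (U 2 s (x + h) - U 2 s x) ^ 2)
      = ∫ τ in s..t, ∫ x,
        (12 * (U 0 τ (x + h) ^ 2 * U 1 τ (x + h)) * (U 2 τ (x + h) - U 2 τ x) ^ 2
      - 8 * ((U 0 τ (x + h) ^ 3 - U 0 τ x ^ 3) * U 3 τ x * (U 2 τ (x + h) - U 2 τ x))
      - 2 * ((U 2 τ (x + h) - U 2 τ x) *
        ((36 * (U 0 τ (x + h) ^ 2 * U 1 τ (x + h) * U 2 τ (x + h))
            + 24 * (U 0 τ (x + h) * U 1 τ (x + h) ^ 3))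
          - (36 * (U 0 τ x ^ 2 * U 1 τ x * U 2 τ x) + 24 * (U 0 τ x * U 1 τ x ^ 3))))) := by
  have l2 := hT.l2 hU (i := 2) (by norm_num)
  have l3 := hT.l2 hU (i := 3) (by norm_num)
  have l1 := hT.l2 hU (i := 1) (by norm_num)
  have b0 := hT.bdd hU (i := 0) (by norm_num)
  have b1 := hT.bdd hU (i := 1) (by norm_num)
  have b2 := hT.bdd hU (i := 2) (by norm_num)
  have lz : L2On (Set.uIcc s t) fun t x => U 2 t (x + h) - U 2 t x := by
    simpa [sub_eq_add_neg] using (l2.shift h).add (l2.const_mul (-1))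
  have lz3 : L2On (Set.uIcc s t) fun t x => U 3 t (x + h) - U 3 t x := by
    simpa [sub_eq_add_neg] using (l3.shift h).add (l3.const_mul (-1))
  have lr : L2On (Set.uIcc s t) fun t x =>
      36 * (U 0 t x ^ 2 * U 1 t x * U 2 t x) + 24 * (U 0 t x * U 1 t x ^ 3) := by
    have := ((l2.mul_bdd ((b0.pow 2).mul b1)).const_mul 36).add
      ((l1.mul_bdd (b0.mul (b1.pow 2))).const_mul 24)
    convert this using 3; ring
  have lrd : L2On (Set.uIcc s t) fun t x =>
      (36 * (U 0 t (x + h) ^ 2 * U 1 t (x + h) * U 2 t (x + h))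
        + 24 * (U 0 t (x + h) * U 1 t (x + h) ^ 3))
      - (36 * (U 0 t x ^ 2 * U 1 t x * U 2 t x) + 24 * (U 0 t x * U 1 t x ^ 3)) := by
    have := (lr.shift h).add (lr.const_mul (-1))
    convert this using 3; ring
  refine balance_total (hU.balance_diff h) (L1On.sq lz) ?_ ?_ L1On.zero (L1On.sq lz).neg
  · have a1 := ((L1On.sq lz).mul_bdd (((b0.shift h).pow 2).mul (b1.shift h))).const_mul 12
    have a2 := ((L1On.mul l3 lz).mul_bdd ((b0.shift h).pow 3)).const_mul 8
    have a3 := ((L1On.mul l3 lz).mul_bdd (b0.pow 3)).const_mul 8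
    exact (((a1.sub a2).add a3).sub ((L1On.mul lz lrd).const_mul 2)).congr fun t x => by ring
  · exact ((L1On.sq lz3).const_mul 3).sub
      (((L1On.sq lz).mul_bdd ((b0.shift h).pow 3)).const_mul 4 |>.congr fun t x => by ring)

lemma third_order_step (hU : Sol U) {n G s t : ℝ} (hT : Reg U (Set.uIcc s t))
    (hn : ∀ τ ∈ Set.uIcc s t, en U 0 τ ≤ n ∧ en U 1 τ ≤ n ∧ en U 2 τ ≤ n)
    (hG : ∀ τ ∈ Set.uIcc s t, en U 3 τ ≤ G) :
    en U 3 t ≤ en U 3 s + thirdConst n * (1 + G) * |t - s| := by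
  have step : ∀ h, 0 < h → ∫ x, (h⁻¹ * (U 2 t (x + h) - U 2 t x)) ^ 2
      ≤ en U 3 s + thirdConst n * (1 + G) * |t - s| := by
    intro h hh
    have hb := hT.diff_balance hU h
    have hS : |(∫ x, (U 2 t (x + h) - U 2 t x) ^ 2) - ∫ x, (U 2 s (x + h) - U 2 s x) ^ 2|
        ≤ h ^ 2 * (thirdConst n * (1 + G)) * |t - s| := by
      rw [hb, ← Real.norm_eq_abs]
      refine intervalIntegral.norm_integral_le_of_norm_le_const fun τ hτ => ?_
      have hτ' := Set.uIoc_subset_uIcc hτ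
      exact hU.diff_source_le (hn τ hτ').1 (hn τ hτ').2.1 (hn τ hτ').2.2 (hG τ hτ') hh
    have hS' := (le_abs_self _).trans hS
    obtain ⟨-, z2⟩ := integral_diff_sq_le (hU.dx 2 s) (hU.cont_slice 3 s) (hU.sq 3 s) hh
    change _ ≤ h ^ 2 * en U 3 s at z2
    simp_rw [mul_pow]
    rw [integral_const_mul]
    calc h⁻¹ ^ 2 * ∫ x, (U 2 t (x + h) - U 2 t x) ^ 2
        ≤ h⁻¹ ^ 2 * (h ^ 2 * (en U 3 s + thirdConst n * (1 + G) * |t - s|)) := by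
          gcongr; linarith
      _ = _ := by field_simp
  have hc := hU.cont_slice 2 t
  have hc3 := hU.cont_slice 3 t
  refine integral_le_of_tendsto
    (F := fun k x => ((1 / ((k : ℝ) + 1))⁻¹ * (U 2 t (x + 1 / ((k : ℝ) + 1)) - U 2 t x)) ^ 2)
    (fun k => ?_) (fun k x => sq_nonneg _) (by fun_prop) (fun x => ?_)
    fun k => step _ (by positivity)
  · simp_rw [mul_pow]
    exact (integral_diff_sq_le (hU.dx 2 t) hc3 (hU.sq 3 t) (by positivity)).1.const_mul _
  · have h1 : Tendsto (fun k : ℕ => 1 / ((k : ℝ) + 1)) atTop (nhdsWithin 0 {0}ᶜ) := by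
      refine tendsto_nhdsWithin_iff.2 ⟨tendsto_one_div_add_atTop_nhds_zero_nat, ?_⟩
      refine Eventually.of_forall fun k => ?_
      have : (1 / ((k : ℝ) + 1)) ≠ 0 := by positivity
      simpa using this
    exact (((hasDerivAt_iff_tendsto_slope_zero.1 (hU.dx 2 t x)).comp h1).congr
      fun k => by simp [smul_eq_mul]).pow 2

end Sol

namespace Sol

variable {U : ℕ → ℝ → ℝ → ℝ} {T : Set ℝ}

/-- The sum of the squared norms of the derivatives up to order three. -/
noncomputable def nrm (U : ℕ → ℝ → ℝ → ℝ) (t : ℝ) : ℝ :=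
  ∫ x, (U 0 t x ^ 2 + U 1 t x ^ 2 + U 2 t x ^ 2 + U 3 t x ^ 2)

lemma integrable_nrm (hU : Sol U) (t : ℝ) :
    Integrable fun x => U 0 t x ^ 2 + U 1 t x ^ 2 + U 2 t x ^ 2 + U 3 t x ^ 2 :=
  (((hU.sq 0 t).fun_add (hU.sq 1 t)).fun_add (hU.sq 2 t)).fun_add (hU.sq 3 t)

lemma nrm_eq (hU : Sol U) (t : ℝ) :
    nrm U t = en U 0 t + en U 1 t + en U 2 t + en U 3 t := by
  have h0 := hU.sq 0 t
  have h1 := hU.sq 1 t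
  have h2 := hU.sq 2 t
  have h3 := hU.sq 3 t
  simp only [nrm, en]
  rw [integral_add ((h0.fun_add h1).fun_add h2) h3, integral_add (h0.fun_add h1) h2,
    integral_add h0 h1]

lemma en_le_nrm (hU : Sol U) {i : ℕ} (hi : i ≤ 3) (t : ℝ) : en U i t ≤ nrm U t := by
  have h0 := en_nonneg (U := U) 0 t
  have h1 := en_nonneg (U := U) 1 t
  have h2 := en_nonneg (U := U) 2 t
  have h3 := en_nonneg (U := U) 3 t
  rw [hU.nrm_eq]
  interval_cases i <;> linarith

lemma reg_of_nrm (hU : Sol U) (h : ∃ C, ∀ τ ∈ T, nrm U τ ≤ C) : Reg U T :=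
  let ⟨C, hC⟩ := h; ⟨C, fun τ hτ _ hi => (hU.en_le_nrm hi τ).trans (hC τ hτ)⟩

lemma isClosed_nrm_le (hU : Sol U) (K : ℝ) : IsClosed {t | nrm U t ≤ K} := by
  refine IsSeqClosed.isClosed ?_
  intro s t hs hst
  have hs' : ∀ k, nrm U (s k) ≤ K := fun k => hs k
  rw [Set.mem_ofPred_eq]
  clear hs
  have hl : ∀ i x, Tendsto (fun k => U i (s k) x) atTop (nhds (U i t x)) := by
    intro i x
    have h : Continuous fun r => U i r x := (hU.cont i).comp (by fun_prop : Continuous fun r : ℝ => (r, x))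
    exact (h.tendsto t).comp hst
  have c0 := hU.cont_slice 0 t
  have c1 := hU.cont_slice 1 t
  have c2 := hU.cont_slice 2 t
  have c3 := hU.cont_slice 3 t
  have hct : Continuous fun x => U 0 t x ^ 2 + U 1 t x ^ 2 + U 2 t x ^ 2 + U 3 t x ^ 2 := by
    fun_prop
  exact integral_le_of_tendsto (fun k => hU.integrable_nrm (s k))
    (fun k x => by positivity) hct
    (fun x => ((((hl 0 x).pow 2).add ((hl 1 x).pow 2)).add ((hl 2 x).pow 2)).add ((hl 3 x).pow 2)) hs'

lemma propagate_second (hU : Sol U) (n : ℝ) : ∃ K, 0 ≤ K ∧ ∀ s t, |t - s| ≤ 1 →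
    Reg U (Set.uIcc s t) → en U 0 s ≤ n → en U 1 s ≤ n → en U 2 s ≤ n →
    ∀ τ ∈ Set.uIcc s t, en U 0 τ ≤ K ∧ en U 1 τ ≤ K ∧ en U 2 τ ≤ K := by
  obtain ⟨K, hK⟩ := hU.propagate_first n
  obtain ⟨C, hC0, hC⟩ := hU.second_order_step K (η := 1 / 2) (by norm_num) (by norm_num)
  refine ⟨max 0 (max K ((n + C) / (1 - 1 / 2))), le_max_left _ _,
    fun s t hst hT h0 h1 h2 τ hτ => ?_⟩
  have hk := hK s t hT h0 h1
  have h3 := hC s t hst hT hk τ hτ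
  refine ⟨(hk τ hτ).1.trans ((le_max_left _ _).trans (le_max_right _ _)),
    (hk τ hτ).2.trans ((le_max_left _ _).trans (le_max_right _ _)),
    (h3.trans ?_).trans ((le_max_right _ _).trans (le_max_right _ _))⟩
  gcongr

lemma thirdConst_pos {n : ℝ} (hn : 0 ≤ n) : 0 < thirdConst n := by
  unfold thirdConst
  positivity

lemma propagate_third (hU : Sol U) {n s t : ℝ} (hT : Reg U (Set.uIcc s t))
    (hn : ∀ τ ∈ Set.uIcc s t, en U 0 τ ≤ n ∧ en U 1 τ ≤ n ∧ en U 2 τ ≤ n)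
    (hst : thirdConst n * |t - s| ≤ 1 / 2) :
    ∀ τ ∈ Set.uIcc s t, en U 3 τ ≤ 2 * en U 3 s + 1 := by
  intro τ hτ
  have hn0 : 0 ≤ n := (en_nonneg 0 τ).trans (hn τ hτ).1
  have := le_of_affine_bound (g := en U 3) (T := Set.uIcc s t) (a := en U 3 s + 1 / 2)
    (η := 1 / 2) (by norm_num) (let ⟨C, hC⟩ := hT; ⟨C, fun τ hτ => hC τ hτ 3 le_rfl⟩)
    (fun G hG τ hτ => ?_) τ hτ
  · norm_num at this
    linarith
  have hsub : Set.uIcc s τ ⊆ Set.uIcc s t := Set.uIcc_subset_uIcc Set.left_mem_uIcc hτ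
  have hG0 : 0 ≤ G := (en_nonneg 3 s).trans (hG s Set.left_mem_uIcc)
  have h1 := hU.third_order_step (hT.mono hsub) (fun r hr => hn r (hsub hr))
    fun r hr => hG r (hsub hr)
  have hlen : |τ - s| ≤ |t - s| := by
    rw [Set.uIcc_comm] at hτ
    have := abs_sub_le_of_mem_uIcc hτ
    rwa [abs_sub_comm, abs_sub_comm s t] at this
  have hc := thirdConst_pos hn0
  have h2 : thirdConst n * |τ - s| ≤ 1 / 2 := le_trans (by gcongr) hst
  have h3 : thirdConst n * |τ - s| * (1 + G) ≤ 1 / 2 * (1 + G) := by gcongr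
  linarith

lemma uIcc_split {a b t τ : ℝ} (hbm : b ∈ Set.uIcc a t) (hτ : τ ∈ Set.uIcc a t)
    (hτa : τ ≠ a) (hτb : τ ∉ Set.uIcc b t) : τ ∈ Set.uIcc a b ∧
    ∀ r ∈ Set.uIcc b τ, r ∈ Set.uIcc a t ∧ r ≠ a ∧ r ∈ Set.uIcc τ t := by
  simp only [Set.mem_uIcc] at *
  constructor
  · grind
  · grind

/-- Regularity bounds are locally uniform in time. -/
theorem nrm_locally_bounded (hU : Sol U) (t : ℝ) :
    ∃ ε > 0, ∃ C, ∀ τ, |τ - t| < ε → nrm U τ ≤ C := by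
  refine locally_bounded_of_propagation hU.isClosed_nrm_le ?_ ?_ t
  · intro n
    obtain ⟨K, hK0, hK⟩ := hU.propagate_second n
    have hc := thirdConst_pos hK0
    refine ⟨K + K + K + (2 * n + 1), min 1 (1 / (2 * thirdConst K)), by positivity,
      fun s t hst hb hs τ hτ => ?_⟩
    have hT := hU.reg_of_nrm hb
    have h1 := hK s t (hst.trans (min_le_left _ _)) hT
      ((hU.en_le_nrm (by norm_num) s).trans hs) ((hU.en_le_nrm (by norm_num) s).trans hs)
      ((hU.en_le_nrm (by norm_num) s).trans hs)
    have h2 := hst.trans (min_le_right _ _)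
    rw [le_div_iff₀ (by positivity)] at h2
    have h3 := hU.propagate_third hT h1 (by linarith) τ hτ
    have h4 := (hU.en_le_nrm (i := 3) le_rfl s).trans hs
    obtain ⟨h5, h6, h7⟩ := h1 τ hτ
    rw [hU.nrm_eq]
    linarith
  · intro a t hat hb
    rcases eq_or_ne a t with rfl | hne
    · exact ⟨nrm U a, fun τ hτ => by simp at hτ; rw [hτ]⟩
    obtain ⟨K, hK0, hK⟩ := hU.propagate_second (nrm U t)
    have hc := thirdConst_pos hK0
    have hlow : ∀ b ∈ Set.uIcc a t, b ≠ a →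
        en U 0 b ≤ K ∧ en U 1 b ≤ K ∧ en U 2 b ≤ K := by
      intro b hbm hba
      have hT := hU.reg_of_nrm (hb b hbm hba)
      rw [Set.uIcc_comm] at hT
      refine hK t b ?_ hT (hU.en_le_nrm (by norm_num) t) (hU.en_le_nrm (by norm_num) t)
        (hU.en_le_nrm (by norm_num) t) b Set.right_mem_uIcc
      rw [abs_sub_comm]
      exact (abs_sub_le_of_mem_uIcc hbm).trans hat
    set θ : ℝ := min 1 (1 / (2 * thirdConst K)) with hθ
    have hθ0 : 0 < θ := by positivity
    set b := a + θ * (t - a) with hbdef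
    have hθ1 : θ ≤ 1 := min_le_left _ _
    have hbm : b ∈ Set.uIcc a t := by
      rw [Set.mem_uIcc]
      rcases le_total a t with h | h
      · left; constructor <;> nlinarith
      · right; constructor <;> nlinarith
    have hba : b ≠ a := by
      have : θ * (t - a) ≠ 0 := mul_ne_zero hθ0.ne' (sub_ne_zero.2 hne.symm)
      intro h; apply this; linarith
    have hlen : thirdConst K * |b - a| ≤ 1 / 2 := by
      have : |b - a| ≤ θ := by
        rw [hbdef, add_sub_cancel_left, abs_mul, abs_of_pos hθ0]
        nlinarith
      have h2 := this.trans (min_le_right _ _)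
      rw [le_div_iff₀ (by positivity)] at h2
      linarith
    obtain ⟨C, hC⟩ := hb b hbm hba
    refine ⟨max (nrm U a) (max C (K + K + K + (2 * en U 3 b + 1))), fun τ hτ => ?_⟩
    rcases eq_or_ne τ a with rfl | hτa
    · exact le_max_left _ _
    refine le_trans ?_ (le_max_right _ _)
    by_cases hτb : τ ∈ Set.uIcc b t
    · exact (hC τ hτb).trans (le_max_left _ _)
    refine le_trans ?_ (le_max_right _ _)
    obtain ⟨hτab, hmem⟩ := uIcc_split hbm hτ hτa hτb
    have hT : Reg U (Set.uIcc b τ) :=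
      (hU.reg_of_nrm (hb τ hτ hτa)).mono fun r hr => (hmem r hr).2.2
    have hlen' : thirdConst K * |τ - b| ≤ 1 / 2 := by
      have := abs_sub_le_of_mem_uIcc hτab
      rw [abs_sub_comm]
      exact le_trans (by gcongr) hlen
    have h3 := hU.propagate_third hT (fun r hr => hlow r (hmem r hr).1 (hmem r hr).2.1) hlen' τ
      Set.right_mem_uIcc
    obtain ⟨h5, h6, h7⟩ := hlow τ hτ hτa
    rw [hU.nrm_eq]
    linarith

theorem reg_uIcc (hU : Sol U) (s t : ℝ) : Reg U (Set.uIcc s t) :=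
  hU.reg_of_nrm (exists_bound_of_locally isCompact_uIcc fun t _ => hU.nrm_locally_bounded t)

theorem mass_conserved (hU : Sol U) (s t : ℝ) : en U 0 t = en U 0 s :=
  hU.mass_eq (hU.reg_uIcc s t)

theorem energy_conserved (hU : Sol U) (s t : ℝ) : ∫ x, eden U t x = ∫ x, eden U s x :=
  hU.energy_eq (hU.reg_uIcc s t)

/-- The norm in `H¹` stays bounded for all times. -/
lemma exists_H1_bound (hU : Sol U) : ∃ K, 0 ≤ K ∧ ∀ t, en U 0 t ≤ K ∧ en U 1 t ≤ K := by
  obtain ⟨K, hK⟩ := hU.propagate_first (max (en U 0 0) (en U 1 0))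
  have h := fun t => hK 0 t (hU.reg_uIcc 0 t) (le_max_left _ _) (le_max_right _ _) t
    Set.right_mem_uIcc
  exact ⟨K, (en_nonneg 0 0).trans (h 0).1, h⟩

/-- The `H²` norm grows slower than any exponential. -/
lemma second_growth (hU : Sol U) {γ : ℝ} (hγ : 0 < γ) (t₀ : ℝ) : ∃ C, 0 ≤ C ∧ ∀ t, t₀ ≤ t →
    en U 2 t ≤ C * exp (γ * t) := by
  obtain ⟨K, -, hK⟩ := hU.exists_H1_bound
  set η := 1 - exp (-γ) with hη
  have hη0 : 0 < η := by
    have : exp (-γ) < 1 := Real.exp_lt_one_iff.2 (by linarith)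
    linarith
  obtain ⟨D, hD0, hD⟩ := hU.second_order_step K hη0 (by have := exp_pos (-γ); linarith)
  set b := D / η with hb
  have hb0 : 0 ≤ b := by positivity
  have step : ∀ s t, |t - s| ≤ 1 → en U 2 t + b ≤ exp γ * (en U 2 s + b) := by
    intro s t hst
    have h := hD s t hst (hU.reg_uIcc s t) (fun τ _ => hK τ) t Set.right_mem_uIcc
    have h1 : 1 - η = exp (-γ) := by rw [hη]; ring
    rw [h1, exp_neg, div_inv_eq_mul] at h
    have hDb : D = η * b := by rw [hb]; field_simp
    have h2 : exp γ * η = exp γ - 1 := by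
      rw [hη, mul_sub, ← exp_add]; simp
    calc en U 2 t + b ≤ (en U 2 s + D) * exp γ + b := by linarith
      _ = exp γ * en U 2 s + (exp γ * η) * b + b := by rw [hDb]; ring
      _ = _ := by rw [h2]; ring
  have iter : ∀ k : ℕ, en U 2 (t₀ + k) + b ≤ exp (γ * k) * (en U 2 t₀ + b) := by
    intro k
    induction k with
    | zero => simp
    | succ k ih =>
      have h := step (t₀ + k) (t₀ + (k + 1 : ℕ)) (by push_cast; ring_nf; simp)
      calc _ ≤ exp γ * (exp (γ * k) * (en U 2 t₀ + b)) := h.trans (by gcongr)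
        _ = _ := by rw [← mul_assoc, ← exp_add]; push_cast; ring_nf
  have h20 := en_nonneg (U := U) 2 t₀
  refine ⟨exp γ * (exp (-γ * t₀) * (en U 2 t₀ + b)), by positivity, fun t ht => ?_⟩
  set k := ⌊t - t₀⌋₊
  have hk1 : (k : ℝ) ≤ t - t₀ := Nat.floor_le (by linarith)
  have hk2 : t - t₀ < k + 1 := Nat.lt_floor_add_one _
  have h := step (t₀ + k) t (by rw [abs_le]; constructor <;> linarith)
  calc en U 2 t ≤ en U 2 t + b := by linarith
    _ ≤ exp γ * (exp (γ * k) * (en U 2 t₀ + b)) := h.trans (by gcongr; exact iter k)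
    _ ≤ exp γ * (exp (γ * (t - t₀)) * (en U 2 t₀ + b)) := by gcongr
    _ = _ := by rw [show γ * (t - t₀) = -γ * t₀ + γ * t by ring, exp_add]; ring

end Sol

lemma Q_pos (x : ℝ) : 0 < Q x := by
  have := cosh_pos (3 * x / 2)
  unfold Q
  positivity

lemma Q_cube (x : ℝ) : Q x ^ 3 = 5 / (2 * cosh (3 * x / 2) ^ 2) := by
  have := cosh_pos (3 * x / 2)
  unfold Q
  rw [← rpow_natCast, ← rpow_mul (by positivity)]
  norm_num

lemma Q_cube' (x : ℝ) : 2 / 5 * Q x ^ 3 = 1 - tanh (3 * x / 2) ^ 2 := by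
  have h := cosh_pos (3 * x / 2)
  rw [Q_cube, tanh_eq_sinh_div_cosh, div_pow]
  have := cosh_sq (3 * x / 2)
  field_simp
  linarith

lemma hasDerivAt_tanh (x : ℝ) : HasDerivAt tanh (1 - tanh x ^ 2) x := by
  have h := cosh_pos x
  have h1 : tanh = fun x => sinh x / cosh x := by ext y; exact tanh_eq_sinh_div_cosh y
  rw [h1]
  refine ((hasDerivAt_sinh x).fun_div (hasDerivAt_cosh x) h.ne').congr_deriv ?_
  field_simp

lemma continuous_tanh : Continuous tanh :=
  continuous_iff_continuousAt.2 fun x => (hasDerivAt_tanh x).continuousAt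

lemma hasDerivAt_Q (x : ℝ) : HasDerivAt Q (-(tanh (3 * x / 2) * Q x)) x := by
  have h := cosh_pos (3 * x / 2)
  have e : Q = fun x => exp ((log (5 / 2) - 2 * log (cosh (3 * x / 2))) * (1 / 3)) := by
    ext y
    have h := cosh_pos (3 * y / 2)
    rw [Q, rpow_def_of_pos (by positivity), log_div (by norm_num) (by positivity),
      log_mul (by norm_num) (by positivity), log_pow, log_div (by norm_num) (by norm_num)]
    congr 1
    push_cast
    ring
  have d1 : HasDerivAt (fun x : ℝ => 3 * x / 2) (3 / 2) x := by
    simpa using ((hasDerivAt_id x).const_mul 3).div_const 2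
  have d2 : HasDerivAt (fun x => log (cosh (3 * x / 2)))
      (sinh (3 * x / 2) * (3 / 2) / cosh (3 * x / 2)) x :=
    d1.cosh.log h.ne'
  have d3 := (((d2.const_mul 2).const_sub (log (5 / 2))).mul_const (1 / 3)).exp
  rw [e]
  refine d3.congr_deriv ?_
  rw [tanh_eq_sinh_div_cosh]
  ring

lemma continuous_Q : Continuous Q :=
  continuous_iff_continuousAt.2 fun x => (hasDerivAt_Q x).continuousAt

lemma Q_le (x : ℝ) : Q x ≤ 3 * exp (-|x|) := by
  have h : exp |3 * x / 2| ≤ 2 * cosh (3 * x / 2) := by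
    rw [← cosh_abs, cosh_eq]
    linarith [exp_pos (-|3 * x / 2|)]
  refine le_of_pow_le_pow_left₀ (n := 3) (by norm_num) (by positivity) ?_
  rw [Q_cube, mul_pow, ← exp_nat_mul]
  have h1 : exp |3 * x / 2| ^ 2 ≤ (2 * cosh (3 * x / 2)) ^ 2 := by gcongr
  have h2 : exp |3 * x / 2| ^ 2 * exp ((3 : ℕ) * -|x|) = 1 := by
    rw [← exp_nat_mul, ← exp_add, exp_eq_one_iff]
    rw [abs_div, abs_mul]
    push_cast
    rw [abs_of_pos (by norm_num : (0:ℝ) < 3), abs_of_pos (by norm_num : (0:ℝ) < 2)]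
    ring
  have h3 := cosh_pos (3 * x / 2)
  rw [div_le_iff₀ (by positivity)]
  have h4 := exp_pos ((3 : ℕ) * -|x|)
  nlinarith [mul_le_mul_of_nonneg_right h1 h4.le]

section

variable {c : ℝ}

lemma Qc_pos (hc : 0 < c) (x : ℝ) : 0 < Qc c x := by
  have := Q_pos (√c * x)
  unfold Qc
  positivity

/-- The derivative of the soliton profile. -/
noncomputable def Qd (c x : ℝ) : ℝ := -(√c * tanh (3 * (√c * x) / 2) * Qc c x)

lemma hasDerivAt_Qc (c x : ℝ) : HasDerivAt (Qc c) (Qd c x) x := by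
  have d1 : HasDerivAt (fun x : ℝ => √c * x) (√c) x := by
    simpa using (hasDerivAt_id x).const_mul (√c)
  refine (((hasDerivAt_Q (√c * x)).comp x d1).const_mul (c ^ ((1:ℝ)/3))).congr_deriv ?_
  simp only [Qd, Qc]
  ring

lemma continuous_Qc (c : ℝ) : Continuous (Qc c) :=
  continuous_iff_continuousAt.2 fun x => (hasDerivAt_Qc c x).continuousAt

lemma continuous_Qd (c : ℝ) : Continuous (Qd c) := by
  have h1 := continuous_Qc c
  have h2 := continuous_tanh
  unfold Qd
  fun_prop

lemma Qc_cube (hc : 0 < c) (x : ℝ) :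
    2 / 5 * Qc c x ^ 3 = c * (1 - tanh (3 * (√c * x) / 2) ^ 2) := by
  rw [← Q_cube', Qc, mul_pow, ← rpow_natCast, ← rpow_mul hc.le]
  norm_num
  ring

lemma Qd_sq (hc : 0 < c) (x : ℝ) : Qd c x ^ 2 = c * Qc c x ^ 2 - 2 / 5 * Qc c x ^ 5 := by
  have h := Qc_cube hc x
  have h1 := sq_sqrt hc.le
  calc Qd c x ^ 2 = √c ^ 2 * tanh (3 * (√c * x) / 2) ^ 2 * Qc c x ^ 2 := by unfold Qd; ring
    _ = (c - 2 / 5 * Qc c x ^ 3) * Qc c x ^ 2 := by rw [h, h1]; ring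
    _ = _ := by ring

lemma hasDerivAt_Qd (hc : 0 < c) (x : ℝ) : HasDerivAt (Qd c) (c * Qc c x - Qc c x ^ 4) x := by
  have d1 : HasDerivAt (fun x : ℝ => 3 * (√c * x) / 2) (3 * √c / 2) x := by
    simpa using (((hasDerivAt_id x).const_mul (√c)).const_mul 3).div_const 2
  have d2 := (hasDerivAt_tanh (3 * (√c * x) / 2)).comp x d1
  refine (((d2.const_mul (√c)).fun_mul (hasDerivAt_Qc c x)).fun_neg).congr_deriv ?_
  have h := Qc_cube hc x
  have h1 := sq_sqrt hc.le
  simp only [Function.comp_def]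
  rw [Qd]
  calc _ = -(3 / 2 * (√c ^ 2 * (1 - tanh (3 * (√c * x) / 2) ^ 2)) * Qc c x)
        + √c ^ 2 * tanh (3 * (√c * x) / 2) ^ 2 * Qc c x := by ring
    _ = -(3 / 2 * (c * (1 - tanh (3 * (√c * x) / 2) ^ 2)) * Qc c x)
        + (c - c * (1 - tanh (3 * (√c * x) / 2) ^ 2)) * Qc c x := by rw [h1]; ring
    _ = _ := by rw [← h]; ring

lemma abs_Qd_le (hc : 0 < c) (x : ℝ) : |Qd c x| ≤ √c * Qc c x := by
  have h := Qc_pos hc x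
  refine abs_le_of_sq_le_sq ?_ (by positivity)
  rw [Qd_sq hc, mul_pow, sq_sqrt hc.le]
  have : 0 < Qc c x ^ 5 := by positivity
  linarith

lemma Qd_nonneg (hc : 0 < c) {x : ℝ} (hx : x ≤ 0) : 0 ≤ Qd c x := by
  have h := Qc_pos hc x
  have h1 : tanh (3 * (√c * x) / 2) ≤ 0 := by
    rw [tanh_eq_sinh_div_cosh]
    refine div_nonpos_of_nonpos_of_nonneg ?_ (cosh_pos _).le
    rw [sinh_nonpos_iff]
    nlinarith [sqrt_nonneg c]
  have h2 := sqrt_nonneg c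
  unfold Qd
  have := mul_nonneg (mul_nonneg h2 (neg_nonneg.2 h1)) h.le
  linarith

lemma Qc_zero_cube (hc : 0 < c) : 2 / 5 * Qc c 0 ^ 3 = c := by
  rw [Qc_cube hc]; simp

lemma Qc_le_zero (hc : 0 < c) (x : ℝ) : Qc c x ≤ Qc c 0 := by
  refine le_of_pow_le_pow_left₀ (n := 3) (by norm_num) (Qc_pos hc 0).le ?_
  have h1 := Qc_cube hc x
  have h2 := Qc_zero_cube hc
  nlinarith [sq_nonneg (tanh (3 * (√c * x) / 2))]

lemma Qc_le (hc : 0 < c) (x : ℝ) : Qc c x ≤ 3 * c ^ ((1:ℝ)/3) * exp (-(√c * |x|)) := by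
  have h := Q_le (√c * x)
  rw [abs_mul, abs_of_nonneg (sqrt_nonneg c)] at h
  unfold Qc
  have : 0 < c ^ ((1:ℝ)/3) := by positivity
  nlinarith

lemma integral_exp_neg_abs {L : ℝ} (hL : 0 < L) :
    (Integrable fun x : ℝ => exp (-(|x| / L))) ∧ ∫ x : ℝ, exp (-(|x| / L)) = 2 * L := by
  have h1 : IntegrableOn (fun x : ℝ => exp (-(|x| / L))) (Set.Ioi 0) := by
    refine (integrableOn_exp_mul_Ioi (a := -L⁻¹) (by simpa using hL) 0).congr_fun
      (fun x hx => ?_) measurableSet_Ioi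
    simp only [Set.mem_Ioi] at hx
    rw [abs_of_pos hx]; ring_nf
  have h2 : ∫ x in Set.Ioi (0:ℝ), exp (-(|x| / L)) = L := by
    rw [setIntegral_congr_fun (g := fun x => exp (-L⁻¹ * x)) measurableSet_Ioi
      fun x hx => by simp only [Set.mem_Ioi] at hx; simp only [abs_of_pos hx]; ring_nf,
      integral_exp_mul_Ioi (by simpa using hL)]
    simp
  constructor
  · rw [← integrableOn_univ, ← Set.Iic_union_Ioi (a := (0:ℝ))]
    refine IntegrableOn.union ?_ h1
    rw [← integrableOn_Ici_iff_integrableOn_Ioi] at h1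
    have := h1.comp_neg
    simpa using this
  · have := integral_comp_abs (f := fun x : ℝ => exp (-(x / L)))
    rw [this, ← setIntegral_congr_fun (f := fun x => exp (-(|x| / L))) measurableSet_Ioi
      fun x hx => by simp only [Set.mem_Ioi] at hx; simp only [abs_of_pos hx], h2]

end

variable {c : ℝ}

lemma integrable_Qc (hc : 0 < c) : Integrable (Qc c) := by
  have h := (integral_exp_neg_abs (L := (√c)⁻¹) (by positivity)).1.const_mul (3 * c ^ ((1:ℝ)/3))
  refine h.mono' (continuous_Qc c).aestronglyMeasurable (ae_of_all _ fun x => ?_)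
  rw [Real.norm_eq_abs, abs_of_pos (Qc_pos hc x), div_inv_eq_mul, mul_comm |x|]
  exact Qc_le hc x

lemma integrable_Qc_pow (hc : 0 < c) (k : ℕ) : Integrable fun x => Qc c x ^ (k + 1) := by
  have h1 := continuous_Qc c
  refine ((integrable_Qc hc).const_mul (Qc c 0 ^ k)).mono'
    (Continuous.aestronglyMeasurable (by fun_prop)) (ae_of_all _ fun x => ?_)
  have h := Qc_pos hc x
  rw [Real.norm_eq_abs, abs_of_pos (by positivity), pow_succ]
  gcongr
  exact Qc_le_zero hc x

lemma integrable_Qd_sq (hc : 0 < c) : Integrable fun x => Qd c x ^ 2 := by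
  simp_rw [Qd_sq hc]
  exact ((integrable_Qc_pow hc 1).const_mul _).sub ((integrable_Qc_pow hc 4).const_mul _)

lemma integral_Qd_sq_aux (hc : 0 < c) :
    ∫ x, Qd c x ^ 2 = c * (∫ x, Qc c x ^ 2) - 2 / 5 * ∫ x, Qc c x ^ 5 := by
  simp_rw [Qd_sq hc]
  rw [integral_sub ((integrable_Qc_pow hc 1).const_mul _) ((integrable_Qc_pow hc 4).const_mul _),
    integral_const_mul, integral_const_mul]

lemma integral_Qc_five (hc : 0 < c) : ∫ x, Qc c x ^ 5 = 10 / 7 * (c * ∫ x, Qc c x ^ 2) := by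
  have hd : ∀ x, HasDerivAt (fun x => Qc c x * Qd c x)
      (Qd c x ^ 2 + (c * Qc c x ^ 2 - Qc c x ^ 5)) x := fun x =>
    ((hasDerivAt_Qc c x).fun_mul (hasDerivAt_Qd hc x)).congr_deriv (by ring)
  have i2 := (integrable_Qc_pow hc 1).const_mul c
  have i5 := integrable_Qc_pow hc 4
  have i25 : Integrable fun x => c * Qc c x ^ 2 - Qc c x ^ 5 := i2.sub i5
  have i0 : Integrable fun x => Qc c x * Qd c x :=
    integrable_mul_of_sq (continuous_Qc c) (continuous_Qd c) (integrable_Qc_pow hc 1)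
      (integrable_Qd_sq hc)
  have h := integral_eq_zero_of_hasDerivAt_of_integrable hd
    ((integrable_Qd_sq hc).fun_add i25) i0
  rw [integral_add (integrable_Qd_sq hc) i25, integral_Qd_sq_aux hc] at h
  have h' : ∫ x, (c * Qc c x ^ 2 - Qc c x ^ 5) = c * (∫ x, Qc c x ^ 2) - ∫ x, Qc c x ^ 5 := by
    rw [integral_sub i2 i5, integral_const_mul]
  rw [h'] at h
  linarith

lemma integral_Qd_sq (hc : 0 < c) : ∫ x, Qd c x ^ 2 = 3 / 7 * (c * ∫ x, Qc c x ^ 2) := by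
  rw [integral_Qd_sq_aux hc, integral_Qc_five hc]; ring

lemma integral_energy_Qc (hc : 0 < c) :
    ∫ x, (Qd c x ^ 2 - 2 / 5 * Qc c x ^ 5) = -(1 / 7) * (c * ∫ x, Qc c x ^ 2) := by
  rw [integral_sub (integrable_Qd_sq hc) ((integrable_Qc_pow hc 4).const_mul _),
    integral_const_mul, integral_Qd_sq hc, integral_Qc_five hc]
  ring

lemma integral_Qc_sq (hc : 0 < c) : ∫ x, Qc c x ^ 2 = c ^ ((1:ℝ)/6) * ∫ x, Q x ^ 2 := by
  have h := Measure.integral_comp_mul_left (fun x => Q x ^ 2) (√c)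
  simp only [Qc, mul_pow]
  rw [integral_const_mul, h, smul_eq_mul, abs_of_nonneg (by positivity), ← mul_assoc,
    sqrt_eq_rpow, ← rpow_natCast, ← rpow_mul hc.le, ← rpow_neg hc.le, ← rpow_add hc]
  norm_num

lemma integral_Qc (hc : 0 < c) : ∫ x, Qc c x = c ^ (-(1:ℝ)/6) * ∫ x, Q x := by
  have h := Measure.integral_comp_mul_left Q (√c)
  simp only [Qc]
  rw [integral_const_mul, h, smul_eq_mul, abs_of_nonneg (by positivity), ← mul_assoc,
    sqrt_eq_rpow, ← rpow_neg hc.le, ← rpow_add hc]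
  norm_num

lemma Qc_one : Qc 1 = Q := by ext x; simp [Qc]

lemma energy_Q : Energy Q = -(1 / 7) * ∫ x, Q x ^ 2 := by
  have h := integral_energy_Qc one_pos
  rw [Qc_one, one_mul] at h
  rw [← h, Energy]
  congr 1
  ext x
  have := hasDerivAt_Qc 1 x
  rw [Qc_one] at this
  rw [this.deriv]

/-- Convexity of the reduced energy `c ↦ (6/7) c ∫ Qc²`, with derivative `∫ Qc²`. -/
lemma reduced_energy_convex {c c' : ℝ} (hc : 0 < c) (hc' : 0 < c') :
    6 / 7 * (c * ∫ x, Qc c x ^ 2) + (c' - c) * ∫ x, Qc c x ^ 2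
      ≤ 6 / 7 * (c' * ∫ x, Qc c' x ^ 2) := by
  rw [integral_Qc_sq hc, integral_Qc_sq hc']
  have hb : 0 ≤ ∫ x, Q x ^ 2 := integral_nonneg fun x => sq_nonneg _
  have h := one_add_mul_self_le_rpow_one_add (s := c' / c - 1) (by
    have : 0 < c' / c := by positivity
    linarith) (p := 7 / 6) (by norm_num)
  rw [add_sub_cancel, div_rpow hc'.le hc.le, le_div_iff₀ (by positivity)] at h
  have e : ∀ a : ℝ, 0 < a → a ^ ((7:ℝ)/6) = a * a ^ ((1:ℝ)/6) := by
    intro a ha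
    rw [show (7:ℝ)/6 = 1 + 1 / 6 by norm_num, rpow_add ha, rpow_one]
  rw [e c hc, e c' hc'] at h
  have h2 : (1 + 7 / 6 * (c' / c - 1)) * (c * c ^ ((1:ℝ)/6))
      = (c + 7 / 6 * (c' - c)) * c ^ ((1:ℝ)/6) := by field_simp
  rw [h2] at h
  nlinarith [mul_le_mul_of_nonneg_right h hb]

/-! ### Logistic weights -/

/-- The logistic function at scale `L`. -/
noncomputable def lg (L y : ℝ) : ℝ := (1 + exp (-(y / L)))⁻¹

/-- The derivative of the logistic function at scale `L`. -/
noncomputable def lgd (L y : ℝ) : ℝ := lg L y * (1 - lg L y) / L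

section Logistic

variable {L : ℝ}

lemma lg_pos (L y : ℝ) : 0 < lg L y := by unfold lg; positivity

lemma lg_lt_one (L y : ℝ) : lg L y < 1 :=
  inv_lt_one_of_one_lt₀ (by linarith [exp_pos (-(y / L))])

lemma lg_le_exp (L y : ℝ) : lg L y ≤ exp (y / L) := by
  rw [lg, ← inv_inv (exp (y / L)), ← exp_neg]
  exact inv_anti₀ (exp_pos _) (by linarith)

lemma one_sub_lg (L y : ℝ) : 1 - lg L y = exp (-(y / L)) * lg L y := by
  have : 1 + exp (-(y / L)) ≠ 0 := by positivity
  rw [lg]; field_simp; ring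

lemma one_sub_lg_le (L y : ℝ) : 1 - lg L y ≤ exp (-(y / L)) := by
  rw [one_sub_lg]
  nlinarith [lg_lt_one L y, exp_pos (-(y / L))]

lemma lgd_nonneg (hL : 0 < L) (y : ℝ) : 0 ≤ lgd L y := by
  have := lg_pos L y; have := lg_lt_one L y
  have : 0 ≤ 1 - lg L y := by linarith
  unfold lgd; positivity

lemma lgd_le (hL : 0 < L) (y : ℝ) : lgd L y ≤ lg L y / L ∧ lgd L y ≤ (1 - lg L y) / L := by
  have h0 := lg_pos L y; have h1 := lg_lt_one L y
  constructor <;> (unfold lgd; gcongr; nlinarith)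

lemma hasDerivAt_lg (L y : ℝ) : HasDerivAt (lg L) (lgd L y) y := by
  have h : HasDerivAt (fun y => 1 + exp (-(y / L))) (exp (-(y / L)) * (-(1 / L))) y :=
    (((hasDerivAt_id' y).div_const L).fun_neg.exp).const_add 1
  refine (h.fun_inv (by positivity)).congr_deriv ?_
  rw [lgd, one_sub_lg]
  have : 1 + exp (-(y / L)) ≠ 0 := by positivity
  unfold lg
  field_simp

lemma continuous_lg (L : ℝ) : Continuous (lg L) :=
  continuous_iff_continuousAt.2 fun x => (hasDerivAt_lg L x).continuousAt

lemma continuous_lgd (L : ℝ) : Continuous (lgd L) := by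
  have := continuous_lg L
  unfold lgd; fun_prop

lemma hasDerivAt_lgd (L y : ℝ) : HasDerivAt (lgd L) (lgd L y * (1 - 2 * lg L y) / L) y := by
  have h := hasDerivAt_lg L y
  refine ((h.fun_mul (h.const_sub 1)).div_const L).congr_deriv ?_
  ring

lemma hasDerivAt_lgd_second (L y : ℝ) : HasDerivAt (fun y => lgd L y * (1 - 2 * lg L y) / L)
    (lgd L y * (1 - 6 * lg L y + 6 * lg L y ^ 2) / L ^ 2) y := by
  have h := hasDerivAt_lg L y
  refine (((hasDerivAt_lgd L y).fun_mul ((h.const_mul 2).const_sub 1)).div_const L).congr_deriv ?_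
  simp only [lgd]
  ring

lemma abs_lgd_second_le (hL : 0 < L) (y : ℝ) :
    |lgd L y * (1 - 2 * lg L y) / L| ≤ lgd L y / L := by
  have h0 := lg_pos L y; have h1 := lg_lt_one L y
  rw [abs_div, abs_mul, abs_of_pos hL, abs_of_nonneg (lgd_nonneg hL y)]
  gcongr
  exact mul_le_of_le_one_right (lgd_nonneg hL y) (abs_le.2 ⟨by linarith, by linarith⟩)

lemma abs_lgd_third_le (hL : 0 < L) (y : ℝ) :
    |lgd L y * (1 - 6 * lg L y + 6 * lg L y ^ 2) / L ^ 2| ≤ lgd L y / L ^ 2 := by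
  have h0 := lg_pos L y; have h1 := lg_lt_one L y
  rw [abs_div, abs_mul, abs_of_pos (by positivity : 0 < L ^ 2), abs_of_nonneg (lgd_nonneg hL y)]
  gcongr
  exact mul_le_of_le_one_right (lgd_nonneg hL y) (abs_le.2 ⟨by nlinarith [sq_nonneg (2 * lg L y - 1)],
    by nlinarith⟩)

lemma lgd_le_one (hL : 1 ≤ L) (y : ℝ) : lgd L y ≤ 1 := by
  have h0 := lg_lt_one L y; have h1 := lg_pos L y
  refine (lgd_le (by linarith) y).1.trans ?_
  rw [div_le_one (by linarith)]; linarith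

lemma weight_lg (hL : 1 ≤ L) : Weight 1 (lg L) (lgd L) (fun y => lgd L y * (1 - 2 * lg L y) / L)
    (fun y => lgd L y * (1 - 6 * lg L y + 6 * lg L y ^ 2) / L ^ 2) := by
  have hL0 : 0 < L := by linarith
  have c0 := continuous_lg L
  have c1 := continuous_lgd L
  refine ⟨hasDerivAt_lg L, hasDerivAt_lgd L, hasDerivAt_lgd_second L, by fun_prop, fun x => ?_,
    fun x => ?_, fun x => ?_, fun x => ?_⟩
  · rw [abs_of_pos (lg_pos L x)]; exact (lg_lt_one L x).le
  · rw [abs_of_nonneg (lgd_nonneg hL0 x)]; exact lgd_le_one hL x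
  · exact (abs_lgd_second_le hL0 x).trans
      (div_le_one_of_le₀ ((lgd_le_one hL x).trans hL) hL0.le)
  · exact (abs_lgd_third_le hL0 x).trans
      (div_le_one_of_le₀ ((lgd_le_one hL x).trans (one_le_pow₀ hL)) (by positivity))

lemma Weight.comp_sub {K : ℝ} {f f1 f2 f3 : ℝ → ℝ} (h : Weight K f f1 f2 f3) (a : ℝ) :
    Weight K (fun y => f (y - a)) (fun y => f1 (y - a)) (fun y => f2 (y - a))
      (fun y => f3 (y - a)) :=
  ⟨fun x => (h.d0 (x - a)).comp_sub_const x a, fun x => (h.d1 (x - a)).comp_sub_const x a,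
    fun x => (h.d2 (x - a)).comp_sub_const x a, h.c3.comp (by fun_prop), fun x => h.b0 _,
    fun x => h.b1 _, fun x => h.b2 _, fun x => h.b3 _⟩

lemma lgd_le_sub (hL : 0 < L) {x y : ℝ} (hxy : x + L ≤ y) :
    lgd L x ≤ 2 / L * (lg L y - lg L x) ∧ lgd L y ≤ 2 / L * (lg L y - lg L x) := by
  set z := exp (-(x / L)) with hz
  set w := exp (-(y / L)) with hw
  have hz0 : 0 < z := exp_pos _
  have hw0 : 0 < w := exp_pos _
  have hwz : 2 * w ≤ z := by
    have h1 : z = exp ((y - x) / L) * w := by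
      rw [hz, hw, ← exp_add]; congr 1; ring
    have h2 : 1 + (y - x) / L ≤ exp ((y - x) / L) := by
      linarith [add_one_le_exp ((y - x) / L)]
    have h3 : 1 ≤ (y - x) / L := by rw [le_div_iff₀ hL]; linarith
    rw [h1]; nlinarith
  have e1 : lg L x = (1 + z)⁻¹ := rfl
  have e2 : lg L y = (1 + w)⁻¹ := rfl
  have e3 : lg L y - lg L x = (z - w) / ((1 + z) * (1 + w)) := by
    rw [e1, e2]; field_simp; ring
  have e4 : lg L x * (1 - lg L x) = z / (1 + z) ^ 2 := by
    rw [e1]; field_simp; ring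
  have e5 : lg L y * (1 - lg L y) = w / (1 + w) ^ 2 := by
    rw [e2]; field_simp; ring
  have h1 : z / (1 + z) ^ 2 ≤ 2 * ((z - w) / ((1 + z) * (1 + w))) := by
    rw [mul_div_assoc', div_le_div_iff₀ (by positivity) (by positivity)]
    nlinarith [mul_pos hz0 hw0, mul_nonneg (sub_nonneg.2 hwz) hz0.le,
      mul_nonneg (mul_nonneg (sub_nonneg.2 hwz) hz0.le) hz0.le,
      mul_nonneg (mul_nonneg (sub_nonneg.2 hwz) hz0.le) hw0.le, mul_pos (mul_pos hz0 hw0) hz0]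
  have h2 : w / (1 + w) ^ 2 ≤ 2 * ((z - w) / ((1 + z) * (1 + w))) := by
    rw [mul_div_assoc', div_le_div_iff₀ (by positivity) (by positivity)]
    have : w * (1 + z) ≤ 2 * (z - w) * (1 + w) := by nlinarith [mul_pos hz0 hw0]
    nlinarith
  constructor
  · rw [lgd, e4, e3, div_mul_eq_mul_div]; gcongr
  · rw [lgd, e5, e3, div_mul_eq_mul_div]; gcongr

lemma lg_mono (hL : 0 < L) {x y : ℝ} (h : x ≤ y) : lg L x ≤ lg L y := by
  unfold lg; gcongr

end Logistic

/-- The product of a localized bump with a weight which is small near the bump. -/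
lemma integral_bump_le {L d p K : ℝ} (hL : 0 < L) {r ω : ℝ → ℝ} (cr : Continuous r)
    (cω : Continuous ω) (hr : ∀ x, |r x| ≤ K * exp (-(|x - p| / L))) (h0 : ∀ x, 0 ≤ ω x)
    (h1 : ∀ x, ω x ≤ 1) (hω : ∀ x, ω x ≤ exp (-((d - |x - p|) / L))) :
    (Integrable fun x => r x * ω x) ∧ |∫ x, r x * ω x| ≤ 4 * L * K * exp (-(d / (2 * L))) := by
  have hK : 0 ≤ K := by
    have := (abs_nonneg _).trans (hr p)
    simpa using this
  obtain ⟨hi, he⟩ := integral_exp_neg_abs (L := 2 * L) (by positivity)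
  have hi' := (hi.comp_sub_right p).const_mul (K * exp (-(d / (2 * L))))
  have hb : ∀ x, ‖r x * ω x‖ ≤ K * exp (-(d / (2 * L))) * exp (-(|x - p| / (2 * L))) := by
    intro x
    rw [norm_mul, Real.norm_eq_abs, Real.norm_eq_abs, abs_of_nonneg (h0 x), mul_assoc, ← exp_add]
    have hm : exp (-(|x - p| / L)) * ω x ≤ exp (-(d / (2 * L)) + -(|x - p| / (2 * L))) := by
      rcases le_total d |x - p| with h | h
      · refine (mul_le_of_le_one_right (exp_pos _).le (h1 x)).trans (exp_le_exp.2 ?_)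
        have : d / (2 * L) ≤ |x - p| / (2 * L) := by gcongr
        have e : |x - p| / L = |x - p| / (2 * L) + |x - p| / (2 * L) := by field_simp; ring
        linarith
      · refine (mul_le_mul_of_nonneg_left (hω x) (exp_pos _).le).trans ?_
        rw [← exp_add]
        refine exp_le_exp.2 ?_
        have : |x - p| / (2 * L) ≤ d / (2 * L) := by gcongr
        have e : (d - |x - p|) / L = d / (2 * L) + d / (2 * L) - |x - p| / L := by field_simp; ring
        linarith
    calc |r x| * ω x ≤ K * exp (-(|x - p| / L)) * ω x := by gcongr; exacts [h0 x, hr x]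
      _ ≤ _ := by rw [mul_assoc]; gcongr
  have hint := hi'.mono' (cr.mul cω).aestronglyMeasurable (ae_of_all _ hb)
  refine ⟨hint, ?_⟩
  have h2 := norm_integral_le_of_norm_le hi' (ae_of_all _ hb)
  rw [Real.norm_eq_abs, integral_const_mul,
    integral_sub_right_eq_self (fun x => exp (-(|x| / (2 * L)))) p, he] at h2
  exact h2.trans (le_of_eq (by ring))

/-- High powers are absorbed by the square up to a multiple of the dominating profile. -/
lemma exists_absorption {B ε : ℝ} (hB : 0 ≤ B) (hε : 0 < ε) : ∃ η C, 0 < η ∧ 0 ≤ C ∧ ∀ a r : ℝ,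
    0 ≤ r → r ≤ B → |a| ≤ r + η → |a| ^ 5 ≤ ε * a ^ 2 + C * r ∧ a ^ 8 ≤ ε * a ^ 2 + C * r := by
  set η := min 1 (ε / 32) with hη
  have h1 : η ≤ 1 := min_le_left _ _
  have h2 : 32 * η ≤ ε := by have := min_le_right 1 (ε / 32); rw [← hη] at this; linarith
  have h0 : 0 < η := by positivity
  refine ⟨η, 32 * (B + 1) ^ 7, h0, by positivity, fun a r hr hrB ha => ?_⟩
  have hA := abs_nonneg a
  have e8 : a ^ 8 = |a| ^ 8 := by rw [← abs_pow, abs_of_nonneg (by positivity)]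
  rw [e8, ← sq_abs a]
  set A := |a|
  have hAB : A ≤ B + 1 := by linarith
  have cube : A ^ 3 ≤ 4 * η + 4 * B ^ 2 * r := by
    have : A ^ 3 ≤ (r + η) ^ 3 := by gcongr
    have h3 : (r + η) ^ 3 ≤ 4 * (r ^ 3 + η ^ 3) := by nlinarith [sq_nonneg (r - η), add_nonneg hr h0.le]
    have h4 : η ^ 3 ≤ η := by
      calc η ^ 3 ≤ η ^ 1 := pow_le_pow_of_le_one h0.le h1 (by norm_num)
        _ = η := pow_one η
    have h5 : r ^ 3 ≤ B ^ 2 * r := by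
      have : r ^ 2 ≤ B ^ 2 := by gcongr
      nlinarith
    linarith
  have six : A ^ 6 ≤ 32 * η + 32 * (B ^ 5) * r := by
    have : A ^ 6 ≤ (r + η) ^ 6 := by gcongr
    have h3 : (r + η) ^ 6 ≤ 32 * (r ^ 6 + η ^ 6) := by
      have := add_pow_le hr h0.le 6
      norm_num at this; linarith
    have h4 : η ^ 6 ≤ η := by
      calc η ^ 6 ≤ η ^ 1 := pow_le_pow_of_le_one h0.le h1 (by norm_num)
        _ = η := pow_one η
    have h5 : r ^ 6 ≤ B ^ 5 * r := by
      have : r ^ 5 ≤ B ^ 5 := by gcongr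
      nlinarith
    linarith
  have hsq : A ^ 2 ≤ (B + 1) ^ 2 := by gcongr
  have hB1 : (1:ℝ) ≤ B + 1 := by linarith
  constructor
  · calc A ^ 5 = A ^ 3 * A ^ 2 := by ring
      _ ≤ (4 * η + 4 * B ^ 2 * r) * A ^ 2 := by gcongr
      _ = 4 * η * A ^ 2 + 4 * (B ^ 2 * A ^ 2) * r := by ring
      _ ≤ ε * A ^ 2 + 32 * (B + 1) ^ 7 * r := by
        gcongr
        · linarith
        · norm_num
        · calc B ^ 2 * A ^ 2 ≤ (B + 1) ^ 2 * (B + 1) ^ 2 := by gcongr; linarith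
            _ = (B + 1) ^ 4 := by ring
            _ ≤ (B + 1) ^ 7 := pow_le_pow_right₀ hB1 (by norm_num)
  · calc A ^ 8 = A ^ 6 * A ^ 2 := by ring
      _ ≤ (32 * η + 32 * B ^ 5 * r) * A ^ 2 := by gcongr
      _ = 32 * η * A ^ 2 + 32 * (B ^ 5 * A ^ 2) * r := by ring
      _ ≤ ε * A ^ 2 + 32 * (B + 1) ^ 7 * r := by
        gcongr
        calc B ^ 5 * A ^ 2 ≤ (B + 1) ^ 5 * (B + 1) ^ 2 := by gcongr; linarith
            _ = (B + 1) ^ 7 := by ring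

/-! ### Decoupling of well separated bumps -/

lemma integrable_sq_of_bump {L K p : ℝ} (hL : 0 < L) {f : ℝ → ℝ} (cf : Continuous f)
    (hb : ∀ x, |f x| ≤ K * exp (-(|x - p| / L))) :
    (Integrable fun x => f x ^ 2) ∧ ∫ x, f x ^ 2 ≤ K ^ 2 * (2 * L) := by
  obtain ⟨hi, he⟩ := integral_exp_neg_abs hL
  have hi' := (hi.comp_sub_right p).const_mul (K ^ 2)
  have hle : ∀ x, f x ^ 2 ≤ K ^ 2 * exp (-(|x - p| / L)) := by
    intro x
    have h1 : exp (-(|x - p| / L)) ≤ 1 := exp_le_one_iff.2 (by simp; positivity)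
    have h2 := exp_pos (-(|x - p| / L))
    calc f x ^ 2 = |f x| ^ 2 := (sq_abs _).symm
      _ ≤ (K * exp (-(|x - p| / L))) ^ 2 := by gcongr; exact hb x
      _ = K ^ 2 * (exp (-(|x - p| / L)) * exp (-(|x - p| / L))) := by ring
      _ ≤ _ := by gcongr; nlinarith
  have hint : Integrable fun x => f x ^ 2 := hi'.mono' (cf.pow 2).aestronglyMeasurable (ae_of_all _ fun x => by
    rw [Real.norm_eq_abs, abs_sq]; exact hle x)
  refine ⟨hint, (integral_mono hint hi' hle).trans_eq ?_⟩
  rw [integral_const_mul, integral_sub_right_eq_self (fun x => exp (-(|x| / L))) p, he]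

lemma integral_overlap_le {L K p q : ℝ} (hL : 0 < L) {f g : ℝ → ℝ} (cf : Continuous f)
    (cg : Continuous g) (hf : ∀ x, |f x| ≤ K * exp (-(|x - p| / L)))
    (hg : ∀ x, |g x| ≤ K * exp (-(|x - q| / L))) :
    ∫ x, |f x * g x| ≤ 4 * L * K ^ 2 * exp (-(|p - q| / (2 * L))) := by
  have hK : 0 ≤ K := by
    have := (abs_nonneg _).trans (hf p)
    simpa using this
  rcases hK.eq_or_lt with rfl | hK
  · have : ∀ x, f x = 0 := fun x => by simpa using hf x
    simp [this]
  obtain ⟨-, h⟩ := integral_bump_le (r := fun x => |f x|) (ω := fun x => |g x| / K) (d := |p - q|)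
    hL (by fun_prop) (by fun_prop) (fun x => by rw [abs_abs]; exact hf x) (fun x => by positivity)
    (fun x => by
      rw [div_le_one hK]
      refine (hg x).trans (mul_le_of_le_one_right hK.le (exp_le_one_iff.2 (by simp; positivity))))
    (fun x => by
      rw [div_le_iff₀ hK, mul_comm]
      refine (hg x).trans ?_
      gcongr
      have := abs_sub_le p x q
      rw [abs_sub_comm p x] at this
      linarith)
  have e : ∀ x, |f x * g x| = K * (|f x| * (|g x| / K)) := fun x => by
    rw [abs_mul]; field_simp
  simp_rw [e]
  rw [integral_const_mul]
  calc K * ∫ x, |f x| * (|g x| / K) ≤ K * (4 * L * K * exp (-(|p - q| / (2 * L)))) := by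
        gcongr; exact (le_abs_self _).trans h
    _ = _ := by ring

/-- If `g` is asymptotic in `L²` to a sum of bumps drifting apart, then `g²` is asymptotic in `L¹`
to the sum of their squares. -/
lemma tendsto_sq_of_bumps {N : ℕ} {L K : ℝ} (hL : 0 < L) {f : ℕ → ℝ → ℝ → ℝ} {p : ℕ → ℝ → ℝ}
    (hc : ∀ j t, Continuous (f j t))
    (hb : ∀ j < N, ∀ t x, |f j t x| ≤ K * exp (-(|x - p j t| / L)))
    (hp : ∀ i < N, ∀ j < N, i ≠ j → Tendsto (fun t => |p i t - p j t|) atTop atTop)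
    {g : ℝ → ℝ → ℝ} (cg : ∀ t, Continuous (g t)) (hg : ∀ t, Integrable fun x => g t x ^ 2)
    (hv : Tendsto (fun t => ∫ x, (g t x - ∑ j ∈ Finset.range N, f j t x) ^ 2) atTop (nhds 0)) :
    Tendsto (fun t => ∫ x, |g t x ^ 2 - ∑ j ∈ Finset.range N, f j t x ^ 2|) atTop (nhds 0) := by
  set F : ℝ → ℝ → ℝ := fun t x => ∑ j ∈ Finset.range N, f j t x with hF
  have cF : ∀ t, Continuous (F t) := fun t => continuous_finsetSum _ fun j _ => hc j t
  set n : ℝ → ℝ := fun t => ∫ x, (g t x - F t x) ^ 2 with hn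
  set A : ℝ := N * (N * (K ^ 2 * (2 * L))) with hA
  have hFsq : ∀ t, (Integrable fun x => F t x ^ 2) ∧ ∫ x, F t x ^ 2 ≤ A := by
    intro t
    have hi : Integrable fun x => (N : ℝ) * ∑ j ∈ Finset.range N, f j t x ^ 2 :=
      (integrable_finsetSum _ fun j hj =>
        (integrable_sq_of_bump hL (hc j t) (hb j (Finset.mem_range.1 hj) t)).1).const_mul _
    have hle : ∀ x, F t x ^ 2 ≤ (N : ℝ) * ∑ j ∈ Finset.range N, f j t x ^ 2 := fun x => by
      have := sq_sum_le_card_mul_sum_sq (s := Finset.range N) (f := fun j => f j t x)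
      simpa using this
    have hint : Integrable fun x => F t x ^ 2 :=
      hi.mono' ((cF t).pow 2).aestronglyMeasurable (ae_of_all _ fun x => by
        rw [Real.norm_eq_abs, abs_sq]; exact hle x)
    refine ⟨hint, (integral_mono hint hi hle).trans ?_⟩
    rw [integral_const_mul, integral_finsetSum _ fun j hj =>
      (integrable_sq_of_bump hL (hc j t) (hb j (Finset.mem_range.1 hj) t)).1]
    refine mul_le_mul_of_nonneg_left ?_ (by positivity)
    refine (Finset.sum_le_card_nsmul _ _ (K ^ 2 * (2 * L)) fun j hj =>
      (integrable_sq_of_bump hL (hc j t) (hb j (Finset.mem_range.1 hj) t)).2).trans_eq ?_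
    simp
  set o : ℝ → ℝ := fun t => ∑ j ∈ Finset.range N, ∑ i ∈ (Finset.range N).erase j,
    4 * L * K ^ 2 * exp (-(|p j t - p i t| / (2 * L))) with ho
  have ho0 : Tendsto o atTop (nhds 0) := by
    have : (0:ℝ) = ∑ j ∈ Finset.range N, ∑ i ∈ (Finset.range N).erase j, 0 := by simp
    rw [this]
    refine tendsto_finsetSum _ fun j hj => tendsto_finsetSum _ fun i hi => ?_
    rw [Finset.mem_erase, Finset.mem_range] at hi
    have h1 := (hp j (Finset.mem_range.1 hj) i hi.2 hi.1.symm).atTop_div_const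
      (by positivity : 0 < 2 * L)
    simpa using (tendsto_exp_neg_atTop_nhds_zero.comp h1).const_mul (4 * L * K ^ 2)
  have hlim : Tendsto (fun t => n t + 2 * √(A * n t) + o t) atTop (nhds 0) := by
    have h1 : Tendsto (fun t => √(A * n t)) atTop (nhds 0) := by
      simpa using (hv.const_mul A).sqrt
    simpa using (hv.add (h1.const_mul 2)).add ho0
  refine squeeze_zero (fun t => integral_nonneg fun x => abs_nonneg _) (fun t => ?_) hlim
  have cv : Continuous fun x => g t x - F t x := (cg t).sub (cF t)
  have iv : Integrable fun x => (g t x - F t x) ^ 2 := by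
    have h := ((hg t).fun_add (hFsq t).1).const_mul 2
    refine h.mono' (cv.pow 2).aestronglyMeasurable (ae_of_all _ fun x => ?_)
    rw [Real.norm_eq_abs, abs_sq]
    nlinarith [sq_nonneg (g t x + F t x)]
  have iFv : Integrable fun x => |F t x * (g t x - F t x)| :=
    (integrable_mul_of_sq (cF t) cv (hFsq t).1 iv).abs
  have io : ∀ j ∈ Finset.range N, ∀ i ∈ (Finset.range N).erase j,
      Integrable fun x => |f j t x * f i t x| := fun j hj i hi =>
    (integrable_mul_of_sq (hc j t) (hc i t)
      (integrable_sq_of_bump hL (hc j t) (hb j (Finset.mem_range.1 hj) t)).1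
      (integrable_sq_of_bump hL (hc i t) (hb i (Finset.mem_range.1 (Finset.mem_of_mem_erase hi)) t)).1).abs
  have io' : Integrable fun x =>
      ∑ j ∈ Finset.range N, ∑ i ∈ (Finset.range N).erase j, |f j t x * f i t x| :=
    integrable_finsetSum _ fun j hj => integrable_finsetSum _ fun i hi => io j hj i hi
  have ivF : Integrable fun x => (g t x - F t x) ^ 2 + 2 * |F t x * (g t x - F t x)| :=
    iv.fun_add (iFv.const_mul 2)
  have hle : ∀ x, |g t x ^ 2 - ∑ j ∈ Finset.range N, f j t x ^ 2|
      ≤ (g t x - F t x) ^ 2 + 2 * |F t x * (g t x - F t x)|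
        + ∑ j ∈ Finset.range N, ∑ i ∈ (Finset.range N).erase j, |f j t x * f i t x| := by
    intro x
    have e : g t x ^ 2 - ∑ j ∈ Finset.range N, f j t x ^ 2
        = (g t x - F t x) ^ 2 + 2 * (F t x * (g t x - F t x))
          + ∑ j ∈ Finset.range N, ∑ i ∈ (Finset.range N).erase j, f j t x * f i t x := by
      have : ∑ j ∈ Finset.range N, ∑ i ∈ (Finset.range N).erase j, f j t x * f i t x
          = F t x ^ 2 - ∑ j ∈ Finset.range N, f j t x ^ 2 := by
        rw [sq, hF, Finset.sum_mul, ← Finset.sum_sub_distrib]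
        refine Finset.sum_congr rfl fun j hj => ?_
        rw [← Finset.mul_sum, Finset.sum_erase_eq_sub hj]
        ring
      rw [this]; ring
    rw [e]
    refine (abs_add_le _ _).trans (add_le_add ((abs_add_le _ _).trans (add_le_add ?_ ?_)) ?_)
    · rw [abs_sq]
    · rw [abs_mul, abs_two]
    · exact (Finset.abs_sum_le_sum_abs _ _).trans
        (Finset.sum_le_sum fun j _ => Finset.abs_sum_le_sum_abs _ _)
  refine (integral_mono_of_nonneg (ae_of_all _ fun x => abs_nonneg _) (ivF.fun_add io')
    (ae_of_all _ hle)).trans ?_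
  rw [integral_add ivF io', integral_add iv (iFv.const_mul 2), integral_const_mul,
    integral_finsetSum _ fun j hj => integrable_finsetSum _ fun i hi => io j hj i hi]
  refine add_le_add (add_le_add le_rfl (mul_le_mul_of_nonneg_left ?_ zero_le_two)) ?_
  · refine Real.le_sqrt_of_sq_le ((integral_abs_mul_sq_le (cF t) cv (hFsq t).1 iv).trans ?_)
    exact mul_le_mul_of_nonneg_right (hFsq t).2 (integral_nonneg fun x => sq_nonneg _)
  · refine Finset.sum_le_sum fun j hj => ?_
    rw [integral_finsetSum _ fun i hi => io j hj i hi]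
    exact Finset.sum_le_sum fun i hi => integral_overlap_le hL (hc j t) (hc i t)
      (hb j (Finset.mem_range.1 hj) t)
      (hb i (Finset.mem_range.1 (Finset.mem_of_mem_erase hi)) t)

/-! ### Outgoing multi-solitons -/

section Bumps

variable (c Δ : ℕ → ℝ)

/-- The centre of the `j`-th soliton. -/
def ctr (j : ℕ) (t : ℝ) : ℝ := c j * t + Δ j

/-- The `j`-th soliton. -/
noncomputable def bump (j : ℕ) (t x : ℝ) : ℝ := Qc (c j) (x - ctr c Δ j t)

/-- The space derivative of the `j`-th soliton. -/
noncomputable def bumpd (j : ℕ) (t x : ℝ) : ℝ := Qd (c j) (x - ctr c Δ j t)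

/-- The sum of the first `N` solitons. -/
noncomputable def bumps (N : ℕ) (t x : ℝ) : ℝ := ∑ j ∈ Finset.range N, bump c Δ j t x

/-- The energy density of the `j`-th soliton. -/
noncomputable def bumpe (j : ℕ) (t x : ℝ) : ℝ :=
  bumpd c Δ j t x ^ 2 - 2 / 5 * bump c Δ j t x ^ 5

lemma continuous_bump (j : ℕ) (t : ℝ) : Continuous (bump c Δ j t) :=
  (continuous_Qc (c j)).comp (by fun_prop)

lemma continuous_bumpd (j : ℕ) (t : ℝ) : Continuous (bumpd c Δ j t) :=
  (continuous_Qd (c j)).comp (by fun_prop)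

lemma continuous_bumps (N : ℕ) (t : ℝ) : Continuous (bumps c Δ N t) :=
  continuous_finsetSum _ fun j _ => continuous_bump c Δ j t

lemma continuous_bumpe (j : ℕ) (t : ℝ) : Continuous (bumpe c Δ j t) := by
  have h1 := continuous_bump c Δ j t
  have h2 := continuous_bumpd c Δ j t
  unfold bumpe; fun_prop

lemma hasDerivAt_bump (j : ℕ) (t x : ℝ) : HasDerivAt (bump c Δ j t) (bumpd c Δ j t x) x :=
  (hasDerivAt_Qc (c j) (x - ctr c Δ j t)).comp_sub_const x (ctr c Δ j t)

end Bumps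

/-- A solution which is asymptotic to a sum of `N` decoupled solitons. -/
structure Out (N : ℕ) (c Δ : ℕ → ℝ) (U : ℕ → ℝ → ℝ → ℝ) : Prop where
  sol : Sol U
  pos : ∀ j < N, 0 < c j
  dec : ∀ i j, i < j → j < N → c j < c i
  lim : Tendsto (fun t => ∫ x, ((U 0 t x - bumps c Δ N t x) ^ 2
    + (U 1 t x - ∑ j ∈ Finset.range N, bumpd c Δ j t x) ^ 2)) atTop (nhds 0)

lemma exists_forall_lt_le (N : ℕ) (f : ℕ → ℝ) : ∃ K, 0 < K ∧ ∀ j < N, f j ≤ K := by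
  refine ⟨1 + ∑ j ∈ Finset.range N, |f j|, by positivity, fun j hj => ?_⟩
  have := Finset.single_le_sum (f := fun j => |f j|) (fun i _ => abs_nonneg _)
    (Finset.mem_range.2 hj)
  linarith [le_abs_self (f j)]

namespace Out

variable {N : ℕ} {c Δ : ℕ → ℝ} {U : ℕ → ℝ → ℝ → ℝ}

/-- Uniform localization of all densities attached to the solitons. -/
lemma exists_profile_bound (h : Out N c Δ U) : ∃ L0 K, 0 < L0 ∧ 0 < K ∧ ∀ L, L0 ≤ L → ∀ j < N,
    ∀ t x, 0 < bump c Δ j t x ∧ bump c Δ j t x ≤ K * exp (-(|x - ctr c Δ j t| / L)) ∧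
      |bumpd c Δ j t x| ≤ K * exp (-(|x - ctr c Δ j t| / L)) ∧
      |bump c Δ j t x ^ 2| ≤ K * exp (-(|x - ctr c Δ j t| / L)) ∧
      |bumpe c Δ j t x| ≤ K * exp (-(|x - ctr c Δ j t| / L)) := by
  obtain ⟨L0, hL0, hL⟩ := exists_forall_lt_le N fun j => (√(c j))⁻¹
  obtain ⟨K1, hK1, h1⟩ := exists_forall_lt_le N fun j => 3 * c j ^ ((1:ℝ)/3)
  obtain ⟨K2, hK2, h2⟩ := exists_forall_lt_le N fun j => √(c j)
  set K := K1 + K2 * K1 + K1 ^ 2 + ((K2 * K1) ^ 2 + K1 ^ 5) with hK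
  refine ⟨L0, K, hL0, by positivity, fun L hLL j hj t x => ?_⟩
  have hc := h.pos j hj
  set z := |x - ctr c Δ j t|
  have hz : 0 ≤ z := abs_nonneg _
  set w := exp (-(z / L)) with hw
  have hLp : 0 < L := hL0.trans_le hLL
  have w0 : 0 < w := exp_pos _
  have w1 : w ≤ 1 := exp_le_one_iff.2 (by simp; positivity)
  have hpw : ∀ n : ℕ, w ^ (n + 1) ≤ w := fun n => by
    calc w ^ (n + 1) ≤ w ^ 1 := pow_le_pow_of_le_one w0.le w1 (by omega)
      _ = w := pow_one w
  have hb0 : 0 < bump c Δ j t x := Qc_pos hc _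
  have hb : bump c Δ j t x ≤ K1 * w := by
    refine (Qc_le hc _).trans ?_
    have : exp (-(√(c j) * z)) ≤ w := by
      refine exp_le_exp.2 (neg_le_neg ?_)
      rw [div_le_iff₀ hLp]
      have h3 : 1 ≤ √(c j) * L := by
        have := (hL j hj).trans hLL
        rwa [inv_le_iff_one_le_mul₀' (sqrt_pos.2 hc)] at this
      nlinarith
    exact mul_le_mul (h1 j hj) this (exp_pos _).le hK1.le
  have hd : |bumpd c Δ j t x| ≤ K2 * K1 * w := by
    refine (abs_Qd_le hc _).trans ?_
    rw [mul_assoc]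
    exact mul_le_mul (h2 j hj) hb hb0.le hK2.le
  have hp2 : bump c Δ j t x ^ 2 ≤ K1 ^ 2 * w := by
    calc bump c Δ j t x ^ 2 ≤ (K1 * w) ^ 2 := by gcongr
      _ = K1 ^ 2 * w ^ 2 := by ring
      _ ≤ _ := by gcongr; exact hpw 1
  have hp5 : bump c Δ j t x ^ 5 ≤ K1 ^ 5 * w := by
    calc bump c Δ j t x ^ 5 ≤ (K1 * w) ^ 5 := by gcongr
      _ = K1 ^ 5 * w ^ 5 := by ring
      _ ≤ _ := by gcongr; exact hpw 4
  have hd2 : bumpd c Δ j t x ^ 2 ≤ (K2 * K1) ^ 2 * w := by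
    calc bumpd c Δ j t x ^ 2 = |bumpd c Δ j t x| ^ 2 := (sq_abs _).symm
      _ ≤ (K2 * K1 * w) ^ 2 := by gcongr
      _ = (K2 * K1) ^ 2 * w ^ 2 := by ring
      _ ≤ _ := by gcongr; exact hpw 1
  have mono : ∀ a, a ≤ K → a * w ≤ K * w := fun a ha => by gcongr
  have q1 : 0 < K2 * K1 := by positivity
  have q2 : 0 < K1 ^ 2 := by positivity
  have q3 : 0 < (K2 * K1) ^ 2 := by positivity
  have q4 : 0 < K1 ^ 5 := by positivity
  refine ⟨hb0, hb.trans (mono _ (by linarith)), hd.trans (mono _ (by linarith)), ?_, ?_⟩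
  · rw [abs_sq]; exact hp2.trans (mono _ (by linarith))
  · refine le_trans ?_ (mono ((K2 * K1) ^ 2 + K1 ^ 5) (by linarith))
    have : 0 < bump c Δ j t x ^ 5 := by positivity
    rw [bumpe, abs_le]
    constructor <;> nlinarith [sq_nonneg (bumpd c Δ j t x)]

/-- Separation of the velocities. -/
lemma exists_gap (h : Out N c Δ U) : ∃ κ, 0 < κ ∧ (∀ j < N, 2 * κ ≤ c j) ∧
    ∀ i j, i < j → j < N → 2 * κ ≤ c i - c j := by
  obtain ⟨K1, hK1, h1⟩ := exists_forall_lt_le N fun j => (c j)⁻¹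
  obtain ⟨K2, hK2, h2⟩ := exists_forall_lt_le N fun j => (c (j - 1) - c j)⁻¹
  have adj : ∀ j, 0 < j → j < N → (K1 + K2)⁻¹ ≤ c (j - 1) - c j := fun j h0 hj => by
    have hp : 0 < c (j - 1) - c j := sub_pos.2 (h.dec _ _ (by omega) hj)
    rw [inv_le_comm₀ (by positivity) hp]
    linarith [h2 j hj]
  refine ⟨(K1 + K2)⁻¹ / 2, by positivity, fun j hj => ?_, fun i j hij hj => ?_⟩
  · rw [mul_div_cancel₀ _ two_ne_zero, inv_le_comm₀ (by positivity) (h.pos j hj)]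
    linarith [h1 j hj]
  · rw [mul_div_cancel₀ _ two_ne_zero]
    refine (adj j (by omega) hj).trans ?_
    rcases (show i ≤ j - 1 by omega).eq_or_lt with e | e
    · rw [e]
    · linarith [h.dec i (j - 1) e (by omega)]

lemma exists_separation (Δ : ℕ → ℝ) {κ : ℝ} (hκ : 0 < κ)
    (hg : ∀ i j, i < j → j < N → 2 * κ ≤ c i - c j) :
    ∃ T1, 0 < T1 ∧ ∀ t, T1 ≤ t → ∀ i j, i < j → j < N → κ * t ≤ ctr c Δ i t - ctr c Δ j t := by
  obtain ⟨D, hD, h1⟩ := exists_forall_lt_le N fun j => |Δ j|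
  refine ⟨2 * D / κ, by positivity, fun t ht i j hij hj => ?_⟩
  have h2 := hg i j hij hj
  have h3 := abs_le.1 (h1 i (by omega))
  have h4 := abs_le.1 (h1 j hj)
  rw [div_le_iff₀ hκ] at ht
  have ht0 : 0 ≤ t := by
    by_contra hneg
    nlinarith
  unfold ctr
  nlinarith

lemma tendsto_ctr_sub (h : Out N c Δ U) {i j : ℕ} (hi : i < N) (hj : j < N) (hij : i ≠ j) :
    Tendsto (fun t => |ctr c Δ i t - ctr c Δ j t|) atTop atTop := by
  obtain ⟨κ, hκ, -, hg⟩ := h.exists_gap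
  obtain ⟨T1, hT1, hs⟩ := exists_separation Δ hκ hg
  refine tendsto_atTop_mono' atTop ?_ (tendsto_id.const_mul_atTop hκ)
  filter_upwards [eventually_ge_atTop T1] with t ht
  rcases lt_or_gt_of_ne hij with hlt | hlt
  · exact (hs t ht i j hlt hj).trans (le_abs_self _)
  · rw [abs_sub_comm]
    exact (hs t ht j i hlt hi).trans (le_abs_self _)

end Out

namespace Out

variable {N : ℕ} {c Δ : ℕ → ℝ} {U : ℕ → ℝ → ℝ → ℝ}

lemma integrable_bump_sq (h : Out N c Δ U) {j : ℕ} (hj : j < N) (t : ℝ) :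
    Integrable fun x => bump c Δ j t x ^ 2 :=
  (integrable_Qc_pow (h.pos j hj) 1).comp_sub_right (ctr c Δ j t)

lemma integrable_bumpd_sq (h : Out N c Δ U) {j : ℕ} (hj : j < N) (t : ℝ) :
    Integrable fun x => bumpd c Δ j t x ^ 2 :=
  (integrable_Qd_sq (h.pos j hj)).comp_sub_right (ctr c Δ j t)

lemma integrable_bumpe (h : Out N c Δ U) {j : ℕ} (hj : j < N) (t : ℝ) :
    Integrable (bumpe c Δ j t) :=
  (h.integrable_bumpd_sq hj t).sub
    (((integrable_Qc_pow (h.pos j hj) 4).comp_sub_right (ctr c Δ j t)).const_mul _)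

lemma integral_bump_sq (c Δ : ℕ → ℝ) (j : ℕ) (t : ℝ) :
    ∫ x, bump c Δ j t x ^ 2 = ∫ x, Qc (c j) x ^ 2 :=
  integral_sub_right_eq_self (fun x => Qc (c j) x ^ 2) (ctr c Δ j t)

lemma integral_bumpe (h : Out N c Δ U) {j : ℕ} (hj : j < N) (t : ℝ) :
    ∫ x, bumpe c Δ j t x = -(1 / 7) * (c j * ∫ x, Qc (c j) x ^ 2) := by
  rw [← integral_energy_Qc (h.pos j hj)]
  exact integral_sub_right_eq_self (fun x => Qd (c j) x ^ 2 - 2 / 5 * Qc (c j) x ^ 5)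
    (ctr c Δ j t)

lemma integrable_sq_sub_sum {g : ℝ → ℝ} {f : ℕ → ℝ → ℝ} (cg : Continuous g)
    (cf : ∀ j, Continuous (f j)) (hg : Integrable fun x => g x ^ 2)
    (hf : ∀ j < N, Integrable fun x => f j x ^ 2) :
    Integrable fun x => (g x - ∑ j ∈ Finset.range N, f j x) ^ 2 := by
  have hi : Integrable fun x => 2 * (g x ^ 2 + N * ∑ j ∈ Finset.range N, f j x ^ 2) :=
    (hg.fun_add ((integrable_finsetSum _ fun j hj => hf j (Finset.mem_range.1 hj)).const_mul
      (N : ℝ))).const_mul 2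
  refine hi.mono' (Continuous.aestronglyMeasurable (by fun_prop)) (ae_of_all _ fun x => ?_)
  rw [Real.norm_eq_abs, abs_sq]
  have := sq_sum_le_card_mul_sum_sq (s := Finset.range N) (f := fun j => f j x)
  rw [Finset.card_range] at this
  nlinarith [sq_nonneg (g x + ∑ j ∈ Finset.range N, f j x)]

lemma integrable_diff_sq (h : Out N c Δ U) (t : ℝ) :
    Integrable fun x => (U 0 t x - bumps c Δ N t x) ^ 2 :=
  integrable_sq_sub_sum (h.sol.cont_slice 0 t) (fun j => continuous_bump c Δ j t) (h.sol.sq 0 t)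
    fun _ hj => h.integrable_bump_sq hj t

lemma integrable_diffd_sq (h : Out N c Δ U) (t : ℝ) :
    Integrable fun x => (U 1 t x - ∑ j ∈ Finset.range N, bumpd c Δ j t x) ^ 2 :=
  integrable_sq_sub_sum (h.sol.cont_slice 1 t) (fun j => continuous_bumpd c Δ j t) (h.sol.sq 1 t)
    fun _ hj => h.integrable_bumpd_sq hj t

lemma lim_diff (h : Out N c Δ U) :
    Tendsto (fun t => ∫ x, (U 0 t x - bumps c Δ N t x) ^ 2) atTop (nhds 0) := by
  refine squeeze_zero (fun t => integral_nonneg fun x => sq_nonneg _) (fun t => ?_) h.lim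
  rw [integral_add (h.integrable_diff_sq t) (h.integrable_diffd_sq t)]
  have : 0 ≤ ∫ x, (U 1 t x - ∑ j ∈ Finset.range N, bumpd c Δ j t x) ^ 2 :=
    integral_nonneg fun x => sq_nonneg _
  linarith

lemma lim_diffd (h : Out N c Δ U) :
    Tendsto (fun t => ∫ x, (U 1 t x - ∑ j ∈ Finset.range N, bumpd c Δ j t x) ^ 2) atTop
      (nhds 0) := by
  refine squeeze_zero (fun t => integral_nonneg fun x => sq_nonneg _) (fun t => ?_) h.lim
  rw [integral_add (h.integrable_diff_sq t) (h.integrable_diffd_sq t)]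
  have : 0 ≤ ∫ x, (U 0 t x - bumps c Δ N t x) ^ 2 := integral_nonneg fun x => sq_nonneg _
  linarith

lemma exists_sup_bound (h : Out N c Δ U) {δ : ℝ} (hδ : 0 < δ) :
    ∃ T0, ∀ t, T0 ≤ t → ∀ x, |U 0 t x - bumps c Δ N t x| ≤ δ := by
  have := (h.lim.eventually_le_const (by positivity : (0:ℝ) < δ ^ 2))
  obtain ⟨T0, hT⟩ := eventually_atTop.1 this
  refine ⟨T0, fun t ht x => abs_le_of_sq_le_sq ?_ hδ.le⟩
  refine le_trans ?_ (hT t ht)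
  rw [integral_add (h.integrable_diff_sq t) (h.integrable_diffd_sq t)]
  refine sq_le_H1 (f := fun x => U 0 t x - bumps c Δ N t x) (fun x => ?_) ?_
    (h.integrable_diff_sq t) (h.integrable_diffd_sq t) x
  · exact (h.sol.dx 0 t x).fun_sub (HasDerivAt.fun_sum fun j _ => hasDerivAt_bump c Δ j t x)
  · exact (h.sol.cont_slice 1 t).sub (continuous_finsetSum _ fun j _ => continuous_bumpd c Δ j t)

lemma lim_mass (h : Out N c Δ U) : Tendsto
    (fun t => ∫ x, |U 0 t x ^ 2 - ∑ j ∈ Finset.range N, bump c Δ j t x ^ 2|) atTop (nhds 0) := by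
  obtain ⟨L, K, hL, hK, hb⟩ := h.exists_profile_bound
  exact tendsto_sq_of_bumps hL (continuous_bump c Δ) (p := ctr c Δ) (K := K)
    (fun j hj t x => by
      rw [abs_of_pos (hb L le_rfl j hj t x).1]; exact (hb L le_rfl j hj t x).2.1)
    (fun i hi j hj hij => h.tendsto_ctr_sub hi hj hij) (h.sol.cont_slice 0) (h.sol.sq 0) h.lim_diff

lemma lim_deriv (h : Out N c Δ U) : Tendsto
    (fun t => ∫ x, |U 1 t x ^ 2 - ∑ j ∈ Finset.range N, bumpd c Δ j t x ^ 2|) atTop (nhds 0) := by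
  obtain ⟨L, K, hL, hK, hb⟩ := h.exists_profile_bound
  exact tendsto_sq_of_bumps hL (continuous_bumpd c Δ) (p := ctr c Δ) (K := K)
    (fun j hj t x => (hb L le_rfl j hj t x).2.2.1)
    (fun i hi j hj hij => h.tendsto_ctr_sub hi hj hij) (h.sol.cont_slice 1) (h.sol.sq 1) h.lim_diffd

lemma integrable_bumps_sq (h : Out N c Δ U) (t : ℝ) :
    Integrable fun x => bumps c Δ N t x ^ 2 := by
  have := integrable_sq_sub_sum (N := N) (g := fun _ => 0) continuous_const
    (fun j => continuous_bump c Δ j t) (by simp) fun _ hj => h.integrable_bump_sq hj t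
  simpa [bumps] using this

lemma lim_overlap (h : Out N c Δ U) : Tendsto
    (fun t => ∫ x, |bumps c Δ N t x ^ 2 - ∑ j ∈ Finset.range N, bump c Δ j t x ^ 2|) atTop
      (nhds 0) := by
  obtain ⟨L, K, hL, hK, hb⟩ := h.exists_profile_bound
  exact tendsto_sq_of_bumps hL (continuous_bump c Δ) (p := ctr c Δ) (K := K)
    (fun j hj t x => by
      rw [abs_of_pos (hb L le_rfl j hj t x).1]; exact (hb L le_rfl j hj t x).2.1)
    (fun i hi j hj hij => h.tendsto_ctr_sub hi hj hij) (continuous_bumps c Δ N)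
    h.integrable_bumps_sq (by simp [bumps])

/-- Decoupling of fifth powers. -/
lemma abs_five_sub_le {N : ℕ} {r : ℕ → ℝ} {u B : ℝ} (hr : ∀ j < N, 0 ≤ r j)
    (hR : ∑ j ∈ Finset.range N, r j ≤ B) (hu : |u| ≤ B) :
    |u ^ 5 - ∑ j ∈ Finset.range N, r j ^ 5|
      ≤ 5 * B ^ 2 * (|u - ∑ j ∈ Finset.range N, r j| * (u ^ 2 + (∑ j ∈ Finset.range N, r j) ^ 2))
        + 4 * B ^ 3 * |(∑ j ∈ Finset.range N, r j) ^ 2 - ∑ j ∈ Finset.range N, r j ^ 2| := by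
  set R := ∑ j ∈ Finset.range N, r j with hRdef
  have hR0 : 0 ≤ R := Finset.sum_nonneg fun j hj => hr j (Finset.mem_range.1 hj)
  have hB : 0 ≤ B := hR0.trans hR
  have h1 : |u ^ 5 - R ^ 5| ≤ 5 * B ^ 2 * (|u - R| * (u ^ 2 + R ^ 2)) := by
    have e : u ^ 5 - R ^ 5 = (u - R) * (u ^ 4 + u ^ 3 * R + u ^ 2 * R ^ 2 + u * R ^ 3 + R ^ 4) := by
      ring
    rw [e, abs_mul, mul_left_comm]
    refine mul_le_mul_of_nonneg_left ?_ (abs_nonneg _)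
    have hu2 : u ^ 2 ≤ B ^ 2 := sq_le_sq' (abs_le.1 hu).1 (abs_le.1 hu).2
    have hR2 : R ^ 2 ≤ B ^ 2 := by gcongr
    have huR : |u * R| ≤ (u ^ 2 + R ^ 2) / 2 := abs_le.2
      ⟨by nlinarith [sq_nonneg (u + R)], by nlinarith [sq_nonneg (u - R)]⟩
    obtain ⟨g1, g2⟩ := abs_le.1 huR
    rw [abs_le]
    have a1 : u ^ 4 ≤ B ^ 2 * u ^ 2 := by nlinarith [sq_nonneg u]
    have a2 : R ^ 4 ≤ B ^ 2 * R ^ 2 := by nlinarith [sq_nonneg R]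
    have a3 : u ^ 2 * R ^ 2 ≤ B ^ 2 * R ^ 2 := by nlinarith [sq_nonneg R]
    have p := sq_nonneg u
    have q := sq_nonneg R
    have b2 := sq_nonneg B
    have a4 : u ^ 3 * R ≤ B ^ 2 * (u ^ 2 + R ^ 2) := by
      nlinarith [mul_nonneg p (sub_nonneg.2 g2), mul_nonneg (sub_nonneg.2 hu2) (add_nonneg p q)]
    have a4' : -(B ^ 2 * (u ^ 2 + R ^ 2)) ≤ u ^ 3 * R := by
      nlinarith [mul_nonneg p (sub_nonneg.2 g1), mul_nonneg (sub_nonneg.2 hu2) (add_nonneg p q)]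
    have a5 : u * R ^ 3 ≤ B ^ 2 * (u ^ 2 + R ^ 2) := by
      nlinarith [mul_nonneg q (sub_nonneg.2 g2), mul_nonneg (sub_nonneg.2 hR2) (add_nonneg p q)]
    have a5' : -(B ^ 2 * (u ^ 2 + R ^ 2)) ≤ u * R ^ 3 := by
      nlinarith [mul_nonneg q (sub_nonneg.2 g1), mul_nonneg (sub_nonneg.2 hR2) (add_nonneg p q)]
    have b3 : 0 ≤ B ^ 2 * u ^ 2 := by positivity
    have b4 : 0 ≤ B ^ 2 * R ^ 2 := by positivity
    have b5 : 0 ≤ u ^ 4 := by positivity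
    have b6 : 0 ≤ R ^ 4 := by positivity
    have b7 : 0 ≤ u ^ 2 * R ^ 2 := by positivity
    constructor <;> nlinarith
  have hle : ∀ j ∈ Finset.range N, r j ≤ R := fun j hj =>
    Finset.single_le_sum (f := r) (fun i hi => hr i (Finset.mem_range.1 hi)) hj
  have e5 : R ^ 5 - ∑ j ∈ Finset.range N, r j ^ 5 = ∑ j ∈ Finset.range N, r j * (R ^ 4 - r j ^ 4) := by
    simp_rw [mul_sub]
    rw [Finset.sum_sub_distrib, ← Finset.sum_mul, ← hRdef]
    congr 1
    · ring
    · exact Finset.sum_congr rfl fun j _ => by ring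
  have e2 : R ^ 2 - ∑ j ∈ Finset.range N, r j ^ 2 = ∑ j ∈ Finset.range N, r j * (R - r j) := by
    simp_rw [mul_sub]
    rw [Finset.sum_sub_distrib, ← Finset.sum_mul, ← hRdef]
    congr 1
    · ring
    · exact Finset.sum_congr rfl fun j _ => by ring
  have n2 : 0 ≤ R ^ 2 - ∑ j ∈ Finset.range N, r j ^ 2 := by
    rw [e2]
    exact Finset.sum_nonneg fun j hj => mul_nonneg (hr j (Finset.mem_range.1 hj))
      (sub_nonneg.2 (hle j hj))
  have n5 : 0 ≤ R ^ 5 - ∑ j ∈ Finset.range N, r j ^ 5 := by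
    rw [e5]
    refine Finset.sum_nonneg fun j hj => mul_nonneg (hr j (Finset.mem_range.1 hj)) (sub_nonneg.2 ?_)
    have := hr j (Finset.mem_range.1 hj)
    have := hle j hj
    gcongr
  have h2 : R ^ 5 - ∑ j ∈ Finset.range N, r j ^ 5
      ≤ 4 * B ^ 3 * (R ^ 2 - ∑ j ∈ Finset.range N, r j ^ 2) := by
    rw [e5, e2, Finset.mul_sum]
    refine Finset.sum_le_sum fun j hj => ?_
    have a := hr j (Finset.mem_range.1 hj)
    have b := hle j hj
    rw [mul_left_comm]
    refine mul_le_mul_of_nonneg_left ?_ a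
    have e : R ^ 4 - r j ^ 4 = (R ^ 3 + R ^ 2 * r j + R * r j ^ 2 + r j ^ 3) * (R - r j) := by ring
    rw [e]
    refine mul_le_mul_of_nonneg_right ?_ (sub_nonneg.2 b)
    have hjB := b.trans hR
    have t1 : R ^ 3 ≤ B ^ 3 := by gcongr
    have t2 : R ^ 2 * r j ≤ B ^ 2 * B := by gcongr
    have t3 : R * r j ^ 2 ≤ B * B ^ 2 := by gcongr
    have t4 : r j ^ 3 ≤ B ^ 3 := by gcongr
    nlinarith
  have e : u ^ 5 - ∑ j ∈ Finset.range N, r j ^ 5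
      = (u ^ 5 - R ^ 5) + (R ^ 5 - ∑ j ∈ Finset.range N, r j ^ 5) := by ring
  rw [e, abs_of_nonneg n2]
  refine (abs_add_le _ _).trans (add_le_add h1 ?_)
  rw [abs_of_nonneg n5]; exact h2

end Out

namespace Out

variable {N : ℕ} {c Δ : ℕ → ℝ} {U : ℕ → ℝ → ℝ → ℝ}

lemma bump_pos (h : Out N c Δ U) {j : ℕ} (hj : j < N) (t x : ℝ) : 0 < bump c Δ j t x :=
  Qc_pos (h.pos j hj) _

lemma bumps_nonneg (h : Out N c Δ U) (t x : ℝ) : 0 ≤ bumps c Δ N t x :=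
  Finset.sum_nonneg fun _ hj => (h.bump_pos (Finset.mem_range.1 hj) t x).le

lemma exists_bumps_le (h : Out N c Δ U) : ∃ B, 0 < B ∧ ∀ t x, bumps c Δ N t x ≤ B := by
  refine ⟨1 + ∑ j ∈ Finset.range N, Qc (c j) 0, ?_, fun t x => ?_⟩
  · have : 0 ≤ ∑ j ∈ Finset.range N, Qc (c j) 0 :=
      Finset.sum_nonneg fun j hj => (Qc_pos (h.pos j (Finset.mem_range.1 hj)) 0).le
    linarith
  · have : bumps c Δ N t x ≤ ∑ j ∈ Finset.range N, Qc (c j) 0 :=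
      Finset.sum_le_sum fun j hj => Qc_le_zero (h.pos j (Finset.mem_range.1 hj)) _
    linarith

lemma integrable_eden (hU : Sol U) (t : ℝ) : Integrable (Sol.eden U t) :=
  (hU.sq 1 t).sub ((hU.integrable_pow 3 t).const_mul _)

lemma abs_diff_le (h : Out N c Δ U) (t x : ℝ) : |U 0 t x - bumps c Δ N t x| ≤
    √(∫ x, ((U 0 t x - bumps c Δ N t x) ^ 2
      + (U 1 t x - ∑ j ∈ Finset.range N, bumpd c Δ j t x) ^ 2)) := by
  refine Real.abs_le_sqrt ?_
  rw [integral_add (h.integrable_diff_sq t) (h.integrable_diffd_sq t)]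
  refine sq_le_H1 (f := fun x => U 0 t x - bumps c Δ N t x) (fun x => ?_) ?_
    (h.integrable_diff_sq t) (h.integrable_diffd_sq t) x
  · exact (h.sol.dx 0 t x).fun_sub (HasDerivAt.fun_sum fun j _ => hasDerivAt_bump c Δ j t x)
  · exact (h.sol.cont_slice 1 t).sub (continuous_finsetSum _ fun j _ => continuous_bumpd c Δ j t)

lemma lim_energy (h : Out N c Δ U) : Tendsto
    (fun t => ∫ x, |Sol.eden U t x - ∑ j ∈ Finset.range N, bumpe c Δ j t x|) atTop (nhds 0) := by
  obtain ⟨B0, hB0, hB⟩ := h.exists_bumps_le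
  obtain ⟨T0, hT0⟩ := h.exists_sup_bound one_pos
  set B := B0 + 1
  set s : ℝ → ℝ := fun t => √(∫ x, ((U 0 t x - bumps c Δ N t x) ^ 2
      + (U 1 t x - ∑ j ∈ Finset.range N, bumpd c Δ j t x) ^ 2)) with hs
  set D : ℝ → ℝ := fun t => ∫ x, |U 1 t x ^ 2 - ∑ j ∈ Finset.range N, bumpd c Δ j t x ^ 2| with hD
  set O : ℝ → ℝ := fun t => ∫ x, |bumps c Δ N t x ^ 2 - ∑ j ∈ Finset.range N, bump c Δ j t x ^ 2|
    with hO
  set n : ℝ → ℝ := fun t => ∫ x, (U 0 t x - bumps c Δ N t x) ^ 2 with hn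
  have hs0 : Tendsto s atTop (nhds 0) := by simpa using h.lim.sqrt
  set M := Sol.en U 0 0
  have hlim : Tendsto (fun t => D t + 2 / 5 * (5 * B ^ 2 * (s t * (3 * M + 2 * n t))
      + 4 * B ^ 3 * O t)) atTop (nhds 0) := by
    have h1 : Tendsto (fun t => s t * (3 * M + 2 * n t)) atTop (nhds 0) := by
      simpa using hs0.mul ((h.lim_diff.const_mul 2).const_add (3 * M))
    simpa using h.lim_deriv.add
      (((h1.const_mul (5 * B ^ 2)).add (h.lim_overlap.const_mul (4 * B ^ 3))).const_mul (2 / 5))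
  refine squeeze_zero' (Eventually.of_forall fun t => integral_nonneg fun x => abs_nonneg _) ?_ hlim
  filter_upwards [eventually_ge_atTop T0] with t ht
  have i1 : Integrable fun x => |U 1 t x ^ 2 - ∑ j ∈ Finset.range N, bumpd c Δ j t x ^ 2| :=
    ((h.sol.sq 1 t).sub (integrable_finsetSum _ fun j hj =>
      h.integrable_bumpd_sq (Finset.mem_range.1 hj) t)).abs
  have i2 : Integrable fun x => U 0 t x ^ 2 + bumps c Δ N t x ^ 2 :=
    (h.sol.sq 0 t).fun_add (h.integrable_bumps_sq t)
  have i3 : Integrable fun x =>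
      |bumps c Δ N t x ^ 2 - ∑ j ∈ Finset.range N, bump c Δ j t x ^ 2| :=
    ((h.integrable_bumps_sq t).sub (integrable_finsetSum _ fun j hj =>
      h.integrable_bump_sq (Finset.mem_range.1 hj) t)).abs
  have i4 : Integrable fun x => 5 * B ^ 2 * (s t * (U 0 t x ^ 2 + bumps c Δ N t x ^ 2)) :=
    (i2.const_mul _).const_mul _
  have i5 : Integrable fun x => 2 / 5 * (5 * B ^ 2 * (s t * (U 0 t x ^ 2 + bumps c Δ N t x ^ 2))
      + 4 * B ^ 3 * |bumps c Δ N t x ^ 2 - ∑ j ∈ Finset.range N, bump c Δ j t x ^ 2|) :=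
    (i4.fun_add (i3.const_mul _)).const_mul _
  have hle : ∀ x, |Sol.eden U t x - ∑ j ∈ Finset.range N, bumpe c Δ j t x|
      ≤ |U 1 t x ^ 2 - ∑ j ∈ Finset.range N, bumpd c Δ j t x ^ 2|
        + 2 / 5 * (5 * B ^ 2 * (s t * (U 0 t x ^ 2 + bumps c Δ N t x ^ 2))
          + 4 * B ^ 3 * |bumps c Δ N t x ^ 2 - ∑ j ∈ Finset.range N, bump c Δ j t x ^ 2|) := by
    intro x
    have hu : |U 0 t x| ≤ B := by
      have h1 := abs_le.1 (hT0 t ht x)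
      have h2 := h.bumps_nonneg t x
      have h3 := hB t x
      exact abs_le.2 ⟨by linarith, by linarith⟩
    have h5 := abs_five_sub_le (N := N) (r := fun j => bump c Δ j t x) (u := U 0 t x) (B := B)
      (fun j hj => (h.bump_pos hj t x).le) ((hB t x).trans (by linarith)) hu
    have e : Sol.eden U t x - ∑ j ∈ Finset.range N, bumpe c Δ j t x
        = (U 1 t x ^ 2 - ∑ j ∈ Finset.range N, bumpd c Δ j t x ^ 2)
          - 2 / 5 * (U 0 t x ^ 5 - ∑ j ∈ Finset.range N, bump c Δ j t x ^ 5) := by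
      simp only [Sol.eden, bumpe]
      rw [Finset.sum_sub_distrib, ← Finset.mul_sum]
      ring
    rw [e]
    refine (abs_sub _ _).trans (add_le_add le_rfl ?_)
    rw [abs_mul, abs_of_pos (by norm_num : (0:ℝ) < 2 / 5)]
    refine mul_le_mul_of_nonneg_left (h5.trans ?_) (by norm_num)
    refine add_le_add ?_ le_rfl
    refine mul_le_mul_of_nonneg_left ?_ (by positivity)
    exact mul_le_mul_of_nonneg_right (h.abs_diff_le t x) (by positivity)
  refine (integral_mono_of_nonneg (ae_of_all _ fun x => abs_nonneg _) (i1.fun_add i5)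
    (ae_of_all _ hle)).trans ?_
  rw [integral_add i1 i5, integral_const_mul, integral_add i4 (i3.const_mul _), integral_const_mul,
    integral_const_mul, integral_const_mul, integral_add (h.sol.sq 0 t) (h.integrable_bumps_sq t)]
  have hM : ∫ x, U 0 t x ^ 2 = M := h.sol.mass_conserved 0 t
  have hR : ∫ x, bumps c Δ N t x ^ 2 ≤ 2 * M + 2 * n t := by
    rw [← hM, ← integral_const_mul, hn, ← integral_const_mul,
      ← integral_add ((h.sol.sq 0 t).const_mul 2) ((h.integrable_diff_sq t).const_mul 2)]
    refine integral_mono (h.integrable_bumps_sq t)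
      (((h.sol.sq 0 t).const_mul 2).add ((h.integrable_diff_sq t).const_mul 2)) fun x => ?_
    simp only
    nlinarith [sq_nonneg (2 * U 0 t x - bumps c Δ N t x)]
  have hs' : 0 ≤ s t := sqrt_nonneg _
  have hB' : 0 ≤ B := by positivity
  have hsum : (∫ x, U 0 t x ^ 2) + ∫ x, bumps c Δ N t x ^ 2 ≤ 3 * M + 2 * n t := by linarith
  exact add_le_add le_rfl (mul_le_mul_of_nonneg_left (add_le_add (mul_le_mul_of_nonneg_left
    (mul_le_mul_of_nonneg_left hsum hs') (by positivity)) le_rfl) (by norm_num))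

lemma mass_eq (h : Out N c Δ U) (t : ℝ) :
    ∫ x, U 0 t x ^ 2 = ∑ j ∈ Finset.range N, ∫ x, Qc (c j) x ^ 2 := by
  refine tendsto_nhds_unique (f := fun s => ∫ x, U 0 s x ^ 2) (l := atTop) ?_ ?_
  · have : (fun s => ∫ x, U 0 s x ^ 2) = fun _ => ∫ x, U 0 t x ^ 2 := by
      ext s; exact h.sol.mass_conserved t s
    rw [this]; exact tendsto_const_nhds
  · rw [tendsto_iff_norm_sub_tendsto_zero]
    refine squeeze_zero (fun s => norm_nonneg _) (fun s => ?_) h.lim_mass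
    have e : ∑ j ∈ Finset.range N, ∫ x, Qc (c j) x ^ 2
        = ∫ x, ∑ j ∈ Finset.range N, bump c Δ j s x ^ 2 := by
      rw [integral_finsetSum _ fun j hj => h.integrable_bump_sq (Finset.mem_range.1 hj) s]
      exact Finset.sum_congr rfl fun j _ => (integral_bump_sq c Δ j s).symm
    rw [e, ← integral_sub (h.sol.sq 0 s) (integrable_finsetSum _ fun j hj =>
      h.integrable_bump_sq (Finset.mem_range.1 hj) s)]
    exact norm_integral_le_integral_norm _

lemma energy_eq (h : Out N c Δ U) (t : ℝ) :
    ∫ x, Sol.eden U t x = ∑ j ∈ Finset.range N, -(1 / 7) * (c j * ∫ x, Qc (c j) x ^ 2) := by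
  refine tendsto_nhds_unique (f := fun s => ∫ x, Sol.eden U s x) (l := atTop) ?_ ?_
  · have : (fun s => ∫ x, Sol.eden U s x) = fun _ => ∫ x, Sol.eden U t x := by
      ext s; exact h.sol.energy_conserved t s
    rw [this]; exact tendsto_const_nhds
  · rw [tendsto_iff_norm_sub_tendsto_zero]
    refine squeeze_zero (fun s => norm_nonneg _) (fun s => ?_) h.lim_energy
    have e : ∑ j ∈ Finset.range N, -(1 / 7) * (c j * ∫ x, Qc (c j) x ^ 2)
        = ∫ x, ∑ j ∈ Finset.range N, bumpe c Δ j s x := by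
      rw [integral_finsetSum _ fun j hj => h.integrable_bumpe (Finset.mem_range.1 hj) s]
      exact Finset.sum_congr rfl fun j hj => (h.integral_bumpe (Finset.mem_range.1 hj) s).symm
    rw [e, ← integral_sub (integrable_eden h.sol s) (integrable_finsetSum _ fun j hj =>
      h.integrable_bumpe (Finset.mem_range.1 hj) s)]
    exact norm_integral_le_integral_norm _

end Out

/-! ### Almost monotonicity of localized densities along moving lines -/

lemma Balance.lin {ρ S j k k1 m m1 m2 F ρ' S' j' k' k1' m' m1' m2' F' : ℝ → ℝ → ℝ}
    (h : Balance ρ S j k k1 m m1 m2 F) (h' : Balance ρ' S' j' k' k1' m' m1' m2' F') (μ ν : ℝ) :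
    Balance (fun t x => μ * ρ t x + ν * ρ' t x) (fun t x => μ * S t x + ν * S' t x)
      (fun t x => μ * j t x + ν * j' t x) (fun t x => μ * k t x + ν * k' t x)
      (fun t x => μ * k1 t x + ν * k1' t x) (fun t x => μ * m t x + ν * m' t x)
      (fun t x => μ * m1 t x + ν * m1' t x) (fun t x => μ * m2 t x + ν * m2' t x)
      (fun t x => μ * F t x + ν * F' t x) := by
  have c1 := h.cF; have c2 := h.ck1; have c3 := h.cm1; have c4 := h.cm2
  have d1 := h'.cF; have d2 := h'.ck1; have d3 := h'.cm1; have d4 := h'.cm2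
  refine ⟨fun t x => ?_, fun t x => ?_, fun t x => ?_, fun t x => ?_, fun t x => ?_,
    by fun_prop, by fun_prop, by fun_prop, by fun_prop⟩
  · exact (((h.dt t x).const_mul μ).fun_add ((h'.dt t x).const_mul ν)).congr_deriv (by ring)
  · have := ((h.dF t x).const_mul μ).fun_add ((h'.dF t x).const_mul ν)
    have e : (fun y => μ * j t y + ν * j' t y + (μ * k1 t y + ν * k1' t y)
        + (μ * m2 t y + ν * m2' t y))
        = fun y => μ * (j t y + k1 t y + m2 t y) + ν * (j' t y + k1' t y + m2' t y) := by
      ext y; ring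
    rwa [e]
  · exact ((h.dk t x).const_mul μ).fun_add ((h'.dk t x).const_mul ν)
  · exact ((h.dm t x).const_mul μ).fun_add ((h'.dm t x).const_mul ν)
  · exact ((h.dm1 t x).const_mul μ).fun_add ((h'.dm1 t x).const_mul ν)

section Small

variable {L a p d : ℝ}

lemma lg_small (hL : 0 < L) (h : p + d ≤ a) (x : ℝ) :
    lg L (x - a) ≤ exp (-((d - |x - p|) / L)) := by
  refine (lg_le_exp L _).trans (exp_le_exp.2 ?_)
  rw [← neg_div]
  gcongr
  linarith [le_abs_self (x - p)]

lemma one_sub_lg_small (hL : 0 < L) (h : a + d ≤ p) (x : ℝ) :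
    1 - lg L (x - a) ≤ exp (-((d - |x - p|) / L)) := by
  refine (one_sub_lg_le L _).trans (exp_le_exp.2 (neg_le_neg ?_))
  exact div_le_div_of_nonneg_right (by linarith [neg_abs_le (x - p)]) hL.le

lemma lgd_small (hL : 0 < L) (h : d ≤ |p - a|) (x : ℝ) :
    L * lgd L (x - a) ≤ exp (-((d - |x - p|) / L)) := by
  have h1 := lgd_le hL (x - a)
  rw [le_div_iff₀ hL, le_div_iff₀ hL] at h1
  rcases le_abs.1 h with h' | h'
  · linarith [one_sub_lg_small hL (by linarith : a + d ≤ p) x]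
  · linarith [lg_small hL (by linarith : p + d ≤ a) x]

end Small

lemma integral_le_of_le_nonneg {f g : ℝ → ℝ} (hg : Integrable g) (h0 : ∀ x, 0 ≤ g x)
    (hfg : ∀ x, f x ≤ g x) : ∫ x, f x ≤ ∫ x, g x := by
  by_cases hf : Integrable f
  · exact integral_mono hf hg hfg
  · rw [integral_undef hf]
    exact integral_nonneg h0

lemma intervalIntegral_le_of_exp {g : ℝ → ℝ} {A γ s t : ℝ} (hγ : 0 < γ) (hA : 0 ≤ A) (hst : s ≤ t)
    (hg : ∀ τ, s ≤ τ → τ ≤ t → g τ ≤ A * exp (-(γ * (τ - s)))) : ∫ τ in s..t, g τ ≤ A / γ := by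
  by_cases hi : IntervalIntegrable g volume s t
  · have hc : Continuous fun τ => A * exp (-(γ * (τ - s))) := by fun_prop
    refine (intervalIntegral.integral_mono_on hst hi (hc.intervalIntegrable _ _)
      fun τ hτ => hg τ hτ.1 hτ.2).trans ?_
    have hd : ∀ τ, HasDerivAt (fun τ => -(A / γ) * exp (-(γ * (τ - s))))
        (A * exp (-(γ * (τ - s)))) τ := fun τ => by
      refine ((((((hasDerivAt_id τ).sub_const s).const_mul γ).fun_neg).exp).const_mul
        (-(A / γ))).congr_deriv ?_
      simp only [id]
      field_simp
    rw [intervalIntegral.integral_eq_sub_of_hasDerivAt (fun τ _ => hd τ)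
      (hc.intervalIntegrable _ _)]
    have : 0 ≤ A / γ * exp (-(γ * (t - s))) := by positivity
    simp
    linarith
  · rw [intervalIntegral.integral_undef hi]
    positivity

/-- The flux through a logistic weight is controlled by the profile. -/
lemma flux_le {a b w f1 f2 f3 L σ κ σ' μ ν ε C r : ℝ} (hf : 0 ≤ f1)
    (h2 : |f2| ≤ f1 / L) (h3 : |f3| ≤ f1 / L ^ 2) (hLκ : 1 / L ^ 2 ≤ κ / 4) (hσ : κ ≤ σ)
    (hσ' : σ ≤ σ') (hκ : 0 < κ) (hμ : 0 ≤ μ) (hμ1 : μ ≤ 1) (hν : 0 ≤ ν)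
    (hε : ε * (1 + σ' + 2 * ν) ≤ ν * κ / 2) (h5 : |a| ^ 5 ≤ ε * a ^ 2 + C * r)
    (h8 : a ^ 8 ≤ ε * a ^ 2 + C * r) :
    -(μ * (3 * w ^ 2 - 2 * (a ^ 4 * w)) + ν * (3 * b ^ 2 - 8 / 5 * a ^ 5)) * f1
      + μ * (-2 * (b * w)) * f2 + ν * a ^ 2 * f3 - σ * (μ * (b ^ 2 - 2 / 5 * a ^ 5) + ν * a ^ 2) * f1
      ≤ C * (1 + σ' + 2 * ν) * r * f1 := by
  have e1 : μ * (-2 * (b * w)) * f2 ≤ μ * (w ^ 2 + b ^ 2 * (1 / L ^ 2)) * f1 := by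
    have : -2 * (b * w) * f2 ≤ (w ^ 2 + b ^ 2 * (1 / L ^ 2)) * f1 := by
      have hq : |2 * (b * w)| * |f2| ≤ |2 * (b * w)| * (f1 / L) := by gcongr
      have hx : -2 * (b * w) * f2 ≤ |2 * (b * w)| * |f2| := by
        rw [← abs_mul]; refine le_trans (le_of_eq ?_) (neg_le_abs _); ring
      have hy : |2 * (b * w)| * (1 / L) ≤ w ^ 2 + b ^ 2 * (1 / L ^ 2) := by
        have hs := sq_nonneg (|w| - |b| * (1 / L))
        rw [abs_mul, abs_mul, abs_two]
        have : (|w| - |b| * (1 / L)) ^ 2 = w ^ 2 + b ^ 2 * (1 / L ^ 2) - 2 * (|b| * |w|) * (1 / L) := by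
          rw [← sq_abs w, ← sq_abs b]; ring
        linarith
      calc _ ≤ |2 * (b * w)| * (f1 / L) := hx.trans hq
        _ = |2 * (b * w)| * (1 / L) * f1 := by ring
        _ ≤ _ := by gcongr
    calc _ = μ * (-2 * (b * w) * f2) := by ring
      _ ≤ μ * ((w ^ 2 + b ^ 2 * (1 / L ^ 2)) * f1) := by gcongr
      _ = _ := by ring
  have e2 : ν * a ^ 2 * f3 ≤ ν * a ^ 2 * (1 / L ^ 2) * f1 := by
    calc ν * a ^ 2 * f3 ≤ ν * a ^ 2 * (f1 / L ^ 2) := by gcongr; exact (le_abs_self _).trans h3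
      _ = _ := by ring
  have a5 : |a ^ 5| = |a| ^ 5 := abs_pow a 5
  have e5 : a ^ 5 ≤ |a| ^ 5 := a5 ▸ le_abs_self _
  have p5 : 0 ≤ |a| ^ 5 := by positivity
  have key : -(μ * (3 * w ^ 2 - 2 * (a ^ 4 * w)) + ν * (3 * b ^ 2 - 8 / 5 * a ^ 5))
      + μ * (w ^ 2 + b ^ 2 * (1 / L ^ 2)) + ν * a ^ 2 * (1 / L ^ 2)
      - σ * (μ * (b ^ 2 - 2 / 5 * a ^ 5) + ν * a ^ 2) ≤ C * (1 + σ' + 2 * ν) * r := by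
    have k1 : μ * (2 * (a ^ 4 * w)) ≤ μ * (w ^ 2 + a ^ 8) := by
      gcongr; nlinarith [sq_nonneg (a ^ 4 - w)]
    have k2 : μ * a ^ 8 ≤ ε * a ^ 2 + C * r :=
      (mul_le_of_le_one_left (by positivity) hμ1).trans h8
    have k3 : μ * (b ^ 2 * (1 / L ^ 2)) ≤ μ * (b ^ 2 * σ) := by gcongr; linarith
    have k4 : ν * a ^ 2 * (1 / L ^ 2) ≤ ν * a ^ 2 * (κ / 4) := by gcongr
    have k5 : ν * a ^ 2 * κ ≤ ν * a ^ 2 * σ := by gcongr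
    have k6 : ν * (8 / 5 * a ^ 5) ≤ 2 * ν * (ε * a ^ 2 + C * r) := by
      have : ν * (8 / 5 * a ^ 5) ≤ ν * (2 * |a| ^ 5) :=
        mul_le_mul_of_nonneg_left (by linarith) hν
      have : ν * |a| ^ 5 ≤ ν * (ε * a ^ 2 + C * r) := by gcongr
      linarith
    have k7 : σ * (μ * (2 / 5 * a ^ 5)) ≤ σ' * (ε * a ^ 2 + C * r) := by
      have hσp : 0 ≤ σ := by linarith
      have hσp' : 0 ≤ σ' := by linarith
      have : σ * (μ * (2 / 5 * a ^ 5)) ≤ σ * (1 * |a| ^ 5) := by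
        gcongr σ * ?_
        calc μ * (2 / 5 * a ^ 5) ≤ μ * |a| ^ 5 := mul_le_mul_of_nonneg_left (by linarith) hμ
          _ ≤ _ := by gcongr
      have : σ * |a| ^ 5 ≤ σ' * (ε * a ^ 2 + C * r) := by gcongr
      linarith
    have k8 : ε * (1 + σ' + 2 * ν) * a ^ 2 ≤ ν * κ / 2 * a ^ 2 := by gcongr
    have k9 : 0 ≤ μ * w ^ 2 := by positivity
    have k10 : 0 ≤ ν * b ^ 2 := by positivity
    have k11 : 0 ≤ ν * a ^ 2 * κ := by positivity
    nlinarith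
  calc _ ≤ (-(μ * (3 * w ^ 2 - 2 * (a ^ 4 * w)) + ν * (3 * b ^ 2 - 8 / 5 * a ^ 5))
      + μ * (w ^ 2 + b ^ 2 * (1 / L ^ 2)) + ν * a ^ 2 * (1 / L ^ 2)
      - σ * (μ * (b ^ 2 - 2 / 5 * a ^ 5) + ν * a ^ 2)) * f1 := by linarith
    _ ≤ _ := by gcongr

/-- A combination of energy and mass densities. -/
noncomputable def dens (μ ν : ℝ) (U : ℕ → ℝ → ℝ → ℝ) (t x : ℝ) : ℝ :=
  μ * (U 1 t x ^ 2 - 2 / 5 * U 0 t x ^ 5) + ν * U 0 t x ^ 2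

/-- The same combination for a single soliton. -/
noncomputable def bdens (μ ν : ℝ) (c Δ : ℕ → ℝ) (j : ℕ) (t x : ℝ) : ℝ :=
  μ * bumpe c Δ j t x + ν * bump c Δ j t x ^ 2

/-- Solitons `i < g` run away to the right of the line `x = σ τ + a`, the others to its left. -/
structure IsLine (N : ℕ) (c Δ : ℕ → ℝ) (κ σ' : ℝ) (g : ℕ) (σ a ℓ T : ℝ) : Prop where
  le : g ≤ N
  low : κ ≤ σ
  up : σ ≤ σ'
  right : ∀ τ, T ≤ τ → ∀ i < g, σ * τ + a + (ℓ + κ * (τ - T)) ≤ ctr c Δ i τ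
  left : ∀ τ, T ≤ τ → ∀ i, g ≤ i → i < N → ctr c Δ i τ + (ℓ + κ * (τ - T)) ≤ σ * τ + a

lemma IsLine.le_abs {N : ℕ} {c Δ : ℕ → ℝ} {κ σ' : ℝ} {g : ℕ} {σ a ℓ T : ℝ}
    (h : IsLine N c Δ κ σ' g σ a ℓ T) {τ : ℝ} (hτ : T ≤ τ) {i : ℕ} (hi : i < N) :
    ℓ + κ * (τ - T) ≤ |ctr c Δ i τ - (σ * τ + a)| := by
  rcases lt_or_ge i g with hg | hg
  · exact (by linarith [h.right τ hτ i hg] : _ ≤ ctr c Δ i τ - (σ * τ + a)).trans (le_abs_self _)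
  · exact (by linarith [h.left τ hτ i hg hi] : _ ≤ -(ctr c Δ i τ - (σ * τ + a))).trans
      (neg_le_abs _)

namespace Out

variable {N : ℕ} {c Δ : ℕ → ℝ} {U : ℕ → ℝ → ℝ → ℝ}

lemma integrable_dens (h : Out N c Δ U) (μ ν t : ℝ) : Integrable (dens μ ν U t) :=
  ((integrable_eden h.sol t).const_mul μ).add ((h.sol.sq 0 t).const_mul ν)

lemma integrable_bdens (h : Out N c Δ U) (μ ν : ℝ) {j : ℕ} (hj : j < N) (t : ℝ) :
    Integrable (bdens μ ν c Δ j t) :=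
  ((h.integrable_bumpe hj t).const_mul μ).add ((h.integrable_bump_sq hj t).const_mul ν)

lemma lim_dens (h : Out N c Δ U) (μ ν : ℝ) : Tendsto
    (fun t => ∫ x, |dens μ ν U t x - ∑ j ∈ Finset.range N, bdens μ ν c Δ j t x|) atTop
      (nhds 0) := by
  have hl := (h.lim_energy.const_mul |μ|).add (h.lim_mass.const_mul |ν|)
  rw [mul_zero, mul_zero, add_zero] at hl
  refine squeeze_zero (fun t => integral_nonneg fun x => abs_nonneg _) (fun t => ?_) hl
  have i1 : Integrable fun x => |Sol.eden U t x - ∑ j ∈ Finset.range N, bumpe c Δ j t x| :=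
    ((integrable_eden h.sol t).sub (integrable_finsetSum _ fun j hj =>
      h.integrable_bumpe (Finset.mem_range.1 hj) t)).abs
  have i2 : Integrable fun x => |U 0 t x ^ 2 - ∑ j ∈ Finset.range N, bump c Δ j t x ^ 2| :=
    ((h.sol.sq 0 t).sub (integrable_finsetSum _ fun j hj =>
      h.integrable_bump_sq (Finset.mem_range.1 hj) t)).abs
  rw [← integral_const_mul, ← integral_const_mul, ← integral_add (i1.const_mul _) (i2.const_mul _)]
  refine integral_mono_of_nonneg (ae_of_all _ fun x => abs_nonneg _)
    ((i1.const_mul _).add (i2.const_mul _)) (ae_of_all _ fun x => ?_)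
  have e : dens μ ν U t x - ∑ j ∈ Finset.range N, bdens μ ν c Δ j t x
      = μ * (Sol.eden U t x - ∑ j ∈ Finset.range N, bumpe c Δ j t x)
        + ν * (U 0 t x ^ 2 - ∑ j ∈ Finset.range N, bump c Δ j t x ^ 2) := by
    simp only [dens, bdens, Sol.eden, Finset.sum_add_distrib, ← Finset.mul_sum]
    ring
  simp only [e]
  rw [← abs_mul, ← abs_mul]
  exact abs_add_le _ _

lemma integral_bdens (h : Out N c Δ U) (μ ν : ℝ) {j : ℕ} (hj : j < N) (t : ℝ) :
    ∫ x, bdens μ ν c Δ j t x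
      = μ * (-(1 / 7) * (c j * ∫ x, Qc (c j) x ^ 2)) + ν * ∫ x, Qc (c j) x ^ 2 := by
  unfold bdens
  rw [integral_add ((h.integrable_bumpe hj t).const_mul μ)
    ((h.integrable_bump_sq hj t).const_mul ν), integral_const_mul, integral_const_mul,
    h.integral_bumpe hj, integral_bump_sq]

/-- Localized densities converge to the contributions of the solitons ahead of the line. -/
lemma tendsto_localized (h : Out N c Δ U) (μ ν : ℝ) {L : ℝ} (hL : 0 < L)
    (hp : ∃ K, 0 < K ∧ ∀ j < N, ∀ t x, |bdens μ ν c Δ j t x| ≤ K * exp (-(|x - ctr c Δ j t| / L)))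
    {κ σ' : ℝ} (hκ : 0 < κ) {g : ℕ} {σ a ℓ T : ℝ} (hl : IsLine N c Δ κ σ' g σ a ℓ T) :
    Tendsto (fun t => ∫ x, dens μ ν U t x * lg L (x - (σ * t + a))) atTop
      (nhds (∑ j ∈ Finset.range g,
        (μ * (-(1 / 7) * (c j * ∫ x, Qc (c j) x ^ 2)) + ν * ∫ x, Qc (c j) x ^ 2))) := by
  obtain ⟨K, hK, hb⟩ := hp
  have hlg : ∀ t, Continuous fun x => lg L (x - (σ * t + a)) := fun t =>
    (continuous_lg L).comp (by fun_prop)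
  have hmul : ∀ t (f : ℝ → ℝ), Integrable f →
      Integrable fun x => f x * lg L (x - (σ * t + a)) := fun t f hf =>
    hf.mul_bdd (c := 1) (hlg t).aestronglyMeasurable (ae_of_all _ fun x => by
      rw [Real.norm_eq_abs, abs_of_pos (lg_pos _ _)]; exact (lg_lt_one _ _).le)
  have cb : ∀ j t, Continuous (bdens μ ν c Δ j t) := fun j t =>
    ((continuous_bumpe c Δ j t).const_mul μ).add (((continuous_bump c Δ j t).pow 2).const_mul ν)
  have hdecay : Tendsto (fun t => 4 * L * K * exp (-((ℓ + κ * (t - T)) / (2 * L)))) atTop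
      (nhds 0) := by
    rw [show (0:ℝ) = 4 * L * K * 0 by ring]
    refine (tendsto_exp_neg_atTop_nhds_zero.comp ?_).const_mul _
    refine Tendsto.atTop_div_const (by positivity) (tendsto_atTop_add_const_left _ _ ?_)
    exact (tendsto_atTop_add_const_right _ (-T) tendsto_id).const_mul_atTop hκ
  have hone : ∀ j < N, Tendsto (fun t => ∫ x, bdens μ ν c Δ j t x * lg L (x - (σ * t + a))) atTop
      (nhds (if j < g then
        μ * (-(1 / 7) * (c j * ∫ x, Qc (c j) x ^ 2)) + ν * ∫ x, Qc (c j) x ^ 2 else 0)) := by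
    intro j hj
    rw [tendsto_iff_norm_sub_tendsto_zero]
    refine squeeze_zero' (Eventually.of_forall fun t => norm_nonneg _) ?_ hdecay
    filter_upwards [eventually_ge_atTop T] with t ht
    rw [Real.norm_eq_abs]
    split_ifs with hjg
    · rw [← h.integral_bdens μ ν hj t, abs_sub_comm,
        ← integral_sub (h.integrable_bdens μ ν hj t) (hmul t _ (h.integrable_bdens μ ν hj t))]
      have := (integral_bump_le (d := ℓ + κ * (t - T)) (ω := fun x => 1 - lg L (x - (σ * t + a))) hL
        (cb j t) (continuous_const.sub (hlg t))
        (hb j hj t) (fun x => (sub_pos.2 (lg_lt_one _ _)).le)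
        (fun x => by linarith [lg_pos L (x - (σ * t + a))])
        (one_sub_lg_small hL (hl.right t ht j hjg))).2
      refine le_trans (le_of_eq ?_) this
      congr 2; ext x; ring
    · rw [sub_zero]
      exact (integral_bump_le hL (cb j t) (hlg t) (hb j hj t) (fun x => (lg_pos _ _).le)
        (fun x => (lg_lt_one _ _).le) (lg_small hL (hl.left t ht j (not_lt.1 hjg) hj))).2
  have hsum := tendsto_finsetSum (Finset.range N) fun j hj => hone j (Finset.mem_range.1 hj)
  rw [← Finset.sum_filter] at hsum
  have hfil : (Finset.range N).filter (· < g) = Finset.range g := by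
    ext j; simp only [Finset.mem_filter, Finset.mem_range]
    exact ⟨fun hj => hj.2, fun hj => ⟨hj.trans_le hl.le, hj⟩⟩
  rw [hfil] at hsum
  have hz : Tendsto (fun t => (∫ x, dens μ ν U t x * lg L (x - (σ * t + a)))
      - ∑ j ∈ Finset.range N, ∫ x, bdens μ ν c Δ j t x * lg L (x - (σ * t + a))) atTop
      (nhds 0) := by
    refine squeeze_zero_norm (fun t => ?_) (h.lim_dens μ ν)
    have is : Integrable fun x => ∑ j ∈ Finset.range N, bdens μ ν c Δ j t x :=
      integrable_finsetSum _ fun j hj => h.integrable_bdens μ ν (Finset.mem_range.1 hj) t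
    rw [← integral_finsetSum _ fun j hj => hmul t _ (h.integrable_bdens μ ν (Finset.mem_range.1 hj) t),
      ← integral_sub (hmul t _ (h.integrable_dens μ ν t))
        (integrable_finsetSum _ fun j hj => hmul t _ (h.integrable_bdens μ ν (Finset.mem_range.1 hj) t))]
    refine norm_integral_le_of_norm_le ((h.integrable_dens μ ν t).sub is).abs
      (ae_of_all _ fun x => ?_)
    rw [← Finset.sum_mul, ← sub_mul, norm_mul, Real.norm_eq_abs, Real.norm_eq_abs,
      abs_of_pos (lg_pos L _)]
    exact mul_le_of_le_one_right (abs_nonneg _) (lg_lt_one _ _).le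
  have := hz.add hsum
  simpa using this

/-- Almost monotonicity: the density ahead of a line has at least its asymptotic value. -/
theorem almost_monotone (h : Out N c Δ U) {μ ν κ σ' : ℝ} (hμ : 0 ≤ μ) (hμ1 : μ ≤ 1) (hν : 0 < ν)
    (hκ : 0 < κ) (hσ' : 0 ≤ σ') :
    ∃ L0, 0 < L0 ∧ ∀ L, L0 ≤ L → ∃ T0 C, 0 ≤ C ∧ ∀ g σ a ℓ T, T0 ≤ T →
      IsLine N c Δ κ σ' g σ a ℓ T →
      (∑ j ∈ Finset.range g,
        (μ * (-(1 / 7) * (c j * ∫ x, Qc (c j) x ^ 2)) + ν * ∫ x, Qc (c j) x ^ 2))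
        ≤ (∫ x, dens μ ν U T x * lg L (x - (σ * T + a))) + C * exp (-(ℓ / (2 * L))) := by
  obtain ⟨L1, K, hL1, hK, hb⟩ := h.exists_profile_bound
  obtain ⟨B, hB, hBle⟩ := h.exists_bumps_le
  obtain ⟨η, A, hη, hA, habs⟩ := exists_absorption (B := B)
    (ε := ν * κ / 2 / (1 + σ' + 2 * ν)) hB.le (by positivity)
  obtain ⟨T0, hT0⟩ := h.exists_sup_bound hη
  refine ⟨1 + L1 + 4 / κ, by positivity, fun L hL => ?_⟩
  have hκ4 : 0 < 4 / κ := by positivity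
  have hL1' : 1 ≤ L := by linarith
  have hLp : 0 < L := by linarith
  have hLκ : 1 / L ^ 2 ≤ κ / 4 := by
    rw [div_le_iff₀ (by positivity)]
    have h1 : 4 / κ ≤ L := by linarith
    rw [div_le_iff₀ hκ] at h1
    nlinarith
  set A' := A * (1 + σ' + 2 * ν) with hA'
  have hA'0 : 0 ≤ A' := by positivity
  refine ⟨T0, A' * (N * (4 * K)) / (κ / (2 * L)), by positivity, fun g σ a ℓ T hT hl => ?_⟩
  have hprof : ∃ K, 0 < K ∧ ∀ j < N, ∀ t x,
      |bdens μ ν c Δ j t x| ≤ K * exp (-(|x - ctr c Δ j t| / L)) := by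
    refine ⟨(1 + ν) * K, by positivity, fun j hj t x => ?_⟩
    obtain ⟨-, -, -, h1, h2⟩ := hb L (by linarith) j hj t x
    unfold bdens
    calc _ ≤ |μ * bumpe c Δ j t x| + |ν * bump c Δ j t x ^ 2| := abs_add_le _ _
      _ = μ * |bumpe c Δ j t x| + ν * |bump c Δ j t x ^ 2| := by
          rw [abs_mul, abs_mul, abs_of_nonneg hμ, abs_of_pos hν]
      _ ≤ 1 * (K * exp (-(|x - ctr c Δ j t| / L))) + ν * (K * exp (-(|x - ctr c Δ j t| / L))) := by
          gcongr
      _ = _ := by ring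
  refine le_of_tendsto' (f := fun n : ℕ => ∫ x, dens μ ν U (T + n) x * lg L (x - (σ * (T + n) + a)))
    (x := atTop) ?_ fun n => ?_
  · exact (h.tendsto_localized μ ν hLp hprof hκ hl).comp
      (tendsto_atTop_add_const_left _ T tendsto_natCast_atTop_atTop)
  set t : ℝ := T + n with ht
  have hTt : T ≤ t := by rw [ht]; linarith [n.cast_nonneg (α := ℝ)]
  have hR := h.sol.reg_uIcc T t
  have key := balance_integral (h.sol.balance_energy.lin h.sol.balance_mass μ ν)
    (((hR.l1_eden h.sol).const_mul μ).add ((hR.l1_mass h.sol).const_mul ν))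
    ((L1On.zero.const_mul μ).add (L1On.zero.const_mul ν))
    (((hR.l1_energy_flux h.sol).const_mul μ).add ((hR.l1_mass_flux h.sol).const_mul ν))
    (((hR.l1_energy_flux' h.sol).const_mul μ).add (L1On.zero.const_mul ν))
    ((L1On.zero.const_mul μ).add ((hR.l1_mass h.sol).neg.const_mul ν))
    ((weight_lg hL1').comp_sub a) σ
  have efl : ∀ τ x, x - σ * τ - a = x - (σ * τ + a) := fun τ x => by ring
  have hdens : ∀ τ, (∫ x, (μ * (U 1 τ x ^ 2 - 2 / 5 * U 0 τ x ^ 5) + ν * U 0 τ x ^ 2)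
      * lg L (x - σ * τ - a)) = ∫ x, dens μ ν U τ x * lg L (x - (σ * τ + a)) := fun τ => by
    simp only [efl, dens]
  rw [hdens, hdens] at key
  suffices hbound : (∫ x, dens μ ν U t x * lg L (x - (σ * t + a)))
      - ∫ x, dens μ ν U T x * lg L (x - (σ * T + a))
      ≤ A' * (N * (4 * K)) * exp (-(ℓ / (2 * L))) / (κ / (2 * L)) by
    rw [mul_div_right_comm] at hbound
    linarith
  rw [key]
  refine intervalIntegral_le_of_exp (by positivity) (by positivity) hTt fun τ h1 h2 => ?_
  set D := ℓ + κ * (τ - T) with hD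
  have hi : ∀ j < N, (Integrable fun x => bump c Δ j τ x * (L * lgd L (x - (σ * τ + a)))) ∧
      |∫ x, bump c Δ j τ x * (L * lgd L (x - (σ * τ + a)))| ≤ 4 * L * K * exp (-(D / (2 * L))) := by
    intro j hj
    refine integral_bump_le hLp (continuous_bump c Δ j τ)
      (continuous_const.mul ((continuous_lgd L).comp (by fun_prop))) (fun x => ?_)
      (fun x => mul_nonneg hLp.le (lgd_nonneg hLp _)) (fun x => ?_)
      (lgd_small hLp (hl.le_abs h1 hj))
    · obtain ⟨h1, h2, -⟩ := hb L (by linarith) j hj τ x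
      rwa [abs_of_pos h1]
    · have := (lgd_le hLp (x - (σ * τ + a))).1
      rw [le_div_iff₀ hLp] at this
      linarith [lg_lt_one L (x - (σ * τ + a))]
  have hi' : Integrable fun x => A' / L * ∑ j ∈ Finset.range N,
      bump c Δ j τ x * (L * lgd L (x - (σ * τ + a))) :=
    (integrable_finsetSum _ fun j hj => (hi j (Finset.mem_range.1 hj)).1).const_mul _
  have hval : ∫ x, A' / L * ∑ j ∈ Finset.range N,
      bump c Δ j τ x * (L * lgd L (x - (σ * τ + a)))
      ≤ A' * (N * (4 * K)) * exp (-(ℓ / (2 * L))) * exp (-(κ / (2 * L) * (τ - T))) := by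
    rw [integral_const_mul, integral_finsetSum _ fun j hj => (hi j (Finset.mem_range.1 hj)).1]
    calc _ ≤ A' / L * ∑ j ∈ Finset.range N, 4 * L * K * exp (-(D / (2 * L))) := by
          gcongr with j hj
          exact (le_abs_self _).trans (hi j (Finset.mem_range.1 hj)).2
      _ = A' * (N * (4 * K)) * exp (-(D / (2 * L))) := by
          rw [Finset.sum_const, Finset.card_range, nsmul_eq_mul]; field_simp
      _ = _ := by
          rw [mul_assoc (A' * _), ← exp_add]; congr 2; rw [hD]; ring
  refine le_trans ?_ hval
  refine integral_le_of_le_nonneg hi' (fun x => mul_nonneg (by positivity) (Finset.sum_nonneg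
    fun j hj => mul_nonneg (h.bump_pos (Finset.mem_range.1 hj) τ x).le
      (mul_nonneg hLp.le (lgd_nonneg hLp _)))) fun x => ?_
  have hu : |U 0 τ x| ≤ bumps c Δ N τ x + η := by
    have h3 := abs_le.1 (hT0 τ (hT.trans h1) x)
    have h4 := h.bumps_nonneg τ x
    exact abs_le.2 ⟨by linarith, by linarith⟩
  obtain ⟨h5, h8⟩ := habs _ _ (h.bumps_nonneg τ x) (hBle τ x) hu
  have hfl := flux_le (b := U 1 τ x) (w := U 2 τ x + U 0 τ x ^ 4) (lgd_nonneg hLp (x - (σ * τ + a)))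
    (abs_lgd_second_le hLp (x - (σ * τ + a))) (abs_lgd_third_le hLp (x - (σ * τ + a))) hLκ
    hl.low hl.up hκ hμ hμ1 hν.le
    (le_of_eq (div_mul_cancel₀ _ (by positivity))) h5 h8
  simp only [flux, efl]
  refine le_trans (le_of_eq ?_) (hfl.trans (le_of_eq ?_))
  · ring
  · rw [← Finset.sum_mul]
    simp only [bumps, hA']
    field_simp

end Out

/-! ### Calibration: lower bound of the energy by the height of a bump -/

lemma two_abs_le_integral_abs_deriv {F F' : ℝ → ℝ} (hd : ∀ x, HasDerivAt F (F' x) x)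
    (hF : Integrable F) (hF' : Integrable F') (x : ℝ) : 2 * |F x| ≤ ∫ y, |F' y| := by
  have h0 : Tendsto F atBot (nhds 0) :=
    tendsto_zero_of_hasDerivAt_of_integrableOn_Iic (a := x) (fun y _ => hd y)
      hF'.integrableOn hF.integrableOn
  have h1 : Tendsto F atTop (nhds 0) :=
    tendsto_zero_of_hasDerivAt_of_integrableOn_Ioi (a := x) (fun y _ => hd y)
      hF'.integrableOn hF.integrableOn
  have e0 := integral_Iic_of_hasDerivAt_of_tendsto' (a := x) (fun y _ => hd y)
      hF'.integrableOn h0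
  have e1 := integral_Ioi_of_hasDerivAt_of_tendsto' (a := x) (fun y _ => hd y)
      hF'.integrableOn h1
  have a0 := abs_integral_le_integral_abs (f := F') (μ := volume.restrict (Set.Iic x))
  have a1 := abs_integral_le_integral_abs (f := F') (μ := volume.restrict (Set.Ioi x))
  rw [e0, sub_zero] at a0
  rw [e1, zero_sub, abs_neg] at a1
  have := intervalIntegral.integral_Iic_add_Ioi (b := x) hF'.abs.integrableOn hF'.abs.integrableOn
  linarith

/-- The integrand of the calibration function. -/
noncomputable def calg (c y : ℝ) : ℝ := √(max 0 (c * y ^ 2 - 2 / 5 * |y| ^ 5))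

/-- The calibration function. -/
noncomputable def calh (c y : ℝ) : ℝ := ∫ t in (0:ℝ)..y, calg c t

lemma calg_nonneg (c y : ℝ) : 0 ≤ calg c y := Real.sqrt_nonneg _

lemma calg_sq (c y : ℝ) : calg c y ^ 2 = max 0 (c * y ^ 2 - 2 / 5 * |y| ^ 5) :=
  Real.sq_sqrt (le_max_left _ _)

lemma calg_sq_le {c : ℝ} (hc : 0 ≤ c) (y : ℝ) : calg c y ^ 2 ≤ c * y ^ 2 := by
  rw [calg_sq]
  exact max_le (by positivity) (by have : 0 ≤ |y| ^ 5 := by positivity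
                                   linarith)

lemma continuous_calg (c : ℝ) : Continuous (calg c) := by
  unfold calg; fun_prop

lemma hasDerivAt_calh (c y : ℝ) : HasDerivAt (calh c) (calg c y) y :=
  ((continuous_calg c).integral_hasStrictDerivAt 0 y).hasDerivAt

lemma abs_calh_le {c : ℝ} (hc : 0 ≤ c) (y : ℝ) : |calh c y| ≤ √c * y ^ 2 := by
  have h : ∀ t ∈ Set.uIoc 0 y, ‖calg c t‖ ≤ √c * |y| := fun t ht => by
    have h1 : |t| ≤ |y| := by
      have := Set.abs_sub_left_of_mem_uIcc (Set.uIoc_subset_uIcc ht)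
      simpa using this
    rw [Real.norm_eq_abs]
    refine (abs_le_of_sq_le_sq (b := √c * |t|) ?_ (by positivity)).trans
      (mul_le_mul_of_nonneg_left h1 (Real.sqrt_nonneg _))
    rw [mul_pow, Real.sq_sqrt hc, sq_abs]
    exact calg_sq_le hc t
  have := intervalIntegral.norm_integral_le_of_norm_le_const h
  rw [Real.norm_eq_abs, sub_zero, mul_assoc, ← sq, sq_abs] at this
  exact this

lemma calibration {v v1 χ χ1 : ℝ → ℝ} {c K : ℝ} (hc : 0 ≤ c)
    (hv : ∀ x, HasDerivAt v (v1 x) x) (cv1 : Continuous v1)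
    (iv : Integrable fun x => v x ^ 2) (iv1 : Integrable fun x => v1 x ^ 2)
    (hχ : ∀ x, HasDerivAt χ (χ1 x) x) (cχ1 : Continuous χ1)
    (h0 : ∀ x, 0 ≤ χ x) (h1 : ∀ x, χ x ≤ 1) (hK : ∀ x, |χ1 x| ≤ K) (x₀ : ℝ) :
    4 * (calh c (v x₀) * χ x₀) ≤
      (∫ x, (v1 x ^ 2 + max 0 (c * v x ^ 2 - 2 / 5 * |v x| ^ 5)) * χ x)
        + 2 * √c * ∫ x, v x ^ 2 * |χ1 x| := by
  have cv : Continuous v := continuous_iff_continuousAt.2 fun x => (hv x).continuousAt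
  have cχ : Continuous χ := continuous_iff_continuousAt.2 fun x => (hχ x).continuousAt
  have ch : Continuous (calh c) :=
    continuous_iff_continuousAt.2 fun x => (hasDerivAt_calh c x).continuousAt
  have cg := continuous_calg c
  have hd : ∀ x, HasDerivAt (fun x => 2 * (calh c (v x) * χ x))
      (2 * (calg c (v x) * v1 x * χ x + calh c (v x) * χ1 x)) x := fun x =>
    ((((hasDerivAt_calh c (v x)).comp x (hv x)).fun_mul (hχ x)).const_mul 2)
  have iF : Integrable fun x => 2 * (calh c (v x) * χ x) := by
    refine (iv.const_mul (2 * √c)).mono' (by fun_prop) (ae_of_all _ fun x => ?_)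
    rw [Real.norm_eq_abs, abs_mul, abs_mul, abs_of_nonneg (h0 x), abs_two]
    have := abs_calh_le hc (v x)
    have h2 := mul_le_mul this (h1 x) (h0 x) (by positivity)
    linarith
  have iA : Integrable fun x => (v1 x ^ 2 + max 0 (c * v x ^ 2 - 2 / 5 * |v x| ^ 5)) * χ x := by
    refine (iv1.add (iv.const_mul c)).mono' (by fun_prop) (ae_of_all _ fun x => ?_)
    have := calg_sq_le hc (v x)
    have h3 := sq_nonneg (calg c (v x))
    rw [calg_sq] at this h3
    rw [Real.norm_eq_abs, abs_of_nonneg (mul_nonneg (add_nonneg (sq_nonneg _) h3) (h0 x))]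
    simp only [Pi.add_apply]
    have := mul_le_mul (add_le_add_right this (v1 x ^ 2)) (h1 x) (h0 x) (by positivity)
    linarith
  have iB : Integrable fun x => v x ^ 2 * |χ1 x| := by
    refine (iv.const_mul K).mono' (by fun_prop) (ae_of_all _ fun x => ?_)
    rw [Real.norm_eq_abs, abs_of_nonneg (by positivity), mul_comm]
    exact mul_le_mul_of_nonneg_right (hK x) (sq_nonneg _)
  have iD : Integrable fun x => (v1 x ^ 2 + max 0 (c * v x ^ 2 - 2 / 5 * |v x| ^ 5)) * χ x
      + 2 * √c * (v x ^ 2 * |χ1 x|) := iA.fun_add (iB.const_mul _)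
  have key : ∀ x, |2 * (calg c (v x) * v1 x * χ x + calh c (v x) * χ1 x)| ≤
      (v1 x ^ 2 + max 0 (c * v x ^ 2 - 2 / 5 * |v x| ^ 5)) * χ x
      + 2 * √c * (v x ^ 2 * |χ1 x|) := fun x => by
    rw [abs_mul, abs_two, ← calg_sq]
    have e1 := abs_add_le (calg c (v x) * v1 x * χ x) (calh c (v x) * χ1 x)
    rw [abs_mul _ (χ x), abs_of_nonneg (h0 x), abs_mul _ (χ1 x)] at e1
    have e2 := mul_le_mul_of_nonneg_right (abs_calh_le hc (v x)) (abs_nonneg (χ1 x))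
    have e3 : 2 * |calg c (v x) * v1 x| ≤ v1 x ^ 2 + calg c (v x) ^ 2 := by
      rw [abs_mul]
      nlinarith [sq_nonneg (|calg c (v x)| - |v1 x|), sq_abs (calg c (v x)), sq_abs (v1 x)]
    have e4 := mul_le_mul_of_nonneg_right e3 (h0 x)
    linarith
  have iF' : Integrable fun x => 2 * (calg c (v x) * v1 x * χ x + calh c (v x) * χ1 x) :=
    iD.mono' (by fun_prop) (ae_of_all _ key)
  have fin := two_abs_le_integral_abs_deriv hd iF iF' x₀
  have fin2 : (∫ x, |2 * (calg c (v x) * v1 x * χ x + calh c (v x) * χ1 x)|) ≤ _ :=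
    integral_mono iF'.abs iD key
  rw [integral_add iA (iB.const_mul _), integral_const_mul] at fin2
  linarith [le_abs_self (2 * (calh c (v x₀) * χ x₀))]

lemma Qc_abs (c x : ℝ) : Qc c |x| = Qc c x := by
  rcases abs_cases x with ⟨h, _⟩ | ⟨h, _⟩ <;> rw [h]
  simp only [Qc, Q]
  rw [show 3 * (√c * -x) / 2 = -(3 * (√c * x) / 2) by ring, Real.cosh_neg]

lemma four_calh {c : ℝ} (hc : 0 < c) : 4 * calh c (Qc c 0) = 2 * ∫ x, Qd c x ^ 2 := by
  have hg : ∀ x, calg c (Qc c x) = |Qd c x| := fun x => by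
    rw [calg, abs_of_pos (Qc_pos hc x), ← Qd_sq hc, max_eq_right (sq_nonneg _), Real.sqrt_sq_eq_abs]
  have ch : Continuous (calh c) :=
    continuous_iff_continuousAt.2 fun x => (hasDerivAt_calh c x).continuousAt
  have cQ := continuous_Qc c
  have hneg : ∀ x, 0 < x → Qd c x ≤ 0 := fun x hx => by
    have h1 : 0 ≤ tanh (3 * (√c * x) / 2) := by
      rw [Real.tanh_eq_sinh_div_cosh]
      exact div_nonneg (Real.sinh_nonneg_iff.2 (by positivity)) (Real.cosh_pos _).le
    have := Qc_pos hc x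
    rw [Qd]
    have : 0 ≤ √c * tanh (3 * (√c * x) / 2) * Qc c x := by positivity
    linarith
  have hd : ∀ x ∈ Set.Ioi (0:ℝ), HasDerivAt (fun x => calh c (Qc c x)) (-Qd c x ^ 2) x :=
    fun x hx => by
      refine ((hasDerivAt_calh c (Qc c x)).comp x (hasDerivAt_Qc c x)).congr_deriv ?_
      rw [hg, abs_of_nonpos (hneg x hx)]
      ring
  have i1 : Integrable fun x => calh c (Qc c x) := by
    refine ((integrable_Qc_pow hc 1).const_mul (√c)).mono' (by fun_prop)
      (ae_of_all _ fun x => ?_)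
    exact abs_calh_le hc.le (Qc c x)
  have i2 : Integrable fun x => -Qd c x ^ 2 := (integrable_Qd_sq hc).neg
  have t0 := tendsto_zero_of_hasDerivAt_of_integrableOn_Ioi hd i2.integrableOn i1.integrableOn
  have e1 := integral_Ioi_of_hasDerivAt_of_tendsto (ch.comp cQ).continuousWithinAt hd
    i2.integrableOn t0
  have e2 := integral_comp_abs (f := fun x => Qd c x ^ 2)
  have e3 : ∀ x, Qd c |x| ^ 2 = Qd c x ^ 2 := fun x => by
    rw [Qd_sq hc, Qd_sq hc, Qc_abs]
  simp only [e3] at e2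
  rw [integral_neg] at e1
  simp only [Function.comp] at e1
  linarith

/-! ### A partition of the line adapted to separated centres -/

section Partition

/-- The edge to the left of the centre `g - 1`. -/
noncomputable def edR (L ℓ : ℝ) (p : ℕ → ℝ) (g : ℕ) (x : ℝ) : ℝ :=
  if g = 0 then 0 else lg L (x - (p (g - 1) - ℓ))

/-- The edge to the right of the centre `g`. -/
noncomputable def edL (L ℓ : ℝ) (p : ℕ → ℝ) (N g : ℕ) (x : ℝ) : ℝ :=
  if g = N then 1 else lg L (x - (p g + ℓ))

/-- The weight of the gap between the centres `g` and `g - 1`. -/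
noncomputable def gapw (L ℓ : ℝ) (p : ℕ → ℝ) (N g : ℕ) (x : ℝ) : ℝ :=
  edL L ℓ p N g x - edR L ℓ p g x

/-- The weight localized at the centre `j`. -/
noncomputable def cut (L ℓ : ℝ) (p : ℕ → ℝ) (j : ℕ) (x : ℝ) : ℝ :=
  lg L (x - (p j - ℓ)) - lg L (x - (p j + ℓ))

/-- The derivative of `cut`. -/
noncomputable def cutd (L ℓ : ℝ) (p : ℕ → ℝ) (j : ℕ) (x : ℝ) : ℝ :=
  lgd L (x - (p j - ℓ)) - lgd L (x - (p j + ℓ))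

/-- The centres `p 0 > p 1 > …` are at mutual distance at least `2 ℓ + L`. -/
structure Sep (N : ℕ) (L ℓ : ℝ) (p : ℕ → ℝ) : Prop where
  hL : 0 < L
  hℓ : 0 ≤ ℓ
  sep : ∀ i j, i < j → j < N → p j + (2 * ℓ + L) ≤ p i

variable {N : ℕ} {L ℓ : ℝ} {p : ℕ → ℝ}

lemma continuous_edR (L ℓ : ℝ) (p : ℕ → ℝ) (g : ℕ) : Continuous (edR L ℓ p g) := by
  have := continuous_lg L
  unfold edR
  split_ifs <;> fun_prop

lemma continuous_edL (L ℓ : ℝ) (p : ℕ → ℝ) (N g : ℕ) : Continuous (edL L ℓ p N g) := by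
  have := continuous_lg L
  unfold edL
  split_ifs <;> fun_prop

lemma continuous_gapw (L ℓ : ℝ) (p : ℕ → ℝ) (N g : ℕ) : Continuous (gapw L ℓ p N g) :=
  (continuous_edL L ℓ p N g).sub (continuous_edR L ℓ p g)

lemma continuous_cut (L ℓ : ℝ) (p : ℕ → ℝ) (j : ℕ) : Continuous (cut L ℓ p j) := by
  have := continuous_lg L
  unfold cut; fun_prop

lemma continuous_cutd (L ℓ : ℝ) (p : ℕ → ℝ) (j : ℕ) : Continuous (cutd L ℓ p j) := by
  have := continuous_lgd L
  unfold cutd; fun_prop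

lemma hasDerivAt_cut (L ℓ : ℝ) (p : ℕ → ℝ) (j : ℕ) (x : ℝ) :
    HasDerivAt (cut L ℓ p j) (cutd L ℓ p j x) x :=
  ((hasDerivAt_lg L _).comp_sub_const x _).fun_sub ((hasDerivAt_lg L _).comp_sub_const x _)

lemma cut_eq {j : ℕ} (hj : j < N) (x : ℝ) :
    cut L ℓ p j x = edR L ℓ p (j + 1) x - edL L ℓ p N j x := by
  simp [cut, edR, edL, hj.ne]

lemma edR_mem (g : ℕ) (x : ℝ) : 0 ≤ edR L ℓ p g x ∧ edR L ℓ p g x ≤ 1 := by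
  unfold edR
  split_ifs
  · simp
  · exact ⟨(lg_pos _ _).le, (lg_lt_one _ _).le⟩

lemma edL_mem (g : ℕ) (x : ℝ) : 0 ≤ edL L ℓ p N g x ∧ edL L ℓ p N g x ≤ 1 := by
  unfold edL
  split_ifs
  · simp
  · exact ⟨(lg_pos _ _).le, (lg_lt_one _ _).le⟩

lemma cut_mem (hL : 0 < L) (hℓ : 0 ≤ ℓ) (j : ℕ) (x : ℝ) :
    0 ≤ cut L ℓ p j x ∧ cut L ℓ p j x ≤ 1 := by
  have h1 := lg_mono hL (x := x - (p j + ℓ)) (y := x - (p j - ℓ)) (by linarith)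
  have h2 := lg_pos L (x - (p j + ℓ))
  have h3 := lg_lt_one L (x - (p j - ℓ))
  unfold cut
  constructor <;> linarith

namespace Sep

lemma gapw_mem (h : Sep N L ℓ p) {g : ℕ} (hg : g ≤ N) (x : ℝ) :
    0 ≤ gapw L ℓ p N g x ∧ gapw L ℓ p N g x ≤ 1 := by
  have e1 := edR_mem (L := L) (ℓ := ℓ) (p := p) g x
  have e2 := edL_mem (L := L) (ℓ := ℓ) (p := p) (N := N) g x
  refine ⟨?_, by unfold gapw; linarith⟩
  unfold gapw
  by_cases h0 : g = 0
  · have : edR L ℓ p g x = 0 := by simp [edR, h0]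
    linarith
  by_cases h1 : g = N
  · have : edL L ℓ p N g x = 1 := by simp [edL, h1]
    linarith
  have := h.sep (g - 1) g (by omega) (by omega)
  have := h.hL
  have := h.hℓ
  simp only [edR, edL, if_neg h0, if_neg h1]
  have := lg_mono h.hL (x := x - (p (g - 1) - ℓ)) (y := x - (p g + ℓ)) (by linarith)
  linarith

lemma anti (h : Sep N L ℓ p) {i j : ℕ} (hij : i ≤ j) (hj : j < N) : p j ≤ p i := by
  rcases hij.eq_or_lt with rfl | hij
  · exact le_rfl
  · linarith [h.sep i j hij hj, h.hL, h.hℓ]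

lemma gapw_small (h : Sep N L ℓ p) {g i : ℕ} (hg : g ≤ N) (hi : i < N) (x : ℝ) :
    gapw L ℓ p N g x ≤ exp (-((ℓ - |x - p i|) / L)) := by
  rcases lt_or_ge i g with hig | hig
  · have h0 : g ≠ 0 := by omega
    have e2 := (edL_mem (L := L) (ℓ := ℓ) (p := p) (N := N) g x).2
    have := one_sub_lg_small h.hL (a := p (g - 1) - ℓ) (d := ℓ) (p := p i)
      (by linarith [h.anti (i := i) (j := g - 1) (by omega) (by omega)]) x
    simp only [gapw, edR, if_neg h0]
    linarith
  · have h1 : g ≠ N := by omega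
    have e2 := (edR_mem (L := L) (ℓ := ℓ) (p := p) g x).1
    have := lg_small h.hL (a := p g + ℓ) (d := ℓ) (p := p i) (by linarith [h.anti hig hi]) x
    simp only [gapw, edL, if_neg h1]
    linarith

lemma cut_small (h : Sep N L ℓ p) {j i : ℕ} (hj : j < N) (hi : i < N) (hij : i ≠ j) (x : ℝ) :
    cut L ℓ p j x ≤ exp (-((ℓ - |x - p i|) / L)) := by
  have := h.hL
  rcases lt_or_gt_of_ne hij with hij | hij
  · have := one_sub_lg_small h.hL (a := p j + ℓ) (d := ℓ) (p := p i)
      (by linarith [h.sep i j hij hj]) x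
    have h3 := lg_lt_one L (x - (p j - ℓ))
    unfold cut; linarith
  · have := lg_small h.hL (a := p j - ℓ) (d := ℓ) (p := p i) (by linarith [h.sep j i hij hi]) x
    have h3 := lg_pos L (x - (p j + ℓ))
    unfold cut; linarith

lemma abs_cutd_le (h : Sep N L ℓ p) {j : ℕ} (hj : j < N) (x : ℝ) :
    |cutd L ℓ p j x| ≤ 2 / L * (gapw L ℓ p N j x + gapw L ℓ p N (j + 1) x) := by
  have hL := h.hL
  have n1 := lgd_nonneg hL (x - (p j - ℓ))
  have n2 := lgd_nonneg hL (x - (p j + ℓ))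
  have h1 : lgd L (x - (p j - ℓ)) ≤ 2 / L * gapw L ℓ p N (j + 1) x := by
    by_cases h1 : j + 1 = N
    · have := (lgd_le hL (x - (p j - ℓ))).2
      have e : gapw L ℓ p N (j + 1) x = 1 - lg L (x - (p j - ℓ)) := by simp [gapw, edL, edR, ← h1]
      rw [e]
      refine this.trans ?_
      rw [div_mul_eq_mul_div]
      gcongr
      linarith [lg_lt_one L (x - (p j - ℓ))]
    · have e : gapw L ℓ p N (j + 1) x = lg L (x - (p (j + 1) + ℓ)) - lg L (x - (p j - ℓ)) := by
        simp [gapw, edL, edR, h1]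
      rw [e]
      exact (lgd_le_sub hL (by linarith [h.sep j (j + 1) (by omega) (by omega)])).1
  have h2 : lgd L (x - (p j + ℓ)) ≤ 2 / L * gapw L ℓ p N j x := by
    by_cases h0 : j = 0
    · have := (lgd_le hL (x - (p j + ℓ))).1
      have e : gapw L ℓ p N j x = lg L (x - (p j + ℓ)) := by simp [gapw, edL, edR, h0, (h0 ▸ hj).ne]
      rw [e]
      refine this.trans ?_
      rw [div_mul_eq_mul_div]
      gcongr
      linarith [lg_pos L (x - (p j + ℓ))]
    · have e : gapw L ℓ p N j x = lg L (x - (p j + ℓ)) - lg L (x - (p (j - 1) - ℓ)) := by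
        simp [gapw, edL, edR, h0, hj.ne]
      rw [e]
      exact (lgd_le_sub hL (by linarith [h.sep (j - 1) j (by omega) (by omega)])).2
  rw [mul_add]
  unfold cutd
  exact abs_sub_le_iff.2 ⟨by linarith, by linarith⟩

lemma one_sub_cut_le (h : Sep N L ℓ p) (j : ℕ) (x : ℝ) :
    1 - cut L ℓ p j x ≤ 2 * exp (-((ℓ - |x - p j|) / L)) := by
  have h1 := one_sub_lg_small h.hL (a := p j - ℓ) (d := ℓ) (p := p j) (by linarith) x
  have h2 := lg_small h.hL (a := p j + ℓ) (d := ℓ) (p := p j) (by linarith) x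
  unfold cut; linarith

end Sep

end Partition

/-- Pointwise comparison of the calibrated integrand with the energy density. -/
lemma calibrated_le {a b R s δ A : ℝ} (hR : 0 ≤ R) (hs : 0 < s) (hδ : 4 * δ ≤ s)
    (ha : |a - (b + R)| ≤ δ) (hA : |a| ≤ A) (hb : a ≤ s ∨ b ≤ δ) (hb0 : 0 ≤ b) :
    max 0 (2 / 5 * s ^ 3 * a ^ 2 - 2 / 5 * |a| ^ 5)
      ≤ 2 / 5 * s ^ 3 * a ^ 2 - 2 / 5 * a ^ 5 + A ^ 5 * (2 / s) * R := by
  have h5 : a ^ 5 ≤ |a| ^ 5 := by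
    rw [← abs_pow]; exact le_abs_self _
  have hA0 : 0 ≤ A := (abs_nonneg a).trans hA
  have hn : 0 ≤ A ^ 5 * (2 / s) * R := by positivity
  have h2 := abs_le.1 ha
  by_cases h : |a| ≤ s
  · refine max_le ?_ (by linarith)
    have h3 : |a| ^ 3 ≤ s ^ 3 := pow_le_pow_left₀ (abs_nonneg _) h 3
    have h4 : |a| ^ 5 = |a| ^ 3 * a ^ 2 := by rw [← sq_abs a]; ring
    have := mul_le_mul_of_nonneg_right h3 (sq_nonneg a)
    linarith
  · push Not at h
    have hab : b ≤ δ := by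
      rcases hb with hb | hb
      · rcases lt_abs.1 h with h | h <;> linarith
      · exact hb
    have h6 : s / 2 ≤ R := by
      rcases lt_abs.1 h with h | h <;> linarith
    have h7 : |a| ^ 5 ≤ A ^ 5 := pow_le_pow_left₀ (abs_nonneg _) hA 5
    have h8 : A ^ 5 ≤ A ^ 5 * (2 / s) * R := by
      rw [mul_assoc]
      refine le_mul_of_one_le_right (by positivity) ?_
      rw [div_mul_eq_mul_div, le_div_iff₀ hs]; linarith
    have h9 : (0:ℝ) ≤ s ^ 3 * a ^ 2 := by positivity
    have h10 : 2 / 5 * s ^ 3 * a ^ 2 - 2 / 5 * |a| ^ 5 ≤ 0 := by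
      have h3 : s ^ 3 ≤ |a| ^ 3 := pow_le_pow_left₀ hs.le h.le 3
      have h4 : |a| ^ 5 = |a| ^ 3 * a ^ 2 := by rw [← sq_abs a]; ring
      have := mul_le_mul_of_nonneg_right h3 (sq_nonneg a)
      linarith
    have h11 := abs_nonneg (a) 
    rw [max_eq_left h10]
    have h12 : 0 ≤ A ^ 5 := by positivity
    linarith

namespace Out

variable {N : ℕ} {c Δ : ℕ → ℝ} {U : ℕ → ℝ → ℝ → ℝ}

lemma bumps_eq_add (c Δ : ℕ → ℝ) {N j : ℕ} (hj : j < N) (t x : ℝ) : bumps c Δ N t x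
    = bump c Δ j t x + ∑ i ∈ (Finset.range N).erase j, bump c Δ i t x :=
  (Finset.add_sum_erase _ (fun i => bump c Δ i t x) (Finset.mem_range.2 hj)).symm

lemma others_nonneg (h : Out N c Δ U) (j : ℕ) (t x : ℝ) :
    0 ≤ ∑ i ∈ (Finset.range N).erase j, bump c Δ i t x :=
  Finset.sum_nonneg fun _ hi =>
    (h.bump_pos (Finset.mem_range.1 (Finset.mem_of_mem_erase hi)) t x).le

lemma exists_others_small (h : Out N c Δ U) (W : ℝ) {δ : ℝ} (hδ : 0 < δ) :
    ∃ T0, ∀ t, T0 ≤ t → ∀ j < N, ∀ x, |x - ctr c Δ j t| ≤ W →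
      ∑ i ∈ (Finset.range N).erase j, bump c Δ i t x ≤ δ := by
  obtain ⟨L, K, hL, hK, hb⟩ := h.exists_profile_bound
  obtain ⟨κ, hκ, -, hg⟩ := h.exists_gap
  obtain ⟨T1, hT1, hs⟩ := exists_separation Δ hκ hg
  have lim : Tendsto (fun t => N * (K * exp (-((κ * t - W) / L)))) atTop (nhds 0) := by
    have : Tendsto (fun t => (κ * t - W) / L) atTop atTop :=
      (tendsto_atTop_add_const_right _ (-W) (tendsto_id.const_mul_atTop hκ)).atTop_div_const hL
    have := ((Real.tendsto_exp_neg_atTop_nhds_zero.comp this).const_mul K).const_mul (N : ℝ)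
    simpa using this
  obtain ⟨T2, hT2⟩ := eventually_atTop.1 (lim.eventually_le_const hδ)
  refine ⟨max T1 T2, fun t ht j hj x hx => ?_⟩
  refine le_trans ?_ (hT2 t (le_trans (le_max_right _ _) ht))
  have : ∀ i ∈ (Finset.range N).erase j, bump c Δ i t x ≤ K * exp (-((κ * t - W) / L)) := by
    intro i hi
    obtain ⟨hij, hi⟩ := Finset.mem_erase.1 hi
    rw [Finset.mem_range] at hi
    refine (hb L le_rfl i hi t x).2.1.trans (mul_le_mul_of_nonneg_left (exp_le_exp.2
      (neg_le_neg (div_le_div_of_nonneg_right ?_ hL.le))) hK.le)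
    have h1 : κ * t ≤ |ctr c Δ i t - ctr c Δ j t| := by
      have ht1 := (le_max_left T1 T2).trans ht
      rcases lt_or_gt_of_ne hij with hij | hij
      · exact (hs t ht1 i j hij hj).trans (le_abs_self _)
      · rw [abs_sub_comm]; exact (hs t ht1 j i hij hi).trans (le_abs_self _)
    have h2 := abs_sub_le (ctr c Δ i t) x (ctr c Δ j t)
    rw [abs_sub_comm _ x] at h2
    linarith
  refine (Finset.sum_le_card_nsmul _ _ _ this).trans ?_
  rw [nsmul_eq_mul]
  refine mul_le_mul_of_nonneg_right ?_ (by positivity)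
  have := Finset.card_erase_le (s := Finset.range N) (a := j)
  rw [Finset.card_range] at this
  exact_mod_cast this

/-- Near each soliton, the energy and the mass are almost bounded below by those of the soliton. -/
lemma soliton_lower (h : Out N c Δ U) : ∃ Kq, 0 < Kq ∧ ∀ η, 0 < η → η ≤ 1 → ∃ L0, 0 < L0 ∧
    ∀ L, L0 ≤ L → ∃ T0 C, 0 ≤ C ∧ ∀ T ℓ, T0 ≤ T → Sep N L ℓ (fun j => ctr c Δ j T) → ∀ j < N,
    6 / 7 * (c j * ∫ x, Qc (c j) x ^ 2) ≤
      (∫ x, dens 1 (c j) U T x * cut L ℓ (fun j => ctr c Δ j T) j x)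
      + η * |(∫ x, U 0 T x ^ 2 * cut L ℓ (fun j => ctr c Δ j T) j x) - ∫ x, Qc (c j) x ^ 2|
      + C * exp (-(ℓ / (2 * L)))
      + Kq / L * ((∫ x, U 0 T x ^ 2 * gapw L ℓ (fun j => ctr c Δ j T) N j x)
        + ∫ x, U 0 T x ^ 2 * gapw L ℓ (fun j => ctr c Δ j T) N (j + 1) x) := by
  obtain ⟨Ks, hKs, hs⟩ := exists_forall_lt_le N fun j => 4 * √(c j + 1)
  obtain ⟨Kc, hKc, hcK⟩ := exists_forall_lt_le N c
  obtain ⟨S1, hS1, hS⟩ := exists_forall_lt_le N fun j => Qc (c j) 0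
  obtain ⟨S2, hS2, hS'⟩ := exists_forall_lt_le N fun j => (Qc (c j) 0)⁻¹
  obtain ⟨B, hB, hBx⟩ := h.exists_bumps_le
  obtain ⟨L0, K, hL0, hK, hb⟩ := h.exists_profile_bound
  refine ⟨Ks, hKs, fun η hη hη1 => ⟨L0, hL0, fun L hL => ?_⟩⟩
  have hLp : 0 < L := hL0.trans_le hL
  obtain ⟨δ, hδ, hδ1, hδ2, hδ3⟩ : ∃ δ, 0 < δ ∧ 8 * (δ * S2) ≤ 1 ∧ 6 * (δ * S1 ^ 2) ≤ η ∧ δ ≤ 1 := by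
    refine ⟨min (min (1 / (8 * S2)) (η / (6 * S1 ^ 2))) 1, by positivity, ?_, ?_, min_le_right _ _⟩
    · have := (min_le_left (min (1 / (8 * S2)) (η / (6 * S1 ^ 2))) 1).trans (min_le_left _ _)
      rw [le_div_iff₀ (by positivity)] at this
      linarith
    · have := (min_le_left (min (1 / (8 * S2)) (η / (6 * S1 ^ 2))) 1).trans (min_le_right _ _)
      rw [le_div_iff₀ (by positivity)] at this
      linarith
  obtain ⟨W, hW0, hW⟩ : ∃ W, 0 ≤ W ∧ K * exp (-(W / L)) ≤ δ := by
    have : Tendsto (fun W => K * exp (-(W / L))) atTop (nhds (K * 0)) :=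
      (Real.tendsto_exp_neg_atTop_nhds_zero.comp (tendsto_id.atTop_div_const hLp)).const_mul K
    rw [mul_zero] at this
    obtain ⟨W, h1, h2⟩ := ((this.eventually_le_const hδ).and (eventually_ge_atTop 0)).exists
    exact ⟨W, h2, h1⟩
  obtain ⟨T1, hT1⟩ := h.exists_sup_bound hδ
  obtain ⟨T2, hT2⟩ := h.exists_others_small W hδ
  set A := B + 1 with hA
  set C1 := A ^ 5 * (4 * S2) with hC1
  set C2 := 4 * (√(Kc + 1) * (2 * S1) ^ 2) * (2 * exp (W / L)) with hC2
  refine ⟨max T1 T2, C2 + C1 * (N * (4 * L * K)), by positivity, fun T ℓ hT hsep j hj => ?_⟩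
  have hℓ := hsep.hℓ
  set p : ℕ → ℝ := fun j => ctr c Δ j T with hp
  have hcj := h.pos j hj
  have hS0 := Qc_pos hcj 0
  have cU := h.sol.cont_slice 0 T
  have hT1' := hT1 T ((le_max_left _ _).trans hT)
  have hT2' := hT2 T ((le_max_right _ _).trans hT) j hj
  -- the maximum in the window
  obtain ⟨x₀, hx₀, hmax⟩ := (isCompact_Icc (a := p j - W) (b := p j + W)).exists_isMaxOn
    ⟨p j, by constructor <;> linarith⟩ cU.continuousOn
  have hwin : ∀ x, |x - p j| ≤ W → x ∈ Set.Icc (p j - W) (p j + W) := fun x hx => by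
    rw [abs_le] at hx; constructor <;> linarith
  have hx₀' : |x₀ - p j| ≤ W := by
    rw [abs_le]; constructor <;> linarith [hx₀.1, hx₀.2]
  set s := U 0 T x₀ with hsdef
  have hs1 : Qc (c j) 0 - δ ≤ s := by
    have h1 : U 0 T (p j) ≤ s := hmax (hwin _ (by simpa using hW0))
    have h2 := abs_le.1 (hT1' (p j))
    rw [bumps_eq_add c Δ hj] at h2
    have h3 := h.others_nonneg j T (p j)
    have h4 : bump c Δ j T (p j) = Qc (c j) 0 := by simp [bump, hp]
    linarith [h2.1]
  have hs2 : s ≤ Qc (c j) 0 + 2 * δ := by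
    have h2 := abs_le.1 (hT1' x₀)
    rw [bumps_eq_add c Δ hj] at h2
    have h3 := hT2' x₀ hx₀'
    have h4 : bump c Δ j T x₀ ≤ Qc (c j) 0 := Qc_le_zero hcj _
    linarith [h2.2]
  have hSδ : 8 * δ ≤ Qc (c j) 0 := by
    have := hS' j hj
    have h2 : 8 * (δ * (Qc (c j) 0)⁻¹) ≤ 1 :=
      le_trans (by linarith [mul_le_mul_of_nonneg_left this hδ.le]) hδ1
    have : δ * (Qc (c j) 0)⁻¹ = δ / Qc (c j) 0 := rfl
    rw [this, ← mul_div_assoc, div_le_one hS0] at h2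
    exact h2
  have hs0 : 0 < s := by linarith
  set c' := 2 / 5 * s ^ 3 with hc'
  have hc'0 : 0 < c' := by positivity
  have hSj := hS j hj
  have hcc : |c' - c j| ≤ η := by
    rw [← Qc_zero_cube hcj, hc']
    have e : 2 / 5 * s ^ 3 - 2 / 5 * Qc (c j) 0 ^ 3
        = (s - Qc (c j) 0) * (2 / 5 * (s ^ 2 + s * Qc (c j) 0 + Qc (c j) 0 ^ 2)) := by ring
    rw [e, abs_mul, abs_of_pos (a := 2 / 5 * _) (by positivity)]
    have h1 : |s - Qc (c j) 0| ≤ 2 * δ := abs_le.2 ⟨by linarith, by linarith⟩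
    have h2 : 2 / 5 * (s ^ 2 + s * Qc (c j) 0 + Qc (c j) 0 ^ 2) ≤ 3 * S1 ^ 2 := by
      have : s ≤ 2 * S1 := by linarith
      nlinarith
    have := mul_le_mul h1 h2 (by positivity) (by positivity)
    linarith
  have hc'1 : c' ≤ c j + 1 := by linarith [le_abs_self (c' - c j)]
  have hsQ : s = Qc c' 0 := by
    have h1 := Qc_zero_cube hc'0
    have : Qc c' 0 ^ 3 = s ^ 3 := by linarith
    exact ((pow_left_inj₀ (Qc_pos hc'0 0).le hs0.le (by norm_num)).1 this).symm
  -- calibration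
  set χ := cut L ℓ p j with hχ
  have χm := fun x => cut_mem (p := p) hLp hℓ j x
  have bd : ∀ x, |cutd L ℓ p j x| ≤ 2 / L * (gapw L ℓ p N j x + gapw L ℓ p N (j + 1) x) :=
    fun x => hsep.abs_cutd_le hj x
  have g1 := fun x => hsep.gapw_mem (g := j) hj.le x
  have g2 := fun x => hsep.gapw_mem (g := j + 1) hj x
  have cal := calibration hc'0.le (fun x => h.sol.dx 0 T x) (h.sol.cont_slice 1 T) (h.sol.sq 0 T)
    (h.sol.sq 1 T) (hasDerivAt_cut L ℓ p j) (continuous_cutd L ℓ p j) (fun x => (χm x).1)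
    (fun x => (χm x).2) (K := 2 / L * 2) (fun x => (bd x).trans (mul_le_mul_of_nonneg_left
      (by linarith [(g1 x).2, (g2 x).2]) (by positivity))) x₀
  have c0 := h.sol.cont_slice 0 T
  have c1 := h.sol.cont_slice 1 T
  have cχ := continuous_cut L ℓ p j
  have imul : ∀ f w : ℝ → ℝ, Integrable f → Continuous w → (∀ x, 0 ≤ w x ∧ w x ≤ 1) →
      Integrable fun x => f x * w x := fun f w hf hw hw1 =>
    hf.mul_bdd (c := 1) hw.aestronglyMeasurable (ae_of_all _ fun x => by
      rw [Real.norm_eq_abs, abs_of_nonneg (hw1 x).1]; exact (hw1 x).2)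
  -- the boundary term
  have bt : ∫ x, U 0 T x ^ 2 * |cutd L ℓ p j x| ≤ 2 / L *
      ((∫ x, U 0 T x ^ 2 * gapw L ℓ p N j x) + ∫ x, U 0 T x ^ 2 * gapw L ℓ p N (j + 1) x) := by
    have i1 := imul _ _ (h.sol.sq 0 T) (continuous_gapw L ℓ p N j) g1
    have i2 := imul _ _ (h.sol.sq 0 T) (continuous_gapw L ℓ p N (j + 1)) g2
    rw [← integral_add i1 i2, ← integral_const_mul]
    refine integral_mono_of_nonneg (ae_of_all _ fun x => by positivity)
      ((i1.add i2).const_mul _) (ae_of_all _ fun x => ?_)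
    have := mul_le_mul_of_nonneg_left (bd x) (sq_nonneg (U 0 T x))
    simp only []
    linarith
  -- the bulk term
  set R : ℝ → ℝ := fun x => ∑ i ∈ (Finset.range N).erase j, bump c Δ i T x with hR
  have cR : Continuous R := continuous_finsetSum _ fun i _ => continuous_bump c Δ i T
  have iR1 : ∀ i ∈ (Finset.range N).erase j, (Integrable fun x => bump c Δ i T x * χ x) ∧
      |∫ x, bump c Δ i T x * χ x| ≤ 4 * L * K * exp (-(ℓ / (2 * L))) := fun i hi => by
    obtain ⟨hij, hi⟩ := Finset.mem_erase.1 hi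
    rw [Finset.mem_range] at hi
    refine integral_bump_le (ω := χ) hLp (continuous_bump c Δ i T) cχ (fun x => ?_)
      (fun x => (χm x).1) (fun x => (χm x).2) (fun x => hsep.cut_small hj hi hij x)
    obtain ⟨h1, h2, -⟩ := hb L hL i hi T x
    rw [abs_of_pos h1]; exact h2
  have eR : (fun x => R x * χ x) = fun x => ∑ i ∈ (Finset.range N).erase j, bump c Δ i T x * χ x := by
    ext x; simp only [hR, Finset.sum_mul]
  have iR : Integrable fun x => R x * χ x := by
    rw [eR]; exact integrable_finsetSum _ fun i hi => (iR1 i hi).1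
  have bR : ∫ x, R x * χ x ≤ N * (4 * L * K) * exp (-(ℓ / (2 * L))) := by
    rw [eR, integral_finsetSum _ fun i hi => (iR1 i hi).1]
    refine (Finset.sum_le_card_nsmul _ _ _ fun i hi =>
      (le_abs_self _).trans (iR1 i hi).2).trans ?_
    rw [nsmul_eq_mul]
    have h1 := Finset.card_erase_le (s := Finset.range N) (a := j)
    rw [Finset.card_range] at h1
    have h2 : (((Finset.range N).erase j).card : ℝ) ≤ N := by exact_mod_cast h1
    have h3 : 0 ≤ 4 * L * K * exp (-(ℓ / (2 * L))) := by positivity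
    have := mul_le_mul_of_nonneg_right h2 h3
    linarith
  have iE := imul _ _ (h.integrable_dens 1 (c j) T) cχ χm
  have iM := imul _ _ (h.sol.sq 0 T) cχ χm
  have bulk : (∫ x, (U 1 T x ^ 2 + max 0 (c' * U 0 T x ^ 2 - 2 / 5 * |U 0 T x| ^ 5)) * χ x) ≤
      (∫ x, dens 1 (c j) U T x * χ x) + (c' - c j) * (∫ x, U 0 T x ^ 2 * χ x)
        + C1 * ∫ x, R x * χ x := by
    have i3 : Integrable fun x => dens 1 (c j) U T x * χ x + (c' - c j) * (U 0 T x ^ 2 * χ x) :=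
      iE.fun_add (iM.const_mul _)
    rw [← integral_const_mul, ← integral_const_mul, ← integral_add iE (iM.const_mul _),
      ← integral_add i3 (iR.const_mul _)]
    refine integral_mono_of_nonneg (ae_of_all _ fun x =>
      mul_nonneg (add_nonneg (sq_nonneg _) (le_max_left _ _)) (χm x).1)
      (i3.fun_add (iR.const_mul _)) (ae_of_all _ fun x => ?_)
    have hbp := (h.bump_pos hj T x).le
    have hd := hT1' x
    have hRx := h.others_nonneg j T x
    have hU : |U 0 T x| ≤ A := by
      have := abs_le.1 hd
      have := hBx T x
      have := h.bumps_nonneg T x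
      rw [abs_le]; constructor <;> linarith
    rw [bumps_eq_add c Δ hj] at hd
    have key := calibrated_le (s := s) (A := A) hRx hs0 (by linarith) hd hU (by
      rcases le_or_gt |x - p j| W with hx | hx
      · exact Or.inl (hmax (hwin x hx))
      · refine Or.inr ((hb L hL j hj T x).2.1.trans (le_trans ?_ hW))
        exact mul_le_mul_of_nonneg_left (exp_le_exp.2 (neg_le_neg
          (div_le_div_of_nonneg_right hx.le hLp.le))) hK.le) hbp
    have hC : A ^ 5 * (2 / s) * R x ≤ C1 * R x := by
      refine mul_le_mul_of_nonneg_right (mul_le_mul_of_nonneg_left ?_ (by positivity)) hRx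
      have h1 : (Qc (c j) 0)⁻¹ ≤ S2 := hS' j hj
      have h2 : s⁻¹ ≤ 2 * (Qc (c j) 0)⁻¹ := by
        rw [← div_eq_mul_inv, inv_le_comm₀ hs0 (by positivity), inv_div]; linarith
      rw [div_eq_mul_inv]; linarith
    have := mul_le_mul_of_nonneg_right (add_le_add_right (key.trans (add_le_add_right hC _))
      (U 1 T x ^ 2)) (χm x).1
    refine this.trans (le_of_eq ?_)
    simp only [dens, hc', hR]
    ring
  -- conclusion
  have conv := reduced_energy_convex hcj hc'0
  have e4 : 4 * calh c' s = 6 / 7 * (c' * ∫ x, Qc c' x ^ 2) := by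
    rw [hsQ, four_calh hc'0, integral_Qd_sq hc'0]; ring
  have hcut : 4 * calh c' s * (1 - χ x₀) ≤ C2 * exp (-(ℓ / (2 * L))) := by
    have h1 : 4 * calh c' s ≤ 4 * (√(Kc + 1) * (2 * S1) ^ 2) := by
      have := (le_abs_self _).trans (abs_calh_le hc'0.le s)
      have h2 : √c' ≤ √(Kc + 1) := Real.sqrt_le_sqrt (by linarith [hcK j hj])
      have h3 : s ^ 2 ≤ (2 * S1) ^ 2 := pow_le_pow_left₀ hs0.le (by linarith) 2
      have := mul_le_mul h2 h3 (sq_nonneg _) (Real.sqrt_nonneg _)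
      linarith
    have h2 : 1 - χ x₀ ≤ 2 * exp (W / L) * exp (-(ℓ / (2 * L))) := by
      refine (hsep.one_sub_cut_le j x₀).trans ?_
      rw [mul_assoc, ← exp_add]
      refine mul_le_mul_of_nonneg_left (exp_le_exp.2 ?_) (by norm_num)
      have e1 : -((ℓ - |x₀ - p j|) / L) = |x₀ - p j| / L - 2 * (ℓ / (2 * L)) := by
        field_simp
        ring
      have e2 : |x₀ - p j| / L ≤ W / L := div_le_div_of_nonneg_right hx₀' hLp.le
      have e3 : 0 ≤ ℓ / (2 * L) := by positivity
      simp only [e1]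
      linarith
    have := mul_le_mul h1 h2 (by linarith [(χm x₀).2]) (by positivity)
    rw [hC2]; linarith
  have hq : 2 * √c' * ∫ x, U 0 T x ^ 2 * |cutd L ℓ p j x| ≤ Ks / L *
      ((∫ x, U 0 T x ^ 2 * gapw L ℓ p N j x) + ∫ x, U 0 T x ^ 2 * gapw L ℓ p N (j + 1) x) := by
    set G := (∫ x, U 0 T x ^ 2 * gapw L ℓ p N j x) + ∫ x, U 0 T x ^ 2 * gapw L ℓ p N (j + 1) x
    have hG : 0 ≤ G := add_nonneg (integral_nonneg fun x => mul_nonneg (sq_nonneg _) (g1 x).1)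
      (integral_nonneg fun x => mul_nonneg (sq_nonneg _) (g2 x).1)
    have h2 : 4 * √c' ≤ Ks := by
      have := hs j hj
      have : √c' ≤ √(c j + 1) := Real.sqrt_le_sqrt hc'1
      linarith [hs j hj]
    calc 2 * √c' * ∫ x, U 0 T x ^ 2 * |cutd L ℓ p j x| ≤ 2 * √c' * (2 / L * G) :=
          mul_le_mul_of_nonneg_left bt (by positivity)
      _ = 4 * √c' * (G / L) := by ring
      _ ≤ Ks * (G / L) := mul_le_mul_of_nonneg_right h2 (by positivity)
      _ = Ks / L * G := by ring
  have hη2 : (c' - c j) * ((∫ x, U 0 T x ^ 2 * χ x) - ∫ x, Qc (c j) x ^ 2) ≤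
      η * |(∫ x, U 0 T x ^ 2 * χ x) - ∫ x, Qc (c j) x ^ 2| := by
    refine (le_abs_self _).trans ?_
    rw [abs_mul]
    exact mul_le_mul_of_nonneg_right hcc (abs_nonneg _)
  have hC1R := mul_le_mul_of_nonneg_left bR (by positivity : 0 ≤ C1)
  have : 4 * calh c' s = 4 * calh c' s * (1 - χ x₀) + 4 * (calh c' s * χ x₀) := by ring
  linarith
end Out

/-! ### The algebra of gaps -/

lemma gap_chain {N : ℕ} (hN : 0 < N) {c lam a b α β : ℕ → ℝ} {θ m K ε ξ Tt : ℝ} (hm : 0 < m)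
    (hK : 0 ≤ K)
    (hlam : ∀ j < N, 0 < lam j ∧ lam j ≤ K ∧ 2 * m ≤ lam j * c j)
    (hε0 : 0 ≤ ε) (hε : ∀ j < N, 2 * ε ≤ c j)
    (hd : ∀ j, j + 1 < N → 0 ≤ lam (j + 1) - lam j ∧ lam (j + 1) - lam j ≤ K ∧
      m ≤ lam (j + 1) * c (j + 1) - lam j * c j - θ * (lam (j + 1) - lam j) ∧
      lam (j + 1) * c (j + 1) - lam j * c j - θ * (lam (j + 1) - lam j) ≤ K)
    (hξ : 0 ≤ ξ) (ha0 : a 0 = 0) (hb0 : b 0 = 0) (haN : a N = -α N) (hbN : b N = -β N)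
    (hα : ∀ g ≤ N, 0 ≤ α g) (hβ : ∀ g ≤ N, -(ε * α g) - ξ ≤ β g)
    (hag : ∀ g, 0 < g → g < N → -ξ ≤ a g ∧ -ξ ≤ b g + θ * a g)
    (hS : ∀ j < N, -(ε * |a (j + 1) - a j - α j|) - ξ - ε * (α j + α (j + 1)) ≤
      (b (j + 1) - b j - β j) + c j * (a (j + 1) - a j - α j))
    (hTt : Tt = ∑ g ∈ Finset.range (N + 1), (|a g| + α g)) :
    m * Tt ≤ 20 * (N + 1) * K * (ξ + ε * Tt) := by
  have hpos : ∀ g ≤ N, 0 ≤ |a g| + α g := fun g hg => add_nonneg (abs_nonneg _) (hα g hg)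
  have hle : ∀ g ≤ N, |a g| + α g ≤ Tt := fun g hg => by
    rw [hTt]
    exact Finset.single_le_sum (f := fun g => |a g| + α g)
      (fun i hi => hpos i (by rw [Finset.mem_range] at hi; omega)) (by simp; omega)
  have hTt0 : 0 ≤ Tt := (hpos 0 (Nat.zero_le _)).trans (hle 0 (Nat.zero_le _))
  have hεTt : 0 ≤ ε * Tt := mul_nonneg hε0 hTt0
  set R := ξ + ε * Tt with hR
  have hR0 : 0 ≤ R := by positivity
  have hξR : ξ ≤ R := by linarith
  have hKR : 0 ≤ K * R := by positivity
  have stepS : ∀ j < N, -(5 * K * R) ≤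
      lam j * ((b (j + 1) - b j - β j) + c j * (a (j + 1) - a j - α j)) := fun j hj => by
    obtain ⟨h1, h2, -⟩ := hlam j hj
    have h3 := hS j hj
    have h4 : |a (j + 1) - a j - α j| ≤ |a (j + 1)| + |a j| + α j := by
      have e1 := abs_sub (a (j + 1) - a j) (α j)
      have e2 := abs_sub (a (j + 1)) (a j)
      rw [abs_of_nonneg (hα j hj.le)] at e1
      linarith
    have h5 := hle j hj.le
    have h6 := hle (j + 1) hj
    have n1 := abs_nonneg (a j)
    have n2 := hα j hj.le
    have h7 : ε * |a (j + 1) - a j - α j| + ε * (α j + α (j + 1)) ≤ 5 * (ε * Tt) := by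
      have : ε * (|a (j + 1) - a j - α j| + (α j + α (j + 1))) ≤ ε * (5 * Tt) :=
        mul_le_mul_of_nonneg_left (by linarith) hε0
      linarith
    have h8 : -(5 * R) ≤ (b (j + 1) - b j - β j) + c j * (a (j + 1) - a j - α j) := by linarith
    have h9 := mul_le_mul_of_nonneg_left h8 h1.le
    have h10 := mul_le_mul_of_nonneg_right h2 hR0
    linarith
  have stepα : ∀ j < N, ∀ g ≤ N, m * α g - K * R ≤ lam j * (β g + c j * α g) := fun j hj g hg => by
    obtain ⟨h1, h2, h3⟩ := hlam j hj
    have h4 := hβ g hg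
    have h5 := mul_le_mul_of_nonneg_right (hε j hj) (hα g hg)
    have h6 := mul_le_mul_of_nonneg_left (by linarith : c j * α g / 2 - ξ ≤ β g + c j * α g) h1.le
    have h7 := mul_le_mul_of_nonneg_right h3 (hα g hg)
    have h8 := mul_le_mul h2 hξR hξ hK
    linarith
  have key : ∀ n, n < N → m * ∑ g ∈ Finset.range (n + 1), (|a g| + α g) ≤
      lam n * (b (n + 1) + c n * a (n + 1)) + 9 * (n + 1) * (K * R) := by
    intro n
    induction n with
    | zero =>
      intro h0
      have h1 := stepS 0 h0
      have h2 := stepα 0 h0 0 (Nat.zero_le _)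
      simp only [zero_add, Finset.range_one, Finset.sum_singleton, ha0, hb0, abs_zero] at h1 ⊢
      push_cast
      linarith
    | succ n ih =>
      intro hn
      have h0 := ih (by omega)
      have h1 := stepS (n + 1) hn
      have h2 := stepα (n + 1) hn (n + 1) hn.le
      obtain ⟨d0, d1, d2, d3⟩ := hd n hn
      obtain ⟨a1, a2⟩ := hag (n + 1) (by omega) hn
      set d := lam (n + 1) - lam n with hdd
      set q := lam (n + 1) * c (n + 1) - lam n * c n - θ * d with hq
      have h3 : d * (b (n + 1) + θ * a (n + 1)) + q * a (n + 1)
          = (lam (n + 1) * b (n + 1) + lam (n + 1) * c (n + 1) * a (n + 1))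
            - lam n * (b (n + 1) + c n * a (n + 1)) := by rw [hq, hdd]; ring
      have h4 := mul_le_mul_of_nonneg_left a2 d0
      have h5 : m * |a (n + 1)| - 2 * (q * ξ) ≤ q * a (n + 1) := by
        have e1 := mul_le_mul_of_nonneg_right d2 (abs_nonneg (a (n + 1)))
        have e2 : |a (n + 1)| - 2 * ξ ≤ a (n + 1) := by
          rcases abs_cases (a (n + 1)) with ⟨e, _⟩ | ⟨e, _⟩ <;> linarith
        have e3 := mul_le_mul_of_nonneg_left e2 (hm.le.trans d2)
        linarith
      have h6 := mul_le_mul d1 hξR hξ hK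
      have h7 := mul_le_mul d3 hξR hξ hK
      rw [Finset.sum_range_succ]
      push_cast
      linarith
  obtain ⟨n, rfl⟩ : ∃ n, N = n + 1 := ⟨N - 1, by omega⟩
  have h1 := key n (by omega)
  have h2 := stepα n (by omega) (n + 1) le_rfl
  have hn1 := hα (n + 1) le_rfl
  rw [haN, hbN] at h1
  rw [Finset.sum_range_succ, haN, abs_neg, abs_of_nonneg hn1] at hTt
  set Tn := ∑ g ∈ Finset.range (n + 1), (|a g| + α g)
  have hTn : 0 ≤ Tn := Finset.sum_nonneg fun i hi =>
    hpos i (by rw [Finset.mem_range] at hi; omega)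
  have h3 : m * Tn + m * α (n + 1) ≤ (9 * (n + 1) + 1) * (K * R) := by linarith
  have h4 : m * Tt ≤ 2 * (m * Tn + m * α (n + 1)) := by
    rw [hTt]
    have := mul_nonneg hm.le hTn
    linarith
  push_cast
  have h5 : 0 ≤ (n:ℝ) * (K * R) := by positivity
  linarith

/-- Small perturbations in the gaps force all the gap masses to be controlled by the errors. -/
lemma exists_gap_bound {N : ℕ} (hN : 0 < N) {c : ℕ → ℝ} (hc : ∀ j < N, 0 < c j)
    (hdec : ∀ i j, i < j → j < N → c j < c i) : ∃ θ ε K, 0 < θ ∧ 0 < ε ∧ 0 < K ∧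
    ∀ (a b α β : ℕ → ℝ) (ξ : ℝ), 0 ≤ ξ → a 0 = 0 → b 0 = 0 → a N = -α N → b N = -β N →
    (∀ g ≤ N, 0 ≤ α g) → (∀ g ≤ N, -(ε * α g) - ξ ≤ β g) →
    (∀ g, 0 < g → g < N → -ξ ≤ a g ∧ -ξ ≤ b g + θ * a g) →
    (∀ j < N, -(ε * |a (j + 1) - a j - α j|) - ξ - ε * (α j + α (j + 1)) ≤
      (b (j + 1) - b j - β j) + c j * (a (j + 1) - a j - α j)) →
    ∀ g ≤ N, α g ≤ K * ξ := by
  obtain ⟨A, hA, hcA⟩ := exists_forall_lt_le N fun j => (c j)⁻¹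
  set θ := A⁻¹ / 4 with hθ
  have hθ0 : 0 < θ := by positivity
  have hcθ : ∀ j < N, 4 * θ ≤ c j := fun j hj => by
    have := hcA j hj
    rw [inv_le_comm₀ (hc j hj) hA] at this
    linarith
  set lam : ℕ → ℝ := fun j => (c j ^ 2)⁻¹ with hlam
  set q : ℕ → ℝ := fun j => lam (j + 1) * c (j + 1) - lam j * c j - θ * (lam (j + 1) - lam j) with hq
  have hd : ∀ j, j + 1 < N → 0 < lam (j + 1) - lam j ∧ 0 < q j := fun j hj => by
    have h1 := hc j (by omega)
    have h2 := hc (j + 1) hj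
    have h3 := hdec j (j + 1) (by omega) hj
    have h4 := hcθ (j + 1) hj
    have e1 : lam (j + 1) - lam j
        = ((c (j + 1))⁻¹ - (c j)⁻¹) * ((c (j + 1))⁻¹ + (c j)⁻¹) := by
      simp only [hlam, ← inv_pow]; ring
    have e2 : q j = ((c (j + 1))⁻¹ - (c j)⁻¹) * (1 - θ * ((c (j + 1))⁻¹ + (c j)⁻¹)) := by
      simp only [hq]
      rw [e1]
      simp only [hlam]
      field_simp
    have h5 : (c j)⁻¹ < (c (j + 1))⁻¹ := inv_strictAnti₀ h2 h3
    have h6 : 0 < (c (j + 1))⁻¹ := by positivity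
    have h7 : 0 < (c j)⁻¹ := by positivity
    have h8 : θ * (c (j + 1))⁻¹ ≤ 1 / 4 := by
      rw [← div_eq_mul_inv, div_le_iff₀ h2]; linarith
    have h9 := mul_le_mul_of_nonneg_left h5.le hθ0.le
    rw [e1, e2]
    exact ⟨mul_pos (by linarith) (by linarith), mul_pos (by linarith) (by linarith)⟩
  obtain ⟨K1, hK1, h1⟩ := exists_forall_lt_le N lam
  obtain ⟨K2, hK2, h2⟩ := exists_forall_lt_le N fun j => lam (j + 1) - lam j
  obtain ⟨K3, hK3, h3⟩ := exists_forall_lt_le N q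
  obtain ⟨m1, hm1, h4⟩ := exists_forall_lt_le N fun j => (lam j * c j)⁻¹
  obtain ⟨m2, hm2, h5⟩ := exists_forall_lt_le N fun j => (q j)⁻¹
  set K := K1 + K2 + K3 with hK
  have hK0 : 0 < K := by positivity
  set m := min (m1⁻¹ / 2) m2⁻¹ with hm
  have hm0 : 0 < m := by positivity
  set ε := min (2 * θ) (m / (40 * (N + 1) * K)) with hε
  have hε0 : 0 < ε := by positivity
  have hεm : ε * (40 * (N + 1) * K) ≤ m := by
    rw [← le_div_iff₀ (by positivity)]; exact min_le_right _ _
  refine ⟨θ, ε, 40 * (N + 1) * K / m, hθ0, hε0, by positivity, ?_⟩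
  intro a b α β ξ hξ ha0 hb0 haN hbN hα hβ hag hS g hg
  have fin := gap_chain hN (c := c) (lam := lam) (θ := θ) (m := m) (K := K) (ε := ε) hm0 hK0.le
    (fun j hj => by
      have hl : 0 < lam j := by have := hc j hj; simp only [hlam]; positivity
      refine ⟨hl, by linarith [h1 j hj], ?_⟩
      have := h4 j hj
      rw [inv_le_comm₀ (mul_pos hl (hc j hj)) hm1] at this
      have : m ≤ m1⁻¹ / 2 := min_le_left _ _
      linarith) hε0.le
    (fun j hj => by
      have : ε ≤ 2 * θ := min_le_left _ _
      linarith [hcθ j hj])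
    (fun j hj => by
      obtain ⟨e1, e2⟩ := hd j hj
      refine ⟨e1.le, by linarith [h2 j (by omega)], ?_, by linarith [h3 j (by omega)]⟩
      have := h5 j (by omega)
      rw [inv_le_comm₀ e2 hm2] at this
      exact (min_le_right _ _).trans this)
    hξ ha0 hb0 haN hbN hα hβ hag hS rfl
  set Tt := ∑ g ∈ Finset.range (N + 1), (|a g| + α g)
  have hle : α g ≤ Tt := by
    refine le_trans (le_add_of_nonneg_left (abs_nonneg (a g)))
      (Finset.single_le_sum (f := fun g => |a g| + α g) (fun i hi => ?_) (by simp; omega))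
    exact add_nonneg (abs_nonneg _) (hα i (by rw [Finset.mem_range] at hi; omega))
  have hTt0 : 0 ≤ Tt := (hα g hg).trans hle
  have e1 := mul_le_mul_of_nonneg_right hεm hTt0
  rw [div_mul_eq_mul_div, le_div_iff₀ hm0]
  have e2 := mul_le_mul_of_nonneg_right hle hm0.le
  linarith

lemma integrable_mul_unit {f w : ℝ → ℝ} (hf : Integrable f) (hw : Continuous w)
    (h : ∀ x, 0 ≤ w x ∧ w x ≤ 1) : Integrable fun x => f x * w x :=
  hf.mul_bdd (c := 1) hw.aestronglyMeasurable (ae_of_all _ fun x => by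
    rw [Real.norm_eq_abs, abs_of_nonneg (h x).1]; exact (h x).2)

namespace Out

variable {N : ℕ} {c Δ : ℕ → ℝ} {U : ℕ → ℝ → ℝ → ℝ}

lemma edge_lower (h : Out N c Δ U) {μ ν : ℝ} (hμ : 0 ≤ μ) (hμ1 : μ ≤ 1) (hν : 0 < ν) :
    ∃ L0, 0 < L0 ∧ ∀ L, L0 ≤ L → ∃ T0 C, 0 ≤ C ∧ ∀ T ℓ g, T0 ≤ T → 0 < g → g ≤ N →
      (∀ i, g ≤ i → i < N → ctr c Δ i T + 2 * ℓ ≤ ctr c Δ (g - 1) T) →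
      (∑ j ∈ Finset.range g, (μ * (-(1 / 7) * (c j * ∫ x, Qc (c j) x ^ 2)) + ν * ∫ x, Qc (c j) x ^ 2))
        ≤ (∫ x, dens μ ν U T x * lg L (x - (ctr c Δ (g - 1) T - ℓ))) + C * exp (-(ℓ / (2 * L))) := by
  obtain ⟨κ, hκ, hκc, hg⟩ := h.exists_gap
  obtain ⟨T1, hT1, hs⟩ := exists_separation Δ hκ hg
  obtain ⟨Kc, hKc, hcK⟩ := exists_forall_lt_le N c
  obtain ⟨L0, hL0, hmon⟩ := h.almost_monotone hμ hμ1 hν hκ (σ' := Kc) hKc.le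
  refine ⟨L0, hL0, fun L hL => ?_⟩
  obtain ⟨T0, C, hC, hmon⟩ := hmon L hL
  refine ⟨max T0 T1, C, hC, fun T ℓ g hT hg0 hgN hsep => ?_⟩
  have hT1' : T1 ≤ T := (le_max_right _ _).trans hT
  have key := hmon g (c (g - 1) - κ) (Δ (g - 1) + κ * T - ℓ) ℓ T ((le_max_left _ _).trans hT)
    { le := hgN
      low := by linarith [hκc (g - 1) (by omega)]
      up := by linarith [hcK (g - 1) (by omega)]
      right := fun τ hτ i hi => by
        have h1 : ctr c Δ (g - 1) τ ≤ ctr c Δ i τ := by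
          rcases Nat.lt_or_ge i (g - 1) with h1 | h1
          · have := hs τ (hT1'.trans hτ) i (g - 1) h1 (by omega)
            have : 0 ≤ κ * τ := mul_nonneg hκ.le (by linarith)
            linarith
          · rw [show i = g - 1 by omega]
        refine le_trans (le_of_eq ?_) h1
        unfold ctr; ring
      left := fun τ hτ i hi hiN => by
        have h1 := hsep i hi hiN
        have h2 := hg (g - 1) i (by omega) hiN
        have h3 := mul_le_mul_of_nonneg_right h2 (sub_nonneg.2 hτ)
        unfold ctr at h1 ⊢
        linarith }
  have e : (c (g - 1) - κ) * T + (Δ (g - 1) + κ * T - ℓ) = ctr c Δ (g - 1) T - ℓ := by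
    unfold ctr; ring
  rwa [e] at key

lemma gap_energy_lower (h : Out N c Δ U) {ε : ℝ} (hε : 0 < ε) : ∃ L0, 0 < L0 ∧ ∀ L, L0 ≤ L →
    ∃ T0 C, 0 ≤ C ∧ ∀ T ℓ, T0 ≤ T → Sep N L ℓ (fun j => ctr c Δ j T) → ∀ g ≤ N,
    -(ε * ∫ x, U 0 T x ^ 2 * gapw L ℓ (fun j => ctr c Δ j T) N g x) - C * exp (-(ℓ / (2 * L)))
      ≤ ∫ x, Sol.eden U T x * gapw L ℓ (fun j => ctr c Δ j T) N g x := by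
  obtain ⟨B, hB, hBx⟩ := h.exists_bumps_le
  obtain ⟨L0, K, hL0, hK, hb⟩ := h.exists_profile_bound
  obtain ⟨η, C, hη, hC, habs⟩ := exists_absorption hB.le hε
  obtain ⟨T0, hT0⟩ := h.exists_sup_bound hη
  refine ⟨L0, hL0, fun L hL => ⟨T0, C * (N * (4 * L * K)), by
    have : 0 < L := hL0.trans_le hL
    positivity, fun T ℓ hT hsep g hg => ?_⟩⟩
  have hLp := hsep.hL
  set w := gapw L ℓ (fun j => ctr c Δ j T) N g with hw
  have cw : Continuous w := continuous_gapw _ _ _ _ _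
  have wm := fun x => hsep.gapw_mem hg x
  have ib : ∀ i ∈ Finset.range N, (Integrable fun x => bump c Δ i T x * w x) ∧
      |∫ x, bump c Δ i T x * w x| ≤ 4 * L * K * exp (-(ℓ / (2 * L))) := fun i hi => by
    rw [Finset.mem_range] at hi
    refine integral_bump_le (ω := w) hLp (continuous_bump c Δ i T) cw (fun x => ?_)
      (fun x => (wm x).1) (fun x => (wm x).2) (fun x => hsep.gapw_small hg hi x)
    obtain ⟨h1, h2, -⟩ := hb L hL i hi T x
    rw [abs_of_pos h1]; exact h2
  have eR : (fun x => bumps c Δ N T x * w x) = fun x => ∑ i ∈ Finset.range N, bump c Δ i T x * w x := by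
    ext x; simp only [bumps, Finset.sum_mul]
  have iR : Integrable fun x => bumps c Δ N T x * w x := by
    rw [eR]; exact integrable_finsetSum _ fun i hi => (ib i hi).1
  have bR : ∫ x, bumps c Δ N T x * w x ≤ N * (4 * L * K * exp (-(ℓ / (2 * L)))) := by
    rw [eR, integral_finsetSum _ fun i hi => (ib i hi).1]
    refine (Finset.sum_le_card_nsmul _ _ _ fun i hi =>
      (le_abs_self _).trans (ib i hi).2).trans ?_
    rw [nsmul_eq_mul, Finset.card_range]
  have iM := integrable_mul_unit (h.sol.sq 0 T) cw wm
  have iE := integrable_mul_unit (integrable_eden h.sol T) cw wm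
  have iS : Integrable fun x => -(ε * (U 0 T x ^ 2 * w x)) - C * (bumps c Δ N T x * w x) :=
    (iM.const_mul ε).neg.sub (iR.const_mul C)
  have : (∫ x, (-(ε * (U 0 T x ^ 2 * w x)) - C * (bumps c Δ N T x * w x))) ≤
      ∫ x, Sol.eden U T x * w x := by
    refine integral_mono iS iE fun x => ?_
    have h0 := h.bumps_nonneg T x
    have h1 : |U 0 T x| ≤ bumps c Δ N T x + η := by
      have := abs_le.1 (hT0 T hT x)
      rw [abs_le]; constructor <;> linarith
    have h2 := (habs _ _ h0 (hBx T x) h1).1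
    have h3 : U 0 T x ^ 5 ≤ |U 0 T x| ^ 5 := by rw [← abs_pow]; exact le_abs_self _
    have h4 : 0 ≤ |U 0 T x| ^ 5 := by positivity
    have h5 : -(ε * U 0 T x ^ 2 + C * bumps c Δ N T x) ≤ Sol.eden U T x := by
      unfold Sol.eden
      linarith [sq_nonneg (U 1 T x)]
    have := mul_le_mul_of_nonneg_right h5 (wm x).1
    simp only []
    linarith
  have iN : Integrable fun x => -(ε * (U 0 T x ^ 2 * w x)) := (iM.const_mul ε).neg
  rw [integral_sub iN (iR.const_mul C), integral_neg, integral_const_mul,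
    integral_const_mul] at this
  have := mul_le_mul_of_nonneg_left bR hC
  linarith

/-- The mass in the gaps between the solitons is exponentially small. -/
lemma gap_decay (h : Out N c Δ U) (hN : 0 < N) : ∃ L0, 0 < L0 ∧ ∀ L, L0 ≤ L →
    ∃ T0 C, 0 ≤ C ∧ ∀ T ℓ, T0 ≤ T → Sep N L ℓ (fun j => ctr c Δ j T) → ∀ g ≤ N,
    ∫ x, U 0 T x ^ 2 * gapw L ℓ (fun j => ctr c Δ j T) N g x ≤ C * exp (-(ℓ / (2 * L))) := by
  obtain ⟨θ, ε, K, hθ, hε, hK, hgap⟩ := exists_gap_bound hN h.pos h.dec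
  obtain ⟨Kq, hKq, hsol⟩ := h.soliton_lower
  obtain ⟨L1, hL1, hsol⟩ := hsol (min ε 1) (by positivity) (min_le_right _ _)
  obtain ⟨L2, hL2, hen⟩ := h.gap_energy_lower hε
  obtain ⟨L3, hL3, hmass⟩ := h.edge_lower (μ := 0) (ν := 1) le_rfl zero_le_one one_pos
  obtain ⟨L4, hL4, hed⟩ := h.edge_lower (μ := 1) (ν := θ) zero_le_one le_rfl hθ
  refine ⟨L1 + L2 + L3 + L4 + Kq / ε, by positivity, fun L hL => ?_⟩
  have hq0 : 0 < Kq / ε := by positivity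
  have hLp : 0 < L := by linarith
  have hq : Kq / L ≤ ε := by
    rw [div_le_iff₀ hLp, ← div_le_iff₀' hε]; linarith
  obtain ⟨T1, C1, hC1, hsol⟩ := hsol L (by linarith)
  obtain ⟨T2, C2, hC2, hen⟩ := hen L (by linarith)
  obtain ⟨T3, C3, hC3, hmass⟩ := hmass L (by linarith)
  obtain ⟨T4, C4, hC4, hed⟩ := hed L (by linarith)
  set C := C1 + C2 + C3 + C4 with hC
  refine ⟨max (max T1 T2) (max T3 T4), K * C, by positivity, fun T ℓ hT hsep => ?_⟩
  simp only [max_le_iff] at hT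
  obtain ⟨⟨hT1, hT2⟩, hT3, hT4⟩ := hT
  have hℓ := hsep.hℓ
  set p : ℕ → ℝ := fun j => ctr c Δ j T with hp
  set e := exp (-(ℓ / (2 * L))) with he
  have he0 : 0 < e := exp_pos _
  set M : ℕ → ℝ := fun j => ∫ x, Qc (c j) x ^ 2 with hM
  have cR := continuous_edR L ℓ p
  have cL := continuous_edL L ℓ p N
  have im := h.sol.sq 0 T
  have ie := integrable_eden h.sol T
  have imR := fun g => integrable_mul_unit im (cR g) (edR_mem g)
  have ieR := fun g => integrable_mul_unit ie (cR g) (edR_mem g)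
  have imL := fun g => integrable_mul_unit im (cL g) (edL_mem g)
  have ieL := fun g => integrable_mul_unit ie (cL g) (edL_mem g)
  set a : ℕ → ℝ := fun g => (∫ x, U 0 T x ^ 2 * edR L ℓ p g x) - ∑ i ∈ Finset.range g, M i with ha
  set b : ℕ → ℝ := fun g => (∫ x, Sol.eden U T x * edR L ℓ p g x)
    - ∑ i ∈ Finset.range g, -(1 / 7) * (c i * M i) with hb
  set α : ℕ → ℝ := fun g => ∫ x, U 0 T x ^ 2 * gapw L ℓ p N g x with hα
  set β : ℕ → ℝ := fun g => ∫ x, Sol.eden U T x * gapw L ℓ p N g x with hβ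
  have eα : ∀ g, α g = (∫ x, U 0 T x ^ 2 * edL L ℓ p N g x) - ∫ x, U 0 T x ^ 2 * edR L ℓ p g x :=
    fun g => by
      rw [← integral_sub (imL g) (imR g)]
      exact integral_congr_ae (ae_of_all _ fun x => by simp only [gapw]; ring)
  have eβ : ∀ g, β g = (∫ x, Sol.eden U T x * edL L ℓ p N g x)
      - ∫ x, Sol.eden U T x * edR L ℓ p g x := fun g => by
    rw [← integral_sub (ieL g) (ieR g)]
    exact integral_congr_ae (ae_of_all _ fun x => by simp only [gapw]; ring)
  have e1 : C1 * e ≤ C * e := mul_le_mul_of_nonneg_right (by linarith) he0.le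
  have e2 : C2 * e ≤ C * e := mul_le_mul_of_nonneg_right (by linarith) he0.le
  have e3 : C3 * e ≤ C * e := mul_le_mul_of_nonneg_right (by linarith) he0.le
  have e4 : C4 * e ≤ C * e := mul_le_mul_of_nonneg_right (by linarith) he0.le
  have hα0 : ∀ g ≤ N, 0 ≤ α g := fun g hg =>
    integral_nonneg fun x => mul_nonneg (sq_nonneg _) (hsep.gapw_mem hg x).1
  have fin := hgap a b α β (C * e) (by positivity) (by simp [ha, edR]) (by simp [hb, edR]) ?_ ?_
    hα0 ?_ ?_ ?_
  · intro g hg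
    have := fin g hg
    rw [mul_assoc]
    exact this
  · have : ∫ x, U 0 T x ^ 2 * edL L ℓ p N N x = ∑ i ∈ Finset.range N, M i := by
      simp only [edL, if_true, mul_one]
      exact h.mass_eq T
    rw [eα, this]
    simp only [ha]; ring
  · have : ∫ x, Sol.eden U T x * edL L ℓ p N N x = ∑ i ∈ Finset.range N, -(1 / 7) * (c i * M i) := by
      simp only [edL, if_true, mul_one]
      exact h.energy_eq T
    rw [eβ, this]
    simp only [hb]; ring
  · intro g hg
    have := hen T ℓ hT2 hsep g hg
    simp only [hα, hβ]
    linarith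
  · intro g hg0 hgN
    have hed0 : ∀ x, edR L ℓ p g x = lg L (x - (ctr c Δ (g - 1) T - ℓ)) := fun x => by
      simp [edR, hg0.ne', hp]
    have hpre : ∀ i, g ≤ i → i < N → ctr c Δ i T + 2 * ℓ ≤ ctr c Δ (g - 1) T := fun i hi hiN => by
      have := hsep.sep (g - 1) i (by omega) hiN
      simp only [hp] at this
      linarith
    have m1 := hmass T ℓ g hT3 hg0 hgN.le hpre
    have m2 := hed T ℓ g hT4 hg0 hgN.le hpre
    simp only [← hed0] at m1 m2
    have d1 : (∫ x, dens 0 1 U T x * edR L ℓ p g x) = ∫ x, U 0 T x ^ 2 * edR L ℓ p g x :=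
      integral_congr_ae (ae_of_all _ fun x => by simp only [dens]; ring)
    have d2 : (∫ x, dens 1 θ U T x * edR L ℓ p g x)
        = (∫ x, Sol.eden U T x * edR L ℓ p g x) + θ * ∫ x, U 0 T x ^ 2 * edR L ℓ p g x := by
      rw [← integral_const_mul, ← integral_add (ieR g) ((imR g).const_mul θ)]
      exact integral_congr_ae (ae_of_all _ fun x => by simp only [dens, Sol.eden]; ring)
    rw [d1] at m1
    have d3 : ∑ i ∈ Finset.range g, (1 * (-(1 / 7) * (c i * M i)) + θ * M i)
        = (∑ i ∈ Finset.range g, -(1 / 7) * (c i * M i)) + θ * ∑ i ∈ Finset.range g, M i := by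
      rw [Finset.sum_add_distrib, Finset.mul_sum]
      simp only [one_mul]
    rw [d2, d3] at m2
    simp only [zero_mul, zero_add, one_mul] at m1
    constructor
    · simp only [ha, hM]
      linarith
    · simp only [ha, hb]
      linarith
  · intro j hj
    have key := hsol T ℓ hT1 hsep j hj
    have cj := continuous_cut L ℓ p j
    have cm := fun x => cut_mem (p := p) hLp hℓ j x
    have cutE : ∀ x, cut L ℓ p j x = edR L ℓ p (j + 1) x - edL L ℓ p N j x := fun x => cut_eq hj x
    have d1 : (∫ x, U 0 T x ^ 2 * cut L ℓ p j x) - M j = a (j + 1) - a j - α j := by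
      have : (∫ x, U 0 T x ^ 2 * cut L ℓ p j x)
          = (∫ x, U 0 T x ^ 2 * edR L ℓ p (j + 1) x) - ∫ x, U 0 T x ^ 2 * edL L ℓ p N j x := by
        rw [← integral_sub (imR _) (imL _)]
        exact integral_congr_ae (ae_of_all _ fun x => by simp only [cutE]; ring)
      rw [this, eα]
      simp only [ha]
      rw [Finset.sum_range_succ]
      ring
    have d2 : (∫ x, Sol.eden U T x * cut L ℓ p j x) + 1 / 7 * (c j * M j)
        = b (j + 1) - b j - β j := by
      have : (∫ x, Sol.eden U T x * cut L ℓ p j x)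
          = (∫ x, Sol.eden U T x * edR L ℓ p (j + 1) x) - ∫ x, Sol.eden U T x * edL L ℓ p N j x := by
        rw [← integral_sub (ieR _) (ieL _)]
        exact integral_congr_ae (ae_of_all _ fun x => by simp only [cutE]; ring)
      rw [this, eβ]
      simp only [hb]
      rw [Finset.sum_range_succ]
      ring
    have d3 : (∫ x, dens 1 (c j) U T x * cut L ℓ p j x)
        = (∫ x, Sol.eden U T x * cut L ℓ p j x) + c j * ∫ x, U 0 T x ^ 2 * cut L ℓ p j x := by
      rw [← integral_const_mul, ← integral_add (integrable_mul_unit ie cj cm)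
        ((integrable_mul_unit im cj cm).const_mul _)]
      exact integral_congr_ae (ae_of_all _ fun x => by simp only [dens, Sol.eden]; ring)
    have key' : 6 / 7 * (c j * M j) ≤ (∫ x, dens 1 (c j) U T x * cut L ℓ p j x)
      + min ε 1 * |(∫ x, U 0 T x ^ 2 * cut L ℓ p j x) - M j| + C1 * e
      + Kq / L * (α j + α (j + 1)) := key
    rw [d3, d1] at key'
    have h1 : min ε 1 * |a (j + 1) - a j - α j| ≤ ε * |a (j + 1) - a j - α j| :=
      mul_le_mul_of_nonneg_right (min_le_left _ _) (abs_nonneg _)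
    have h2 : Kq / L * (α j + α (j + 1)) ≤ ε * (α j + α (j + 1)) :=
      mul_le_mul_of_nonneg_right hq (add_nonneg (hα0 j hj.le) (hα0 (j + 1) hj))
    have d4 : c j * (∫ x, U 0 T x ^ 2 * cut L ℓ p j x) = c j * (a (j + 1) - a j - α j) + c j * M j := by
      rw [← d1]; ring
    linarith

end Out

lemma lg_one_sub {L : ℝ} (hL : 0 < L) : 1 / 4 ≤ lg L L - lg L (-L) := by
  have h1 : 1 - lg L L ≤ exp (-(L / L)) * lg L L := (one_sub_lg L L).le
  have h2 : lg L (-L) = 1 - lg L L := by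
    rw [one_sub_lg, lg, lg]
    have e1 : exp (-(-L / L)) = (exp (-(L / L)))⁻¹ := by
      rw [← exp_neg]; congr 1; ring
    have : 0 < exp (-(L / L)) := exp_pos _
    rw [e1]
    field_simp
    ring
  have h3 : exp (-(L / L)) ≤ 1 / 2 := by
    rw [div_self hL.ne', exp_neg, one_div]
    exact inv_anti₀ two_pos (by linarith [add_one_le_exp (1:ℝ)])
  have h4 := mul_le_mul_of_nonneg_right h3 (lg_pos L L).le
  have h5 := lg_lt_one L L
  have h6 := lg_lt_one L (-L)
  have h7 : 2 / 3 ≤ lg L L := by linarith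
  linarith

lemma Sep.cover {N : ℕ} {L ℓ : ℝ} {p : ℕ → ℝ} (h : Sep N L ℓ p) {x : ℝ}
    (hx : ∀ j < N, ℓ + L ≤ |x - p j|) :
    1 / 4 ≤ ∑ g ∈ Finset.range (N + 1), gapw L ℓ p N g x := by
  have hL := h.hL
  have hℓ := h.hℓ
  obtain ⟨g, hgN, hg1, hg2⟩ : ∃ g ≤ N, (∀ j < g, x + (ℓ + L) ≤ p j) ∧
      (g < N → p g + (ℓ + L) ≤ x) := by
    classical
    have hex : ∃ g, g = N ∨ (g < N ∧ p g + (ℓ + L) ≤ x) := ⟨N, Or.inl rfl⟩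
    refine ⟨Nat.find hex, ?_, fun j hj => ?_, fun hlt => ?_⟩
    · rcases Nat.find_spec hex with e | e <;> omega
    · have h1 := Nat.find_min hex hj
      push Not at h1
      have h2 : j < N := by
        have : Nat.find hex ≤ N := Nat.find_min' hex (Or.inl rfl)
        omega
      have h3 := h1.2 h2
      rcases le_abs.1 (hx j h2) with h4 | h4 <;> linarith
    · rcases Nat.find_spec hex with e | e
      · omega
      · exact e.2
  have key : 1 / 4 ≤ gapw L ℓ p N g x := by
    have h0 := lg_one_sub hL
    have e1 : lg L L ≤ edL L ℓ p N g x := by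
      unfold edL
      split_ifs with hN
      · exact (lg_lt_one _ _).le
      · exact lg_mono hL (by linarith [hg2 (by omega)])
    have e2 : edR L ℓ p g x ≤ lg L (-L) := by
      unfold edR
      split_ifs with h0
      · exact (lg_pos _ _).le
      · exact lg_mono hL (by linarith [hg1 (g - 1) (by omega)])
    unfold gapw
    linarith
  refine key.trans (Finset.single_le_sum (f := fun g => gapw L ℓ p N g x) (fun i hi => ?_) ?_)
  · rw [Finset.mem_range] at hi
    exact (h.gapw_mem (by omega) x).1
  · rw [Finset.mem_range]; omega

/-- The points at distance at least `ℓ` from all the centres. -/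
def far (c Δ : ℕ → ℝ) (N : ℕ) (T ℓ : ℝ) : Set ℝ := {x | ∀ j < N, ℓ ≤ |x - ctr c Δ j T|}

lemma measurableSet_far (c Δ : ℕ → ℝ) (N : ℕ) (T ℓ : ℝ) : MeasurableSet (far c Δ N T ℓ) := by
  have : far c Δ N T ℓ = ⋂ j ∈ Finset.range N, {x | ℓ ≤ |x - ctr c Δ j T|} := by
    ext x; simp [far]
  rw [this]
  exact Finset.measurableSet_biInter _ fun j _ =>
    measurableSet_le measurable_const (by fun_prop)

namespace Out

variable {N : ℕ} {c Δ : ℕ → ℝ} {U : ℕ → ℝ → ℝ → ℝ}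

/-- Far from the solitons the mass is exponentially small. -/
lemma far_mass (h : Out N c Δ U) (hN : 0 < N) : ∃ γ κ T0 C, 0 < γ ∧ 0 < κ ∧ 0 < T0 ∧ 0 ≤ C ∧
    (∀ j < N, 2 * κ ≤ c j) ∧ (∀ j < N, ∀ t, T0 ≤ t → κ * t ≤ ctr c Δ j t) ∧
    ∀ T ℓ, T0 ≤ T → ℓ ≤ κ * T → ∫ x in far c Δ N T ℓ, U 0 T x ^ 2 ≤ C * exp (-(γ * ℓ)) := by
  obtain ⟨L, hL, hdec⟩ := h.gap_decay hN
  obtain ⟨T0, C, hC, hdec⟩ := hdec L le_rfl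
  obtain ⟨κ, hκ, hκc, hg⟩ := h.exists_gap
  obtain ⟨T1, hT1, hs⟩ := exists_separation Δ hκ hg
  obtain ⟨D, hD, hΔ⟩ := exists_forall_lt_le N fun j => |Δ j|
  obtain ⟨K, hK, hKb⟩ := h.sol.exists_H1_bound
  set γ := 1 / (2 * L) with hγ
  have hγ0 : 0 < γ := by positivity
  have eγ : ∀ ℓ, ℓ / (2 * L) = γ * ℓ := fun ℓ => by rw [hγ]; ring
  refine ⟨γ, κ / 2, max (max T0 T1) (D / κ), max (4 * ((N + 1) * C) * exp (γ * L)) (K * exp (γ * L)),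
    hγ0, by positivity, lt_max_of_lt_left (lt_max_of_lt_right hT1), by positivity,
    fun j hj => by linarith [hκc j hj], fun j hj t ht => ?_, fun T ℓ hT hℓ => ?_⟩
  · have h1 : D / κ ≤ t := (le_max_right _ _).trans ht
    rw [div_le_iff₀ hκ] at h1
    have h2 := (abs_le.1 (hΔ j hj)).1
    have h3 : 0 < t := hT1.trans_le (((le_max_right _ _).trans (le_max_left _ _)).trans ht)
    have h4 := mul_le_mul_of_nonneg_right (hκc j hj) h3.le
    unfold ctr
    linarith [mul_pos hκ h3]
  simp only [max_le_iff] at hT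
  obtain ⟨⟨hT0, hT1'⟩, -⟩ := hT
  have hsq := h.sol.sq 0 T
  rcases lt_or_ge ℓ L with hlt | hge
  · have h1 : ∫ x in far c Δ N T ℓ, U 0 T x ^ 2 ≤ K :=
      (setIntegral_le_integral hsq (ae_of_all _ fun x => sq_nonneg _)).trans (hKb T).1
    refine h1.trans (le_trans ?_ (mul_le_mul_of_nonneg_right (le_max_right _ _) (exp_pos _).le))
    rw [mul_assoc, ← exp_add]
    refine le_mul_of_one_le_right hK (one_le_exp ?_)
    have := mul_le_mul_of_nonneg_left hlt.le hγ0.le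
    linarith
  · have hsep : Sep N L (ℓ - L) (fun j => ctr c Δ j T) :=
      ⟨hL, by linarith, fun i j hij hj => by linarith [hs T hT1' i j hij hj]⟩
    have hd := hdec T (ℓ - L) hT0 hsep
    set p : ℕ → ℝ := fun j => ctr c Δ j T with hp
    have iw : ∀ g ∈ Finset.range (N + 1),
        Integrable fun x => U 0 T x ^ 2 * gapw L (ℓ - L) p N g x := fun g hg =>
      integrable_mul_unit hsq (continuous_gapw _ _ _ _ _)
        fun x => hsep.gapw_mem (by rw [Finset.mem_range] at hg; omega) x
    have iS : Integrable fun x => 4 * ∑ g ∈ Finset.range (N + 1), U 0 T x ^ 2 * gapw L (ℓ - L) p N g x :=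
      (integrable_finsetSum _ iw).const_mul 4
    have h1 : ∫ x in far c Δ N T ℓ, U 0 T x ^ 2 ≤
        ∫ x in far c Δ N T ℓ, 4 * ∑ g ∈ Finset.range (N + 1), U 0 T x ^ 2 * gapw L (ℓ - L) p N g x := by
      refine setIntegral_mono_on hsq.integrableOn iS.integrableOn (measurableSet_far _ _ _ _ _)
        fun x hx => ?_
      have := hsep.cover (x := x) (fun j hj => by simpa using hx j hj)
      rw [← Finset.mul_sum]
      have := mul_le_mul_of_nonneg_left this (sq_nonneg (U 0 T x))
      linarith
    have h2 : (∫ x in far c Δ N T ℓ, 4 * ∑ g ∈ Finset.range (N + 1), U 0 T x ^ 2 * gapw L (ℓ - L) p N g x)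
        ≤ ∫ x, 4 * ∑ g ∈ Finset.range (N + 1), U 0 T x ^ 2 * gapw L (ℓ - L) p N g x :=
      setIntegral_le_integral iS (ae_of_all _ fun x => by
        refine mul_nonneg (by norm_num) (Finset.sum_nonneg fun g hg => ?_)
        exact mul_nonneg (sq_nonneg _) (hsep.gapw_mem (by rw [Finset.mem_range] at hg; omega) x).1)
    have e0 : (∫ x, 4 * ∑ g ∈ Finset.range (N + 1), U 0 T x ^ 2 * gapw L (ℓ - L) p N g x)
        = 4 * ∑ g ∈ Finset.range (N + 1), ∫ x, U 0 T x ^ 2 * gapw L (ℓ - L) p N g x := by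
      rw [integral_const_mul, integral_finsetSum _ iw]
    rw [e0] at h2
    have h3 : ∑ g ∈ Finset.range (N + 1), ∫ x, U 0 T x ^ 2 * gapw L (ℓ - L) p N g x ≤
        (N + 1) * (C * exp (-((ℓ - L) / (2 * L)))) := by
      refine (Finset.sum_le_card_nsmul _ _ _ fun g hg => hd g
        (by rw [Finset.mem_range] at hg; omega)).trans (le_of_eq ?_)
      rw [nsmul_eq_mul, Finset.card_range]; push_cast; ring
    have e : exp (-((ℓ - L) / (2 * L))) = exp (γ * L) * exp (-(γ * ℓ)) := by
      rw [← exp_add, eγ]; congr 1; ring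
    rw [e] at h3
    refine le_trans ?_ (mul_le_mul_of_nonneg_right (le_max_left _ _) (exp_pos _).le)
    linarith

end Out

/-! ### Polynomial decay of the tails -/

/-- A weight with values in the unit interval whose derivatives are controlled by its dilation. -/
structure Tail (K : ℝ) (g g1 g2 g3 : ℝ → ℝ) : Prop where
  weight : Weight K g g1 g2 g3
  nonneg : ∀ y, 0 ≤ g y
  le_one : ∀ y, g y ≤ 1
  r1 : ∀ y, |g1 y| ≤ K * g (2 * y) ^ 2
  r3 : ∀ y, |g3 y| ≤ K * g (2 * y) ^ 2

lemma Weight.comp_neg {K : ℝ} {f f1 f2 f3 : ℝ → ℝ} (h : Weight K f f1 f2 f3) :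
    Weight K (fun x => f (-x)) (fun x => -f1 (-x)) (fun x => f2 (-x)) fun x => -f3 (-x) := by
  have hd : ∀ {a a' : ℝ → ℝ}, (∀ x, HasDerivAt a (a' x) x) →
      ∀ x, HasDerivAt (fun x => a (-x)) (-a' (-x)) x := fun ha x => by
    refine ((ha (-x)).comp x (hasDerivAt_neg x)).congr_deriv ?_
    ring
  refine ⟨hd h.d0, fun x => ?_, hd h.d2, ?_, fun x => h.b0 _, fun x => ?_, fun x => h.b2 _,
    fun x => ?_⟩
  · simpa using (hd h.d1 x).fun_neg
  · have := h.c3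
    fun_prop
  · rw [abs_neg]; exact h.b1 _
  · rw [abs_neg]; exact h.b3 _

lemma Tail.comp_neg {K : ℝ} {g g1 g2 g3 : ℝ → ℝ} (h : Tail K g g1 g2 g3) :
    Tail K (fun x => g (-x)) (fun x => -g1 (-x)) (fun x => g2 (-x)) fun x => -g3 (-x) := by
  refine ⟨h.weight.comp_neg, fun y => h.nonneg _, fun y => h.le_one _, fun y => ?_, fun y => ?_⟩
  · have := h.r1 (-y)
    rwa [abs_neg, ← mul_neg]
  · have := h.r3 (-y)
    rwa [abs_neg, ← mul_neg]

lemma exists_tail : ∃ (K : ℝ) (g g1 g2 g3 : ℝ → ℝ), Tail K g g1 g2 g3 ∧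
    (∀ y, y ≤ 1 → g y = 0) ∧ ∀ y, 2 ≤ y → g y = 1 := by
  let g : ℝ → ℝ := fun y => Real.smoothTransition (y - 1)
  have g0 : ∀ y, y ≤ 1 → g y = 0 := fun y hy =>
    Real.smoothTransition.zero_of_nonpos (by linarith)
  have g2 : ∀ y, 2 ≤ y → g y = 1 := fun y hy =>
    Real.smoothTransition.one_of_one_le (by linarith)
  have hc : ∀ k : ℕ, ContDiff ℝ (⊤ : ℕ∞) (deriv^[k] g) := fun k => by
    induction k with
    | zero => exact Real.smoothTransition.contDiff.comp (contDiff_id.sub contDiff_const)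
    | succ k ih =>
      rw [Function.iterate_succ_apply']
      exact (contDiff_infty_iff_deriv.1 ih).2
  have hd : ∀ k x, HasDerivAt (deriv^[k] g) (deriv^[k + 1] g x) x := fun k x => by
    rw [Function.iterate_succ_apply']
    exact ((hc k).differentiable (by simp) x).hasDerivAt
  have hz : ∀ k x, x < 1 → deriv^[k + 1] g x = 0 := fun k => by
    induction k with
    | zero =>
      intro x hx
      have : g =ᶠ[nhds x] fun _ => 0 := by
        filter_upwards [(isOpen_gt' (1 : ℝ)).mem_nhds hx] with y hy
        exact g0 y (le_of_lt hy)
      simp only [zero_add, Function.iterate_one]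
      rw [this.deriv_eq, deriv_const]
    | succ k ih =>
      intro x hx
      have : (deriv^[k + 1] g) =ᶠ[nhds x] fun _ => 0 := by
        filter_upwards [(isOpen_gt' (1 : ℝ)).mem_nhds hx] with y hy
        exact ih y hy
      rw [Function.iterate_succ_apply', this.deriv_eq, deriv_const]
  have h1 : ∀ k x, 2 < x → deriv^[k + 1] g x = 0 := fun k => by
    induction k with
    | zero =>
      intro x hx
      have : g =ᶠ[nhds x] fun _ => 1 := by
        filter_upwards [(isOpen_lt' (2 : ℝ)).mem_nhds hx] with y hy
        exact g2 y (le_of_lt hy)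
      simp only [zero_add, Function.iterate_one]
      rw [this.deriv_eq, deriv_const]
    | succ k ih =>
      intro x hx
      have : (deriv^[k + 1] g) =ᶠ[nhds x] fun _ => 0 := by
        filter_upwards [(isOpen_lt' (2 : ℝ)).mem_nhds hx] with y hy
        exact ih y hy
      rw [Function.iterate_succ_apply', this.deriv_eq, deriv_const]
  have hbd : ∀ k : ℕ, ∃ B, 0 ≤ B ∧ ∀ x, |deriv^[k + 1] g x| ≤ B := fun k => by
    obtain ⟨B, hB⟩ := isCompact_Icc (a := (1 : ℝ)) (b := 2) |>.exists_bound_of_continuousOn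
      (hc (k + 1)).continuous.continuousOn
    refine ⟨max B 0, le_max_right _ _, fun x => ?_⟩
    rcases lt_or_ge x 1 with hx | hx
    · rw [hz k x hx, abs_zero]; exact le_max_right _ _
    · rcases lt_or_ge 2 x with hx2 | hx2
      · rw [h1 k x hx2, abs_zero]; exact le_max_right _ _
      · exact (hB x ⟨hx, hx2⟩).trans (le_max_left _ _)
  choose B hB0 hB using hbd
  have hn : ∀ y, 0 ≤ g y := fun y => Real.smoothTransition.nonneg _
  have hl : ∀ y, g y ≤ 1 := fun y => Real.smoothTransition.le_one _
  have hr : ∀ k y, |deriv^[k + 1] g y| ≤ B k * g (2 * y) ^ 2 := fun k y => by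
    rcases lt_or_ge y 1 with hx | hx
    · rw [hz k y hx, abs_zero]; exact mul_nonneg (hB0 k) (sq_nonneg _)
    · rw [g2 (2 * y) (by linarith)]; simpa using hB k y
  have hK : ∀ k ≤ 2, B k ≤ 1 + B 0 + B 1 + B 2 := fun k hk => by
    have h0 := hB0 0; have h1 := hB0 1; have h2 := hB0 2
    interval_cases k <;> linarith
  refine ⟨1 + B 0 + B 1 + B 2, g, deriv^[1] g, deriv^[2] g, deriv^[3] g,
    ⟨⟨hd 0, hd 1, hd 2, (hc 3).continuous, fun x => ?_, fun x => (hB 0 x).trans (hK 0 (by norm_num)),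
      fun x => (hB 1 x).trans (hK 1 (by norm_num)), fun x => (hB 2 x).trans (hK 2 le_rfl)⟩, hn, hl,
      fun y => (hr 0 y).trans (mul_le_mul_of_nonneg_right (hK 0 (by norm_num)) (sq_nonneg _)),
      fun y => (hr 2 y).trans (mul_le_mul_of_nonneg_right (hK 2 le_rfl) (sq_nonneg _))⟩, g0, g2⟩
  rw [abs_of_nonneg (hn x)]
  linarith [hl x, hB0 0, hB0 1, hB0 2]

/-- Mass seen by the dilated weight `g` moving at speed `σ`. -/
noncomputable def tail (U : ℕ → ℝ → ℝ → ℝ) (g : ℝ → ℝ) (σ t X : ℝ) : ℝ :=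
  ∫ x, U 0 t x ^ 2 * g ((x - σ * t) / X)

section

variable {U : ℕ → ℝ → ℝ → ℝ} {K : ℝ} {g g1 g2 g3 : ℝ → ℝ}

lemma Tail.integrable (hg : Tail K g g1 g2 g3) (hU : Sol U) (σ t X : ℝ) :
    Integrable fun x => U 0 t x ^ 2 * g ((x - σ * t) / X) := by
  have := hg.weight.c0
  exact integrable_mul_unit (hU.sq 0 t) (w := fun x => g ((x - σ * t) / X)) (by fun_prop)
    fun x => ⟨hg.nonneg _, hg.le_one _⟩

lemma Tail.tail_nonneg (hg : Tail K g g1 g2 g3) (σ t X : ℝ) : 0 ≤ tail U g σ t X :=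
  integral_nonneg fun _ => mul_nonneg (sq_nonneg _) (hg.nonneg _)

lemma sqrt_le_one_add {z : ℝ} (hz : 0 ≤ z) : √z ≤ 1 + z := by
  rw [sqrt_le_left (by linarith)]
  nlinarith

/-- The derivative in the tail is controlled by the mass and the second derivative. -/
lemma Tail.deriv_sq_le (hg : Tail K g g1 g2 g3) (hU : Sol U) (σ t : ℝ) {X : ℝ} (hX : 2 ≤ X) :
    (Integrable fun x => U 1 t x ^ 2 * g (2 * ((x - σ * t) / X)) ^ 2) ∧
    ∫ x, U 1 t x ^ 2 * g (2 * ((x - σ * t) / X)) ^ 2 ≤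
      √(tail U g σ t (X / 2)) * (1 + 2 * Sol.en U 2 t + 8 * (K ^ 2 * Sol.en U 1 t)) := by
  set ψ : ℝ → ℝ := fun x => g (2 * ((x - σ * t) / X)) with hψ
  set ψ1 : ℝ → ℝ := fun x => g1 (2 * ((x - σ * t) / X)) * (2 * (1 / X)) with hψ1
  have cg := hg.weight.c0
  have cg1 := hg.weight.c1
  have c0 := hU.cont_slice 0 t; have c1 := hU.cont_slice 1 t; have c2 := hU.cont_slice 2 t
  have cψ : Continuous ψ := by fun_prop
  have cψ1 : Continuous ψ1 := by fun_prop
  have dψ : ∀ x, HasDerivAt ψ (ψ1 x) x := fun x =>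
    (hg.weight.d0 _).comp x ((((hasDerivAt_id x).sub_const (σ * t)).div_const X).const_mul 2)
  have hψb : ∀ x, 0 ≤ ψ x ∧ ψ x ≤ 1 := fun x => ⟨hg.nonneg _, hg.le_one _⟩
  have hK0 : 0 ≤ K := (abs_nonneg _).trans (hg.weight.b0 0)
  have hψ1b : ∀ x, |ψ1 x| ≤ K := fun x => by
    rw [hψ1]; dsimp only
    rw [abs_mul, abs_of_nonneg (a := 2 * (1 / X)) (by positivity)]
    have : 2 * (1 / X) ≤ 1 := by
      rw [mul_one_div, div_le_one (by linarith)]; exact hX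
    exact (mul_le_mul (hg.weight.b1 _) this (by positivity) hK0).trans (by simp)
  have hψs : ∀ x, 0 ≤ ψ x ^ 2 ∧ ψ x ^ 2 ≤ 1 := fun x =>
    ⟨sq_nonneg _, pow_le_one₀ (hψb x).1 (hψb x).2⟩
  have i1 : Integrable fun x => U 1 t x ^ 2 * ψ x ^ 2 :=
    integrable_mul_unit (hU.sq 1 t) (cψ.pow 2) hψs
  refine ⟨i1, ?_⟩
  have iF2 : Integrable fun x => (U 0 t x * ψ x) ^ 2 := by
    simp_rw [mul_pow]; exact integrable_mul_unit (hU.sq 0 t) (cψ.pow 2) hψs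
  have cG : Continuous fun x => U 2 t x * ψ x + 2 * (U 1 t x * ψ1 x) := by fun_prop
  have hGle : ∀ x, (U 2 t x * ψ x + 2 * (U 1 t x * ψ1 x)) ^ 2 ≤
      2 * U 2 t x ^ 2 + 8 * K ^ 2 * U 1 t x ^ 2 := fun x => by
    have h1 := mul_le_mul_of_nonneg_left (hψs x).2 (sq_nonneg (U 2 t x))
    have h2 : ψ1 x ^ 2 ≤ K ^ 2 := sq_le_sq' (abs_le.1 (hψ1b x)).1 (abs_le.1 (hψ1b x)).2
    have h3 := mul_le_mul_of_nonneg_left h2 (sq_nonneg (U 1 t x))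
    have h4 := sq_nonneg (U 2 t x * ψ x - 2 * (U 1 t x * ψ1 x))
    linarith
  have iB : Integrable fun x => 2 * U 2 t x ^ 2 + 8 * K ^ 2 * U 1 t x ^ 2 :=
    ((hU.sq 2 t).const_mul 2).fun_add ((hU.sq 1 t).const_mul _)
  have iG2 : Integrable fun x => (U 2 t x * ψ x + 2 * (U 1 t x * ψ1 x)) ^ 2 := by
    refine iB.mono' (cG.pow 2).aestronglyMeasurable (ae_of_all _ fun x => ?_)
    rw [Real.norm_eq_abs, abs_of_nonneg (sq_nonneg _)]
    exact hGle x
  have cF : Continuous fun x => U 0 t x * ψ x := by fun_prop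
  have iFG := integrable_mul_of_sq cF cG iF2 iG2
  have cs := integral_abs_mul_sq_le cF cG iF2 iG2
  have iW : Integrable fun x => U 0 t x * ψ x * (U 1 t x * ψ x) :=
    integrable_mul_of_sq cF (by fun_prop) iF2 (by simp_rw [mul_pow]; exact i1)
  have hd : ∀ x, HasDerivAt (fun x => U 0 t x * ψ x * (U 1 t x * ψ x))
      (U 1 t x ^ 2 * ψ x ^ 2 + U 0 t x * ψ x * (U 2 t x * ψ x + 2 * (U 1 t x * ψ1 x))) x :=
    fun x => by
    refine (((hU.dx 0 t x).fun_mul (dψ x)).fun_mul ((hU.dx 1 t x).fun_mul (dψ x))).congr_deriv ?_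
    ring
  have ibp := integral_eq_zero_of_hasDerivAt_of_integrable hd (i1.fun_add iFG) iW
  rw [integral_add i1 iFG] at ibp
  have hle : ∫ x, U 1 t x ^ 2 * ψ x ^ 2 ≤
      ∫ x, |U 0 t x * ψ x * (U 2 t x * ψ x + 2 * (U 1 t x * ψ1 x))| := by
    have := (neg_le_abs _).trans
      (abs_integral_le_integral_abs (μ := volume)
        (f := fun x => U 0 t x * ψ x * (U 2 t x * ψ x + 2 * (U 1 t x * ψ1 x))))
    linarith
  have hm : ∫ x, (U 0 t x * ψ x) ^ 2 ≤ tail U g σ t (X / 2) := by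
    refine integral_mono iF2 (hg.integrable hU σ t _) fun x => ?_
    have e : (x - σ * t) / (X / 2) = 2 * ((x - σ * t) / X) := by
      field_simp
    simp only [e, mul_pow]
    refine mul_le_mul_of_nonneg_left ?_ (sq_nonneg _)
    have := hψb x
    change ψ x ^ 2 ≤ ψ x
    nlinarith
  have hG : ∫ x, (U 2 t x * ψ x + 2 * (U 1 t x * ψ1 x)) ^ 2 ≤
      2 * Sol.en U 2 t + 8 * (K ^ 2 * Sol.en U 1 t) := by
    refine (integral_mono iG2 iB hGle).trans (le_of_eq ?_)
    rw [integral_add ((hU.sq 2 t).const_mul 2) ((hU.sq 1 t).const_mul _), integral_const_mul,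
      integral_const_mul]
    simp only [Sol.en]; ring
  have hZ : 0 ≤ 2 * Sol.en U 2 t + 8 * (K ^ 2 * Sol.en U 1 t) :=
    (integral_nonneg fun x => sq_nonneg _).trans hG
  refine hle.trans ?_
  have h1 := abs_le_sqrt (cs.trans (mul_le_mul hm hG (integral_nonneg fun x => sq_nonneg _)
    (hg.tail_nonneg σ t _)))
  rw [sqrt_mul (hg.tail_nonneg σ t _)] at h1
  refine (le_abs_self _).trans (h1.trans (mul_le_mul_of_nonneg_left ?_ (sqrt_nonneg _)))
  linarith [sqrt_le_one_add hZ]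

end

section

variable {U : ℕ → ℝ → ℝ → ℝ} {K : ℝ} {g g1 g2 g3 : ℝ → ℝ}

lemma Tail.flux_le (hg : Tail K g g1 g2 g3) (hU : Sol U) (σ : ℝ) : ∃ C, 0 ≤ C ∧ ∀ t X, 2 ≤ X →
    |∫ x, flux (fun t x => U 0 t x ^ 2) (fun _ _ => 0)
      (fun t x => 3 * U 1 t x ^ 2 - 8 / 5 * U 0 t x ^ 5) (fun _ _ => 0) (fun t x => -U 0 t x ^ 2)
      (fun x => g (x / X)) (fun x => g1 (x / X) / X) (fun x => g2 (x / X) / X ^ 2)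
      (fun x => g3 (x / X) / X ^ 3) σ t x| ≤
      C / X * √(tail U g σ t (X / 2)) * (1 + Sol.en U 2 t) := by
  obtain ⟨M, hM, hMb⟩ := hU.exists_H1_bound
  have hK0 : 0 ≤ K := (abs_nonneg _).trans (hg.weight.b0 0)
  set B := √(2 * M) with hB
  have hUB : ∀ t x, |U 0 t x| ≤ B := fun t x =>
    abs_le_sqrt ((hU.sup_sq 0 t x).trans (by have := hMb t; norm_num; linarith))
  have hB0 : 0 ≤ B := sqrt_nonneg _
  set A := 8 / 5 * B ^ 3 + 1 + |σ| with hA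
  have hA0 : 0 ≤ A := by positivity
  refine ⟨K * (3 * (2 + 8 * (K ^ 2 * M)) + A * √M), by positivity, fun t X hX => ?_⟩
  obtain ⟨i1, h1⟩ := hg.deriv_sq_le hU σ t hX
  have hX0 : 0 < X := by linarith
  set ψ : ℝ → ℝ := fun x => g (2 * ((x - σ * t) / X)) with hψ
  have cg := hg.weight.c0
  have cψ : Continuous ψ := by fun_prop
  have hψb : ∀ x, 0 ≤ ψ x ∧ ψ x ≤ 1 := fun x => ⟨hg.nonneg _, hg.le_one _⟩
  have hψs : ∀ x, 0 ≤ ψ x ^ 2 ∧ ψ x ^ 2 ≤ 1 := fun x =>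
    ⟨sq_nonneg _, pow_le_one₀ (hψb x).1 (hψb x).2⟩
  have i0 : Integrable fun x => U 0 t x ^ 2 * ψ x ^ 2 :=
    integrable_mul_unit (hU.sq 0 t) (cψ.pow 2) hψs
  have iR : Integrable fun x => K / X * (3 * (U 1 t x ^ 2 * ψ x ^ 2) + A * (U 0 t x ^ 2 * ψ x ^ 2)) :=
    ((i1.const_mul 3).fun_add (i0.const_mul A)).const_mul _
  have hpt : ∀ x, ‖flux (fun t x => U 0 t x ^ 2) (fun _ _ => 0)
      (fun t x => 3 * U 1 t x ^ 2 - 8 / 5 * U 0 t x ^ 5) (fun _ _ => 0) (fun t x => -U 0 t x ^ 2)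
      (fun x => g (x / X)) (fun x => g1 (x / X) / X) (fun x => g2 (x / X) / X ^ 2)
      (fun x => g3 (x / X) / X ^ 3) σ t x‖ ≤
      K / X * (3 * (U 1 t x ^ 2 * ψ x ^ 2) + A * (U 0 t x ^ 2 * ψ x ^ 2)) := fun x => by
    rw [Real.norm_eq_abs]
    simp only [flux]
    set a := g1 ((x - σ * t) / X) / X with ha
    set b := g3 ((x - σ * t) / X) / X ^ 3 with hb
    have hab : |a| ≤ K / X * ψ x ^ 2 := by
      rw [ha, abs_div, abs_of_pos hX0, div_mul_eq_mul_div]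
      exact div_le_div_of_nonneg_right (hg.r1 _) hX0.le
    have hbb : |b| ≤ K / X * ψ x ^ 2 := by
      rw [hb, abs_div, abs_of_pos (by positivity : 0 < X ^ 3), div_mul_eq_mul_div]
      refine (div_le_div_of_nonneg_right (hg.r3 _) (by positivity)).trans ?_
      refine div_le_div_of_nonneg_left (mul_nonneg hK0 (sq_nonneg _)) hX0 ?_
      nlinarith [mul_nonneg hX0.le hX0.le, sq_nonneg X]
    have h5 : |U 0 t x ^ 5| ≤ B ^ 3 * U 0 t x ^ 2 := by
      have : |U 0 t x ^ 5| = |U 0 t x| ^ 3 * U 0 t x ^ 2 := by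
        rw [← sq_abs (U 0 t x), abs_pow]; ring
      rw [this]
      exact mul_le_mul_of_nonneg_right (pow_le_pow_left₀ (abs_nonneg _) (hUB t x) 3) (sq_nonneg _)
    set P := K / X * ψ x ^ 2 with hP
    have hP0 : 0 ≤ P := (abs_nonneg _).trans hab
    have e1 : |3 * U 1 t x ^ 2 - 8 / 5 * U 0 t x ^ 5| ≤
        3 * U 1 t x ^ 2 + 8 / 5 * (B ^ 3 * U 0 t x ^ 2) := by
      refine (abs_sub _ _).trans ?_
      rw [abs_of_nonneg (by positivity : 0 ≤ 3 * U 1 t x ^ 2), abs_mul,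
        abs_of_pos (by norm_num : (0 : ℝ) < 8 / 5)]
      linarith
    have e2 : |(3 * U 1 t x ^ 2 - 8 / 5 * U 0 t x ^ 5) * a| ≤
        (3 * U 1 t x ^ 2 + 8 / 5 * (B ^ 3 * U 0 t x ^ 2)) * P := by
      rw [abs_mul]
      exact mul_le_mul e1 hab (abs_nonneg _) ((abs_nonneg _).trans e1)
    have e3 : |U 0 t x ^ 2 * b| ≤ U 0 t x ^ 2 * P := by
      rw [abs_mul, abs_of_nonneg (sq_nonneg _)]
      exact mul_le_mul_of_nonneg_left hbb (sq_nonneg _)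
    have e4 : |σ * (U 0 t x ^ 2 * a)| ≤ |σ| * (U 0 t x ^ 2 * P) := by
      rw [abs_mul, abs_mul (U 0 t x ^ 2), abs_of_nonneg (sq_nonneg (U 0 t x))]
      exact mul_le_mul_of_nonneg_left (mul_le_mul_of_nonneg_left hab (sq_nonneg _)) (abs_nonneg _)
    have e : K / X * (3 * (U 1 t x ^ 2 * ψ x ^ 2) + A * (U 0 t x ^ 2 * ψ x ^ 2)) =
        (3 * U 1 t x ^ 2 + 8 / 5 * (B ^ 3 * U 0 t x ^ 2)) * P + U 0 t x ^ 2 * P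
          + |σ| * (U 0 t x ^ 2 * P) := by
      rw [hP, hA]; ring
    rw [e]
    have f2 := abs_le.1 e2; have f3 := abs_le.1 e3; have f4 := abs_le.1 e4
    rw [abs_le]; constructor <;> linarith [f2.1, f2.2, f3.1, f3.2, f4.1, f4.2]
  have h2 := norm_integral_le_of_norm_le iR (ae_of_all _ hpt)
  rw [Real.norm_eq_abs, integral_const_mul, integral_add (i1.const_mul 3) (i0.const_mul A),
    integral_const_mul, integral_const_mul] at h2
  refine h2.trans ?_
  set m := tail U g σ t (X / 2) with hm
  have hm0 : 0 ≤ m := hg.tail_nonneg σ t _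
  have hmM : m ≤ M := by
    refine le_trans ?_ (hMb t).1
    refine integral_mono (hg.integrable hU σ t _) (hU.sq 0 t) fun x => ?_
    exact mul_le_of_le_one_right (sq_nonneg _) (hg.le_one _)
  have h3 : ∫ x, U 0 t x ^ 2 * ψ x ^ 2 ≤ √m * √M := by
    have : ∫ x, U 0 t x ^ 2 * ψ x ^ 2 ≤ m := by
      refine integral_mono i0 (hg.integrable hU σ t _) fun x => ?_
      have e : (x - σ * t) / (X / 2) = 2 * ((x - σ * t) / X) := by
        field_simp
      simp only [e]
      refine mul_le_mul_of_nonneg_left ?_ (sq_nonneg _)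
      have := hψb x
      change ψ x ^ 2 ≤ ψ x
      nlinarith
    refine this.trans ?_
    calc m = √m * √m := (mul_self_sqrt hm0).symm
      _ ≤ √m * √M := mul_le_mul_of_nonneg_left (sqrt_le_sqrt hmM) (sqrt_nonneg _)
  have hE := Sol.en_nonneg (U := U) 2 t
  have hs := sqrt_nonneg m
  have h4 : 3 * (∫ x, U 1 t x ^ 2 * ψ x ^ 2) + A * ∫ x, U 0 t x ^ 2 * ψ x ^ 2 ≤
      (3 * (2 + 8 * (K ^ 2 * M)) + A * √M) * √m * (1 + Sol.en U 2 t) := by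
    have a1 : 1 + 2 * Sol.en U 2 t + 8 * (K ^ 2 * Sol.en U 1 t) ≤
        (2 + 8 * (K ^ 2 * M)) * (1 + Sol.en U 2 t) := by
      have b1 := mul_le_mul_of_nonneg_left (hMb t).2 (sq_nonneg K)
      have b2 : 0 ≤ K ^ 2 * M * Sol.en U 2 t := mul_nonneg (mul_nonneg (sq_nonneg _) hM) hE
      linarith
    have a2 := h1.trans (mul_le_mul_of_nonneg_left a1 hs)
    have a3 := mul_le_mul_of_nonneg_left h3 hA0
    have a4 : 0 ≤ A * (√m * √M) * Sol.en U 2 t :=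
      mul_nonneg (mul_nonneg hA0 (mul_nonneg hs (sqrt_nonneg _))) hE
    linarith
  calc K / X * (3 * (∫ x, U 1 t x ^ 2 * ψ x ^ 2) + A * ∫ x, U 0 t x ^ 2 * ψ x ^ 2)
      ≤ K / X * ((3 * (2 + 8 * (K ^ 2 * M)) + A * √M) * √m * (1 + Sol.en U 2 t)) :=
        mul_le_mul_of_nonneg_left h4 (div_nonneg hK0 hX0.le)
    _ = _ := by ring

/-- Decay of the mass in a tail improves under dilation. -/
lemma Tail.improve (hg : Tail K g g1 g2 g3) (hU : Sol U) (σ t₁ : ℝ) {γ : ℝ} (hγ : 0 < γ) :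
    ∃ C, 0 ≤ C ∧ ∀ X b, 2 ≤ X → 0 ≤ b →
      (∀ t, t₁ ≤ t → tail U g σ t (X / 2) ≤ b ^ 2 * exp (-(γ * t))) →
      Tendsto (fun t => tail U g σ t X) atTop (nhds 0) →
      ∀ t, t₁ ≤ t → tail U g σ t X ≤ C * b / X * exp (-(γ / 4 * t)) := by
  obtain ⟨C, hC, hfl⟩ := hg.flux_le hU σ
  obtain ⟨E, hE, hgr⟩ := hU.second_growth (γ := γ / 4) (by linarith) t₁
  set D := exp (-(γ / 4 * t₁)) + E with hD
  have hD0 : 0 ≤ D := add_nonneg (exp_pos _).le hE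
  refine ⟨C * D / (γ / 4), by positivity, fun X b hX hb hτ hlim t ht => ?_⟩
  have hX0 : 0 < X := by linarith
  have hfb : ∀ τ, t₁ ≤ τ → C / X * √(tail U g σ τ (X / 2)) * (1 + Sol.en U 2 τ) ≤
      C / X * b * D * exp (-(γ / 4 * τ)) := fun τ hτ1 => by
    have a1 : √(tail U g σ τ (X / 2)) ≤ b * exp (-(γ / 2 * τ)) := by
      refine (sqrt_le_left (by positivity)).2 ((hτ τ hτ1).trans (le_of_eq ?_))
      rw [mul_pow, ← exp_nat_mul]; congr 2; push_cast; ring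
    have a2 : 1 + Sol.en U 2 τ ≤ D * exp (γ / 4 * τ) := by
      have : 1 ≤ exp (-(γ / 4 * t₁)) * exp (γ / 4 * τ) := by
        rw [← exp_add]
        refine one_le_exp ?_
        have := mul_le_mul_of_nonneg_left hτ1 (by linarith : 0 ≤ γ / 4)
        linarith
      linarith [hgr τ hτ1]
    have hE0 := Sol.en_nonneg (U := U) 2 τ
    calc C / X * √(tail U g σ τ (X / 2)) * (1 + Sol.en U 2 τ)
        ≤ C / X * (b * exp (-(γ / 2 * τ))) * (D * exp (γ / 4 * τ)) :=
          mul_le_mul (mul_le_mul_of_nonneg_left a1 (div_nonneg hC hX0.le)) a2 (by linarith)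
            (by positivity)
      _ = C / X * b * D * (exp (-(γ / 2 * τ)) * exp (γ / 4 * τ)) := by ring
      _ = _ := by rw [← exp_add]; congr 2; ring
  have hw := hg.weight.comp_div (R := X) (by linarith)
  refine ge_of_tendsto (x := atTop)
    (f := fun s => tail U g σ s X + C * D / (γ / 4) * b / X * exp (-(γ / 4 * t))) ?_ ?_
  · simpa using hlim.add_const (C * D / (γ / 4) * b / X * exp (-(γ / 4 * t)))
  · filter_upwards [eventually_ge_atTop t] with s hs
    have hT := hU.reg_uIcc s t
    have hbal := balance_integral hU.balance_mass (hT.l1_mass hU) L1On.zero (hT.l1_mass_flux hU)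
      L1On.zero (hT.l1_mass hU).neg hw σ
    rw [intervalIntegral.integral_symm, ← intervalIntegral.integral_neg] at hbal
    have hA : 0 ≤ C / X * b * D * exp (-(γ / 4 * t)) := by positivity
    have := intervalIntegral_le_of_exp (g := fun τ => -∫ x, flux (fun t x => U 0 t x ^ 2)
      (fun _ _ => 0) (fun t x => 3 * U 1 t x ^ 2 - 8 / 5 * U 0 t x ^ 5) (fun _ _ => 0)
      (fun t x => -U 0 t x ^ 2) (fun x => g (x / X)) (fun x => g1 (x / X) / X)
      (fun x => g2 (x / X) / X ^ 2) (fun x => g3 (x / X) / X ^ 3) σ τ x)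
      (γ := γ / 4) (by linarith) hA hs fun τ h1 _ => by
        refine (neg_le_abs _).trans ((hfl τ X hX).trans ((hfb τ (ht.trans h1)).trans
          (le_of_eq ?_)))
        rw [mul_assoc _ (exp _), ← exp_add]; congr 2; ring
    rw [← hbal] at this
    simp only [tail]
    have e : C * D / (γ / 4) * b / X * exp (-(γ / 4 * t)) =
      C / X * b * D * exp (-(γ / 4 * t)) / (γ / 4) := by ring
    rw [e]; linarith

/-- Exponential decay in time of the mass in a tail yields polynomial decay in space. -/
lemma Tail.polynomial_decay (hg : Tail K g g1 g2 g3) (hU : Sol U) (σ t₁ : ℝ) {γ D : ℝ} (hγ : 0 < γ)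
    (hD : 0 ≤ D) (h0 : ∀ t X, t₁ ≤ t → 1 ≤ X → tail U g σ t X ≤ D * exp (-(γ * t))) :
    ∃ C, 0 ≤ C ∧ ∀ t X, t₁ ≤ t → 4 ≤ X →
      tail U g σ t X ≤ C / (X * √X) * exp (-(γ / 16 * t)) := by
  obtain ⟨C1, hC1, h1⟩ := hg.improve hU σ t₁ hγ
  obtain ⟨C2, hC2, h2⟩ := hg.improve hU σ t₁ (γ := γ / 4) (by linarith)
  have hlim : ∀ X, 1 ≤ X → Tendsto (fun t => tail U g σ t X) atTop (nhds 0) := fun X hX => by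
    refine tendsto_of_tendsto_of_tendsto_of_le_of_le' (g := fun _ => 0)
      (h := fun t => D * exp (-(γ * t))) tendsto_const_nhds ?_
      (Eventually.of_forall fun t => hg.tail_nonneg σ t X) ?_
    · have : Tendsto (fun t : ℝ => exp (-(γ * t))) atTop (nhds 0) :=
        tendsto_exp_neg_atTop_nhds_zero.comp (tendsto_id.const_mul_atTop hγ)
      simpa using this.const_mul D
    · filter_upwards [eventually_ge_atTop t₁] with t ht using h0 t X ht hX
  have s1 : ∀ t X, t₁ ≤ t → 2 ≤ X → tail U g σ t X ≤ C1 * √D / X * exp (-(γ / 4 * t)) :=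
    fun t X ht hX => h1 X (√D) hX (sqrt_nonneg _)
      (fun t ht => by rw [sq_sqrt hD]; exact h0 t _ ht (by linarith)) (hlim X (by linarith)) t ht
  refine ⟨C2 * √(2 * (C1 * √D)), by positivity, fun t X ht hX => ?_⟩
  have hX0 : 0 < X := by linarith
  have := h2 X (√(2 * (C1 * √D)) / √X) (by linarith) (by positivity)
    (fun t ht => by
      rw [div_pow, sq_sqrt (by positivity), sq_sqrt hX0.le]
      refine (s1 t (X / 2) ht (by linarith)).trans (le_of_eq ?_)
      field_simp) (hlim X (by linarith)) t ht
  refine this.trans (le_of_eq ?_)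
  rw [show γ / 4 / 4 = γ / 16 by ring]
  congr 1
  field_simp

end

/-- Points at distance at least `X` from the region swept by the solitons. -/
def outer (σ t X : ℝ) : Set ℝ := {x | X ≤ x - σ * t ∨ X ≤ -x}

lemma measurableSet_outer (σ t X : ℝ) : MeasurableSet (outer σ t X) := by
  refine IsClosed.measurableSet (IsClosed.union ?_ ?_)
  · exact isClosed_le continuous_const (continuous_id.sub continuous_const)
  · exact isClosed_le continuous_const continuous_neg

namespace Out

variable {N : ℕ} {c Δ : ℕ → ℝ} {U : ℕ → ℝ → ℝ → ℝ}

lemma tail_exp_decay (h : Out N c Δ U) (hN : 0 < N) (σ t₁ : ℝ) {K : ℝ} {g g1 g2 g3 : ℝ → ℝ}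
    (hg : Tail K g g1 g2 g3) {κ T1 : ℝ} (hκ : 0 < κ)
    (hs : ∀ T X x, T1 ≤ T → 1 ≤ X → g ((x - σ * T) / X) ≠ 0 → x ∈ far c Δ N T (κ * T)) :
    ∃ γ D, 0 < γ ∧ 0 ≤ D ∧ ∀ t X, t₁ ≤ t → 1 ≤ X → tail U g σ t X ≤ D * exp (-(γ * t)) := by
  obtain ⟨γ, κ', T0, C, hγ, hκ', hT0, hC, -, -, hfar⟩ := h.far_mass hN
  obtain ⟨M, hM, hMb⟩ := h.sol.exists_H1_bound
  set μ := min κ κ' with hμ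
  have hμ0 : 0 < μ := lt_min hκ hκ'
  set T2 := max T0 T1 with hT2
  have hT20 : 0 < T2 := hT0.trans_le (le_max_left _ _)
  refine ⟨γ * μ, max C (M * exp (γ * μ * T2)), mul_pos hγ hμ0, hC.trans (le_max_left _ _),
    fun t X ht hX => ?_⟩
  have hle : tail U g σ t X ≤ M := by
    refine le_trans ?_ (hMb t).1
    refine integral_mono (hg.integrable h.sol σ t _) (h.sol.sq 0 t) fun x => ?_
    exact mul_le_of_le_one_right (sq_nonneg _) (hg.le_one _)
  rcases lt_or_ge t T2 with hlt | hge
  · refine hle.trans (le_trans ?_ (mul_le_mul_of_nonneg_right (le_max_right _ _) (exp_pos _).le))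
    rw [mul_assoc, ← exp_add]
    refine le_mul_of_one_le_right hM (one_le_exp ?_)
    have := mul_le_mul_of_nonneg_left hlt.le (mul_pos hγ hμ0).le
    linarith
  · have ht0 : 0 < t := hT20.trans_le hge
    have h1 := hfar t (μ * t) ((le_max_left _ _).trans hge)
      (mul_le_mul_of_nonneg_right (min_le_right _ _) ht0.le)
    refine le_trans ?_ (h1.trans ?_)
    · rw [tail, ← integral_indicator (measurableSet_far _ _ _ _ _)]
      refine integral_mono (hg.integrable h.sol σ t _)
        ((h.sol.sq 0 t).indicator (measurableSet_far _ _ _ _ _)) fun x => ?_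
      by_cases hx : g ((x - σ * t) / X) = 0
      · simp only [hx, mul_zero]
        exact Set.indicator_nonneg (fun _ _ => sq_nonneg _) _
      · have hx' : x ∈ far c Δ N t (μ * t) := fun j hj =>
          (mul_le_mul_of_nonneg_right (min_le_left _ _) ht0.le).trans
            (hs t X x ((le_max_right _ _).trans hge) hX hx j hj)
        simp only [Set.indicator_of_mem hx']
        exact mul_le_of_le_one_right (sq_nonneg _) (hg.le_one _)
    · rw [← mul_assoc]
      exact mul_le_mul_of_nonneg_right (le_max_left _ _) (exp_pos _).le

lemma tail_decay (h : Out N c Δ U) (hN : 0 < N) (t₁ : ℝ) : ∃ γ C, 0 < γ ∧ 0 ≤ C ∧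
    ∀ t X, t₁ ≤ t → 8 ≤ X →
      ∫ x in outer (c 0 + 1) t X, U 0 t x ^ 2 ≤ C / (X * √X) * exp (-(γ * t)) := by
  obtain ⟨K, g, g1, g2, g3, hg, hg0, hg2⟩ := exists_tail
  obtain ⟨-, κ, T0, -, -, hκ, hT0, -, -, hctr, -⟩ := h.far_mass hN
  obtain ⟨B, hB, hBΔ⟩ := exists_forall_lt_le N fun j => Δ j
  set σ := c 0 + 1 with hσ
  have hpos : ∀ {y X : ℝ}, 1 ≤ X → g (y / X) ≠ 0 → 0 ≤ y := fun {y X} hX hy => by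
    by_contra hn
    push Not at hn
    refine hy (hg0 _ ?_)
    rw [div_le_one (by linarith)]; linarith
  obtain ⟨γ, D, hγ, hD, hr⟩ := h.tail_exp_decay hN σ t₁ hg (κ := 1 / 2) (T1 := max 0 (2 * B))
    (by norm_num) fun T X x hT hX hx j hj => by
      have hy := hpos hX hx
      have hTB := (le_max_right _ _).trans hT
      have hT0 : 0 ≤ T := (le_max_left _ _).trans hT
      have hc : c j ≤ c 0 := by
        rcases Nat.eq_zero_or_pos j with rfl | hj0
        · exact le_rfl
        · exact (h.dec 0 j hj0 hj).le
      have := mul_le_mul_of_nonneg_right hc hT0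
      have := hBΔ j hj
      refine le_trans ?_ (le_abs_self _)
      unfold ctr
      rw [hσ] at hy
      linarith
  obtain ⟨γ', D', hγ', hD', hl⟩ := h.tail_exp_decay hN 0 t₁ hg.comp_neg (κ := κ) (T1 := T0)
    hκ fun T X x hT hX hx j hj => by
      rw [← neg_div] at hx
      have hy := hpos hX hx
      have := hctr j hj T hT
      refine le_trans ?_ (neg_le_abs _)
      linarith
  obtain ⟨C1, hC1, h1⟩ := hg.polynomial_decay h.sol σ t₁ hγ hD hr
  obtain ⟨C2, hC2, h2⟩ := hg.comp_neg.polynomial_decay h.sol 0 t₁ hγ' hD' hl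
  set μ := min (γ / 16) (γ' / 16) with hμ
  have hμ0 : 0 < μ := lt_min (by linarith) (by linarith)
  have hexp : ∀ γ₀, μ ≤ γ₀ → ∃ A, 0 ≤ A ∧ ∀ t, t₁ ≤ t → exp (-(γ₀ * t)) ≤ A * exp (-(μ * t)) :=
    fun γ₀ hγ₀ => ⟨exp (-((γ₀ - μ) * t₁)), (exp_pos _).le, fun t ht => by
      rw [← exp_add, exp_le_exp]
      have := mul_le_mul_of_nonneg_left ht (sub_nonneg.2 hγ₀)
      linarith⟩
  obtain ⟨A1, hA1, hA1e⟩ := hexp _ (min_le_left _ _)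
  obtain ⟨A2, hA2, hA2e⟩ := hexp _ (min_le_right _ _)
  refine ⟨μ, 4 * (C1 * A1 + C2 * A2), hμ0, by positivity, fun t X ht hX => ?_⟩
  have hX0 : 0 < X := by linarith
  have hle : ∫ x in outer σ t X, U 0 t x ^ 2 ≤
      tail U g σ t (X / 2) + tail U (fun x => g (-x)) 0 t (X / 2) := by
    rw [tail, tail, ← integral_add (hg.integrable h.sol _ _ _)
      (hg.comp_neg.integrable h.sol _ _ _), ← integral_indicator (measurableSet_outer _ _ _)]
    refine integral_mono ((h.sol.sq 0 t).indicator (measurableSet_outer _ _ _))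
      ((hg.integrable h.sol _ _ _).fun_add (hg.comp_neg.integrable h.sol _ _ _)) fun x => ?_
    have n1 := mul_nonneg (sq_nonneg (U 0 t x)) (hg.nonneg ((x - σ * t) / (X / 2)))
    have n2 := mul_nonneg (sq_nonneg (U 0 t x)) (hg.nonneg (-((x - 0 * t) / (X / 2))))
    by_cases hx : x ∈ outer σ t X
    · rw [Set.indicator_of_mem hx]
      rcases hx with hx | hx
      · have : g ((x - σ * t) / (X / 2)) = 1 := hg2 _ (by
          rw [le_div_iff₀ (by linarith)]; linarith)
        rw [this] at n1 ⊢
        linarith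
      · have : g (-((x - 0 * t) / (X / 2))) = 1 := hg2 _ (by
          rw [← neg_div, le_div_iff₀ (by linarith)]; linarith)
        rw [this] at n2 ⊢
        linarith
    · rw [Set.indicator_of_notMem hx]
      exact add_nonneg n1 n2
  have hden : ∀ C, 0 ≤ C → C / (X / 2 * √(X / 2)) ≤ 4 * C / (X * √X) := fun C hC => by
    have hs : √X ≤ 2 * √(X / 2) := by
      rw [sqrt_le_left (by positivity), mul_pow, sq_sqrt (by linarith)]; linarith
    rw [div_le_div_iff₀ (by positivity) (by positivity)]
    have := mul_le_mul_of_nonneg_left hs (mul_nonneg hC hX0.le)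
    linarith
  have e1 : tail U g σ t (X / 2) ≤ 4 * C1 / (X * √X) * (A1 * exp (-(μ * t))) :=
    (h1 t _ ht (by linarith)).trans
      (mul_le_mul (hden C1 hC1) (hA1e t ht) (exp_pos _).le (by positivity))
  have e2 : tail U (fun x => g (-x)) 0 t (X / 2) ≤ 4 * C2 / (X * √X) * (A2 * exp (-(μ * t))) :=
    (h2 t _ ht (by linarith)).trans
      (mul_le_mul (hden C2 hC2) (hA2e t ht) (exp_pos _).le (by positivity))
  refine hle.trans ((add_le_add e1 e2).trans (le_of_eq ?_))
  ring

end Out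

/-! ### Integrability -/

lemma integrableOn_of_sq {f : ℝ → ℝ} (hf : Continuous f) (hf2 : Integrable fun x => f x ^ 2)
    {S : Set ℝ} {m v l : ℝ} (hm : ∫ x in S, f x ^ 2 ≤ m) (hv0 : 0 ≤ v)
    (hv : volume S ≤ ENNReal.ofReal v) (hl : 0 < l) :
    IntegrableOn f S ∧ ∫ x in S, |f x| ≤ (l * m + v / l) / 2 := by
  have hfin : volume S < ⊤ := hv.trans_lt ENNReal.ofReal_lt_top
  have : IsFiniteMeasure (volume.restrict S) := ⟨by simpa using hfin⟩
  have ic : Integrable (fun _ : ℝ => 1 / l) (volume.restrict S) := integrable_const _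
  have iB : Integrable (fun x => (l * f x ^ 2 + 1 / l) / 2) (volume.restrict S) :=
    ((hf2.integrableOn.const_mul l).fun_add ic).div_const 2
  have hpt : ∀ x, |f x| ≤ (l * f x ^ 2 + 1 / l) / 2 := fun x => by
    have h1 := sq_nonneg (l * |f x| - 1)
    have h2 : l * (2 * |f x|) ≤ l * (l * f x ^ 2 + 1 / l) := by
      have : l * (1 / l) = 1 := by field_simp
      rw [mul_add, this, ← sq_abs (f x)]
      linarith
    linarith [le_of_mul_le_mul_left h2 hl]
  have hi : IntegrableOn f S :=
    iB.mono' hf.aestronglyMeasurable (ae_of_all _ fun x => hpt x)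
  refine ⟨hi, (integral_mono hi.abs iB hpt).trans ?_⟩
  have e : ∫ x in S, (l * f x ^ 2 + 1 / l) / 2 =
      (l * (∫ x in S, f x ^ 2) + volume.real S * (1 / l)) / 2 := by
    rw [integral_div, integral_add (hf2.integrableOn.const_mul l) ic, integral_const_mul]
    simp
  rw [e]
  have h1 := mul_le_mul_of_nonneg_left hm hl.le
  have h2 : volume.real S ≤ v := ENNReal.toReal_le_of_le_ofReal hv0 hv
  have h3 := mul_le_mul_of_nonneg_right h2 (one_div_pos.2 hl).le
  rw [div_eq_mul_one_div v l]
  linarith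

/-- Integrability from bounds on the mass on a geometric family of shells. -/
lemma integrableOn_of_shells {f : ℝ → ℝ} (hf : Continuous f) (hf2 : Integrable fun x => f x ^ 2)
    {E : Set ℝ} {S : ℕ → Set ℝ} {m v l : ℕ → ℝ} {a q : ℝ} (hE : E ⊆ ⋃ k, S k)
    (hm : ∀ k, ∫ x in S k, f x ^ 2 ≤ m k) (hv0 : ∀ k, 0 ≤ v k)
    (hv : ∀ k, volume (S k) ≤ ENNReal.ofReal (v k)) (hl : ∀ k, 0 < l k) (ha : 0 ≤ a) (hq : 0 ≤ q)
    (hq1 : q < 1) (hb : ∀ k, l k * m k + v k / l k ≤ 2 * (a * q ^ k)) :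
    IntegrableOn f E ∧ ∫ x in E, |f x| ≤ a / (1 - q) := by
  have hk := fun k => integrableOn_of_sq hf hf2 (hm k) (hv0 k) (hv k) (hl k)
  have hsum : Summable fun k => a * q ^ k := (summable_geometric_of_lt_one hq hq1).mul_left a
  have hlint : ∫⁻ x in E, ‖f x‖ₑ ≤ ENNReal.ofReal (a / (1 - q)) := by
    calc ∫⁻ x in E, ‖f x‖ₑ ≤ ∫⁻ x in ⋃ k, S k, ‖f x‖ₑ := lintegral_mono_set hE
      _ ≤ ∑' k, ∫⁻ x in S k, ‖f x‖ₑ := lintegral_iUnion_le _ _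
      _ ≤ ∑' k, ENNReal.ofReal (a * q ^ k) := by
        refine ENNReal.tsum_le_tsum fun k => ?_
        rw [← ofReal_integral_norm_eq_lintegral_enorm (hk k).1]
        refine ENNReal.ofReal_le_ofReal ((hk k).2.trans ?_)
        linarith [hb k]
      _ = ENNReal.ofReal (∑' k, a * q ^ k) :=
        (ENNReal.ofReal_tsum_of_nonneg (fun k => mul_nonneg ha (pow_nonneg hq k)) hsum).symm
      _ = ENNReal.ofReal (a / (1 - q)) := by
        rw [tsum_mul_left, tsum_geometric_of_lt_one hq hq1, div_eq_mul_inv]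
  have hi : IntegrableOn f E :=
    ⟨hf.aestronglyMeasurable, hlint.trans_lt ENNReal.ofReal_lt_top⟩
  refine ⟨hi, ?_⟩
  have h1 : ENNReal.ofReal (∫ x in E, ‖f x‖) ≤ ENNReal.ofReal (a / (1 - q)) := by
    rw [ofReal_integral_norm_eq_lintegral_enorm hi]; exact hlint
  exact (ENNReal.ofReal_le_ofReal_iff (div_nonneg ha (by linarith))).1 h1

namespace Out

variable {N : ℕ} {c Δ : ℕ → ℝ} {U : ℕ → ℝ → ℝ → ℝ}

lemma tail_integrable (h : Out N c Δ U) (hN : 0 < N) (t₁ : ℝ) : ∃ γ C, 0 < γ ∧ 0 ≤ C ∧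
    ∀ t, t₁ ≤ t → IntegrableOn (U 0 t) (outer (c 0 + 1) t 8) ∧
      ∫ x in outer (c 0 + 1) t 8, |U 0 t x| ≤ C * exp (-(γ * t)) := by
  obtain ⟨γ, C, hγ, hC, hdec⟩ := h.tail_decay hN t₁
  refine ⟨γ / 2, C + 240, by linarith, by positivity, fun t ht => ?_⟩
  set σ := c 0 + 1 with hσ
  set e := exp (γ / 2 * t) with he
  have he0 : 0 < e := exp_pos _
  have hee : exp (-(γ * t)) = 1 / (e * e) := by
    rw [he, ← exp_add, one_div, ← exp_neg]; congr 1; ring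
  have hee' : exp (-(γ / 2 * t)) = 1 / e := by rw [he, one_div, ← exp_neg]
  let S : ℕ → Set ℝ := fun k => outer σ t (8 * 16 ^ k) \ outer σ t (8 * 16 ^ (k + 1))
  have hcov : outer σ t 8 ⊆ ⋃ k, S k := fun x hx => by
    have hex : ∃ n : ℕ, x ∉ outer σ t (8 * 16 ^ n) := by
      obtain ⟨n, hn⟩ := pow_unbounded_of_one_lt (max (x - σ * t) (-x)) (by norm_num : (1 : ℝ) < 16)
      refine ⟨n, fun hx => ?_⟩
      have h0 : (0 : ℝ) < 16 ^ n := by positivity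
      have h1 := le_max_left (x - σ * t) (-x)
      have h2 := le_max_right (x - σ * t) (-x)
      rcases hx with hx | hx <;> linarith
    classical
    have hf := Nat.find_spec hex
    have hmin := fun {k : ℕ} => Nat.find_min hex (m := k)
    obtain ⟨n, hn⟩ : ∃ n, Nat.find hex = n + 1 := by
      refine Nat.exists_eq_succ_of_ne_zero fun h0 => ?_
      rw [h0] at hf
      exact hf (by simpa using hx)
    rw [hn] at hf
    exact Set.mem_iUnion.2 ⟨n, not_not.1 (hmin (by omega)), hf⟩
  have := integrableOn_of_shells (h.sol.cont_slice 0 t) (h.sol.sq 0 t) hcov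
    (m := fun k => C / 64 ^ k * (1 / (e * e))) (v := fun k => 240 * 16 ^ k)
    (l := fun k => 32 ^ k * e) (a := (C + 240) / 2 * (1 / e)) (q := 1 / 2) (fun k => ?_)
    (fun k => by positivity) (fun k => ?_) (fun k => by positivity) (by positivity) (by norm_num)
    (by norm_num) (fun k => ?_)
  · refine ⟨this.1, this.2.trans (le_of_eq ?_)⟩
    rw [hee']; ring
  · have h1 : ∫ x in S k, U 0 t x ^ 2 ≤ ∫ x in outer σ t (8 * 16 ^ k), U 0 t x ^ 2 :=
      setIntegral_mono_set (h.sol.sq 0 t).integrableOn (ae_of_all _ fun x => sq_nonneg _)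
        (Set.sdiff_subset.eventuallyLE)
    have hp : (1 : ℝ) ≤ 16 ^ k := one_le_pow₀ (by norm_num)
    refine h1.trans ((hdec t (8 * 16 ^ k) ht (by linarith)).trans ?_)
    rw [hee]
    refine mul_le_mul_of_nonneg_right ?_ (by positivity)
    refine div_le_div_of_nonneg_left hC (by positivity) ?_
    have hs : (4 : ℝ) ^ k ≤ √(8 * 16 ^ k) := by
      refine Real.le_sqrt_of_sq_le ?_
      rw [← pow_mul, mul_comm k, pow_mul]; norm_num
    calc (64 : ℝ) ^ k = 16 ^ k * 4 ^ k := by rw [← mul_pow]; norm_num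
      _ ≤ 8 * 16 ^ k * √(8 * 16 ^ k) := mul_le_mul (by linarith) hs (by positivity) (by positivity)
  · have hsub : S k ⊆ Set.Icc (σ * t + 8 * 16 ^ k) (σ * t + 8 * 16 ^ (k + 1)) ∪
        Set.Icc (-(8 * 16 ^ (k + 1))) (-(8 * 16 ^ k)) := fun x hx => by
      obtain ⟨hx1, hx2⟩ := hx
      simp only [outer, Set.mem_ofPred_eq, not_or, not_le] at hx1 hx2
      rcases hx1 with hx1 | hx1
      · left; constructor <;> linarith [hx2.1]
      · right; constructor <;> linarith [hx2.2]
    refine (measure_mono hsub).trans ((measure_union_le _ _).trans ?_)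
    rw [Real.volume_Icc, Real.volume_Icc, ← ENNReal.ofReal_add]
    · refine ENNReal.ofReal_le_ofReal (le_of_eq ?_)
      rw [pow_succ]; ring
    · rw [pow_succ]; linarith [(by positivity : (0 : ℝ) < 16 ^ k)]
    · rw [pow_succ]; linarith [(by positivity : (0 : ℝ) < 16 ^ k)]
  · refine le_of_eq ?_
    have e1 : (64 : ℝ) ^ k = 32 ^ k * 2 ^ k := by rw [← mul_pow]; norm_num
    have e2 : (32 : ℝ) ^ k = 16 ^ k * 2 ^ k := by rw [← mul_pow]; norm_num
    have e3 : ((1 : ℝ) / 2) ^ k = 1 / 2 ^ k := by rw [div_pow, one_pow]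
    rw [e1, e3]
    rw [e2]
    field_simp

end Out

namespace Out

variable {N : ℕ} {c Δ : ℕ → ℝ} {U : ℕ → ℝ → ℝ → ℝ}

lemma volume_compl_outer_le {σ t : ℝ} {A : Set ℝ} (hσ : 0 ≤ σ) (hA : Disjoint A (outer σ t 8)) :
    volume A ≤ ENNReal.ofReal (σ * |t| + 16) := by
  have hsub : A ⊆ Set.Icc (-8) (σ * |t| + 8) := fun x hx => by
    have h1 := Set.disjoint_left.1 hA hx
    simp only [outer, Set.mem_ofPred_eq, not_or, not_le] at h1
    have := mul_le_mul_of_nonneg_left (le_abs_self t) hσ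
    constructor <;> linarith [h1.1, h1.2]
  refine (measure_mono hsub).trans ?_
  rw [Real.volume_Icc]
  exact ENNReal.ofReal_le_ofReal (by linarith)

lemma speed_pos (h : Out N c Δ U) (hN : 0 < N) : 0 ≤ c 0 + 1 := by
  linarith [h.pos 0 hN]

lemma integral_abs_bounded (h : Out N c Δ U) (hN : 0 < N) (s t : ℝ) :
    ∃ C, ∀ τ ∈ Set.uIcc s t, Integrable (U 0 τ) ∧ ∫ x, |U 0 τ x| ≤ C := by
  obtain ⟨γ, C, hγ, hC, htail⟩ := h.tail_integrable hN (min s t)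
  obtain ⟨M, hM, hMb⟩ := h.sol.exists_H1_bound
  set σ := c 0 + 1 with hσ
  have hσ0 : 0 ≤ σ := h.speed_pos hN
  refine ⟨C * exp (-(γ * min s t)) + (M + (σ * (|s| + |t|) + 16)) / 2, fun τ hτ => ?_⟩
  rw [Set.mem_uIcc] at hτ
  have hτ1 : min s t ≤ τ := by grind
  have hτ2 : |τ| ≤ |s| + |t| := by grind
  obtain ⟨i1, b1⟩ := htail τ hτ1
  obtain ⟨i2, b2⟩ := integrableOn_of_sq (h.sol.cont_slice 0 τ) (h.sol.sq 0 τ)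
    (S := (outer σ τ 8)ᶜ) (m := M) (v := σ * |τ| + 16) (l := 1)
    ((setIntegral_le_integral (h.sol.sq 0 τ) (ae_of_all _ fun x => sq_nonneg _)).trans (hMb τ).1)
    (by positivity) (volume_compl_outer_le hσ0 disjoint_compl_left) one_pos
  have hi : Integrable (U 0 τ) := by
    rw [← integrableOn_univ, ← Set.union_compl_self (outer σ τ 8)]
    exact i1.union i2
  refine ⟨hi, ?_⟩
  rw [← integral_add_compl (measurableSet_outer σ τ 8) hi.abs]
  have e1 : exp (-(γ * τ)) ≤ exp (-(γ * min s t)) := by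
    rw [exp_le_exp]
    have := mul_le_mul_of_nonneg_left hτ1 hγ.le
    linarith
  have e2 := mul_le_mul_of_nonneg_left e1 hC
  have e3 := mul_le_mul_of_nonneg_left hτ2 hσ0
  linarith

lemma integrable (h : Out N c Δ U) (hN : 0 < N) (t : ℝ) : Integrable (U 0 t) := by
  obtain ⟨C, hC⟩ := h.integral_abs_bounded hN t t
  exact (hC t Set.left_mem_uIcc).1

lemma integral_conserved (h : Out N c Δ U) (hN : 0 < N) (s t : ℝ) :
    ∫ x, U 0 t x = ∫ x, U 0 s x := by
  have hU := h.sol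
  have hT := hU.reg_uIcc s t
  have hρ : L1On (Set.uIcc s t) fun t x => U 0 t x := ⟨hU.cont 0, h.integral_abs_bounded hN s t⟩
  have := balance_total hU.balance_integral hρ L1On.zero (hT.l1_pow hU 2).neg L1On.zero hρ.neg
  simp only [integral_zero, intervalIntegral.integral_zero] at this
  exact sub_eq_zero.1 this

lemma volume_shell_le (c Δ : ℕ → ℝ) (N : ℕ) (T a : ℝ) {A : Set ℝ} (hA : A ⊆ far c Δ N T a)
    (hA' : Disjoint A (far c Δ N T (a + 1))) : volume A ≤ ENNReal.ofReal (2 * N) := by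
  have hsub : A ⊆ ⋃ j ∈ Finset.range N, (Set.Icc (ctr c Δ j T + a) (ctr c Δ j T + (a + 1)) ∪
      Set.Icc (ctr c Δ j T - (a + 1)) (ctr c Δ j T - a)) := fun x hx => by
    have h1 := hA hx
    have h2 := Set.disjoint_left.1 hA' hx
    simp only [far, Set.mem_ofPred_eq, not_forall, not_le] at h1 h2
    obtain ⟨j, hj, hlt⟩ := h2
    have hge := h1 j hj
    refine Set.mem_iUnion₂.2 ⟨j, Finset.mem_range.2 hj, ?_⟩
    rcases le_total 0 (x - ctr c Δ j T) with h0 | h0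
    · rw [abs_of_nonneg h0] at hlt hge
      left; constructor <;> linarith
    · rw [abs_of_nonpos h0] at hlt hge
      right; constructor <;> linarith
  refine (measure_mono hsub).trans ((measure_biUnion_finset_le _ _).trans ?_)
  refine (Finset.sum_le_card_nsmul _ _ (ENNReal.ofReal 2) fun j _ => ?_).trans (le_of_eq ?_)
  · refine (measure_union_le _ _).trans (le_of_eq ?_)
    rw [Real.volume_Icc, Real.volume_Icc, ← ENNReal.ofReal_add (by linarith) (by linarith)]
    congr 1; ring
  · rw [Finset.card_range, ← ENNReal.ofReal_nsmul]; congr 1; simp [mul_comm]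

lemma volume_near_le (c Δ : ℕ → ℝ) (N : ℕ) (T ℓ : ℝ) :
    volume (far c Δ N T ℓ)ᶜ ≤ ENNReal.ofReal (2 * |ℓ| * N) := by
  have hsub : (far c Δ N T ℓ)ᶜ ⊆
      ⋃ j ∈ Finset.range N, Set.Icc (ctr c Δ j T - |ℓ|) (ctr c Δ j T + |ℓ|) := fun x hx => by
    simp only [far, Set.mem_compl_iff, Set.mem_ofPred_eq, not_forall, not_le] at hx
    obtain ⟨j, hj, hlt⟩ := hx
    refine Set.mem_iUnion₂.2 ⟨j, Finset.mem_range.2 hj, ?_⟩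
    have := abs_le.1 (hlt.le.trans (le_abs_self ℓ))
    constructor <;> linarith [this.1, this.2]
  refine (measure_mono hsub).trans ((measure_biUnion_finset_le _ _).trans ?_)
  refine (Finset.sum_le_card_nsmul _ _ (ENNReal.ofReal (2 * |ℓ|)) fun j _ => ?_).trans
    (le_of_eq ?_)
  · rw [Real.volume_Icc]
    exact ENNReal.ofReal_le_ofReal (by linarith)
  · rw [Finset.card_range, ← ENNReal.ofReal_nsmul]; congr 1; simp [mul_comm]

/-- The solution is small in `L¹` away from the solitons. -/
lemma far_integral (h : Out N c Δ U) (hN : 0 < N) : ∃ (A μ : ℝ) (B : ℝ → ℝ), 0 < μ ∧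
    Tendsto B atTop (nhds 0) ∧ ∀ ℓ : ℝ, ∀ᶠ T in atTop,
      ∫ x in far c Δ N T ℓ, |U 0 T x| ≤ A * exp (-(μ * ℓ)) + B T := by
  obtain ⟨γ, κ, T0, C, hγ, hκ, hT0, hC, -, -, hfar⟩ := h.far_mass hN
  obtain ⟨γ', C', hγ', hC', htail⟩ := h.tail_integrable hN 0
  set σ := c 0 + 1 with hσ
  have hσ0 : 0 ≤ σ := h.speed_pos hN
  set q := exp (-(γ / 2)) with hq
  have hq0 : 0 < q := exp_pos _
  have hq1 : q < 1 := Real.exp_lt_one_iff.2 (by linarith)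
  refine ⟨(C + 2 * N) / 2 / (1 - q), γ / 2,
    fun T => (C + (σ * T + 16)) / 2 * exp (-(γ / 2 * κ * T)) + C' * exp (-(γ' * T)), by linarith,
    ?_, fun ℓ => ?_⟩
  · have h1 : Tendsto (fun T : ℝ => exp (-(γ' * T))) atTop (nhds 0) :=
      tendsto_exp_neg_atTop_nhds_zero.comp (tendsto_id.const_mul_atTop hγ')
    have h2 : Tendsto (fun T : ℝ => exp (-(γ / 2 * κ * T))) atTop (nhds 0) :=
      tendsto_exp_neg_atTop_nhds_zero.comp (tendsto_id.const_mul_atTop (by positivity))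
    have hk : 0 < γ / 2 * κ := by positivity
    have h3 : Tendsto (fun T : ℝ => γ / 2 * κ * T * exp (-(γ / 2 * κ * T))) atTop (nhds 0) := by
      have := (Real.tendsto_pow_mul_exp_neg_atTop_nhds_zero 1).comp (tendsto_id.const_mul_atTop hk)
      simpa [Function.comp_def] using this
    have h4 := ((h2.const_mul ((C + 16) / 2)).add (h3.const_mul (σ / 2 / (γ / 2 * κ)))).add
      (h1.const_mul C')
    simp only [mul_zero, add_zero] at h4
    refine h4.congr fun T => ?_
    field_simp
    ring
  · filter_upwards [eventually_ge_atTop T0] with T hT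
    have hTpos : 0 < T := hT0.trans_le hT
    have hsq := h.sol.sq 0 T
    have cU := h.sol.cont_slice 0 T
    have far_mono : ∀ {a b : ℝ}, a ≤ b → far c Δ N T b ⊆ far c Δ N T a := fun hab x hx j hj =>
      hab.trans (hx j hj)
    have hmass : ∀ a ≤ κ * T, ∀ S ⊆ far c Δ N T a,
        ∫ x in S, U 0 T x ^ 2 ≤ C * exp (-(γ * a)) := fun a ha S hS =>
      (setIntegral_mono_set hsq.integrableOn (ae_of_all _ fun x => sq_nonneg _)
        hS.eventuallyLE).trans (hfar T a hT ha)
    have hshell := integrableOn_of_shells cU hsq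
      (E := far c Δ N T ℓ \ far c Δ N T (κ * T))
      (S := fun k : ℕ => far c Δ N T (ℓ + k) \ (far c Δ N T (ℓ + k + 1) ∪ far c Δ N T (κ * T)))
      (m := fun k => C * exp (-(γ * (ℓ + k)))) (v := fun _ => 2 * N)
      (l := fun k => exp (γ / 2 * (ℓ + k))) (a := (C + 2 * N) / 2 * exp (-(γ / 2 * ℓ))) (q := q)
      (fun x hx => ?_) (fun k => ?_) (fun k => by positivity) (fun k => ?_) (fun k => exp_pos _)
      (by positivity) hq0.le hq1 (fun k => le_of_eq ?_)
    · have hmid := integrableOn_of_sq cU hsq (S := far c Δ N T (κ * T) \ outer σ T 8)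
        (m := C * exp (-(γ * (κ * T)))) (v := σ * |T| + 16) (l := exp (γ / 2 * κ * T))
        (hmass _ le_rfl _ Set.sdiff_subset) (by positivity)
        (volume_compl_outer_le hσ0 Set.disjoint_sdiff_left) (exp_pos _)
      have hout := htail T hTpos.le
      have hsub : far c Δ N T ℓ ⊆ (far c Δ N T ℓ \ far c Δ N T (κ * T)) ∪
          ((far c Δ N T (κ * T) \ outer σ T 8) ∪ outer σ T 8) := fun x hx => by
        by_cases h1 : x ∈ far c Δ N T (κ * T)
        · by_cases h2 : x ∈ outer σ T 8
          · exact Or.inr (Or.inr h2)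
          · exact Or.inr (Or.inl ⟨h1, h2⟩)
        · exact Or.inl ⟨hx, h1⟩
      have i2 := hmid.1.union hout.1
      have i3 := hshell.1.union i2
      have hu : ∀ {E F : Set ℝ}, IntegrableOn (U 0 T) E → IntegrableOn (U 0 T) F →
          ∫ x in E ∪ F, |U 0 T x| ≤ (∫ x in E, |U 0 T x|) + ∫ x in F, |U 0 T x| :=
        fun {E F} hE hF => by
        rw [← integral_add_measure hE.abs hF.abs]
        exact integral_mono_measure (Measure.restrict_union_le _ _)
          (ae_of_all _ fun x => abs_nonneg _) (hE.abs.add_measure hF.abs)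
      have j1 : ∫ x in far c Δ N T ℓ, |U 0 T x| ≤ _ :=
        setIntegral_mono_set i3.abs (ae_of_all _ fun x => abs_nonneg _) hsub.eventuallyLE
      have j2 := hu hshell.1 i2
      have j3 := hu hmid.1 hout.1
      have e1 : (exp (γ / 2 * κ * T) * (C * exp (-(γ * (κ * T)))) +
          (σ * |T| + 16) / exp (γ / 2 * κ * T)) / 2 =
          (C + (σ * T + 16)) / 2 * exp (-(γ / 2 * κ * T)) := by
        have a1 : exp (-(γ * (κ * T))) = exp (-(γ / 2 * κ * T)) * exp (-(γ / 2 * κ * T)) := by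
          rw [← exp_add]; congr 1; ring
        rw [a1, abs_of_pos hTpos, exp_neg]
        field_simp
      rw [e1] at hmid
      have e2 : (C + 2 * N) / 2 * exp (-(γ / 2 * ℓ)) / (1 - q) =
          (C + 2 * N) / 2 / (1 - q) * exp (-(γ / 2 * ℓ)) := by ring
      rw [e2] at hshell
      linarith [hshell.2, hmid.2, hout.2]
    · obtain ⟨hx1, hx2⟩ := hx
      have hex : ∃ n : ℕ, x ∉ far c Δ N T (ℓ + n) := by
        obtain ⟨n, hn⟩ := exists_nat_gt (|x - ctr c Δ 0 T| - ℓ)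
        exact ⟨n, fun hx => by have := hx 0 hN; linarith⟩
      classical
      have hf := Nat.find_spec hex
      have hmin := fun {k : ℕ} => Nat.find_min hex (m := k)
      obtain ⟨n, hn⟩ : ∃ n, Nat.find hex = n + 1 := by
        refine Nat.exists_eq_succ_of_ne_zero fun h0 => ?_
        rw [h0] at hf
        exact hf (by simpa using hx1)
      rw [hn] at hf
      refine Set.mem_iUnion.2 ⟨n, not_not.1 (hmin (by omega)), fun hx => ?_⟩
      rcases hx with hx | hx
      · exact hf (by push_cast; rwa [← add_assoc])
      · exact hx2 hx
    · rcases le_or_gt (ℓ + k) (κ * T) with hle | hgt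
      · exact hmass _ hle _ Set.sdiff_subset
      · have hempty : far c Δ N T (ℓ + k) \ (far c Δ N T (ℓ + k + 1) ∪ far c Δ N T (κ * T)) = ∅ := by
          refine Set.eq_empty_of_forall_notMem fun x hx => hx.2 (Or.inr (far_mono hgt.le hx.1))
        rw [hempty, setIntegral_empty]
        positivity
    · exact volume_shell_le c Δ N T (ℓ + k) Set.sdiff_subset
        (Set.disjoint_sdiff_left.mono_right Set.subset_union_left)
    · have a1 : exp (-(γ * (ℓ + k))) = exp (-(γ / 2 * (ℓ + k))) * exp (-(γ / 2 * (ℓ + k))) := by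
        rw [← exp_add]; congr 1; ring
      have a2 : exp (-(γ / 2 * (ℓ + k))) = exp (-(γ / 2 * ℓ)) * q ^ k := by
        rw [hq, ← exp_nat_mul, ← exp_add]; congr 1; ring
      have a3 : exp (γ / 2 * (ℓ + k)) = (exp (-(γ / 2 * (ℓ + k))))⁻¹ := by
        rw [← exp_neg, neg_neg]
      have a4 := exp_pos (-(γ / 2 * (ℓ + k)))
      rw [a1, a3]
      have : 2 * ((C + 2 * N) / 2 * exp (-(γ / 2 * ℓ)) * q ^ k) =
          (C + 2 * N) * exp (-(γ / 2 * (ℓ + k))) := by rw [a2]; ring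
      rw [this]
      field_simp

end Out

lemma measurableSet_le_abs (ℓ : ℝ) : MeasurableSet {y : ℝ | ℓ ≤ |y|} :=
  (isClosed_le continuous_const continuous_abs).measurableSet

lemma tendsto_integral_le_abs {f : ℝ → ℝ} (hf : Integrable f) :
    Tendsto (fun ℓ : ℝ => ∫ y, Set.indicator {y : ℝ | ℓ ≤ |y|} f y) atTop (nhds 0) := by
  have h := tendsto_integral_filter_of_dominated_convergence (μ := volume) (l := atTop)
    (F := fun (ℓ : ℝ) y => Set.indicator {y : ℝ | ℓ ≤ |y|} f y) (f := fun _ => (0 : ℝ))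
    (fun y => ‖f y‖)
    (Eventually.of_forall fun ℓ => (hf.indicator (measurableSet_le_abs ℓ)).aestronglyMeasurable)
    (Eventually.of_forall fun ℓ => ae_of_all _ fun y => norm_indicator_le_norm_self _ _)
    hf.norm (ae_of_all _ fun y => ?_)
  · simpa using h
  · refine tendsto_const_nhds.congr' ?_
    filter_upwards [eventually_gt_atTop |y|] with ℓ hℓ
    rw [Set.indicator_of_notMem]
    simpa using hℓ

namespace Out

variable {N : ℕ} {c Δ : ℕ → ℝ} {U : ℕ → ℝ → ℝ → ℝ}

lemma integrable_bump (h : Out N c Δ U) {j : ℕ} (hj : j < N) (t : ℝ) :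
    Integrable (bump c Δ j t) :=
  (integrable_Qc (h.pos j hj)).comp_sub_right (ctr c Δ j t)

lemma integrable_bumps (h : Out N c Δ U) (t : ℝ) : Integrable (bumps c Δ N t) :=
  integrable_finsetSum _ fun _ hj => h.integrable_bump (Finset.mem_range.1 hj) t

lemma integral_bumps (h : Out N c Δ U) (t : ℝ) :
    ∫ x, bumps c Δ N t x = ∑ j ∈ Finset.range N, ∫ x, Qc (c j) x := by
  simp only [bumps]
  rw [integral_finsetSum _ fun _ hj => h.integrable_bump (Finset.mem_range.1 hj) t]
  exact Finset.sum_congr rfl fun j _ => integral_sub_right_eq_self (Qc (c j)) (ctr c Δ j t)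

lemma far_bumps_le (h : Out N c Δ U) (T ℓ : ℝ) :
    ∫ x in far c Δ N T ℓ, bumps c Δ N T x ≤
      ∑ j ∈ Finset.range N, ∫ y, Set.indicator {y : ℝ | ℓ ≤ |y|} (Qc (c j)) y := by
  simp only [bumps]
  rw [integral_finsetSum _ fun _ hj => (h.integrable_bump (Finset.mem_range.1 hj) T).integrableOn]
  refine Finset.sum_le_sum fun j hj => ?_
  have hj' := Finset.mem_range.1 hj
  have hi := (integrable_Qc (h.pos j hj')).indicator (measurableSet_le_abs ℓ)
  rw [← integral_sub_right_eq_self (Set.indicator {y : ℝ | ℓ ≤ |y|} (Qc (c j))) (ctr c Δ j T),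
    ← integral_indicator (measurableSet_far _ _ _ _ _)]
  refine integral_mono ((h.integrable_bump hj' T).indicator (measurableSet_far _ _ _ _ _))
    (hi.comp_sub_right (ctr c Δ j T)) fun x => ?_
  by_cases hx : x ∈ far c Δ N T ℓ
  · have hx' : x - ctr c Δ j T ∈ {y : ℝ | ℓ ≤ |y|} := hx j hj'
    simp only [Set.indicator_of_mem hx, Set.indicator_of_mem hx', bump, le_refl]
  · rw [Set.indicator_of_notMem hx]
    exact Set.indicator_nonneg (fun y _ => (Qc_pos (h.pos j hj') y).le) _

lemma integral_eq (h : Out N c Δ U) (hN : 0 < N) (t : ℝ) :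
    ∫ x, U 0 t x = ∑ j ∈ Finset.range N, ∫ x, Qc (c j) x := by
  obtain ⟨A, μ, B, hμ, hB, hfar⟩ := h.far_integral hN
  set δ : ℝ → ℝ := fun ℓ =>
    ∑ j ∈ Finset.range N, ∫ y, Set.indicator {y : ℝ | ℓ ≤ |y|} (Qc (c j)) y with hδ
  have hδ0 : Tendsto δ atTop (nhds 0) := by
    have := tendsto_finsetSum (Finset.range N) fun j hj =>
      tendsto_integral_le_abs (integrable_Qc (h.pos j (Finset.mem_range.1 hj)))
    simpa using this
  set D := |(∫ x, U 0 t x) - ∑ j ∈ Finset.range N, ∫ x, Qc (c j) x| with hD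
  have key : ∀ ℓ l : ℝ, 0 < l → ∀ᶠ T in atTop, D ≤
      (l * (∫ x, (U 0 T x - bumps c Δ N T x) ^ 2) + 2 * |ℓ| * N / l) / 2
        + (A * exp (-(μ * ℓ)) + B T) + δ ℓ := fun ℓ l hl => by
    filter_upwards [hfar ℓ] with T hT
    have iU := h.integrable hN T
    have iR := h.integrable_bumps T
    have iD : Integrable fun x => U 0 T x - bumps c Δ N T x := iU.sub iR
    have mF := measurableSet_far c Δ N T ℓ
    have e1 : (∫ x, U 0 t x) - ∑ j ∈ Finset.range N, ∫ x, Qc (c j) x =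
        ∫ x, (U 0 T x - bumps c Δ N T x) := by
      rw [integral_sub iU iR, h.integral_bumps, h.integral_conserved hN T t]
    have e2 : ∫ x, |U 0 T x - bumps c Δ N T x| =
        (∫ x in far c Δ N T ℓ, |U 0 T x - bumps c Δ N T x|)
          + ∫ x in (far c Δ N T ℓ)ᶜ, |U 0 T x - bumps c Δ N T x| :=
      (integral_add_compl mF iD.abs).symm
    have hnear := (integrableOn_of_sq ((h.sol.cont_slice 0 T).fun_sub (continuous_bumps c Δ N T))
      (h.integrable_diff_sq T) (S := (far c Δ N T ℓ)ᶜ)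
      (setIntegral_le_integral (h.integrable_diff_sq T) (ae_of_all _ fun x => sq_nonneg _))
      (by positivity) (volume_near_le c Δ N T ℓ) hl).2
    have hfar' : ∫ x in far c Δ N T ℓ, |U 0 T x - bumps c Δ N T x| ≤
        (∫ x in far c Δ N T ℓ, |U 0 T x|) + ∫ x in far c Δ N T ℓ, bumps c Δ N T x := by
      rw [← integral_add iU.abs.integrableOn iR.integrableOn]
      refine integral_mono iD.abs.integrableOn (iU.abs.fun_add iR).integrableOn fun x => ?_
      have := abs_sub (U 0 T x) (bumps c Δ N T x)
      rwa [abs_of_nonneg (h.bumps_nonneg T x)] at this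
    rw [hD, e1]
    refine abs_integral_le_integral_abs.trans ?_
    rw [e2]
    have hb : ∫ x in far c Δ N T ℓ, bumps c Δ N T x ≤ δ ℓ := h.far_bumps_le T ℓ
    linarith
  have key2 : ∀ ℓ l : ℝ, 0 < l → D ≤ |ℓ| * N * l⁻¹ + A * exp (-(μ * ℓ)) + δ ℓ :=
    fun ℓ l hl => by
    refine ge_of_tendsto ?_ (key ℓ l hl)
    have := (((((h.lim_diff.const_mul l).add_const (2 * |ℓ| * N / l)).div_const 2).add
      (hB.const_add (A * exp (-(μ * ℓ))))).add_const (δ ℓ))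
    convert this using 2
    ring
  have key3 : ∀ ℓ : ℝ, D ≤ A * exp (-(μ * ℓ)) + δ ℓ := fun ℓ => by
    refine ge_of_tendsto (x := atTop) (f := fun l : ℝ => |ℓ| * N * l⁻¹ + A * exp (-(μ * ℓ)) + δ ℓ)
      ?_ ?_
    · simpa using ((tendsto_inv_atTop_zero.const_mul (|ℓ| * N)).add_const
        (A * exp (-(μ * ℓ)))).add_const (δ ℓ)
    · filter_upwards [eventually_gt_atTop 0] with l hl using key2 ℓ l hl
  have key4 : D ≤ 0 := by
    refine ge_of_tendsto' (x := atTop) (f := fun ℓ : ℝ => A * exp (-(μ * ℓ)) + δ ℓ) ?_ key3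
    have h1 : Tendsto (fun ℓ : ℝ => exp (-(μ * ℓ))) atTop (nhds 0) :=
      tendsto_exp_neg_atTop_nhds_zero.comp (tendsto_id.const_mul_atTop hμ)
    simpa using (h1.const_mul A).add hδ0
  exact sub_eq_zero.1 (abs_nonpos_iff.1 key4)

end Out

lemma sum_Icc_one_eq_sum_range (N : ℕ) (f : ℕ → ℝ) :
    ∑ j ∈ Finset.Icc 1 N, f j = ∑ j ∈ Finset.range N, f (j + 1) := by
  rw [Finset.range_eq_Ico, Finset.sum_Ico_add' f 0 N 1]
  rfl

lemma out_of_isGKdVSolution {N : ℕ} {c Δ : ℕ → ℝ}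
    (hcpos : ∀ j, 1 ≤ j → j ≤ N → 0 < c j) (hcdec : ∀ j, 1 ≤ j → j < N → c (j + 1) < c j)
    {u : ℝ → ℝ → ℝ} (hu : IsGKdVSolution u)
    (hout : Tendsto (fun t => H1norm (fun x =>
      u t x - ∑ j ∈ Finset.Icc 1 N, Qc (c j) (x - c j * t - Δ j))) atTop (nhds 0)) :
    Out N (fun j => c (j + 1)) (fun j => Δ (j + 1)) fun k t => iteratedDeriv k (u t) := by
  have hsol := sol_of_isGKdVSolution hu
  refine ⟨hsol, fun j hj => hcpos _ (by omega) (by omega), fun i j hij => ?_, ?_⟩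
  · induction j, hij using Nat.le_induction with
    | base => exact fun hj => hcdec (i + 1) (by omega) (by omega)
    | succ j hij ih => exact fun hj => (hcdec (j + 1) (by omega) (by omega)).trans (ih (by omega))
  · have h2 := hout.pow 2
    rw [zero_pow two_ne_zero] at h2
    refine h2.congr fun t => ?_
    have e : (fun x => u t x - ∑ j ∈ Finset.Icc 1 N, Qc (c j) (x - c j * t - Δ j)) =
        fun x => iteratedDeriv 0 (u t) x
          - bumps (fun j => c (j + 1)) (fun j => Δ (j + 1)) N t x := by
      funext x
      rw [sum_Icc_one_eq_sum_range, iteratedDeriv_zero]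
      simp only [bumps, bump, ctr, sub_sub]
    have hd : ∀ x, deriv (fun x => iteratedDeriv 0 (u t) x
        - bumps (fun j => c (j + 1)) (fun j => Δ (j + 1)) N t x) x =
        iteratedDeriv 1 (u t) x -
          ∑ j ∈ Finset.range N, bumpd (fun j => c (j + 1)) (fun j => Δ (j + 1)) j t x := fun x =>
      ((hsol.dx 0 t x).fun_sub (HasDerivAt.fun_sum fun j _ => hasDerivAt_bump _ _ j t x)).deriv
    rw [e, H1norm, sq_sqrt (integral_nonneg fun x => by positivity)]
    simp only [hd]

end GKdV

/-- Conservation laws on an outgoing multi-soliton: values of the mass,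
energy and integral for all time. -/
theorem conservation_laws_multisoliton
    (N : ℕ) (hN : 2 ≤ N) (c Δ : ℕ → ℝ)
    (hcpos : ∀ j, 1 ≤ j → j ≤ N → 0 < c j)
    (hcdec : ∀ j, 1 ≤ j → j < N → c (j + 1) < c j)
    (u : ℝ → ℝ → ℝ) (hu : IsGKdVSolution u)
    (hout : Tendsto
      (fun t => H1norm (fun x =>
        u t x - ∑ j ∈ Finset.Icc 1 N, Qc (c j) (x - c j * t - Δ j)))
      atTop (nhds 0)) :
    ∀ t : ℝ,
      (∫ x : ℝ, (u t x) ^ 2)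
        = (∑ j ∈ Finset.Icc 1 N, c j ^ ((1:ℝ)/6)) * ∫ x : ℝ, (Q x) ^ 2 ∧
      Energy (u t) = (∑ j ∈ Finset.Icc 1 N, c j ^ ((7:ℝ)/6)) * Energy Q ∧
      Integrable (u t) ∧
      (∫ x : ℝ, u t x)
        = (∑ j ∈ Finset.Icc 1 N, c j ^ (-(1:ℝ)/6)) * ∫ x : ℝ, Q x := by
  intro t
  have h := GKdV.out_of_isGKdVSolution hcpos hcdec hu hout
  have hN0 : 0 < N := by omega
  have hm := h.mass_eq t
  have he := h.energy_eq t
  have hI := h.integral_eq hN0 t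
  have hi := h.integrable hN0 t
  simp only [GKdV.Sol.eden, iteratedDeriv_zero, iteratedDeriv_one] at hm he hI hi
  simp only [GKdV.sum_Icc_one_eq_sum_range, Finset.sum_mul]
  have hpos : ∀ j ∈ Finset.range N, 0 < c (j + 1) := fun j hj =>
    hcpos _ (by omega) (by rw [Finset.mem_range] at hj; omega)
  refine ⟨?_, ?_, hi, ?_⟩
  · rw [hm]
    exact Finset.sum_congr rfl fun j hj => GKdV.integral_Qc_sq (hpos j hj)
  · rw [Energy, he, GKdV.energy_Q]
    refine Finset.sum_congr rfl fun j hj => ?_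
    rw [GKdV.integral_Qc_sq (hpos j hj), show (7 : ℝ) / 6 = 1 + 1 / 6 by norm_num,
      rpow_add (hpos j hj), rpow_one]
    ring
  · rw [hI]
    exact Finset.sum_congr rfl fun j hj => GKdV.integral_Qc (hpos j hj)
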